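/- Let G be a 3-connected nonplanar simple graph. Then the following are equivalent: (i) G is almost-planar; (ii) G is a minor of a double wheel, a Möbius ladder, or a graph in the class W; (iii) G has no minor isomorphic to any of the five graphs EX1, EX2, K33h, K5h, EX8. -/

import Mathlib

open SimpleGraph

/-- `H` is a minor of `G` (branch-set / model definition). -/
def IsMinor {W V : Type*} (H : SimpleGraph W) (G : SimpleGraph V) : Prop :=
  ∃ B : W → Set V,
    (∀ w, (B w).Nonempty) ∧
    (∀ w, (G.induce (B w)).Connected) ∧
    (Pairwise fun w₁ w₂ => Disjoint (B w₁) (B w₂)) ∧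
    (∀ ⦃w₁ w₂ : W⦄, H.Adj w₁ w₂ → ∃ v₁ ∈ B w₁, ∃ v₂ ∈ B w₂, G.Adj v₁ v₂)

def K5 : SimpleGraph (Fin 5) := ⊤

def K33 : SimpleGraph (Fin 3 ⊕ Fin 3) := completeBipartiteGraph (Fin 3) (Fin 3)

/-- A graph is planar iff it has neither a `K₅` nor a `K₃,₃` minor (Wagner's theorem). -/
def Planar {V : Type*} (G : SimpleGraph V) : Prop := ¬ IsMinor K5 G ∧ ¬ IsMinor K33 G

/-- `G / uw`: contract the edge `uw`, merging `w` into `u` (the vertex `w` becomes isolated). -/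
def contractEdge {V : Type*} (G : SimpleGraph V) (u w : V) : SimpleGraph V :=
  SimpleGraph.fromRel fun a b =>
    a ≠ w ∧ b ≠ w ∧ (G.Adj a b ∨ (a = u ∧ G.Adj w b) ∨ (b = u ∧ G.Adj a w))

/-- A nonplanar graph is almost-planar if for every edge, deletion or contraction is planar. -/
def AlmostPlanar {V : Type*} (G : SimpleGraph V) : Prop :=
  ¬ Planar G ∧ ∀ ⦃u v : V⦄, G.Adj u v →
    (Planar (G.deleteEdges {s(u, v)}) ∨ Planar (contractEdge G u v))

/-- `G` is `k`-connected: more than `k` vertices and deleting fewer than `k` vertices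
leaves a connected graph. -/
def KConnected {V : Type*} (G : SimpleGraph V) (k : ℕ) : Prop :=
  k < Nat.card V ∧ ∀ s : Set V, s.ncard < k → (G.induce (sᶜ)).Connected

/-- `{G[A], G[B]}` is a `k`-separation of `G`. -/
def IsSep {V : Type*} (G : SimpleGraph V) (k : ℕ) (A B : Set V) : Prop :=
  A ∪ B = Set.univ ∧ A ≠ Set.univ ∧ B ≠ Set.univ ∧ (A ∩ B).ncard = k ∧
  ∀ ⦃x y : V⦄, G.Adj x y → (x ∈ A ∧ y ∈ A) ∨ (x ∈ B ∧ y ∈ B)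

/-- The star `K_{1,3}`, with centre `0`. -/
def K13 : SimpleGraph (Fin 4) := SimpleGraph.fromRel fun a _ => a = 0

def InternallyFourConnected {V : Type*} (G : SimpleGraph V) : Prop :=
  KConnected G 3 ∧ 5 ≤ Nat.card V ∧
  ∀ A B : Set V, IsSep G 3 A B →
    Xor' (Nonempty (G.induce A ≃g K13)) (Nonempty (G.induce B ≃g K13))

/-- The wheel `W_n`: a cycle of length `n` plus a hub (`none`) joined to all of it. -/
def wheelGraph (n : ℕ) : SimpleGraph (Option (Fin n)) :=
  SimpleGraph.fromRel fun a b =>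
    match a, b with
    | some i, some j => j.val = (i.val + 1) % n
    | none, some _ => True
    | _, _ => False

def IsWheel {V : Type*} (G : SimpleGraph V) : Prop :=
  ∃ n, 3 ≤ n ∧ Nonempty (G ≃g wheelGraph n)

/-- The double wheel `DW_n`: a cycle of length `n` plus two adjacent hubs joined to all of it. -/
def doubleWheel (n : ℕ) : SimpleGraph (Fin n ⊕ Fin 2) :=
  SimpleGraph.fromRel fun a b =>
    match a, b with
    | .inl i, .inl j => j.val = (i.val + 1) % n
    | .inl _, .inr _ => True
    | .inr _, .inr _ => True
    | _, _ => False

/-- The Möbius ladder `M_n`: a cycle of length `2n` plus all "opposite" chords. -/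
def mobiusLadder (n : ℕ) : SimpleGraph (Fin (2 * n)) :=
  SimpleGraph.fromRel fun i j =>
    j.val = (i.val + 1) % (2 * n) ∨ j.val = (i.val + n) % (2 * n)

/-- `C²_m`: a cycle of length `m` plus all chords between vertices at distance two. -/
def squareCycle (m : ℕ) : SimpleGraph (Fin m) :=
  SimpleGraph.fromRel fun i j =>
    j.val = (i.val + 1) % m ∨ j.val = (i.val + 2) % m

/-- The alternating double wheel `AW_{2n}`: a cycle of length `2n` plus two adjacent hubs,
each joined to alternating cycle vertices. -/
def altDoubleWheel (n : ℕ) : SimpleGraph (Fin (2 * n) ⊕ Fin 2) :=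
  SimpleGraph.fromRel fun a b =>
    match a, b with
    | .inl i, .inl j => j.val = (i.val + 1) % (2 * n)
    | .inl i, .inr k => i.val % 2 = k.val
    | .inr _, .inr _ => True
    | _, _ => False

/-- The class `𝒲`: three wheels glued along a common triangle `V₀`, with no other edges. -/
def InClassW {V : Type*} (G : SimpleGraph V) : Prop :=
  ∃ P : V → Fin 4,
    (P ⁻¹' {0}).ncard = 3 ∧
    (∀ x y : V, P x = 0 → P y = 0 → x ≠ y → G.Adj x y) ∧
    (∀ i : Fin 4, i ≠ 0 → IsWheel (G.induce {v | P v = 0 ∨ P v = i})) ∧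
    (∀ ⦃x y : V⦄, G.Adj x y → ∃ i : Fin 4, i ≠ 0 ∧ (P x = 0 ∨ P x = i) ∧ (P y = 0 ∨ P y = i))

/-- `EX₁`: `K₃,₃` plus a vertex joined to all of one colour class. -/
def EX1 : SimpleGraph (Option (Fin 3 ⊕ Fin 3)) :=
  SimpleGraph.fromRel fun a b =>
    match a, b with
    | some (.inl _), some (.inr _) => True
    | none, some (.inl _) => True
    | _, _ => False

/-- `EX₂`: `K₅` plus a vertex joined to three of its vertices. -/
def EX2 : SimpleGraph (Option (Fin 5)) :=
  SimpleGraph.fromRel fun a b =>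
    match a, b with
    | some i, some j => i ≠ j
    | none, some j => j.val < 3
    | _, _ => False

/-- `EX₈`: `K₃,₃` plus a vertex joined to two vertices of one class and one of the other. -/
def EX8 : SimpleGraph (Option (Fin 3 ⊕ Fin 3)) :=
  SimpleGraph.fromRel fun a b =>
    match a, b with
    | some (.inl _), some (.inr _) => True
    | none, some x => x = Sum.inl 0 ∨ x = Sum.inl 1 ∨ x = Sum.inr 0
    | _, _ => False

/-- `K₅ʰ`: subdivide the edges `01` and `02` of `K₅` and join the two subdivision vertices. -/
def K5h : SimpleGraph (Fin 5 ⊕ Fin 2) :=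
  SimpleGraph.fromRel fun a b =>
    match a, b with
    | .inl i, .inl j =>
        i ≠ j ∧ ¬(i = 0 ∧ j = 1) ∧ ¬(i = 1 ∧ j = 0) ∧ ¬(i = 0 ∧ j = 2) ∧ ¬(i = 2 ∧ j = 0)
    | .inl i, .inr k => (k = 0 ∧ (i = 0 ∨ i = 1)) ∨ (k = 1 ∧ (i = 0 ∨ i = 2))
    | .inr _, .inr _ => True
    | _, _ => False

/-- `K₃,₃ʰ`: subdivide two edges of `K₃,₃` at a common endpoint and join
the two subdivision vertices. -/
def K33h : SimpleGraph ((Fin 3 ⊕ Fin 3) ⊕ Fin 2) :=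
  SimpleGraph.fromRel fun a b =>
    match a, b with
    | .inl (.inl i), .inl (.inr j) => ¬(i = 0 ∧ (j = 0 ∨ j = 1))
    | .inl (.inr j), .inl (.inl i) => ¬(i = 0 ∧ (j = 0 ∨ j = 1))
    | .inl x, .inr k =>
        (k = 0 ∧ (x = Sum.inl 0 ∨ x = Sum.inr 0)) ∨ (k = 1 ∧ (x = Sum.inl 0 ∨ x = Sum.inr 1))
    | .inr _, .inr _ => True
    | _, _ => False

/-- `K₅⁺`: `K₅` plus a pendant vertex. -/
def K5plus : SimpleGraph (Option (Fin 5)) :=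
  SimpleGraph.fromRel fun a b =>
    match a, b with
    | some i, some j => i ≠ j
    | none, some j => j = 0
    | _, _ => False

/-- `K₃,₃⁺`: `K₃,₃` plus a pendant vertex. -/
def K33plus : SimpleGraph (Option (Fin 3 ⊕ Fin 3)) :=
  SimpleGraph.fromRel fun a b =>
    match a, b with
    | some (.inl _), some (.inr _) => True
    | none, some x => x = Sum.inl 0
    | _, _ => False

/-- `K₅ ⊕ e`: disjoint union of `K₅` and one edge. -/
def K5oplus : SimpleGraph (Fin 5 ⊕ Fin 2) :=
  SimpleGraph.fromRel fun a b =>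
    match a, b with
    | .inl i, .inl j => i ≠ j
    | .inr _, .inr _ => True
    | _, _ => False

/-- `K₃,₃ ⊕ e`: disjoint union of `K₃,₃` and one edge. -/
def K33oplus : SimpleGraph ((Fin 3 ⊕ Fin 3) ⊕ Fin 2) :=
  SimpleGraph.fromRel fun a b =>
    match a, b with
    | .inl (.inl _), .inl (.inr _) => True
    | .inr _, .inr _ => True
    | _, _ => False

/-- The triad addition of `H` at `x y z`: add a new vertex joined to `x`, `y`, `z`. -/
def triadAddition {U : Type*} (H : SimpleGraph U) (x y z : U) : SimpleGraph (Option U) :=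
  SimpleGraph.fromRel fun a b =>
    match a, b with
    | some u, some v => H.Adj u v
    | none, some u => u = x ∨ u = y ∨ u = z
    | _, _ => False

def IsTriadAdditionOf {V U : Type*} (G : SimpleGraph V) (H : SimpleGraph U) : Prop :=
  ∃ x y z : U, x ≠ y ∧ y ≠ z ∧ x ≠ z ∧ Nonempty (G ≃g triadAddition H x y z)

/-- `G` is obtained from `H` by subdividing (possibly repeatedly) edges of `H`,
all of which lie in `S`. -/
def IsSubdivisionWithin {V W : Type*} (G : SimpleGraph V) (H : SimpleGraph W)
    (S : Set (Sym2 W)) : Prop :=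
  ∃ (f : W ↪ V) (p : ∀ ⦃u v : W⦄, H.Adj u v → G.Walk (f u) (f v)),
    (∀ ⦃u v : W⦄ (h : H.Adj u v), (p h).IsPath) ∧
    (∀ ⦃u v : W⦄ (h : H.Adj u v), p h.symm = (p h).reverse) ∧
    (∀ ⦃u v : W⦄ (h : H.Adj u v), s(u, v) ∉ S → (p h).length = 1) ∧
    (∀ ⦃u v : W⦄ (h : H.Adj u v) (w : W), f w ∈ (p h).support → w = u ∨ w = v) ∧
    (∀ ⦃u v u' v' : W⦄ (h : H.Adj u v) (h' : H.Adj u' v'), s(u, v) ≠ s(u', v') →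
      ∀ x : V, x ∈ (p h).support → x ∈ (p h').support → x ∈ Set.range f) ∧
    (∀ x : V, x ∈ Set.range f ∨ ∃ (u v : W) (h : H.Adj u v), x ∈ (p h).support) ∧
    (∀ e ∈ G.edgeSet, ∃ (u v : W) (h : H.Adj u v), e ∈ (p h).edges)

/-- `G` is a subdivision of `H`. -/
def IsSubdivision {V W : Type*} (G : SimpleGraph V) (H : SimpleGraph W) : Prop :=
  IsSubdivisionWithin G H Set.univ

/-- `D(H)`: the set of edges of `H` whose deletion leaves a planar graph. -/
def Dset {U : Type*} (H : SimpleGraph U) : Set (Sym2 U) :=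
  {e | e ∈ H.edgeSet ∧ Planar (H.deleteEdges {e})}

/-- `G[A]` together with all edges between vertices of `T` (`T ⊆ A` intended). -/
def deltaGraph {V : Type*} (G : SimpleGraph V) (A T : Set V) : SimpleGraph A :=
  SimpleGraph.fromRel fun a b => G.Adj a.1 b.1 ∨ (a.1 ∈ T ∧ b.1 ∈ T)

/-- `G[A]^Y` for the separation `{G[A], G[B]}`: add a new vertex joined to `A ∩ B`. -/
def sepY {V : Type*} (G : SimpleGraph V) (A B : Set V) : SimpleGraph (Option A) :=
  SimpleGraph.fromRel fun x y =>
    match x, y with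
    | some a, some b => G.Adj a.1 b.1
    | none, some a => a.1 ∈ A ∩ B
    | _, _ => False

/-- `G₂` is obtained from `G` by adding isolated vertices. -/
def AddIsolated {V₂ V : Type*} (G₂ : SimpleGraph V₂) (G : SimpleGraph V) : Prop :=
  ∃ f : V ↪ V₂, (∀ a b : V, G₂.Adj (f a) (f b) ↔ G.Adj a b) ∧
    ∀ x : V₂, x ∉ Set.range f → ∀ y : V₂, ¬ G₂.Adj x y

/-- The set of non-isolated vertices of `G` (so `G* = G.induce (core G)`). -/
def core {V : Type*} (G : SimpleGraph V) : Set V := {v | ∃ w, G.Adj v w}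

/-- `G` is obtained from `G'` by 3-summing wheels onto distinct triangles of `G'`. -/
def SumWheelsOnto {V U : Type*} (G : SimpleGraph V) (G' : SimpleGraph U) : Prop :=
  ∃ (g : U ↪ V) (k : ℕ) (Wp : Fin k → Set V) (T : Fin k → Set U),
    (∀ i, (T i).ncard = 3) ∧
    (∀ i, ∀ x ∈ T i, ∀ y ∈ T i, x ≠ y → G'.Adj x y) ∧
    Function.Injective T ∧
    (∀ i, Disjoint (Wp i) (Set.range ⇑g)) ∧
    (Pairwise fun i j => Disjoint (Wp i) (Wp j)) ∧
    (Set.range ⇑g ∪ ⋃ i, Wp i) = Set.univ ∧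
    (∀ i, IsWheel (deltaGraph G (Wp i ∪ ⇑g '' T i) (⇑g '' T i))) ∧
    (∀ a b : U, G.Adj (g a) (g b) → G'.Adj a b) ∧
    (∀ a b : U, G'.Adj a b → (G.Adj (g a) (g b) ∨ ∃ i, a ∈ T i ∧ b ∈ T i)) ∧
    (∀ ⦃x y : V⦄, G.Adj x y → (x ∈ Set.range ⇑g ∧ y ∈ Set.range ⇑g) ∨
      ∃ i, x ∈ Wp i ∪ ⇑g '' T i ∧ y ∈ Wp i ∪ ⇑g '' T i) ∧
    (∀ i, ∀ x ∈ Wp i, ∀ ⦃y : V⦄, G.Adj x y → y ∈ Wp i ∪ ⇑g '' T i)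

/-- `H` has an edge whose deletion and contraction are both nonplanar. -/
def HasBadEdge {V : Type*} (H : SimpleGraph V) : Prop :=
  ∃ u v : V, H.Adj u v ∧ ¬ Planar (H.deleteEdges {s(u, v)}) ∧ ¬ Planar (contractEdge H u v)

section APmain
open SimpleGraph
set_option linter.all false

namespace AP

section Basics
variable {V : Type*} {G H : SimpleGraph V} {S T : Set V}

/-- connected nonempty vertex set -/
def Cn (G : SimpleGraph V) (S : Set V) : Prop := (G.induce S).Connected

/-- two sets joined by an edge -/
def Tch (G : SimpleGraph V) (S T : Set V) : Prop := ∃ x ∈ S, ∃ y ∈ T, G.Adj x y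

lemma Tch.symm (h : Tch G S T) : Tch G T S := by
  obtain ⟨x, hx, y, hy, h⟩ := h
  exact ⟨y, hy, x, hx, h.symm⟩

lemma Tch.mono {S' T' : Set V} (h : Tch G S T) (hS : S ⊆ S') (hT : T ⊆ T') : Tch G S' T' := by
  obtain ⟨x, hx, y, hy, h⟩ := h
  exact ⟨x, hS hx, y, hT hy, h⟩

lemma Cn.nonempty (h : Cn G S) : S.Nonempty := by
  obtain ⟨x⟩ := SimpleGraph.Connected.nonempty h
  exact ⟨x.1, x.2⟩

/-- reachability inside `S` -/
def Rch (G : SimpleGraph V) (S : Set V) (x y : V) : Prop :=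
  Relation.ReflTransGen (fun a b => G.Adj a b ∧ a ∈ S ∧ b ∈ S) x y

lemma Rch.mem {x y : V} (h : Rch G S x y) (hx : x ∈ S) : y ∈ S := by
  induction h with
  | refl => exact hx
  | tail _ h _ => exact h.2.2

lemma Rch.symm {x y : V} (h : Rch G S x y) : Rch G S y x := by
  induction h with
  | refl => exact .refl
  | tail _ h ih => exact Relation.ReflTransGen.head ⟨h.1.symm, h.2.2, h.2.1⟩ ih

lemma Rch.trans {x y z : V} (h : Rch G S x y) (h' : Rch G S y z) : Rch G S x z :=
  Relation.ReflTransGen.trans h h'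

lemma Rch.mono {x y : V} (h : Rch G S x y) (hST : S ⊆ T) : Rch G T x y :=
  Relation.ReflTransGen.mono (fun _ _ h => ⟨h.1, hST h.2.1, hST h.2.2⟩) _ _ h

lemma cn_iff : Cn G S ↔ S.Nonempty ∧ ∀ x ∈ S, ∀ y ∈ S, Rch G S x y := by
  constructor
  · intro h
    refine ⟨h.nonempty, fun x hx y hy => ?_⟩
    obtain ⟨w⟩ := h.preconnected ⟨x, hx⟩ ⟨y, hy⟩
    have : ∀ (a b : S) (w : (G.induce S).Walk a b), Rch G S a.1 b.1 := by
      intro a b w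
      induction w with
      | nil => exact .refl
      | cons h _ ih => exact Relation.ReflTransGen.head ⟨h, Subtype.property _, Subtype.property _⟩ ih
    exact this _ _ w
  · rintro ⟨⟨x0, hx0⟩, h⟩
    haveI : Nonempty S := ⟨⟨x0, hx0⟩⟩
    refine ⟨?_⟩
    rintro ⟨x, hx⟩ ⟨y, hy⟩
    have : ∀ y (_ : Rch G S x y) (hy : y ∈ S), (G.induce S).Reachable ⟨x, hx⟩ ⟨y, hy⟩ := by
      intro y h
      induction h with
      | refl => intro _; exact Reachable.refl _
      | tail _ hb ih =>
        intro hc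
        refine (ih hb.2.1).trans (Adj.reachable ?_)
        exact hb.1
    exact this y (h x hx y hy) hy

/-- connected sets: from one root -/
lemma cn_of_root {r : V} (hr : r ∈ S) (h : ∀ x ∈ S, Rch G S r x) : Cn G S :=
  cn_iff.2 ⟨⟨r, hr⟩, fun x hx y hy => (h x hx).symm.trans (h y hy)⟩

lemma Cn.rch (h : Cn G S) {x y : V} (hx : x ∈ S) (hy : y ∈ S) : Rch G S x y := (cn_iff.1 h).2 x hx y hy

lemma Cn.singleton (x : V) : Cn G {x} :=
  cn_of_root (Set.mem_singleton x) (by rintro y rfl; exact .refl)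

lemma Cn.mono_graph (hGH : G ≤ H) (h : Cn G S) : Cn H S := by
  rw [cn_iff] at h ⊢
  exact ⟨h.1, fun x hx y hy => Relation.ReflTransGen.mono (fun _ _ h => ⟨hGH h.1, h.2⟩) _ _ (h.2 x hx y hy)⟩

lemma Cn.congr (hGH : ∀ x ∈ S, ∀ y ∈ S, G.Adj x y → H.Adj x y) (h : Cn G S) : Cn H S := by
  rw [cn_iff] at h ⊢
  exact ⟨h.1, fun x hx y hy => Relation.ReflTransGen.mono
    (fun _ _ h => ⟨hGH _ h.2.1 _ h.2.2 h.1, h.2⟩) _ _ (h.2 x hx y hy)⟩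

lemma Cn.union (hS : Cn G S) (hT : Cn G T) (h : (S ∩ T).Nonempty) : Cn G (S ∪ T) := by
  obtain ⟨z, hz1, hz2⟩ := h
  refine cn_of_root (r := z) (Or.inl hz1) ?_
  rintro x (hx | hx)
  · exact (hS.rch hz1 hx).mono Set.subset_union_left
  · exact (hT.rch hz2 hx).mono Set.subset_union_right

lemma Cn.union_tch (hS : Cn G S) (hT : Cn G T) (h : Tch G S T) : Cn G (S ∪ T) := by
  obtain ⟨a, ha, b, hb, hab⟩ := h
  refine cn_of_root (r := a) (Or.inl ha) ?_
  rintro x (hx | hx)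
  · exact (hS.rch ha hx).mono Set.subset_union_left
  · exact Relation.ReflTransGen.head ⟨hab, Or.inl ha, Or.inr hb⟩
      ((hT.rch hb hx).mono Set.subset_union_right)

lemma Cn.insert {x : V} (hS : Cn G S) (h : ∃ y ∈ S, G.Adj x y) : Cn G (insert x S) := by
  obtain ⟨y, hy, hxy⟩ := h
  rw [Set.insert_eq]
  exact (Cn.singleton x).union_tch hS ⟨x, rfl, y, hy, hxy⟩

/-- crossing edge -/
lemma Cn.cross (hS : Cn G S) {A : Set V} (h1 : (S ∩ A).Nonempty) (h2 : (S \ A).Nonempty) :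
    ∃ x ∈ S, ∃ y ∈ S, x ∈ A ∧ y ∉ A ∧ G.Adj x y := by
  obtain ⟨a, ha, haA⟩ := h1
  obtain ⟨b, hb, hbA⟩ := h2
  by_contra hcon
  push Not at hcon
  have : ∀ y, Rch G S a y → y ∈ A := by
    intro y h
    induction h with
    | refl => exact haA
    | tail _ h ih =>
      by_contra hc
      exact hcon _ h.2.1 _ h.2.2 ih hc h.1
  exact hbA (this b (hS.rch ha hb))

/-- component -/
def cmp (G : SimpleGraph V) (S : Set V) (x : V) : Set V := {y | Rch G S x y}

lemma cmp_self {x : V} : x ∈ cmp G S x := .refl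

lemma cmp_sub {x : V} (hx : x ∈ S) : cmp G S x ⊆ S := fun _ h => Rch.mem h hx

lemma cmp_closed {x y z : V} (hx : x ∈ S) (hy : y ∈ cmp G S x) (hz : z ∈ S) (h : G.Adj y z) :
    z ∈ cmp G S x :=
  Relation.ReflTransGen.tail hy ⟨h, cmp_sub hx hy, hz⟩

lemma cmp_cn {x : V} (hx : x ∈ S) : Cn G (cmp G S x) := by
  refine cn_of_root (r := x) cmp_self ?_
  intro y hy
  have : ∀ y, Rch G S x y → Rch G (cmp G S x) x y := by
    intro y h
    induction h with
    | refl => exact .refl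
    | tail hb h ih => exact Relation.ReflTransGen.tail ih ⟨h.1, hb, Relation.ReflTransGen.tail hb h⟩
  exact this y hy

lemma cmp_sup {x : V} (hT : Cn G T) (hTS : T ⊆ S) (h : (T ∩ cmp G S x).Nonempty) :
    T ⊆ cmp G S x := by
  obtain ⟨z, hz, hz'⟩ := h
  intro y hy
  exact Rch.trans hz' ((hT.rch hz hy).mono hTS)

/-- `p 0, …, p n` is a path -/
structure Pth (G : SimpleGraph V) (p : ℕ → V) (n : ℕ) : Prop where
  adj : ∀ i < n, G.Adj (p i) (p (i+1))
  inj : ∀ i ≤ n, ∀ j ≤ n, p i = p j → i = j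

lemma Cn.path (hS : Cn G S) {a b : V} (ha : a ∈ S) (hb : b ∈ S) :
    ∃ (p : ℕ → V) (n : ℕ), Pth G p n ∧ p 0 = a ∧ p n = b ∧ ∀ i ≤ n, p i ∈ S := by
  classical
  obtain ⟨w, hw⟩ := (hS.preconnected ⟨a, ha⟩ ⟨b, hb⟩).exists_isPath
  refine ⟨fun i => (w.getVert i).1, w.length, ⟨?_, ?_⟩, ?_, ?_, ?_⟩
  · intro i hi
    exact w.adj_getVert_succ hi
  · intro i hi j hj h
    exact hw.getVert_injOn hi hj (Subtype.ext h)
  · simp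
  · simp
  · intro i _
    exact (w.getVert i).2

/-- interval of a sequence -/
def Itv (p : ℕ → V) (a b : ℕ) : Set V := {v | ∃ i, a ≤ i ∧ i ≤ b ∧ p i = v}

lemma Itv.mem {p : ℕ → V} {a b i : ℕ} (h1 : a ≤ i) (h2 : i ≤ b) : p i ∈ Itv p a b := ⟨i, h1, h2, rfl⟩

lemma Itv.mono {p : ℕ → V} {a b a' b' : ℕ} (h1 : a' ≤ a) (h2 : b ≤ b') : Itv p a b ⊆ Itv p a' b' := by
  rintro _ ⟨i, h, h', rfl⟩
  exact ⟨i, by omega, by omega, rfl⟩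

lemma Itv.cn {p : ℕ → V} {a b : ℕ} (hab : a ≤ b) (h : ∀ i, a ≤ i → i < b → G.Adj (p i) (p (i+1))) :
    Cn G (Itv p a b) := by
  refine cn_of_root (r := p a) (Itv.mem le_rfl hab) ?_
  have : ∀ i, a + i ≤ b → Rch G (Itv p a b) (p a) (p (a+i)) := by
    intro i
    induction i with
    | zero => intro _; exact .refl
    | succ i ih =>
      intro hi
      refine Relation.ReflTransGen.tail (ih (by omega))
        ⟨h (a+i) (by omega) (by omega), Itv.mem (by omega) (by omega), Itv.mem (by omega) (by omega)⟩
  rintro _ ⟨i, h1, h2, rfl⟩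
  have := this (i - a) (by omega)
  rwa [show a + (i - a) = i by omega] at this

end Basics

section Minor
variable {U V W : Type*}

lemma IsMinor.mono_map {H : SimpleGraph U} {K : SimpleGraph W} {G : SimpleGraph V}
    (h : IsMinor K G) (f : U → W) (hf : Function.Injective f)
    (hadj : ∀ a b, H.Adj a b → K.Adj (f a) (f b)) : IsMinor H G := by
  obtain ⟨B, h1, h2, h3, h4⟩ := h
  exact ⟨fun u => B (f u), fun u => h1 _, fun u => h2 _, fun a b hab => h3 (hf.ne hab),
    fun a b hab => h4 (hadj a b hab)⟩

lemma isMinor_of_map {H : SimpleGraph U} {G : SimpleGraph V} (f : U → V)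
    (hf : Function.Injective f) (hadj : ∀ a b, H.Adj a b → G.Adj (f a) (f b)) : IsMinor H G := by
  refine ⟨fun u => {f u}, fun u => ⟨_, rfl⟩, fun u => Cn.singleton _, fun a b hab => ?_, fun a b hab =>
    ⟨_, rfl, _, rfl, hadj a b hab⟩⟩
  simpa using hf.ne hab

lemma IsMinor.trans {H : SimpleGraph U} {K : SimpleGraph W} {G : SimpleGraph V}
    (h : IsMinor H K) (h' : IsMinor K G) : IsMinor H G := by
  obtain ⟨B, h1, h2, h3, h4⟩ := h
  obtain ⟨C, k1, k2, k3, k4⟩ := h'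
  refine ⟨fun u => {v | ∃ w ∈ B u, v ∈ C w}, fun u => ?_, fun u => ?_, ?_, ?_⟩
  · obtain ⟨w, hw⟩ := h1 u
    obtain ⟨v, hv⟩ := k1 w
    exact ⟨v, w, hw, hv⟩
  · obtain ⟨w0, hw0⟩ := h1 u
    obtain ⟨v0, hv0⟩ := k1 w0
    refine cn_of_root (r := v0) ⟨w0, hw0, hv0⟩ ?_
    have hsub : ∀ w ∈ B u, C w ⊆ {v | ∃ w ∈ B u, v ∈ C w} := fun w hw v hv => ⟨w, hw, hv⟩
    have key : ∀ w, Rch K (B u) w0 w → ∀ v ∈ C w, Rch G {v | ∃ w ∈ B u, v ∈ C w} v0 v := by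
      intro w h
      induction h with
      | refl => intro v hv; exact (Cn.rch (k2 w0) hv0 hv).mono (hsub _ hw0)
      | tail _ h ih =>
        intro v hv
        obtain ⟨x, hx, y, hy, hxy⟩ := k4 h.1
        refine (ih x hx).trans (Relation.ReflTransGen.head ⟨hxy, hsub _ h.2.1 hx, hsub _ h.2.2 hy⟩ ?_)
        exact (Cn.rch (k2 _) hy hv).mono (hsub _ h.2.2)
    rintro x ⟨w, hw, hx⟩
    exact key w (Cn.rch (h2 u) hw0 hw) x hx
  · intro a b hab
    refine Set.disjoint_left.2 ?_
    rintro v ⟨w, hw, hv⟩ ⟨w', hw', hv'⟩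
    by_cases hww : w = w'
    · subst hww
      exact Set.disjoint_left.1 (h3 hab) hw hw'
    · exact Set.disjoint_left.1 (k3 hww) hv hv'
  · intro a b hab
    obtain ⟨w, hw, w', hw', hww⟩ := h4 hab
    obtain ⟨x, hx, y, hy, hxy⟩ := k4 hww
    exact ⟨x, ⟨w, hw, hx⟩, y, ⟨w', hw', hy⟩, hxy⟩

end Minor

section Cert
variable {V : Type*} {G : SimpleGraph V}

/-- disjoint connected sets indexed by numbers below `n` -/
structure Mod (G : SimpleGraph V) (n : ℕ) (R : ℕ → Set V) : Prop where
  cn : ∀ i < n, Cn G (R i)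
  disj : ∀ i < n, ∀ j < n, ∀ v, v ∈ R i → v ∈ R j → i = j

/-- the graph on `0..n-1` with edge list `E` is a minor of `G` -/
def HasM (G : SimpleGraph V) (n : ℕ) (E : List (ℕ × ℕ)) : Prop :=
  ∃ R, Mod G n R ∧ ∀ p ∈ E, Tch G (R p.1) (R p.2)

def adjB (E : List (ℕ × ℕ)) (a b : ℕ) : Bool :=
  E.any fun p => (Nat.beq p.1 a && Nat.beq p.2 b) || (Nat.beq p.1 b && Nat.beq p.2 a)

def connB (E : List (ℕ × ℕ)) : List ℕ → List ℕ → Bool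
  | _, [] => true
  | seen, x :: r => seen.any (fun y => adjB E x y) && connB E (x :: seen) r

def okB (E : List (ℕ × ℕ)) (n : ℕ) : List ℕ → Bool
  | [] => false
  | x :: r => connB E [x] r && (x :: r).all (fun y => Nat.blt y n)

def nodupB : List ℕ → Bool
  | [] => true
  | x :: r => r.all (fun y => !(Nat.beq x y)) && nodupB r

def chk (n : ℕ) (E : List (ℕ × ℕ)) (t : ℕ) (T : List (ℕ × ℕ)) (c : List (List ℕ)) : Bool :=
  Nat.beq c.length t && c.all (okB E n) && nodupB c.flatten &&
    T.all fun p => (c.getD p.1 []).any fun a => (c.getD p.2 []).any fun b => adjB E a b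

lemma adjB_tch {E : List (ℕ × ℕ)} {R : ℕ → Set V} (hE : ∀ p ∈ E, Tch G (R p.1) (R p.2)) {a b : ℕ}
    (h : adjB E a b = true) : Tch G (R a) (R b) := by
  unfold adjB at h
  simp only [List.any_eq_true, Bool.or_eq_true, Bool.and_eq_true, Nat.beq_eq] at h
  obtain ⟨p, hp, (⟨rfl, rfl⟩ | ⟨rfl, rfl⟩)⟩ := h
  · exact hE p hp
  · exact (hE p hp).symm

lemma nodupB_nodup : ∀ {l : List ℕ}, nodupB l = true → l.Nodup
  | [], _ => List.nodup_nil
  | x :: r, h => by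
    simp only [nodupB, Bool.and_eq_true, List.all_eq_true, Bool.not_eq_true'] at h
    rw [List.nodup_cons]
    exact ⟨fun hx => by simpa using h.1 x hx, nodupB_nodup h.2⟩

lemma connB_cn {E : List (ℕ × ℕ)} {n : ℕ} {R : ℕ → Set V} (hR : Mod G n R)
    (hE : ∀ p ∈ E, Tch G (R p.1) (R p.2)) :
    ∀ (r seen : List ℕ), (∀ x ∈ r, x < n) → connB E seen r = true →
      Cn G {v | ∃ j ∈ seen, v ∈ R j} → Cn G {v | ∃ j ∈ seen ++ r, v ∈ R j}
  | [], seen, _, _, h => by simpa using h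
  | x :: r, seen, hr, hc, h => by
    simp only [connB, Bool.and_eq_true, List.any_eq_true] at hc
    obtain ⟨⟨y, hy, hxy⟩, hc⟩ := hc
    have h1 : Cn G {v | ∃ j ∈ x :: seen, v ∈ R j} := by
      have : {v | ∃ j ∈ x :: seen, v ∈ R j} = R x ∪ {v | ∃ j ∈ seen, v ∈ R j} := by
        ext v; simp
      rw [this]
      refine (hR.cn x (hr x (by simp))).union_tch h ?_
      exact (adjB_tch hE hxy).mono subset_rfl (fun v hv => ⟨y, hy, hv⟩)
    have h2 := connB_cn hR hE r (x :: seen) (fun z hz => hr z (by simp [hz])) hc h1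
    convert h2 using 1
    ext v
    simp only [List.mem_append, List.mem_cons, Set.mem_ofPred_eq]
    grind

theorem HasM.chk {n : ℕ} {E : List (ℕ × ℕ)} (h : HasM G n E) {t : ℕ} {T : List (ℕ × ℕ)}
    (cc : List (List ℕ)) (hc : AP.chk n E t T cc = true) : HasM G t T := by
  obtain ⟨R, hR, hE⟩ := h
  simp only [AP.chk, Bool.and_eq_true, List.all_eq_true, Nat.beq_eq, List.any_eq_true] at hc
  obtain ⟨⟨⟨h1, h2⟩, h3⟩, h4⟩ := hc
  have h3 := nodupB_nodup h3
  rw [List.nodup_flatten] at h3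
  have hget : ∀ i < t, ∃ hi : i < cc.length, cc.getD i [] = cc[i] := by
    intro i hi
    exact ⟨by omega, by simp [List.getD, List.getElem?_eq_getElem (show i < cc.length by omega)]⟩
  refine ⟨fun i => {v | ∃ j ∈ cc.getD i [], v ∈ R j}, ⟨?_, ?_⟩, ?_⟩
  · intro i hi
    obtain ⟨hi', e⟩ := hget i hi
    rw [e]
    have h2 := h2 cc[i] (List.getElem_mem _)
    cases hl : cc[i] with
    | nil => rw [hl] at h2; simp [okB] at h2
    | cons x r =>
      rw [hl] at h2
      simp only [okB, Bool.and_eq_true, List.all_eq_true, Nat.blt_eq] at h2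
      refine connB_cn hR hE r [x] (fun z hz => h2.2 z (by simp [hz])) h2.1 ?_
      have := hR.cn x (h2.2 x (by simp))
      simpa using this
  · rintro i hi j hj v ⟨a, ha, hva⟩ ⟨b, hb, hvb⟩
    obtain ⟨hi', e⟩ := hget i hi
    obtain ⟨hj', e'⟩ := hget j hj
    rw [e] at ha
    rw [e'] at hb
    have hlt : ∀ l ∈ cc, ∀ x ∈ l, x < n := by
      intro l hl x hx
      have h2 := h2 l hl
      cases l with
      | nil => simp at hx
      | cons y r =>
        simp only [okB, Bool.and_eq_true, List.all_eq_true, Nat.blt_eq] at h2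
        exact h2.2 x hx
    have hab := hR.disj a (hlt _ (List.getElem_mem _) a ha) b (hlt _ (List.getElem_mem _) b hb) v hva hvb
    subst hab
    by_contra hij
    have := h3.2
    rw [List.pairwise_iff_getElem] at this
    rcases lt_or_gt_of_ne hij with hlt | hlt
    · exact this i j hi' hj' hlt ha hb
    · exact this j i hj' hi' hlt hb ha
  · intro p hp
    obtain ⟨a, ha, b, hb, hab⟩ := h4 p hp
    exact (adjB_tch hE hab).mono (fun v hv => ⟨a, ha, hv⟩) (fun v hv => ⟨b, hb, hv⟩)

end Cert
end AP

set_option linter.all false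
namespace AP

section Contract
variable {U V : Type*}

def EP (G : SimpleGraph V) : Prop := ∀ ⦃u v : V⦄, G.Adj u v →
    (Planar (G.deleteEdges {s(u, v)}) ∨ Planar (contractEdge G u v))

lemma planar_minor {G : SimpleGraph V} {H : SimpleGraph U} (h : Planar H) (hm : IsMinor G H) :
    Planar G := ⟨fun hk => h.1 (IsMinor.trans hk hm), fun hk => h.2 (IsMinor.trans hk hm)⟩

open Classical in
lemma contract_adj {H : SimpleGraph U} {v1 v2 x y : U} (h12 : v1 ≠ v2) (h : H.Adj x y)
    (hne : (if x = v2 then v1 else x) ≠ (if y = v2 then v1 else y)) :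
    (contractEdge H v1 v2).Adj (if x = v2 then v1 else x) (if y = v2 then v1 else y) := by
  unfold contractEdge
  rw [fromRel_adj]
  refine ⟨hne, Or.inl ?_⟩
  split_ifs at hne ⊢ with hx hy hy
  · exact absurd rfl hne
  · subst hx
    exact ⟨h12, hy, Or.inr (Or.inl ⟨rfl, h⟩)⟩
  · subst hy
    exact ⟨hx, h12, Or.inr (Or.inr ⟨rfl, h⟩)⟩
  · exact ⟨hx, hy, Or.inl h⟩

open Classical in
lemma contract_cn {H : SimpleGraph U} {v1 v2 : U} (h12 : v1 ≠ v2) {S : Set U} (hS : Cn H S)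
    (h1 : v1 ∈ S) : Cn (contractEdge H v1 v2) (S \ {v2}) := by
  have hmem : ∀ x ∈ S, (if x = v2 then v1 else x) ∈ S \ {v2} := by
    intro x hx
    split_ifs with h
    · exact ⟨h1, h12⟩
    · exact ⟨hx, h⟩
  refine cn_of_root (r := v1) ⟨h1, h12⟩ ?_
  have key : ∀ x, Rch H S v1 x → Rch (contractEdge H v1 v2) (S \ {v2}) v1 (if x = v2 then v1 else x) := by
    intro x h
    induction h with
    | refl => rw [if_neg h12]; exact .refl
    | @tail b c _ h ih =>
      by_cases e : (if b = v2 then v1 else b) = (if c = v2 then v1 else c)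
      · rw [← e]; exact ih
      · exact Relation.ReflTransGen.tail ih ⟨contract_adj h12 h.1 e, hmem _ h.2.1, hmem _ h.2.2⟩
  rintro x ⟨hx, hx2⟩
  have := key x (hS.rch h1 hx)
  rwa [if_neg (by simpa using hx2)] at this

open Classical in
lemma EP.minor {G : SimpleGraph V} {H : SimpleGraph U} (hH : EP H) (hm : IsMinor G H) : EP G := by
  intro g h hgh
  obtain ⟨B, h1, h2, h3, h4⟩ := hm
  obtain ⟨v1, hv1, v2, hv2, hv⟩ := h4 hgh
  have hne : g ≠ h := hgh.ne
  have hdj : ∀ {a b x}, x ∈ B a → x ∈ B b → a = b := by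
    intro a b x ha hb
    by_contra hab
    exact Set.disjoint_left.1 (h3 hab) ha hb
  have h12 : v1 ≠ v2 := hv.ne
  rcases hH hv with hp | hp
  · left
    refine planar_minor hp ⟨B, h1, fun w => ?_, h3, ?_⟩
    · refine Cn.congr ?_ (h2 w)
      intro x hx y hy hxy
      rw [deleteEdges_adj]
      refine ⟨hxy, ?_⟩
      simp only [Set.mem_singleton_iff, Sym2.eq_iff, not_or, not_and]
      constructor
      · rintro rfl rfl
        exact hne (hdj hv1 hx |>.trans (hdj hy hv2))
      · rintro rfl rfl
        exact hne (hdj hv1 hy |>.trans (hdj hx hv2))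
    · intro a b hab
      rw [deleteEdges_adj] at hab
      obtain ⟨hab, hn⟩ := hab
      obtain ⟨x, hx, y, hy, hxy⟩ := h4 hab
      refine ⟨x, hx, y, hy, ?_⟩
      rw [deleteEdges_adj]
      refine ⟨hxy, ?_⟩
      simp only [Set.mem_singleton_iff, Sym2.eq_iff, not_or, not_and] at hn ⊢
      constructor
      · rintro rfl rfl
        exact hn.1 (hdj hx hv1) (hdj hy hv2)
      · rintro rfl rfl
        exact hn.2 (hdj hx hv2) (hdj hy hv1)
  · right
    let B' : V → Set U := fun w => if w = g then (B g ∪ B h) \ {v2} else if w = h then {v2} else B w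
    have hB'g : B' g = (B g ∪ B h) \ {v2} := if_pos rfl
    have hB'h : B' h = {v2} := by simp [B', hne.symm]
    have hB' : ∀ w, w ≠ g → w ≠ h → B' w = B w := by intro w a b; simp [B', a, b]
    have hcn : ∀ w, Cn (contractEdge H v1 v2) (B' w) := by
      intro w
      by_cases hg : w = g
      · subst hg
        rw [hB'g]
        exact contract_cn h12 (Cn.union_tch (h2 _) (h2 _) ⟨v1, hv1, v2, hv2, hv⟩) (Or.inl hv1)
      by_cases hh : w = h
      · subst hh
        rw [hB'h]
        exact Cn.singleton _
      rw [hB' w hg hh]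
      refine Cn.congr ?_ (h2 w)
      intro x hx y hy hxy
      have hx2 : x ≠ v2 := by rintro rfl; exact hh (hdj hx hv2)
      have hy2 : y ≠ v2 := by rintro rfl; exact hh (hdj hy hv2)
      have := contract_adj (v1 := v1) (v2 := v2) h12 hxy (by rw [if_neg hx2, if_neg hy2]; exact hxy.ne)
      rwa [if_neg hx2, if_neg hy2] at this
    have hdj' : ∀ {a b x}, x ∈ B' a → x ∈ B' b → a = b := by
      intro a b x ha hb
      by_cases hag : a = g
      · subst hag
        by_cases hbg : b = a
        · exact hbg.symm
        rw [hB'g] at ha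
        by_cases hbh : b = h
        · subst hbh; rw [hB'h] at hb; exact absurd hb ha.2
        rw [hB' b hbg hbh] at hb
        rcases ha.1 with h | h
        · exact hdj h hb
        · exact absurd (hdj hb h) hbh
      by_cases hah : a = h
      · subst hah
        rw [hB'h] at ha
        obtain rfl : x = v2 := ha
        by_cases hbg : b = g
        · subst hbg; rw [hB'g] at hb; exact absurd rfl hb.2
        by_cases hbh : b = a
        · exact hbh.symm
        rw [hB' b hbg hbh] at hb
        exact hdj hv2 hb
      rw [hB' a hag hah] at ha
      by_cases hbg : b = g
      · subst hbg
        rw [hB'g] at hb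
        rcases hb.1 with h | h
        · exact hdj ha h
        · exact absurd (hdj ha h) hah
      by_cases hbh : b = h
      · subst hbh; rw [hB'h] at hb
        obtain rfl : x = v2 := hb
        exact hdj ha hv2
      rw [hB' b hbg hbh] at hb
      exact hdj ha hb
    refine planar_minor hp ⟨B', fun w => (hcn w).nonempty, hcn, fun a b hab =>
      Set.disjoint_left.2 fun x hx hx' => hab (hdj' hx hx'), ?_⟩
    have hphi : ∀ a x, a ≠ h → (x ∈ B a ∨ a = g ∧ x ∈ B h) → (if x = v2 then v1 else x) ∈ B' a := by
      intro a x hah hx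
      by_cases hag : a = g
      · subst hag
        rw [hB'g]
        split_ifs with e
        · exact ⟨Or.inl hv1, h12⟩
        · exact ⟨by tauto, e⟩
      · rw [hB' a hag hah]
        have hx : x ∈ B a := by tauto
        rw [if_neg]
        · exact hx
        · rintro rfl; exact hah (hdj hx hv2)
    have main : ∀ a b, a ≠ b → a ≠ h → b ≠ h → (G.Adj a b ∨ (a = g ∧ G.Adj h b) ∨ (b = g ∧ G.Adj a h)) →
        ∃ x ∈ B' a, ∃ y ∈ B' b, (contractEdge H v1 v2).Adj x y := by
      intro a b hab ha hb hr
      have : ∃ x y, H.Adj x y ∧ (x ∈ B a ∨ a = g ∧ x ∈ B h) ∧ (y ∈ B b ∨ b = g ∧ y ∈ B h) := by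
        rcases hr with hr | ⟨e, hr⟩ | ⟨e, hr⟩
        · obtain ⟨x, hx, y, hy, hxy⟩ := h4 hr
          exact ⟨x, y, hxy, Or.inl hx, Or.inl hy⟩
        · obtain ⟨x, hx, y, hy, hxy⟩ := h4 hr
          exact ⟨x, y, hxy, Or.inr ⟨e, hx⟩, Or.inl hy⟩
        · obtain ⟨x, hx, y, hy, hxy⟩ := h4 hr
          exact ⟨x, y, hxy, Or.inl hx, Or.inr ⟨e, hy⟩⟩
      obtain ⟨x, y, hxy, hx, hy⟩ := this
      have hx' := hphi a x ha hx
      have hy' := hphi b y hb hy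
      exact ⟨_, hx', _, hy', contract_adj h12 hxy (fun e => hab (hdj' hx' (e ▸ hy')))⟩
    intro a b hab
    unfold contractEdge at hab
    rw [fromRel_adj] at hab
    obtain ⟨hab, ⟨r1, r2, r3⟩ | ⟨r1, r2, r3⟩⟩ := hab
    · exact main a b hab r1 r2 r3
    · obtain ⟨x, hx, y, hy, hxy⟩ := main b a hab.symm r1 r2 r3
      exact ⟨y, hy, x, hx, hxy.symm⟩

end Contract

section Targets
variable {V W : Type*} {G : SimpleGraph V}

def K33E : List (ℕ × ℕ) := [(0,3),(0,4),(0,5),(1,3),(1,4),(1,5),(2,3),(2,4),(2,5)]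
def K5E : List (ℕ × ℕ) := [(0,1),(0,2),(0,3),(0,4),(1,2),(1,3),(1,4),(2,3),(2,4),(3,4)]
def EX1E : List (ℕ × ℕ) := [(6,0),(6,1),(6,2)] ++ K33E
def EX8E : List (ℕ × ℕ) := [(6,0),(6,1),(6,3)] ++ K33E
def EX2E : List (ℕ × ℕ) := [(5,0),(5,1),(5,2)] ++ K5E
def K33hE : List (ℕ × ℕ) :=
  [(0,5),(1,3),(1,4),(1,5),(2,3),(2,4),(2,5),(6,0),(6,3),(7,0),(7,4),(6,7)]
def K5hE : List (ℕ × ℕ) :=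
  [(0,3),(0,4),(1,2),(1,3),(1,4),(2,3),(2,4),(3,4),(5,0),(5,1),(6,0),(6,2),(5,6)]

lemma HasM.toMinor {n : ℕ} {E : List (ℕ × ℕ)} (h : HasM G n E) {H : SimpleGraph W} (enc : W → ℕ)
    (hlt : ∀ w, enc w < n) (hinj : ∀ a b, enc a = enc b → a = b)
    (hadj : ∀ a b, H.Adj a b → adjB E (enc a) (enc b) = true) : IsMinor H G := by
  obtain ⟨R, hR, hE⟩ := h
  refine ⟨fun w => R (enc w), fun w => (hR.cn _ (hlt w)).nonempty, fun w => hR.cn _ (hlt w),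
    fun a b hab => Set.disjoint_left.2 fun x hx hx' => hab (hinj _ _ (hR.disj _ (hlt a) _ (hlt b) x hx hx')),
    fun a b hab => adjB_tch hE (hadj a b hab)⟩

lemma HasM.ofMinor {H : SimpleGraph W} (h : IsMinor H G) {n : ℕ} {E : List (ℕ × ℕ)} (dec : ℕ → W)
    (hinj : ∀ i < n, ∀ j < n, dec i = dec j → i = j)
    (hadj : ∀ p ∈ E, H.Adj (dec p.1) (dec p.2)) : HasM G n E := by
  obtain ⟨B, h1, h2, h3, h4⟩ := h
  refine ⟨fun i => B (dec i), ⟨fun i _ => h2 _, fun i hi j hj v hv hv' => ?_⟩, fun p hp => h4 (hadj p hp)⟩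
  by_contra hij
  exact Set.disjoint_left.1 (h3 (fun e => hij (hinj i hi j hj e))) hv hv'

def enc33 : Fin 3 ⊕ Fin 3 → ℕ
  | .inl i => i.val
  | .inr i => 3 + i.val
def enc33o : Option (Fin 3 ⊕ Fin 3) → ℕ
  | none => 6
  | some x => enc33 x
def enc33h : (Fin 3 ⊕ Fin 3) ⊕ Fin 2 → ℕ
  | .inl x => enc33 x
  | .inr i => 6 + i.val
def enc5o : Option (Fin 5) → ℕ
  | none => 5
  | some x => x.val
def enc5h : Fin 5 ⊕ Fin 2 → ℕ
  | .inl x => x.val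
  | .inr i => 5 + i.val
def dec33 (n : ℕ) : Fin 3 ⊕ Fin 3 :=
  if n = 0 then .inl 0 else if n = 1 then .inl 1 else if n = 2 then .inl 2
  else if n = 3 then .inr 0 else if n = 4 then .inr 1 else .inr 2
def dec5 (n : ℕ) : Fin 5 :=
  if n = 0 then 0 else if n = 1 then 1 else if n = 2 then 2 else if n = 3 then 3 else 4

lemma minor_K33 (h : HasM G 6 K33E) : IsMinor K33 G :=
  h.toMinor enc33 (by decide) (by decide) (by
    rintro (a|a) (b|b) hab <;> first | (simp [K33] at hab; done) | (fin_cases a <;> fin_cases b <;> decide))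

lemma hasM_K33 (h : IsMinor K33 G) : HasM G 6 K33E :=
  HasM.ofMinor h dec33 (by decide) (by
    intro p hp
    simp only [K33E, List.mem_cons, List.mem_nil_iff, or_false] at hp
    rcases hp with rfl|rfl|rfl|rfl|rfl|rfl|rfl|rfl|rfl <;> simp [K33, dec33])

lemma minor_K5 (h : HasM G 5 K5E) : IsMinor K5 G :=
  h.toMinor (fun i => i.val) (by decide) (by decide) (by
    intro a b hab
    have : a ≠ b := hab.ne
    revert this
    revert a b
    unfold K5
    decide)

lemma hasM_K5 (h : IsMinor K5 G) : HasM G 5 K5E :=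
  HasM.ofMinor h dec5 (by decide) (by
    intro p hp
    simp only [K5E, List.mem_cons, List.mem_nil_iff, or_false] at hp
    rcases hp with rfl|rfl|rfl|rfl|rfl|rfl|rfl|rfl|rfl|rfl <;> simp [K5, dec5])

lemma minor_EX1 (h : HasM G 7 EX1E) : IsMinor EX1 G :=
  h.toMinor enc33o (by decide) (by decide) (by
    rintro (_|a|a) (_|b|b) hab <;> simp [EX1] at hab <;> (try fin_cases a) <;> (try fin_cases b) <;> decide)

lemma minor_EX8 (h : HasM G 7 EX8E) : IsMinor EX8 G :=
  h.toMinor enc33o (by decide) (by decide) (by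
    rintro (_|a|a) (_|b|b) hab <;> (try fin_cases a) <;> (try fin_cases b) <;>
      first | decide | (simp [EX8] at hab; done))

lemma minor_EX2 (h : HasM G 6 EX2E) : IsMinor EX2 G :=
  h.toMinor enc5o (by decide) (by decide) (by
    rintro (_|a) (_|b) hab <;> (try fin_cases a) <;> (try fin_cases b) <;>
      first | decide | (simp [EX2] at hab; done))

lemma minor_K33h (h : HasM G 8 K33hE) : IsMinor K33h G :=
  h.toMinor enc33h (by decide) (by decide) (by
    rintro ((a|a)|a) ((b|b)|b) hab <;> (try fin_cases a) <;> (try fin_cases b) <;>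
      first | decide | (simp [K33h] at hab; done))

lemma minor_K5h (h : HasM G 7 K5hE) : IsMinor K5h G :=
  h.toMinor enc5h (by decide) (by decide) (by
    rintro (a|a) (b|b) hab <;> (try fin_cases a) <;> (try fin_cases b) <;>
      first | decide | (simp [K5h] at hab; done))

/-- a graph has a subgraph given by a list -/
lemma hasM_map {H : SimpleGraph W} {n : ℕ} {E : List (ℕ × ℕ)} (dec : ℕ → W)
    (hinj : ∀ i < n, ∀ j < n, dec i = dec j → i = j)
    (hadj : ∀ p ∈ E, H.Adj (dec p.1) (dec p.2)) : HasM H n E := by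
  refine ⟨fun i => {dec i}, ⟨fun i _ => Cn.singleton _, fun i hi j hj v hv hv' => ?_⟩,
    fun p hp => ⟨_, rfl, _, rfl, hadj p hp⟩⟩
  exact hinj i hi j hj (hv.symm.trans hv')

end Targets
end AP

set_option linter.all false
namespace AP
section BadEdges

lemma notEP_of {V : Type*} {G : SimpleGraph V} {u v : V} (h : G.Adj u v)
    (h1 : ¬ Planar (G.deleteEdges {s(u, v)})) (h2 : ¬ Planar (contractEdge G u v)) : ¬ EP G := by
  intro hE
  rcases hE h with h | h
  · exact h1 h
  · exact h2 h

def decEX1 (n : ℕ) : Option (Fin 3 ⊕ Fin 3) :=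
  if n = 0 then some (.inl 0) else if n = 1 then some (.inl 1) else if n = 2 then some (.inl 2)
  else if n = 3 then none else if n = 4 then some (.inr 1) else some (.inr 2)

lemma notEP_EX1 : ¬ EP EX1 := by
  refine notEP_of (u := some (.inl 0)) (v := some (.inr 0)) (by simp [EX1]) ?_ ?_
  · refine fun h => h.2 (minor_K33 (hasM_map decEX1 (by decide) ?_))
    intro p hp
    simp only [K33E, List.mem_cons, List.mem_nil_iff, or_false] at hp
    rcases hp with rfl|rfl|rfl|rfl|rfl|rfl|rfl|rfl|rfl <;> simp [EX1, decEX1]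
  · refine fun h => h.2 (minor_K33 (hasM_map decEX1 (by decide) ?_))
    intro p hp
    simp only [K33E, List.mem_cons, List.mem_nil_iff, or_false] at hp
    rcases hp with rfl|rfl|rfl|rfl|rfl|rfl|rfl|rfl|rfl <;> simp [EX1, decEX1, contractEdge]

lemma notEP_EX8 : ¬ EP EX8 := by
  refine notEP_of (u := some (.inl 0)) (v := none) (by simp [EX8]) ?_ ?_
  · refine fun h => h.2 (minor_K33 (hasM_map (fun n => some (dec33 n)) (by decide) ?_))
    intro p hp
    simp only [K33E, List.mem_cons, List.mem_nil_iff, or_false] at hp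
    rcases hp with rfl|rfl|rfl|rfl|rfl|rfl|rfl|rfl|rfl <;> simp [EX8, dec33]
  · refine fun h => h.2 (minor_K33 (hasM_map (fun n => some (dec33 n)) (by decide) ?_))
    intro p hp
    simp only [K33E, List.mem_cons, List.mem_nil_iff, or_false] at hp
    rcases hp with rfl|rfl|rfl|rfl|rfl|rfl|rfl|rfl|rfl <;> simp [EX8, dec33, contractEdge]

lemma notEP_EX2 : ¬ EP EX2 := by
  refine notEP_of (u := some 0) (v := none) (by simp [EX2]) ?_ ?_
  · refine fun h => h.1 (minor_K5 (hasM_map (fun n => some (dec5 n)) (by decide) ?_))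
    intro p hp
    simp only [K5E, List.mem_cons, List.mem_nil_iff, or_false] at hp
    rcases hp with rfl|rfl|rfl|rfl|rfl|rfl|rfl|rfl|rfl|rfl <;> simp [EX2, dec5]
  · refine fun h => h.1 (minor_K5 (hasM_map (fun n => some (dec5 n)) (by decide) ?_))
    intro p hp
    simp only [K5E, List.mem_cons, List.mem_nil_iff, or_false] at hp
    rcases hp with rfl|rfl|rfl|rfl|rfl|rfl|rfl|rfl|rfl|rfl <;> simp [EX2, dec5, contractEdge]

def dec33h (n : ℕ) : (Fin 3 ⊕ Fin 3) ⊕ Fin 2 :=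
  if n < 6 then .inl (dec33 n) else if n = 6 then .inr 0 else .inr 1
def dec5h (n : ℕ) : Fin 5 ⊕ Fin 2 :=
  if n < 5 then .inl (dec5 n) else if n = 5 then .inr 0 else .inr 1

def K33hD : List (ℕ × ℕ) := [(0,5),(1,3),(1,4),(1,5),(2,3),(2,4),(2,5),(6,0),(6,3),(7,0),(7,4)]
def K33hC : List (ℕ × ℕ) := [(0,5),(1,3),(1,4),(1,5),(2,3),(2,4),(2,5),(6,0),(6,3),(6,4)]
def K5hD : List (ℕ × ℕ) :=
  [(0,3),(0,4),(1,2),(1,3),(1,4),(2,3),(2,4),(3,4),(5,0),(5,1),(6,0),(6,2)]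
def K5hC : List (ℕ × ℕ) := [(0,3),(0,4),(1,2),(1,3),(1,4),(2,3),(2,4),(3,4),(5,0),(5,1),(5,2)]

lemma notEP_K33h : ¬ EP K33h := by
  refine notEP_of (u := .inr 0) (v := .inr 1) (by simp [K33h]) ?_ ?_
  · refine fun h => h.2 (minor_K33 ((hasM_map (n := 8) (E := K33hD) dec33h (by decide) ?_).chk
      [[0],[1],[2],[3,6],[4,7],[5]] (by decide)))
    intro p hp
    simp only [K33hD, List.mem_cons, List.mem_nil_iff, or_false] at hp
    rcases hp with rfl|rfl|rfl|rfl|rfl|rfl|rfl|rfl|rfl|rfl|rfl <;> simp [K33h, dec33, dec33h]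
  · refine fun h => h.2 (minor_K33 ((hasM_map (n := 7) (E := K33hC) dec33h (by decide) ?_).chk
      [[0,6],[1],[2],[3],[4],[5]] (by decide)))
    intro p hp
    simp only [K33hC, List.mem_cons, List.mem_nil_iff, or_false] at hp
    rcases hp with rfl|rfl|rfl|rfl|rfl|rfl|rfl|rfl|rfl|rfl <;> simp [K33h, dec33, dec33h, contractEdge]

lemma notEP_K5h : ¬ EP K5h := by
  refine notEP_of (u := .inr 0) (v := .inr 1) (by simp [K5h]) ?_ ?_
  · refine fun h => h.1 (minor_K5 ((hasM_map (n := 7) (E := K5hD) dec5h (by decide) ?_).chk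
      [[0],[1,5],[2,6],[3],[4]] (by decide)))
    intro p hp
    simp only [K5hD, List.mem_cons, List.mem_nil_iff, or_false] at hp
    rcases hp with rfl|rfl|rfl|rfl|rfl|rfl|rfl|rfl|rfl|rfl|rfl|rfl <;> simp [K5h, dec5, dec5h]
  · refine fun h => h.1 (minor_K5 ((hasM_map (n := 6) (E := K5hC) dec5h (by decide) ?_).chk
      [[0,5],[1],[2],[3],[4]] (by decide)))
    intro p hp
    simp only [K5hC, List.mem_cons, List.mem_nil_iff, or_false] at hp
    rcases hp with rfl|rfl|rfl|rfl|rfl|rfl|rfl|rfl|rfl|rfl|rfl <;> simp [K5h, dec5, dec5h, contractEdge]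

end BadEdges
end AP

set_option linter.all false
namespace AP
section Outer
variable {V : Type*} {G : SimpleGraph V}

/-- `f` is a non-crossing linear layout of `G` on `S` -/
structure NC (G : SimpleGraph V) (S : Set V) (f : V → ℕ) : Prop where
  inj : ∀ a ∈ S, ∀ b ∈ S, f a = f b → a = b
  nc : ∀ a ∈ S, ∀ b ∈ S, ∀ c ∈ S, ∀ d ∈ S, f a < f b → f b < f c → f c < f d →
    G.Adj a c → G.Adj b d → False

lemma NC.noint {S : Set V} {f : V → ℕ} (h : NC G S f) {X Y : Set V} (hX : Cn G X) (hY : Cn G Y)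
    (hXS : X ⊆ S) (hYS : Y ⊆ S) (hd : ∀ v, v ∈ X → v ∈ Y → False) {x1 x2 y1 y2 : V}
    (hx1 : x1 ∈ X) (hx2 : x2 ∈ X) (hy1 : y1 ∈ Y) (hy2 : y2 ∈ Y)
    (hx : (f y1 < f x2 ∧ f x2 < f y2)) (hx' : ¬ (f y1 < f x1 ∧ f x1 < f y2)) : False := by
  have hne : ∀ x ∈ X, ∀ y ∈ Y, f x ≠ f y := fun x hx y hy e =>
    hd x hx (h.inj x (hXS hx) y (hYS hy) e ▸ hy)
  obtain ⟨a, ha, b, hb, haA, hbA, hab⟩ := hX.cross (A := {v | f y1 < f v ∧ f v < f y2})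
    ⟨x2, hx2, hx⟩ ⟨x1, hx1, hx'⟩
  simp only [Set.mem_ofPred_eq] at haA hbA
  have n1 := hne b hb y1 hy1
  have n2 := hne b hb y2 hy2
  rcases lt_or_gt_of_ne n1 with hb1 | hb1
  · -- b < y1 < a < y2
    obtain ⟨c, hc, d, hd', hcA, hdA, hcd⟩ := hY.cross (A := {v | f b < f v ∧ f v < f a})
      ⟨y1, hy1, hb1, haA.1⟩ ⟨y2, hy2, fun hh => by have := hh.2; omega⟩
    simp only [Set.mem_ofPred_eq] at hcA hdA
    have n3 := hne a ha d hd'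
    have n4 := hne b hb d hd'
    rcases lt_or_gt_of_ne n4 with h4 | h4
    · exact h.nc b (hXS hb) c (hYS hc) a (hXS ha) d (hYS hd') hcA.1 hcA.2 (by omega) hab.symm hcd
    · exact h.nc d (hYS hd') b (hXS hb) c (hYS hc) a (hXS ha) h4 hcA.1 hcA.2 hcd.symm hab.symm
  · obtain ⟨c, hc, d, hd', hcA, hdA, hcd⟩ := hY.cross (A := {v | f a < f v ∧ f v < f b})
      ⟨y2, hy2, haA.2, by omega⟩ ⟨y1, hy1, fun hh => by have := hh.1; omega⟩
    simp only [Set.mem_ofPred_eq] at hcA hdA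
    have n3 := hne a ha d hd'
    have n4 := hne b hb d hd'
    rcases lt_or_gt_of_ne n3 with h4 | h4
    · exact h.nc a (hXS ha) c (hYS hc) b (hXS hb) d (hYS hd') hcA.1 hcA.2 (by omega) hab hcd
    · exact h.nc d (hYS hd') a (hXS ha) c (hYS hc) b (hXS hb) h4 hcA.1 hcA.2 hcd.symm hab

lemma NC.noint2 {S : Set V} {f : V → ℕ} (h : NC G S f) {X Y X' Y' : Set V}
    (hX : Cn G X) (hX' : Cn G X') (hY : Cn G Y) (hY' : Cn G Y') (tX : Tch G X X') (tY : Tch G Y Y')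
    (sX : X ⊆ S) (sX' : X' ⊆ S) (sY : Y ⊆ S) (sY' : Y' ⊆ S)
    (d1 : ∀ v, v ∈ X → v ∈ Y → False) (d2 : ∀ v, v ∈ X → v ∈ Y' → False)
    (d3 : ∀ v, v ∈ X' → v ∈ Y → False) (d4 : ∀ v, v ∈ X' → v ∈ Y' → False)
    {x x' y y' : V} (hx : x ∈ X) (hx' : x' ∈ X') (hy : y ∈ Y) (hy' : y' ∈ Y') :
    (f y < f x ∧ f x < f y' → f y < f x' ∧ f x' < f y') ∧
    (f y' < f x ∧ f x < f y → f y' < f x' ∧ f x' < f y) ∧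
    (f y < f x' ∧ f x' < f y' → f y < f x ∧ f x < f y') ∧
    (f y' < f x' ∧ f x' < f y → f y' < f x ∧ f x < f y) ∧
    f x ≠ f y ∧ f x ≠ f y' ∧ f x' ≠ f y ∧ f x' ≠ f y' := by
  have hXX := hX.union_tch hX' tX
  have hYY := hY.union_tch hY' tY
  have hd : ∀ v, v ∈ X ∪ X' → v ∈ Y ∪ Y' → False := by
    rintro v (h | h) (h' | h')
    exacts [d1 v h h', d2 v h h', d3 v h h', d4 v h h']
  have sXX := Set.union_subset sX sX'
  have sYY := Set.union_subset sY sY'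
  have key := fun (x1 x2 y1 y2 : V) (a : x1 ∈ X ∪ X') (b : x2 ∈ X ∪ X') (c : y1 ∈ Y ∪ Y')
    (d : y2 ∈ Y ∪ Y') => NC.noint h hXX hYY sXX sYY hd a b c d
  have hne : ∀ x ∈ X ∪ X', ∀ y ∈ Y ∪ Y', f x ≠ f y := fun x hx y hy e =>
    hd x hx (h.inj x (sXX hx) y (sYY hy) e ▸ hy)
  refine ⟨fun hh => ?_, fun hh => ?_, fun hh => ?_, fun hh => ?_, hne _ (Or.inl hx) _ (Or.inl hy),
    hne _ (Or.inl hx) _ (Or.inr hy'), hne _ (Or.inr hx') _ (Or.inl hy), hne _ (Or.inr hx') _ (Or.inr hy')⟩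
  · by_contra hc; exact key x' x y y' (Or.inr hx') (Or.inl hx) (Or.inl hy) (Or.inr hy') hh hc
  · by_contra hc; exact key x' x y' y (Or.inr hx') (Or.inl hx) (Or.inr hy') (Or.inl hy) hh hc
  · by_contra hc; exact key x x' y y' (Or.inl hx) (Or.inr hx') (Or.inl hy) (Or.inr hy') hh hc
  · by_contra hc; exact key x x' y' y (Or.inl hx) (Or.inr hx') (Or.inr hy') (Or.inl hy) hh hc

lemma NC.noK4 {S : Set V} {f : V → ℕ} (h : NC G S f) {n : ℕ} {R : ℕ → Set V} (hR : Mod G n R)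
    {a b c d : ℕ} (ha : a < n) (hb : b < n) (hc : c < n) (hd : d < n)
    (hab : a ≠ b) (hac : a ≠ c) (had : a ≠ d) (hbc : b ≠ c) (hbd : b ≠ d) (hcd : c ≠ d)
    (sa : R a ⊆ S) (sb : R b ⊆ S) (sc : R c ⊆ S) (sd : R d ⊆ S)
    (tab : Tch G (R a) (R b)) (tac : Tch G (R a) (R c)) (tad : Tch G (R a) (R d))
    (tbc : Tch G (R b) (R c)) (tbd : Tch G (R b) (R d)) (tcd : Tch G (R c) (R d)) : False := by
  obtain ⟨x, hx⟩ := (hR.cn a ha).nonempty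
  obtain ⟨y, hy⟩ := (hR.cn b hb).nonempty
  obtain ⟨z, hz⟩ := (hR.cn c hc).nonempty
  obtain ⟨w, hw⟩ := (hR.cn d hd).nonempty
  have dj : ∀ {i j}, i < n → j < n → i ≠ j → ∀ v, v ∈ R i → v ∈ R j → False :=
    fun hi hj hij v h1 h2 => hij (hR.disj _ hi _ hj v h1 h2)
  have q1 := h.noint2 (hR.cn a ha) (hR.cn b hb) (hR.cn c hc) (hR.cn d hd) tab tcd sa sb sc sd
    (dj ha hc hac) (dj ha hd had) (dj hb hc hbc) (dj hb hd hbd) hx hy hz hw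
  have q2 := h.noint2 (hR.cn a ha) (hR.cn c hc) (hR.cn b hb) (hR.cn d hd) tac tbd sa sc sb sd
    (dj ha hb hab) (dj ha hd had) (dj hc hb hbc.symm) (dj hc hd hcd) hx hz hy hw
  have q3 := h.noint2 (hR.cn a ha) (hR.cn d hd) (hR.cn b hb) (hR.cn c hc) tad tbc sa sd sb sc
    (dj ha hb hab) (dj ha hc hac) (dj hd hb hbd.symm) (dj hd hc hcd.symm) hx hw hy hz
  clear * - q1 q2 q3
  generalize f x = x at *
  generalize f y = y at *
  generalize f z = z at *
  generalize f w = w at *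
  grind

lemma NC.noK23 {S : Set V} {f : V → ℕ} (h : NC G S f) {n : ℕ} {R : ℕ → Set V} (hR : Mod G n R)
    {a b c d e : ℕ} (ha : a < n) (hb : b < n) (hc : c < n) (hd : d < n) (he : e < n)
    (hab : a ≠ b) (hac : a ≠ c) (had : a ≠ d) (hae : a ≠ e) (hbc : b ≠ c) (hbd : b ≠ d) (hbe : b ≠ e)
    (hcd : c ≠ d) (hce : c ≠ e) (hde : d ≠ e)
    (sa : R a ⊆ S) (sb : R b ⊆ S) (sc : R c ⊆ S) (sd : R d ⊆ S) (se : R e ⊆ S)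
    (tac : Tch G (R a) (R c)) (tad : Tch G (R a) (R d)) (tae : Tch G (R a) (R e))
    (tbc : Tch G (R b) (R c)) (tbd : Tch G (R b) (R d)) (tbe : Tch G (R b) (R e)) : False := by
  obtain ⟨x, hx⟩ := (hR.cn a ha).nonempty
  obtain ⟨y, hy⟩ := (hR.cn b hb).nonempty
  obtain ⟨z, hz⟩ := (hR.cn c hc).nonempty
  obtain ⟨w, hw⟩ := (hR.cn d hd).nonempty
  obtain ⟨t, ht⟩ := (hR.cn e he).nonempty
  have dj : ∀ {i j}, i < n → j < n → i ≠ j → ∀ v, v ∈ R i → v ∈ R j → False :=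
    fun hi hj hij v h1 h2 => hij (hR.disj _ hi _ hj v h1 h2)
  have key : ∀ {a b c d : ℕ} {x y z w : V} (ha : a < n) (hb : b < n) (hc : c < n) (hd : d < n)
    (hab : a ≠ b) (had : a ≠ d) (hbc : b ≠ c) (hcd : c ≠ d)
    (sa : R a ⊆ S) (sb : R b ⊆ S) (sc : R c ⊆ S) (sd : R d ⊆ S)
    (tac : Tch G (R a) (R c)) (tbd : Tch G (R b) (R d)) (hx : x ∈ R a) (hy : y ∈ R b) (hz : z ∈ R c)
    (hw : w ∈ R d), _ := fun {a b c d x y z w} ha hb hc hd hab had hbc hcd sa sb sc sd tac tbd hx hy hz hw =>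
      h.noint2 (hR.cn a ha) (hR.cn c hc) (hR.cn b hb) (hR.cn d hd) tac tbd sa sc sb sd
        (dj ha hb hab) (dj ha hd had) (dj hc hb hbc.symm) (dj hc hd hcd) hx hz hy hw
  have q1 := key ha hb hc hd hab had hbc hcd sa sb sc sd tac tbd hx hy hz hw
  have q2 := key ha hb hd hc hab hac hbd hcd.symm sa sb sd sc tad tbc hx hy hw hz
  have q3 := key ha hb hc he hab hae hbc hce sa sb sc se tac tbe hx hy hz ht
  have q4 := key ha hb he hc hab hac hbe hce.symm sa sb se sc tae tbc hx hy ht hz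
  have q5 := key ha hb hd he hab hae hbd hde sa sb sd se tad tbe hx hy hw ht
  have q6 := key ha hb he hd hab had hbe hde.symm sa sb se sd tae tbd hx hy ht hw
  clear * - q1 q2 q3 q4 q5 q6
  generalize f x = x at *
  generalize f y = y at *
  generalize f z = z at *
  generalize f w = w at *
  generalize f t = t at *
  rcases lt_trichotomy x y with h | h | h <;> grind

/-- planarity from an apex vertex -/
theorem planar_of_NC {x : V} {f : V → ℕ} (h : NC G {x}ᶜ f) : Planar G := by
  have sub : ∀ {R : ℕ → Set V} {n i j : ℕ}, Mod G n R → i < n → j < n → i ≠ j → x ∈ R i → R j ⊆ {x}ᶜ := by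
    intro R n i j hR hi hj hij hx v hv hvx
    obtain rfl : v = x := hvx
    exact hij (hR.disj i hi j hj v hx hv)
  have sub' : ∀ {R : ℕ → Set V} {j : ℕ}, x ∉ R j → R j ⊆ {x}ᶜ := by
    intro R j hx v hv hvx
    obtain rfl : v = x := hvx
    exact hx hv
  constructor
  · intro hm
    obtain ⟨R, hR, hE⟩ := hasM_K5 hm
    have E : ∀ i j, adjB K5E i j = true → Tch G (R i) (R j) := fun i j h => adjB_tch hE h
    have key : ∀ a b c d : ℕ, a < 5 ∧ b < 5 ∧ c < 5 ∧ d < 5 ∧ a ≠ b ∧ a ≠ c ∧ a ≠ d ∧ b ≠ c ∧ b ≠ d ∧ c ≠ d ∧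
        adjB K5E a b = true ∧ adjB K5E a c = true ∧ adjB K5E a d = true ∧ adjB K5E b c = true ∧
        adjB K5E b d = true ∧ adjB K5E c d = true →
        R a ⊆ {x}ᶜ → R b ⊆ {x}ᶜ → R c ⊆ {x}ᶜ → R d ⊆ {x}ᶜ → False := by
      rintro a b c d ⟨h1, h2, h3, h4, h5, h6, h7, h8, h9, h10, h11, h12, h13, h14, h15, h16⟩ s1 s2 s3 s4
      exact h.noK4 hR h1 h2 h3 h4 h5 h6 h7 h8 h9 h10 s1 s2 s3 s4 (E _ _ h11) (E _ _ h12) (E _ _ h13)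
        (E _ _ h14) (E _ _ h15) (E _ _ h16)
    by_cases x0 : x ∈ R 4
    · have s := fun j (hj : j < 5) (hne : 4 ≠ j) => sub hR (show 4 < 5 by decide) hj hne x0
      exact key 0 1 2 3 (by decide) (s _ (by decide) (by decide)) (s _ (by decide) (by decide))
        (s _ (by decide) (by decide)) (s _ (by decide) (by decide))
    by_cases x1 : x ∈ R 3
    · have s := fun j (hj : j < 5) (hne : 3 ≠ j) => sub hR (show 3 < 5 by decide) hj hne x1
      exact key 0 1 2 4 (by decide) (s _ (by decide) (by decide)) (s _ (by decide) (by decide))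
        (s _ (by decide) (by decide)) (s _ (by decide) (by decide))
    by_cases x2 : x ∈ R 2
    · have s := fun j (hj : j < 5) (hne : 2 ≠ j) => sub hR (show 2 < 5 by decide) hj hne x2
      exact key 0 1 3 4 (by decide) (s _ (by decide) (by decide)) (s _ (by decide) (by decide))
        (s _ (by decide) (by decide)) (s _ (by decide) (by decide))
    by_cases x3 : x ∈ R 1
    · have s := fun j (hj : j < 5) (hne : 1 ≠ j) => sub hR (show 1 < 5 by decide) hj hne x3
      exact key 0 2 3 4 (by decide) (s _ (by decide) (by decide)) (s _ (by decide) (by decide))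
        (s _ (by decide) (by decide)) (s _ (by decide) (by decide))
    exact key 1 2 3 4 (by decide) (sub' x3) (sub' x2) (sub' x1) (sub' x0)
  · intro hm
    obtain ⟨R, hR, hE⟩ := hasM_K33 hm
    have E : ∀ i j, adjB K33E i j = true → Tch G (R i) (R j) := fun i j h => adjB_tch hE h
    have key : ∀ a b c d e : ℕ, (a < 6 ∧ b < 6 ∧ c < 6 ∧ d < 6 ∧ e < 6) ∧ (a ≠ b ∧ a ≠ c ∧ a ≠ d ∧ a ≠ e ∧
        b ≠ c ∧ b ≠ d ∧ b ≠ e ∧ c ≠ d ∧ c ≠ e ∧ d ≠ e) ∧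
        (adjB K33E a c = true ∧ adjB K33E a d = true ∧ adjB K33E a e = true ∧ adjB K33E b c = true ∧
        adjB K33E b d = true ∧ adjB K33E b e = true) →
        R a ⊆ {x}ᶜ → R b ⊆ {x}ᶜ → R c ⊆ {x}ᶜ → R d ⊆ {x}ᶜ → R e ⊆ {x}ᶜ → False := by
      rintro a b c d e ⟨⟨h1, h2, h3, h4, h5⟩, ⟨k1, k2, k3, k4, k5, k6, k7, k8, k9, k10⟩, m1, m2, m3, m4, m5, m6⟩
        s1 s2 s3 s4 s5
      exact h.noK23 hR h1 h2 h3 h4 h5 k1 k2 k3 k4 k5 k6 k7 k8 k9 k10 s1 s2 s3 s4 s5 (E _ _ m1) (E _ _ m2)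
        (E _ _ m3) (E _ _ m4) (E _ _ m5) (E _ _ m6)
    have fin : ∀ i a b c d e : ℕ, i < 6 → x ∈ R i → (i ≠ a ∧ i ≠ b ∧ i ≠ c ∧ i ≠ d ∧ i ≠ e) → 
        ((a < 6 ∧ b < 6 ∧ c < 6 ∧ d < 6 ∧ e < 6) ∧ (a ≠ b ∧ a ≠ c ∧ a ≠ d ∧ a ≠ e ∧
        b ≠ c ∧ b ≠ d ∧ b ≠ e ∧ c ≠ d ∧ c ≠ e ∧ d ≠ e) ∧
        (adjB K33E a c = true ∧ adjB K33E a d = true ∧ adjB K33E a e = true ∧ adjB K33E b c = true ∧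
        adjB K33E b d = true ∧ adjB K33E b e = true)) → False := by
      rintro i a b c d e hi hx ⟨i1, i2, i3, i4, i5⟩ hh
      exact key a b c d e hh (sub hR hi hh.1.1 i1 hx) (sub hR hi hh.1.2.1 i2 hx) (sub hR hi hh.1.2.2.1 i3 hx)
        (sub hR hi hh.1.2.2.2.1 i4 hx) (sub hR hi hh.1.2.2.2.2 i5 hx)
    by_cases x0 : x ∈ R 0
    · exact fin 0 1 2 3 4 5 (by decide) x0 (by decide) (by decide)
    by_cases x1 : x ∈ R 1
    · exact fin 1 0 2 3 4 5 (by decide) x1 (by decide) (by decide)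
    by_cases x3 : x ∈ R 3
    · exact fin 3 4 5 0 1 2 (by decide) x3 (by decide) (by decide)
    by_cases x4 : x ∈ R 4
    · exact fin 4 3 5 0 1 2 (by decide) x4 (by decide) (by decide)
    by_cases x5 : x ∈ R 5
    · exact fin 5 3 4 0 1 2 (by decide) x5 (by decide) (by decide)
    exact key 0 1 3 4 5 (by decide) (sub' x0) (sub' x1) (sub' x3) (sub' x4) (sub' x5)

open Classical in
theorem planar_contract {u w : V} {f : V → ℕ} (h : NC G {u, w}ᶜ f) : Planar (contractEdge G u w) := by
  have hadj : ∀ a b, a ≠ u → b ≠ u → (contractEdge G u w).Adj a b → a ≠ w ∧ b ≠ w ∧ G.Adj a b := by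
    intro a b ha hb hab
    unfold contractEdge at hab
    rw [fromRel_adj] at hab
    obtain ⟨_, ⟨r1, r2, r3⟩ | ⟨r1, r2, r3⟩⟩ := hab
    · exact ⟨r1, r2, by tauto⟩
    · exact ⟨r2, r1, by have := G.symm; rcases r3 with h | h | h
                        · exact h.symm
                        · exact absurd h.1 hb
                        · exact absurd h.1 ha⟩
  refine planar_of_NC (x := u) (f := fun v => if v = w then 0 else f v + 1) ⟨?_, ?_⟩
  · intro a ha b hb hab
    by_cases h1 : a = w <;> by_cases h2 : b = w
    · rw [h1, h2]
    · simp [h1, h2] at hab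
    · simp [h1, h2] at hab
    · simp only [h1, h2, if_false] at hab
      exact h.inj a (by simp; exact ⟨ha, h1⟩) b (by simp; exact ⟨hb, h2⟩) (by omega)
  · intro a ha b hb c hc d hd h1 h2 h3 hac hbd
    obtain ⟨aw, cw, hac⟩ := hadj a c ha hc hac
    obtain ⟨bw, dw, hbd⟩ := hadj b d hb hd hbd
    simp only [aw, bw, cw, dw, if_false] at h1 h2 h3
    exact h.nc a (by simp; exact ⟨ha, aw⟩) b (by simp; exact ⟨hb, bw⟩) c (by simp; exact ⟨hc, cw⟩) d
      (by simp; exact ⟨hd, dw⟩) (by omega) (by omega) (by omega) hac hbd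

end Outer
end AP

set_option linter.all false
namespace AP
section Fam

/-- rotation: position of `j` when `i` is put last -/
def rot (n i j : ℕ) : ℕ := if i < j then j - i - 1 else j + n - i - 1

lemma dw_ll {n : ℕ} {a b : Fin n} (h : (doubleWheel n).Adj (.inl a) (.inl b)) :
    b.val = (a.val + 1) % n ∨ a.val = (b.val + 1) % n := by
  simp [doubleWheel] at h
  exact h.2

lemma succ_mod {n a b : ℕ} (ha : a < n) (h : b = (a + 1) % n) : b = a + 1 ∨ (b = 0 ∧ a + 1 = n) := by
  rcases Nat.lt_or_ge (a+1) n with h1 | h1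
  · left; rw [h, Nat.mod_eq_of_lt h1]
  · right
    have : a + 1 = n := by omega
    refine ⟨?_, this⟩
    rw [h, this, Nat.mod_self]

lemma dw_ll' {n : ℕ} {a b : Fin n} (h : (doubleWheel n).Adj (.inl a) (.inl b)) :
    b.val = a.val + 1 ∨ (b.val = 0 ∧ a.val + 1 = n) ∨ a.val = b.val + 1 ∨ (a.val = 0 ∧ b.val + 1 = n) := by
  rcases dw_ll h with h | h
  · have := succ_mod a.2 h; tauto
  · have := succ_mod b.2 h; tauto

/-- the layout of a double wheel -/
def dwf (n i : ℕ) : Fin n ⊕ Fin 2 → ℕ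
  | .inl j => 1 + rot n i j.val
  | .inr _ => 0

lemma dw_spoke {n : ℕ} (i : Fin n) (k : Fin 2) : NC (doubleWheel n) {.inl i, .inr k}ᶜ (dwf n i) := by
  constructor
  · rintro (a | a) ha (b | b) hb hab
    · simp [dwf, rot] at hab ha hb
      have := a.2
      have := b.2
      have := i.2
      congr 1
      ext
      split_ifs at hab <;> omega
    · simp only [dwf] at hab; omega
    · simp only [dwf] at hab; omega
    · simp at ha hb
      congr 1
      ext
      omega
  · rintro (a | a) ha (b | b) hb (c | c) hc (d | d) hd h1 h2 h3 hac hbd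
    all_goals try (simp only [dwf] at h1 h2 h3; omega)
    all_goals
      have hbd := dw_ll' hbd
      simp [dwf, rot] at h1 h2 h3 ha hb hc hd
      have := b.2
      have := c.2
      have := d.2
      have := i.2
      split_ifs at h1 h2 h3 <;> omega

lemma dw_del {n : ℕ} (hn : 3 ≤ n) (i j : Fin n) (hij : j.val = (i.val + 1) % n) :
    NC ((doubleWheel n).deleteEdges {s(.inl i, .inl j)}) {.inr 0}ᶜ (dwf n i) := by
  constructor
  · rintro (a | a) ha (b | b) hb hab
    · simp [dwf, rot] at hab ha hb
      have := a.2
      have := b.2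
      have := i.2
      congr 1
      ext
      split_ifs at hab <;> omega
    · simp only [dwf] at hab; omega
    · simp only [dwf] at hab; omega
    · simp at ha hb
      congr 1
      ext
      omega
  · rintro (a | a) ha (b | b) hb (c | c) hc (d | d) hd h1 h2 h3 hac hbd
    all_goals try (simp only [dwf] at h1 h2 h3; omega)
    all_goals
      rw [deleteEdges_adj] at hbd
      obtain ⟨hbd, hne⟩ := hbd
      have hbd := dw_ll' hbd
      have hij := succ_mod i.2 hij
      simp [dwf, rot, Fin.ext_iff] at h1 h2 h3 hne
      have := b.2
      have := c.2
      have := d.2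
      have := i.2
      split_ifs at h1 h2 h3 <;> omega

lemma dw_hub {n : ℕ} (k l : Fin 2) (hkl : k ≠ l) :
    NC (doubleWheel n) {.inr k, .inr l}ᶜ (fun v => match v with | .inl j => j.val | .inr _ => 0) := by
  have : ∀ a : Fin 2, (Sum.inr a : Fin n ⊕ Fin 2) ∈ ({.inr k, .inr l}ᶜ : Set _) → False := by
    intro a ha
    simp at ha
    omega
  constructor
  · rintro (a | a) ha (b | b) hb hab
    · exact congrArg _ (Fin.ext hab)
    all_goals exact absurd (this _ ‹_›) (by simp)
  · rintro (a | a) ha (b | b) hb (c | c) hc (d | d) hd h1 h2 h3 hac hbd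
    all_goals try exact absurd (this _ ‹_›) (by simp)
    have hbd := dw_ll' hbd
    simp only at h1 h2 h3
    have := d.2
    omega

theorem EP_dw {n : ℕ} (hn : 3 ≤ n) : EP (doubleWheel n) := by
  rintro (i | k) (j | l) h
  · left
    rcases dw_ll h with h | h
    · exact planar_of_NC (dw_del hn i j h)
    · rw [Sym2.eq_swap]
      exact planar_of_NC (dw_del hn j i h)
  · right
    exact planar_contract (dw_spoke i l)
  · right
    refine planar_contract (f := dwf n j) ?_
    rw [Set.pair_comm]
    exact dw_spoke j k
  · right
    exact planar_contract (dw_hub k l (fun e => h.ne (by rw [e])))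

/-- position relative to the start `i` -/
def rt (m i j : ℕ) : ℕ := if i ≤ j then j - i else j + m - i

def mbf (n i j : ℕ) : ℕ := if rt (2*n) i j < n then rt (2*n) i j else 3 * n - 1 - rt (2*n) i j

lemma mob_adj {n : ℕ} {a b : Fin (2*n)} (h : (mobiusLadder n).Adj a b) :
    (b.val = (a.val + 1) % (2 * n) ∨ b.val = (a.val + n) % (2 * n)) ∨
    (a.val = (b.val + 1) % (2 * n) ∨ a.val = (b.val + n) % (2 * n)) := by
  simp [mobiusLadder] at h
  tauto

lemma mob_adj' {n : ℕ} {a b : Fin (2*n)} (h : (mobiusLadder n).Adj a b) :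
    b.val = a.val + 1 ∨ (b.val = 0 ∧ a.val + 1 = 2 * n) ∨ a.val = b.val + 1 ∨ (a.val = 0 ∧ b.val + 1 = 2 * n) ∨
    b.val = a.val + n ∨ a.val = b.val + n := by
  have key : ∀ x y : ℕ, x < 2 * n → y = (x + n) % (2 * n) → y = x + n ∨ x = y + n := by
    intro x y hx hy
    rcases Nat.lt_or_ge (x + n) (2*n) with h1 | h1
    · left; rw [hy, Nat.mod_eq_of_lt h1]
    · right
      rw [Nat.mod_eq_sub_mod h1, Nat.mod_eq_of_lt (by omega)] at hy
      omega
  rcases mob_adj h with (h | h) | (h | h)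
  · have := succ_mod a.2 h; tauto
  · have := key _ _ a.2 h; tauto
  · have := succ_mod b.2 h; tauto
  · have := key _ _ b.2 h; tauto

lemma mob_rt {n : ℕ} (hn : 3 ≤ n) {i a b : ℕ} (hi : i < 2 * n) (ha : a < 2 * n) (hb : b < 2 * n)
    (h : b = a + 1 ∨ (b = 0 ∧ a + 1 = 2 * n) ∨ a = b + 1 ∨ (a = 0 ∧ b + 1 = 2 * n) ∨ b = a + n ∨ a = b + n) :
    rt (2*n) i b = rt (2*n) i a + 1 ∨ rt (2*n) i a = rt (2*n) i b + 1 ∨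
    (rt (2*n) i b = 0 ∧ rt (2*n) i a + 1 = 2 * n) ∨ (rt (2*n) i a = 0 ∧ rt (2*n) i b + 1 = 2 * n) ∨
    rt (2*n) i b = rt (2*n) i a + n ∨ rt (2*n) i a = rt (2*n) i b + n := by
  unfold rt
  split_ifs <;> omega

lemma rt_lt {m i j : ℕ} (hi : i < m) (hj : j < m) : rt m i j < m := by
  unfold rt; split_ifs <;> omega

lemma rt_inj {m i j k : ℕ} (hi : i < m) (hj : j < m) (hk : k < m) (h : rt m i j = rt m i k) : j = k := by
  unfold rt at h; split_ifs at h <;> omega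

/-- the numeric heart of the Möbius layout -/
lemma mob_nc {n ra rb rc rd : ℕ} (hn : 3 ≤ n) (ha : ra < 2 * n) (hb : rb < 2 * n) (hc : rc < 2 * n)
    (hd : rd < 2 * n) (na : ra ≠ n) (nb : rb ≠ n) (nc : rc ≠ n) (nd : rd ≠ n)
    (hac : rc = ra + 1 ∨ ra = rc + 1 ∨ rc = ra + n ∨ ra = rc + n)
    (hbd : rd = rb + 1 ∨ rb = rd + 1 ∨ rd = rb + n ∨ rb = rd + n)
    (h1 : (if ra < n then ra else 3 * n - 1 - ra) < (if rb < n then rb else 3 * n - 1 - rb))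
    (h2 : (if rb < n then rb else 3 * n - 1 - rb) < (if rc < n then rc else 3 * n - 1 - rc))
    (h3 : (if rc < n then rc else 3 * n - 1 - rc) < (if rd < n then rd else 3 * n - 1 - rd)) : False := by
  split_ifs at h1 h2 h3 <;> omega

lemma mob_inj {n : ℕ} {i a b : ℕ} (hi : i < 2 * n) (ha : a < 2 * n) (hb : b < 2 * n)
    (na : rt (2*n) i a ≠ n) (nb : rt (2*n) i b ≠ n) (h : mbf n i a = mbf n i b) : a = b := by
  refine rt_inj hi ha hb ?_
  have := rt_lt hi ha
  have := rt_lt hi hb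
  unfold mbf at h
  split_ifs at h <;> omega

/-- antipode -/
def anti {n : ℕ} (i : Fin (2*n)) : Fin (2*n) :=
  if h : i.val < n then ⟨i.val + n, by omega⟩ else ⟨i.val - n, by have := i.2; omega⟩

lemma rt_anti {n : ℕ} {i j : Fin (2*n)} (h : rt (2*n) i j = n) : j = anti i := by
  have := i.2
  have := j.2
  unfold rt at h
  unfold anti
  ext
  split_ifs at * <;> simp <;> omega

lemma mob_del {n : ℕ} (hn : 3 ≤ n) (i j : Fin (2*n)) (hij : i.val = (j.val + 1) % (2*n)) :
    NC ((mobiusLadder n).deleteEdges {s(j, i)}) {anti i}ᶜ (fun v => mbf n i v) := by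
  have hna : ∀ v : Fin (2*n), v ∈ ({anti i}ᶜ : Set _) → rt (2*n) i v ≠ n := fun v hv e => hv (rt_anti e)
  have hadj : ∀ a c, ((mobiusLadder n).deleteEdges {s(j, i)}).Adj a c →
      let ra := rt (2*n) i a; let rc := rt (2*n) i c
      rc = ra + 1 ∨ ra = rc + 1 ∨ rc = ra + n ∨ ra = rc + n := by
    intro a c hac
    rw [deleteEdges_adj] at hac
    obtain ⟨hac, hne⟩ := hac
    have h1 := mob_adj' hac
    have hij := succ_mod j.2 hij
    have h2 := mob_rt hn i.2 a.2 c.2 h1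
    simp [Fin.ext_iff] at hne
    have : ¬ ((rt (2*n) i c = 0 ∧ rt (2*n) i a + 1 = 2 * n)) := by
      have := i.2; have := j.2; have := a.2; have := c.2
      clear h2 h1
      unfold rt
      split_ifs <;> omega
    have : ¬ ((rt (2*n) i a = 0 ∧ rt (2*n) i c + 1 = 2 * n)) := by
      have := i.2; have := j.2; have := a.2; have := c.2
      clear h2 h1
      unfold rt
      split_ifs <;> omega
    dsimp only
    omega
  constructor
  · intro a ha b hb h
    exact Fin.ext (mob_inj i.2 a.2 b.2 (hna a ha) (hna b hb) h)
  · intro a ha b hb c hc d hd h1 h2 h3 hac hbd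
    exact mob_nc hn (rt_lt i.2 a.2) (rt_lt i.2 b.2) (rt_lt i.2 c.2) (rt_lt i.2 d.2) (hna _ ha) (hna _ hb)
      (hna _ hc) (hna _ hd) (hadj _ _ hac) (hadj _ _ hbd) h1 h2 h3

lemma mob_con {n : ℕ} (hn : 3 ≤ n) (i : Fin (2*n)) :
    NC (mobiusLadder n) {i, anti i}ᶜ (fun v => mbf n i v) := by
  have hna : ∀ v : Fin (2*n), v ∈ ({i, anti i}ᶜ : Set _) → rt (2*n) i v ≠ n ∧ rt (2*n) i v ≠ 0 := by
    intro v hv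
    simp at hv
    refine ⟨fun e => hv.2 (rt_anti e), fun e => hv.1 ?_⟩
    have := i.2; have := v.2
    ext
    unfold rt at e
    split_ifs at e <;> omega
  have hadj : ∀ a c : Fin (2*n), rt (2*n) i a ≠ 0 → rt (2*n) i c ≠ 0 → (mobiusLadder n).Adj a c →
      let ra := rt (2*n) i a; let rc := rt (2*n) i c
      rc = ra + 1 ∨ ra = rc + 1 ∨ rc = ra + n ∨ ra = rc + n := by
    intro a c h0 h0' hac
    have h2 := mob_rt hn i.2 a.2 c.2 (mob_adj' hac)
    dsimp only
    omega
  constructor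
  · intro a ha b hb h
    exact Fin.ext (mob_inj i.2 a.2 b.2 (hna a ha).1 (hna b hb).1 h)
  · intro a ha b hb c hc d hd h1 h2 h3 hac hbd
    exact mob_nc hn (rt_lt i.2 a.2) (rt_lt i.2 b.2) (rt_lt i.2 c.2) (rt_lt i.2 d.2) (hna _ ha).1 (hna _ hb).1
      (hna _ hc).1 (hna _ hd).1 (hadj _ _ (hna _ ha).2 (hna _ hc).2 hac) (hadj _ _ (hna _ hb).2 (hna _ hd).2 hbd)
      h1 h2 h3

theorem EP_mob {n : ℕ} (hn : 3 ≤ n) : EP (mobiusLadder n) := by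
  intro a b h
  have ant : ∀ x y : Fin (2*n), y.val = (x.val + n) % (2*n) → y = anti x := by
    intro x y hy
    have := x.2
    unfold anti
    ext
    split_ifs with h
    · rw [hy, Nat.mod_eq_of_lt (by omega)]
    · rw [hy, Nat.mod_eq_sub_mod (by omega), Nat.mod_eq_of_lt (by omega)]
      simp
      omega
  rcases mob_adj h with (h | h) | (h | h)
  · left; exact planar_of_NC (mob_del hn b a h)
  · right; rw [ant a b h]; exact planar_contract (mob_con hn a)
  · left; rw [Sym2.eq_swap]; exact planar_of_NC (mob_del hn a b h)
  · right
    rw [ant b a h]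
    refine planar_contract (f := fun v => mbf n b v) ?_
    rw [Set.pair_comm]
    exact mob_con hn b

end Fam
end AP

set_option linter.all false
namespace AP
section WClass
variable {U : Type*} {G : SimpleGraph U}

structure WS (G : SimpleGraph U) (P : U → Fin 4) (f : U → ℕ) (N : Fin 4 → ℕ) (h k l : Fin 4 → U) :
    Prop where
  tri : ∀ i, i ≠ 0 → ∀ v, P v = 0 ↔ v = h i ∨ v = k i ∨ v = l i
  dist : ∀ i, i ≠ 0 → h i ≠ k i ∧ h i ≠ l i ∧ k i ≠ l i
  rng : ∀ v, P v ≠ 0 → 1 ≤ f v ∧ f v ≤ N (P v)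
  inj : ∀ v w, P v ≠ 0 → P v = P w → f v = f w → v = w
  sep : ∀ v w, G.Adj v w → P v = 0 ∨ P w = 0 ∨ P v = P w
  con : ∀ v w, G.Adj v w → P v ≠ 0 → P v = P w → f w = f v + 1 ∨ f v = f w + 1
  ka : ∀ v, P v ≠ 0 → G.Adj v (k (P v)) → f v = 1
  la : ∀ v, P v ≠ 0 → G.Adj v (l (P v)) → f v = N (P v)

lemma wheel_ss {n : ℕ} {a b : Fin n} (h : (wheelGraph n).Adj (some a) (some b)) :
    b.val = a.val + 1 ∨ (b.val = 0 ∧ a.val + 1 = n) ∨ a.val = b.val + 1 ∨ (a.val = 0 ∧ b.val + 1 = n) := by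
  simp [wheelGraph] at h
  rcases h.2 with h | h
  · have := succ_mod a.2 h; tauto
  · have := succ_mod b.2 h; tauto

lemma wheel_hub {n : ℕ} (a b : Fin n) (hab : (wheelGraph n).Adj (some a) (some b)) :
    ∃ (f : Option (Fin n) → ℕ) (N : ℕ) (k l : Option (Fin n)),
      ((k = some a ∧ l = some b) ∨ (k = some b ∧ l = some a)) ∧
      (∀ v, v ≠ none → v ≠ some a → v ≠ some b → 1 ≤ f v ∧ f v ≤ N) ∧
      (∀ v w, v ≠ none → w ≠ none → f v = f w → v = w) ∧
      (∀ v w, v ≠ none → v ≠ some a → v ≠ some b → w ≠ none → w ≠ some a → w ≠ some b →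
        (wheelGraph n).Adj v w → f w = f v + 1 ∨ f v = f w + 1) ∧
      (∀ v, v ≠ none → v ≠ some a → v ≠ some b → (wheelGraph n).Adj v k → f v = 1) ∧
      (∀ v, v ≠ none → v ≠ some a → v ≠ some b → (wheelGraph n).Adj v l → f v = N) := by
  wlog H : b.val = a.val + 1 ∨ (b.val = 0 ∧ a.val + 1 = n) generalizing a b
  · have h1 := wheel_ss hab
    obtain ⟨f, N, k, l, h1, h2, h3, h4, h5, h6⟩ := this b a hab.symm (by tauto)
    refine ⟨f, N, k, l, by tauto, ?_, h3, ?_, ?_, ?_⟩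
    · intro v a b c; exact h2 v a c b
    · intro v w a b c d e f g; exact h4 v w a c b d f e g
    · intro v a b c; exact h5 v a c b
    · intro v a b c; exact h6 v a c b
  have ha := a.2
  have hb := b.2
  refine ⟨fun v => match v with | none => 0 | some c => rt n b.val c.val, n - 2, some b, some a, Or.inr ⟨rfl, rfl⟩, ?_, ?_, ?_, ?_, ?_⟩
  · rintro (_ | v) h1 h2 h3
    · exact absurd rfl h1
    · have := v.2
      have h2 : v.val ≠ a.val := fun e => h2 (by rw [Fin.ext e])
      have h3 : v.val ≠ b.val := fun e => h3 (by rw [Fin.ext e])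
      simp only [rt]
      split_ifs <;> omega
  · rintro (_ | v) (_ | w) h1 h2 h3
    · exact absurd rfl h1
    · exact absurd rfl h1
    · exact absurd rfl h2
    · rw [Fin.ext (rt_inj b.2 v.2 w.2 h3)]
  · rintro (_ | v) (_ | w) h1 h2 h3 k1 k2 k3 hh
    · exact absurd rfl h1
    · exact absurd rfl h1
    · exact absurd rfl k1
    · have hh := wheel_ss hh
      have := v.2
      have := w.2
      have h2 : v.val ≠ a.val := fun e => h2 (by rw [Fin.ext e])
      have h3 : v.val ≠ b.val := fun e => h3 (by rw [Fin.ext e])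
      have k2 : w.val ≠ a.val := fun e => k2 (by rw [Fin.ext e])
      have k3 : w.val ≠ b.val := fun e => k3 (by rw [Fin.ext e])
      simp only [rt]
      split_ifs <;> omega
  · rintro (_ | v) h1 h2 h3 hh
    · exact absurd rfl h1
    · have hh := wheel_ss hh
      have := v.2
      have h2 : v.val ≠ a.val := fun e => h2 (by rw [Fin.ext e])
      have h3 : v.val ≠ b.val := fun e => h3 (by rw [Fin.ext e])
      simp only [rt]
      split_ifs <;> omega
  · rintro (_ | v) h1 h2 h3 hh
    · exact absurd rfl h1
    · have hh := wheel_ss hh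
      have := v.2
      have h2 : v.val ≠ a.val := fun e => h2 (by rw [Fin.ext e])
      have h3 : v.val ≠ b.val := fun e => h3 (by rw [Fin.ext e])
      simp only [rt]
      split_ifs <;> omega

def WTri (n : ℕ) (x y z : Option (Fin n)) : Prop :=
    ∃ (f : Option (Fin n) → ℕ) (N : ℕ) (h k l : Option (Fin n)),
      (∀ v, (v = x ∨ v = y ∨ v = z) ↔ (v = h ∨ v = k ∨ v = l)) ∧ (h ≠ k ∧ h ≠ l ∧ k ≠ l) ∧
      (∀ v, ¬ (v = h ∨ v = k ∨ v = l) → 1 ≤ f v ∧ f v ≤ N) ∧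
      (∀ v w, ¬ (v = h ∨ v = k ∨ v = l) → ¬ (w = h ∨ w = k ∨ w = l) → f v = f w → v = w) ∧
      (∀ v w, ¬ (v = h ∨ v = k ∨ v = l) → ¬ (w = h ∨ w = k ∨ w = l) →
        (wheelGraph n).Adj v w → f w = f v + 1 ∨ f v = f w + 1) ∧
      (∀ v, ¬ (v = h ∨ v = k ∨ v = l) → (wheelGraph n).Adj v k → f v = 1) ∧
      (∀ v, ¬ (v = h ∨ v = k ∨ v = l) → (wheelGraph n).Adj v l → f v = N)

lemma wheel_tri {n : ℕ} (hn : 3 ≤ n) (x y z : Option (Fin n)) (hxy : (wheelGraph n).Adj x y)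
    (hxz : (wheelGraph n).Adj x z) (hyz : (wheelGraph n).Adj y z) :
    WTri n x y z := by
  have main : ∀ a b : Fin n, (wheelGraph n).Adj (some a) (some b) →
      (∀ v, (v = x ∨ v = y ∨ v = z) ↔ (v = none ∨ v = some a ∨ v = some b)) → WTri n x y z := by
    intro a b hab hv
    obtain ⟨f, N, k, l, h1, h2, h3, h4, h5, h6⟩ := wheel_hub a b hab
    have hne := hab.ne
    have e : ∀ v, (v = none ∨ v = k ∨ v = l) ↔ (v = none ∨ v = some a ∨ v = some b) := by
      intro v
      rcases h1 with ⟨rfl, rfl⟩ | ⟨rfl, rfl⟩ <;> tauto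
    refine ⟨f, N, none, k, l, fun v => by rw [hv, e], ?_, ?_, ?_, ?_, ?_, ?_⟩
    · rcases h1 with ⟨rfl, rfl⟩ | ⟨rfl, rfl⟩
      · exact ⟨by simp, by simp, hne⟩
      · exact ⟨by simp, by simp, hne.symm⟩
    · intro v hv; rw [e] at hv; push Not at hv; exact h2 v hv.1 hv.2.1 hv.2.2
    · intro v w hv hw; rw [e] at hv hw; push Not at hv hw; exact h3 v w hv.1 hw.1
    · intro v w hv hw; rw [e] at hv hw; push Not at hv hw
      exact h4 v w hv.1 hv.2.1 hv.2.2 hw.1 hw.2.1 hw.2.2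
    · intro v hv; rw [e] at hv; push Not at hv; exact h5 v hv.1 hv.2.1 hv.2.2
    · intro v hv; rw [e] at hv; push Not at hv; exact h6 v hv.1 hv.2.1 hv.2.2
  rcases x with _ | a <;> rcases y with _ | b <;> rcases z with _ | c
  · exact absurd rfl hxy.ne
  · exact absurd rfl hxy.ne
  · exact absurd rfl hxz.ne
  · exact main b c hyz (fun v => Iff.rfl)
  · exact absurd rfl hyz.ne
  · exact main a c hxz (fun v => by tauto)
  · exact main a b hxy (fun v => by tauto)
  · -- n = 3
    have e1 := wheel_ss hxy
    have e2 := wheel_ss hxz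
    have e3 := wheel_ss hyz
    have ha := a.2; have hb := b.2; have hc := c.2
    have hab : a.val ≠ b.val := by omega
    have hac : a.val ≠ c.val := by omega
    have hbc : b.val ≠ c.val := by omega
    have hn3 : n = 3 := by omega
    have key : ∀ v : Option (Fin n), ¬ (v = some a ∨ v = some b ∨ v = some c) → v = none := by
      rintro (_ | v) hv
      · rfl
      · exfalso
        have := v.2
        push Not at hv
        have h1 : v.val ≠ a.val := fun e => hv.1 (by rw [Fin.ext e])
        have h2 : v.val ≠ b.val := fun e => hv.2.1 (by rw [Fin.ext e])
        have h3 : v.val ≠ c.val := fun e => hv.2.2 (by rw [Fin.ext e])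
        omega
    refine ⟨fun _ => 1, 1, some a, some b, some c, fun v => Iff.rfl, ⟨hxy.ne, hxz.ne, hyz.ne⟩, ?_, ?_, ?_, ?_, ?_⟩
    · intros; simp
    · intro v w hv hw _; rw [key v hv, key w hw]
    · intro v w hv hw hh; rw [key v hv, key w hw] at hh; exact absurd rfl hh.ne
    · intros; rfl
    · intros; rfl

open Classical in
lemma WS.of (h : InClassW G) : ∃ P f N h k l, WS G P f N h k l := by
  obtain ⟨P, h1, h2, h3, h4⟩ := h
  obtain ⟨x, y, z, hxy, hxz, hyz, hT⟩ := Set.ncard_eq_three.1 h1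
  have hT' : ∀ v, P v = 0 ↔ (v = x ∨ v = y ∨ v = z) := by
    intro v
    have : v ∈ P ⁻¹' {0} ↔ v ∈ ({x, y, z} : Set U) := by rw [hT]
    simpa using this
  have hx : P x = 0 := (hT' x).2 (by simp)
  have hy : P y = 0 := (hT' y).2 (by simp)
  have hz : P z = 0 := (hT' z).2 (by simp)
  have key : ∀ i : Fin 4, ∃ (f : U → ℕ) (N : ℕ) (h k l : U), i ≠ 0 →
      (∀ v, P v = 0 ↔ v = h ∨ v = k ∨ v = l) ∧ (h ≠ k ∧ h ≠ l ∧ k ≠ l) ∧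
      (∀ v, P v = i → 1 ≤ f v ∧ f v ≤ N) ∧
      (∀ v w, P v = i → P w = i → f v = f w → v = w) ∧
      (∀ v w, P v = i → P w = i → G.Adj v w → f w = f v + 1 ∨ f v = f w + 1) ∧
      (∀ v, P v = i → G.Adj v k → f v = 1) ∧ (∀ v, P v = i → G.Adj v l → f v = N) := by
    intro i
    by_cases hi : i = 0
    · exact ⟨fun _ => 0, 0, x, x, x, fun h => absurd hi h⟩
    obtain ⟨n, hn, ⟨e⟩⟩ := h3 i hi
    have adj : ∀ a b (ha : a ∈ {v | P v = 0 ∨ P v = i}) (hb : b ∈ {v | P v = 0 ∨ P v = i}),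
        (wheelGraph n).Adj (e ⟨a, ha⟩) (e ⟨b, hb⟩) ↔ G.Adj a b := fun a b ha hb =>
      (e.map_adj_iff (v := ⟨a, ha⟩) (w := ⟨b, hb⟩))
    obtain ⟨f, N, h, k, l, g1, g2, g3, g4, g5, g6, g7⟩ := wheel_tri hn (e ⟨x, Or.inl hx⟩) (e ⟨y, Or.inl hy⟩)
      (e ⟨z, Or.inl hz⟩) ((adj _ _ _ _).2 (h2 _ _ hx hy hxy)) ((adj _ _ _ _).2 (h2 _ _ hx hz hxz))
      ((adj _ _ _ _).2 (h2 _ _ hy hz hyz))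
    have hh : ∀ v (hv : v ∈ {v | P v = 0 ∨ P v = i}), (P v = 0 ↔ (e ⟨v, hv⟩ = h ∨ e ⟨v, hv⟩ = k ∨ e ⟨v, hv⟩ = l)) := by
      intro v hv
      rw [← g1, hT']
      simp only [e.injective.eq_iff, Subtype.mk.injEq]
    have hs : ∀ w, e (e.symm w) = w := fun w => e.apply_symm_apply w
    have hS : ∀ w v (hv : v ∈ {v | P v = 0 ∨ P v = i}), e ⟨v, hv⟩ = w ↔ v = (e.symm w).1 := by
      intro w v hv
      constructor
      · rintro rfl; rw [e.symm_apply_apply]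
      · intro h; have : (⟨v, hv⟩ : {v | P v = 0 ∨ P v = i}) = e.symm w := Subtype.ext h
        rw [this, hs]
    have hz0 : ∀ w, (w = h ∨ w = k ∨ w = l) → P (e.symm w).1 = 0 := by
      intro w hw
      rw [hh _ (e.symm w).2]
      simp only [Subtype.coe_eta, hs]; exact hw
    refine ⟨fun v => if hv : P v = 0 ∨ P v = i then f (e ⟨v, hv⟩) else 0, N, (e.symm h).1, (e.symm k).1, (e.symm l).1,
      fun _ => ⟨?_, ?_, ?_, ?_, ?_, ?_, ?_⟩⟩
    · intro v
      constructor
      · intro hv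
        have := (hh v (Or.inl hv)).1 hv
        simpa only [hS] using this
      · rintro (rfl | rfl | rfl)
        · exact hz0 _ (by simp)
        · exact hz0 _ (by simp)
        · exact hz0 _ (by simp)
    · have hi : ∀ a b, a ≠ b → (e.symm a).1 ≠ (e.symm b).1 := fun a b hab hc =>
        hab (e.symm.injective (Subtype.ext hc))
      exact ⟨hi _ _ g2.1, hi _ _ g2.2.1, hi _ _ g2.2.2⟩
    · intro v hv
      dsimp only
      rw [dif_pos (Or.inr hv)]
      exact g3 _ (by rw [← hh, hv]; exact hi)
    · intro v w hv hw
      dsimp only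
      rw [dif_pos (Or.inr hv), dif_pos (Or.inr hw)]
      intro hf
      have := g4 _ _ (by rw [← hh, hv]; exact hi) (by rw [← hh, hw]; exact hi) hf
      exact congrArg Subtype.val (e.injective this)
    · intro v w hv hw ha
      dsimp only
      rw [dif_pos (Or.inr hv), dif_pos (Or.inr hw)]
      exact g5 _ _ (by rw [← hh, hv]; exact hi) (by rw [← hh, hw]; exact hi) ((adj _ _ _ _).2 ha)
    · intro v hv ha
      dsimp only
      rw [dif_pos (Or.inr hv)]
      refine g6 _ (by rw [← hh, hv]; exact hi) ?_
      have := (adj v (e.symm k).1 (Or.inr hv) (e.symm k).2).2 ha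
      simpa only [Subtype.coe_eta, hs] using this
    · intro v hv ha
      dsimp only
      rw [dif_pos (Or.inr hv)]
      refine g7 _ (by rw [← hh, hv]; exact hi) ?_
      have := (adj v (e.symm l).1 (Or.inr hv) (e.symm l).2).2 ha
      simpa only [Subtype.coe_eta, hs] using this
  choose f N h k l hk using key
  refine ⟨P, fun v => f (P v) v, N, h, k, l, ⟨fun i hi => (hk i hi).1, fun i hi => (hk i hi).2.1, ?_, ?_, ?_, ?_, ?_, ?_⟩⟩
  · intro v hv; exact (hk _ hv).2.2.1 v rfl
  · intro v w hv hw hf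
    rw [← hw] at hf
    exact (hk _ hv).2.2.2.1 v w rfl hw.symm hf
  · intro v w hvw
    obtain ⟨i, hi, h5, h6⟩ := h4 hvw
    rcases h5 with h5 | h5
    · exact Or.inl h5
    · rcases h6 with h6 | h6
      · exact Or.inr (Or.inl h6)
      · exact Or.inr (Or.inr (h5.trans h6.symm))
  · intro v w hvw hv hw
    have := (hk _ hv).2.2.2.2.1 v w rfl hw.symm hvw
    rwa [← hw]
  · intro v hv; exact (hk _ hv).2.2.2.2.2.1 v rfl
  · intro v hv; exact (hk _ hv).2.2.2.2.2.2 v rfl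

end WClass
end AP

set_option linter.all false
namespace AP
section WClass2
variable {U : Type*} {G : SimpleGraph U}

/-- shape of an edge of the layout -/
def LE (M N2 N3 : ℕ) (u2 u3 : Prop) (a c : ℕ) : Prop :=
  c = a + 1 ∨
  (a = 0 ∧ (c ≤ N2 ∨ c = M) ∧ (u2 → c = 1 ∨ c = M)) ∨
  (c = M ∧ 1 ≤ a ∧ a ≤ N2 ∧ (¬ u2 → a = N2)) ∨
  (a = 0 ∧ 3 * M ≤ c + N3 ∧ (u3 → c < 3 * M → c + 1 = 3 * M)) ∨
  (a = M ∧ M < c ∧ c < 3 * M ∧ (¬ u3 → c < 2 * M ∨ c + N3 = 3 * M))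

lemma LE.nc {M N2 N3 : ℕ} {u2 u3 : Prop} (h2 : N2 + 1 < M) (h3 : N3 + 1 < M) {a b c d : ℕ}
    (h : LE M N2 N3 u2 u3 a c) (h' : LE M N2 N3 u2 u3 b d) (hab : a < b) (hbc : b < c) (hcd : c < d) : False := by
  unfold LE at h h'
  by_cases u2 <;> by_cases u3 <;> simp only [*, true_implies, false_implies, not_true_eq_false, not_false_eq_true, and_true] at h h' <;> omega

set_option maxHeartbeats 800000 in
open Classical in
lemma WS.layout {P f N} {h k l : Fin 4 → U} (W : WS G P f N h k l) {j : Fin 4} (hj : j ≠ 0)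
    {G' : SimpleGraph U} (hG : G' ≤ G) {S : Set U} (hS : h j ∉ S) (s : ℕ)
    (H1 : ∀ a ∈ S, ∀ b ∈ S, P a = j → P b = j → G'.Adj a b → f a ≤ s → f b ≤ s)
    (H2 : ∀ a ∈ S, P a = j → G'.Adj a (k j) → f a ≤ s)
    (H3 : ∀ a ∈ S, P a = j → G'.Adj a (l j) → s < f a) : ∃ p, NC G' S p := by
  obtain ⟨m2, m3, hm2, hm3, hm23, hmj2, hmj3, hall⟩ : ∃ m2 m3 : Fin 4, m2 ≠ 0 ∧ m3 ≠ 0 ∧ m2 ≠ m3 ∧ m2 ≠ j ∧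
      m3 ≠ j ∧ ∀ i : Fin 4, i = 0 ∨ i = j ∨ i = m2 ∨ i = m3 := by
    clear H1 H2 H3 hS; revert hj; revert j; decide
  obtain ⟨M, hMj, hM2, hM3⟩ : ∃ M, N j + 1 < M ∧ N m2 + 1 < M ∧ N m3 + 1 < M :=
    ⟨N j + N m2 + N m3 + 2, by omega, by omega, by omega⟩
  set y := k j with hy
  set z := l j with hz
  have hd := W.dist j hj
  have hyz : y ≠ z := hd.2.2
  have hPy : P y = 0 := (W.tri j hj y).2 (by simp [hy])
  have hPz : P z = 0 := (W.tri j hj z).2 (by simp [hz])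
  set o : Fin 4 → Prop := fun m => k m = y ∨ l m = z with ho
  set g : U → ℕ := fun v => if o (P v) then f v else N (P v) + 1 - f v with hg
  have gr : ∀ v, P v ≠ 0 → 1 ≤ g v ∧ g v ≤ N (P v) := by
    intro v hv
    have := W.rng v hv
    simp only [hg]; split_ifs <;> omega
  have ginj : ∀ v w, P v ≠ 0 → P v = P w → g v = g w → v = w := by
    intro v w hv hw e
    have r1 := W.rng v hv
    have r2 := W.rng w (hw ▸ hv)
    refine W.inj v w hv hw ?_
    simp only [hg, ← hw] at e r2
    split_ifs at e <;> omega
  have gcon : ∀ v w, G.Adj v w → P v ≠ 0 → P v = P w → g w = g v + 1 ∨ g v = g w + 1 := by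
    intro v w ha hv hw
    have r1 := W.rng v hv
    have r2 := W.rng w (hw ▸ hv)
    have := W.con v w ha hv hw
    simp only [hg, ← hw] at r2 ⊢
    split_ifs <;> omega
  have gy : ∀ v, P v ≠ 0 → G.Adj v y → h (P v) = y ∨ g v = 1 := by
    intro v hv ha
    have r1 := W.rng v hv
    have e1 := (W.tri _ hv y).1 hPy
    have e2 := (W.tri _ hv z).1 hPz
    have e3 := W.dist _ hv
    rcases e1 with e1 | e1 | e1
    · left; exact e1.symm
    · right
      have : f v = 1 := W.ka v hv (e1 ▸ ha)
      simp only [hg]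
      rw [if_pos (Or.inl e1.symm)]; exact this
    · right
      have : f v = N (P v) := W.la v hv (e1 ▸ ha)
      simp only [hg]
      rw [if_neg]
      · omega
      · rintro (h' | h')
        · exact e3.2.2 (h'.trans e1)
        · exact hyz (e1.trans h')
  have gz : ∀ v, P v ≠ 0 → G.Adj v z → h (P v) = z ∨ g v = N (P v) := by
    intro v hv ha
    have r1 := W.rng v hv
    have e2 := (W.tri _ hv z).1 hPz
    have e3 := W.dist _ hv
    rcases e2 with e1 | e1 | e1
    · left; exact e1.symm
    · right
      have : f v = 1 := W.ka v hv (e1 ▸ ha)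
      simp only [hg]
      rw [if_neg]
      · omega
      · rintro (h' | h')
        · exact hyz (h'.symm.trans e1.symm)
        · exact e3.2.2 (e1.symm.trans h'.symm)
    · right
      have : f v = N (P v) := W.la v hv (e1 ▸ ha)
      simp only [hg]
      rw [if_pos (Or.inr e1.symm)]; exact this
  set p : U → ℕ := fun v => if v = y then 0 else if v = z then M else if P v = m2 then g v else
    if P v = m3 then 2 * M + (M - g v) else if f v ≤ s then 3 * M + (M - f v) else M + (N j + 1 - f v) with hp
  have typ : ∀ v ∈ S, (v = y ∧ p v = 0) ∨ (v = z ∧ p v = M) ∨ (P v = m2 ∧ p v = g v) ∨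
      (P v = m3 ∧ p v = 2 * M + (M - g v)) ∨ (P v = j ∧ f v ≤ s ∧ p v = 3 * M + (M - f v)) ∨
      (P v = j ∧ s < f v ∧ p v = M + (N j + 1 - f v)) := by
    intro v hv
    by_cases h0 : P v = 0
    · have := (W.tri j hj v).1 h0
      rcases this with rfl | rfl | rfl
      · exact absurd hv hS
      · left; exact ⟨rfl, by simp only [hp]; rw [if_pos hy.symm]⟩
      · right; left; exact ⟨rfl, by simp only [hp]; rw [if_neg hyz.symm, if_pos rfl]⟩
    · have n1 : v ≠ y := by rintro rfl; exact h0 hPy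
      have n2 : v ≠ z := by rintro rfl; exact h0 hPz
      have := hall (P v)
      simp only [hp, if_neg n1, if_neg n2]
      by_cases c2 : P v = m2
      · simp [c2, n1, n2]
      by_cases c3 : P v = m3
      · simp [c3, n1, n2, hm23.symm]
      have cj : P v = j := by tauto
      by_cases c4 : f v ≤ s
      · simp [cj, n1, n2, hmj2.symm, hmj3.symm, c4]
      · simp [cj, n1, n2, hmj2.symm, hmj3.symm, c4]; omega
  refine ⟨p, ⟨?_, ?_⟩⟩
  · intro a ha b hb hab
    have ra := W.rng a
    have rb := W.rng b
    have ga := gr a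
    have gb := gr b
    rcases typ a ha with ⟨e, t⟩ | ⟨e, t⟩ | ⟨e, t⟩ | ⟨e, t⟩ | ⟨e, t', t⟩ | ⟨e, t', t⟩ <;>
    rcases typ b hb with ⟨e', q⟩ | ⟨e', q⟩ | ⟨e', q⟩ | ⟨e', q⟩ | ⟨e', q', q⟩ | ⟨e', q', q⟩
    all_goals first
      | (rw [e, e']; done)
      | (rw [t, q] at hab
         simp only [e, e', hPy, hPz, ne_eq, hm2, hm3, hj, not_false_eq_true, true_implies, not_true_eq_false, false_implies] at ra rb ga gb
         first
          | omega
          | exact ginj a b (by rw [e]; assumption) (e.trans e'.symm) (by omega)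
          | exact W.inj a b (by rw [e]; assumption) (e.trans e'.symm) (by omega))
  · have adj : ∀ a ∈ S, ∀ b ∈ S, G'.Adj a b → p a < p b → LE M (N m2) (N m3) (h m2 ≠ y) (h m3 ≠ y) (p a) (p b) := by
      intro a ha b hb hab hlt
      have hab' := hG hab
      have tb := typ b hb
      unfold LE
      rcases typ a ha with ⟨e, t⟩ | ⟨e, t⟩ | ⟨e, t⟩ | ⟨e, t⟩ | ⟨e, t', t⟩ | ⟨e, t', t⟩
      · -- a = y
        rcases tb with ⟨e', q⟩ | ⟨e', q⟩ | ⟨e', q⟩ | ⟨e', q⟩ | ⟨e', q', q⟩ | ⟨e', q', q⟩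
        · omega
        · right; left; exact ⟨t, Or.inr q, fun _ => Or.inr q⟩
        · have hb0 : P b ≠ 0 := by rw [e']; exact hm2
          have h1 := gr b hb0
          have h2 := gy b hb0 (e ▸ hab'.symm)
          rw [e'] at h1 h2
          right; left; exact ⟨t, Or.inl (by omega), fun u => Or.inl (by have := h2.resolve_left u; omega)⟩
        · have hb0 : P b ≠ 0 := by rw [e']; exact hm3
          have h1 := gr b hb0
          have h2 := gy b hb0 (e ▸ hab'.symm)
          rw [e'] at h1 h2
          right; right; right; left; exact ⟨t, by omega, fun u _ => by have := h2.resolve_left u; omega⟩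
        · have h1 := W.rng b (by rw [e']; exact hj)
          rw [e'] at h1
          right; right; right; left; exact ⟨t, by omega, fun u _ => by omega⟩
        · have := H2 b hb e' (by rw [← e]; exact hab.symm)
          omega
      · -- a = z
        rcases tb with ⟨e', q⟩ | ⟨e', q⟩ | ⟨e', q⟩ | ⟨e', q⟩ | ⟨e', q', q⟩ | ⟨e', q', q⟩
        · omega
        · omega
        · have h1 := gr b (by rw [e']; exact hm2)
          rw [e'] at h1; omega
        · have hb0 : P b ≠ 0 := by rw [e']; exact hm3
          have h1 := gr b hb0
          have h2 := gz b hb0 (e ▸ hab'.symm)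
          rw [e'] at h1 h2
          right; right; right; right
          refine ⟨t, by omega, by omega, fun u => Or.inr ?_⟩
          have := h2.resolve_left (fun h' => u (fun h'' => hyz (h''.symm.trans h')))
          omega
        · have := H3 b hb e' (by rw [← e]; exact hab.symm)
          omega
        · have h1 := W.rng b (by rw [e']; exact hj)
          rw [e'] at h1
          right; right; right; right
          exact ⟨t, by omega, by omega, fun u => Or.inl (by omega)⟩
      · -- a in m2
        have ha0 : P a ≠ 0 := by rw [e]; exact hm2
        have h1 := gr a ha0
        rw [e] at h1
        rcases tb with ⟨e', q⟩ | ⟨e', q⟩ | h'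
        · omega
        · have h2 := gz a ha0 (e' ▸ hab')
          rw [e] at h2
          right; right; left
          refine ⟨q, by omega, by omega, fun u => ?_⟩
          have := h2.resolve_left (fun h' => u (fun h'' => hyz (h''.symm.trans h')))
          omega
        · have hb0 : P b ≠ 0 := by
            rcases h' with h' | h' | h' | h' <;> rw [h'.1] <;> assumption
          have := (W.sep a b hab').resolve_left ha0
          have := this.resolve_left hb0
          have c := gcon a b hab' ha0 this
          rcases h' with h' | h' | h' | h'
          · left; omega
          · exact absurd (e.symm.trans (this.trans h'.1)) hm23
          · exact absurd (e.symm.trans (this.trans h'.1)) hmj2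
          · exact absurd (e.symm.trans (this.trans h'.1)) hmj2
      · have ha0 : P a ≠ 0 := by rw [e]; exact hm3
        have h1 := gr a ha0
        rw [e] at h1
        rcases tb with ⟨e', q⟩ | ⟨e', q⟩ | h'
        · omega
        · omega
        · have hb0 : P b ≠ 0 := by
            rcases h' with h' | h' | h' | h' <;> rw [h'.1] <;> assumption
          have := (W.sep a b hab').resolve_left ha0
          have := this.resolve_left hb0
          have c := gcon a b hab' ha0 this
          have h2 := gr b hb0
          rw [← this, e] at h2
          rcases h' with h' | h' | h' | h'
          · exact absurd (e.symm.trans (this.trans h'.1)) hm23.symm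
          · left; omega
          · exact absurd (e.symm.trans (this.trans h'.1)) hmj3
          · exact absurd (e.symm.trans (this.trans h'.1)) hmj3
      · have ha0 : P a ≠ 0 := by rw [e]; exact hj
        have h1 := W.rng a ha0
        rw [e] at h1
        rcases tb with ⟨e', q⟩ | ⟨e', q⟩ | h'
        · omega
        · omega
        · have hb0 : P b ≠ 0 := by
            rcases h' with h' | h' | h' | h' <;> rw [h'.1] <;> assumption
          have := (W.sep a b hab').resolve_left ha0
          have := this.resolve_left hb0
          have c := W.con a b hab' ha0 this
          have h2 := W.rng b hb0
          rw [← this, e] at h2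
          rcases h' with h' | h' | h' | h'
          · exact absurd (e.symm.trans (this.trans h'.1)) hmj2.symm
          · exact absurd (e.symm.trans (this.trans h'.1)) hmj3.symm
          · left; omega
          · have := H1 a ha b hb e h'.1 hab t'; omega
      · have ha0 : P a ≠ 0 := by rw [e]; exact hj
        have h1 := W.rng a ha0
        rw [e] at h1
        rcases tb with ⟨e', q⟩ | ⟨e', q⟩ | h'
        · omega
        · omega
        · have hb0 : P b ≠ 0 := by
            rcases h' with h' | h' | h' | h' <;> rw [h'.1] <;> assumption
          have := (W.sep a b hab').resolve_left ha0
          have := this.resolve_left hb0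
          have c := W.con a b hab' ha0 this
          have h2 := W.rng b hb0
          rw [← this, e] at h2
          rcases h' with h' | h' | h' | h'
          · exact absurd (e.symm.trans (this.trans h'.1)) hmj2.symm
          · exact absurd (e.symm.trans (this.trans h'.1)) hmj3.symm
          · have := H1 b hb a ha h'.1 e hab.symm h'.2.1; omega
          · left; omega
    intro a ha b hb c hc d hd h1 h2 h3 hac hbd
    exact LE.nc hM2 hM3 (adj a ha c hc hac (by omega)) (adj b hb d hd hbd (by omega)) h1 h2 h3

lemma WS.ep_tri {P f N} {h k l : Fin 4 → U} (W : WS G P f N h k l) {u v : U} (hu : P u = 0) (hv : P v = 0)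
    (huv : u ≠ v) : ∃ p, NC G {u, v}ᶜ p := by
  classical
  obtain ⟨r, hr⟩ : ∃ r, ∀ w, P w = 0 → w = u ∨ w = v ∨ w = r := by
    have t := W.tri 1 (by decide)
    rcases (t u).1 hu with e | e | e <;> rcases (t v).1 hv with e' | e' | e'
    · exact absurd (e.trans e'.symm) huv
    · exact ⟨l 1, fun w hw => by have := (t w).1 hw; rw [e, e']; tauto⟩
    · exact ⟨k 1, fun w hw => by have := (t w).1 hw; rw [e, e']; tauto⟩
    · exact ⟨l 1, fun w hw => by have := (t w).1 hw; rw [e, e']; tauto⟩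
    · exact absurd (e.trans e'.symm) huv
    · exact ⟨h 1, fun w hw => by have := (t w).1 hw; rw [e, e']; tauto⟩
    · exact ⟨k 1, fun w hw => by have := (t w).1 hw; rw [e, e']; tauto⟩
    · exact ⟨h 1, fun w hw => by have := (t w).1 hw; rw [e, e']; tauto⟩
    · exact absurd (e.trans e'.symm) huv
  obtain ⟨M, hM1, hM2, hM3⟩ : ∃ M, N 1 + 1 < M ∧ N 2 + 1 < M ∧ N 3 + 1 < M :=
    ⟨N 1 + N 2 + N 3 + 2, by omega, by omega, by omega⟩
  set p : U → ℕ := fun w => if P w = 0 then 0 else if P w = 1 then f w else if P w = 2 then M + f w else 2 * M + f w with hp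
  have typ : ∀ w ∈ ({u, v}ᶜ : Set U), (w = r ∧ p w = 0) ∨ (P w = 1 ∧ p w = f w ∧ 1 ≤ f w ∧ f w + 1 < M) ∨
      (P w = 2 ∧ p w = M + f w ∧ 1 ≤ f w ∧ f w + 1 < M) ∨ (P w = 3 ∧ p w = 2 * M + f w ∧ 1 ≤ f w ∧ f w + 1 < M) := by
    intro w hw
    simp at hw
    have h4 : ∀ i : Fin 4, i = 0 ∨ i = 1 ∨ i = 2 ∨ i = 3 := by decide
    have rr := W.rng w
    rcases h4 (P w) with h0 | h0 | h0 | h0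
    · left
      exact ⟨by have := hr w h0; tauto, by simp [hp, h0]⟩
    · simp [h0] at rr
      right; left; exact ⟨h0, by simp [hp, h0], by omega, by omega⟩
    · simp [h0] at rr
      right; right; left; exact ⟨h0, by simp [hp, h0], by omega, by omega⟩
    · simp [h0] at rr
      right; right; right; exact ⟨h0, by simp [hp, h0], by omega, by omega⟩
  have ne : ∀ w ∈ ({u, v}ᶜ : Set U), p w ≠ 0 → P w ≠ 0 := by
    intro w hw h0 h1
    exact h0 (by simp [hp, h1])
  refine ⟨p, ⟨?_, ?_⟩⟩
  · intro a ha b hb hab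
    rcases typ a ha with ⟨e, t⟩ | ⟨e, t⟩ | ⟨e, t⟩ | ⟨e, t⟩ <;>
    rcases typ b hb with ⟨e', t'⟩ | ⟨e', t'⟩ | ⟨e', t'⟩ | ⟨e', t'⟩
    all_goals first
      | (rw [e, e']; done)
      | (exfalso; omega)
      | exact W.inj a b (by rw [e]; decide) (e.trans e'.symm) (by omega)
  · intro a ha b hb c hc d hd h1 h2 h3 hac hbd
    have nb := ne b hb (by omega)
    have nd := ne d hd (by omega)
    have e := ((W.sep b d hbd).resolve_left nb).resolve_left nd
    have c := W.con b d hbd nb e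
    rcases typ b hb with ⟨_, t⟩ | ⟨q, t⟩ | ⟨q, t⟩ | ⟨q, t⟩
    · omega
    all_goals
      rcases typ d hd with ⟨_, t'⟩ | ⟨q', t'⟩ | ⟨q', t'⟩ | ⟨q', t'⟩
      all_goals first
        | omega
        | (rw [q, q'] at e; exact absurd e (by decide))

lemma EP_of_swap (h : ∀ u v, G.Adj u v → (∃ x p, NC (G.deleteEdges {s(u, v)}) {x}ᶜ p) ∨ (∃ p, NC G {u, v}ᶜ p)) :
    EP G := by
  intro u v huv
  rcases h u v huv with ⟨x, p, hp⟩ | ⟨p, hp⟩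
  · exact Or.inl (planar_of_NC hp)
  · exact Or.inr (planar_contract hp)

theorem EP_W (hW : InClassW G) : EP G := by
  obtain ⟨P, f, N, h, k, l, W⟩ := WS.of hW
  refine EP_of_swap ?_
  have half : ∀ u v, G.Adj u v → P v ≠ 0 → (P u ≠ 0 → f v = f u + 1) →
      (∃ x p, NC (G.deleteEdges {s(u, v)}) {x}ᶜ p) ∨ (∃ p, NC G {u, v}ᶜ p) := by
    intro u v huv hv hu
    set j := P v with hj
    have hle : G.deleteEdges {s(u, v)} ≤ G := deleteEdges_le _
    by_cases hu0 : P u = 0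
    · rcases (W.tri j hv u).1 hu0 with e | e | e
      · right
        refine W.layout hv le_rfl (by simp [← e]) (f v) ?_ ?_ ?_
        · intro a ha b hb haj hbj hab hf
          have c := W.con a b hab (haj ▸ hv) (haj.trans hbj.symm)
          have : f a ≠ f v := fun e' => by
            have := W.inj a v (haj ▸ hv) haj e'
            simp [this] at ha
          omega
        · intro a ha haj hak
          have c := W.ka a (haj ▸ hv) (by rw [haj]; exact hak)
          have := W.rng v hv
          omega
        · intro a ha haj hal
          have c := W.la a (haj ▸ hv) (by rw [haj]; exact hal)
          have hr : 1 ≤ f v ∧ f v ≤ N j := W.rng v hv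
          have : f a ≠ f v := fun e' => by
            have := W.inj a v (haj ▸ hv) haj e'
            simp [this] at ha
          rw [haj] at c
          omega
      · left
        refine ⟨h j, W.layout hv hle (by simp) 0 ?_ ?_ ?_⟩
        · intro a ha b hb haj hbj hab hf
          have := W.rng a (haj ▸ hv)
          omega
        · intro a ha haj hak
          exfalso
          have h1 := W.ka a (haj ▸ hv) (by rw [haj]; exact hle hak)
          have h2 := W.ka v hv (by rw [← hj, ← e]; exact huv.symm)
          have := W.inj a v (haj ▸ hv) haj (h1.trans h2.symm)
          rw [this, ← e] at hak
          simp [Sym2.eq_swap] at hak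
        · intro a ha haj hal
          have := W.rng a (haj ▸ hv)
          omega
      · left
        refine ⟨h j, W.layout hv hle (by simp) (N j) ?_ ?_ ?_⟩
        · intro a ha b hb haj hbj hab hf
          have := W.rng b (hbj ▸ hv)
          rw [hbj] at this
          omega
        · intro a ha haj hak
          have := W.rng a (haj ▸ hv)
          rw [haj] at this
          omega
        · intro a ha haj hal
          exfalso
          have h1 := W.la a (haj ▸ hv) (by rw [haj]; exact hle hal)
          have h2 := W.la v hv (by rw [← hj, ← e]; exact huv.symm)
          rw [haj] at h1
          have := W.inj a v (haj ▸ hv) haj (h1.trans h2.symm)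
          rw [this, ← e] at hal
          simp [Sym2.eq_swap] at hal
    · left
      have hf := hu hu0
      have hPuv : P u = j := by
        have := W.sep u v huv
        tauto
      refine ⟨h j, W.layout hv hle (by simp) (f u) ?_ ?_ ?_⟩
      · intro a ha b hb haj hbj hab hf'
        have c := W.con a b (hle hab) (haj ▸ hv) (haj.trans hbj.symm)
        by_contra hb'
        have e1 := W.inj a u (haj ▸ hv) (haj.trans hPuv.symm) (by omega)
        have e2 := W.inj b v (hbj ▸ hv) hbj (by omega)
        rw [e1, e2] at hab
        simp at hab
      · intro a ha haj hak
        have c := W.ka a (haj ▸ hv) (by rw [haj]; exact hle hak)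
        have := W.rng u hu0
        omega
      · intro a ha haj hal
        have c := W.la a (haj ▸ hv) (by rw [haj]; exact hle hal)
        have := W.rng v hv
        rw [haj] at c
        rw [← hj] at this
        omega
  intro u v huv
  by_cases hv : P v = 0
  · by_cases hu : P u = 0
    · right; exact W.ep_tri hu hv huv.ne
    · have := half v u huv.symm hu (fun h => absurd hv h)
      rwa [Sym2.eq_swap, Set.pair_comm] at this
  · by_cases hu : P u = 0
    · exact half u v huv hv (fun h => absurd hu h)
    · have e : P u = P v := by have := W.sep u v huv; tauto
      rcases W.con u v huv hu e with c | c
      · exact half u v huv hv (fun _ => c)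
      · have := half v u huv.symm hu (fun h => c)
        rwa [Sym2.eq_swap, Set.pair_comm] at this
end WClass2
end AP

set_option linter.all false
namespace AP
section Span
variable {V : Type*} {G : SimpleGraph V}

/-- splitting a connected set -/
lemma Cn.split {S : Set V} (hS : Cn G S) {u w : V} (hu : u ∈ S) (hw : w ∈ S) (huw : u ≠ w) :
    ∃ X Y : Set V, u ∈ X ∧ w ∈ Y ∧ Cn G X ∧ Cn G Y ∧ X ∪ Y = S ∧ (∀ v, v ∈ X → v ∈ Y → False) ∧ Tch G X Y := by
  have huS : u ∈ S \ {w} := ⟨hu, huw⟩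
  set X := cmp G (S \ {w}) u with hX
  have hXS : X ⊆ S \ {w} := cmp_sub huS
  have hwX : w ∉ X := fun h => (hXS h).2 rfl
  have hwY : w ∈ S \ X := ⟨hw, hwX⟩
  have hY : Cn G (S \ X) := by
    have : S \ X = cmp G (S \ X) w := by
      refine Set.Subset.antisymm ?_ (cmp_sub hwY)
      intro y hy
      by_contra hyZ
      obtain ⟨p, hp, q, hq, hpA, hqA, hpq⟩ := hS.cross (A := (S \ X) \ cmp G (S \ X) w)
        ⟨y, hy.1, hy, hyZ⟩ ⟨u, hu, fun h => h.1.2 cmp_self⟩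
      by_cases hqX : q ∈ X
      · have hpw : p ≠ w := by rintro rfl; exact hpA.2 cmp_self
        exact hpA.1.2 (cmp_closed huS hqX ⟨hp, hpw⟩ hpq.symm)
      · have : q ∈ cmp G (S \ X) w := by
          by_contra h; exact hqA ⟨⟨hq, hqX⟩, h⟩
        exact hpA.2 (cmp_closed hwY this hpA.1 hpq.symm)
    rw [this]; exact cmp_cn hwY
  refine ⟨X, S \ X, cmp_self, hwY, cmp_cn huS, hY, ?_, fun v h1 h2 => h2.2 h1, ?_⟩
  · exact Set.union_diff_cancel (fun x hx => (hXS hx).1)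
  · obtain ⟨p, hp, q, hq, h1, h2, h3⟩ := hS.cross (A := X) ⟨u, hu, cmp_self⟩ ⟨w, hw, hwX⟩
    exact ⟨p, h1, q, ⟨hq, h2⟩, h3⟩

lemma con3 (h3 : KConnected G 3) (D : Set V) (a b : V) (h1 : ∃ d ∈ D, d ≠ a ∧ d ≠ b)
    (h2 : ∃ o, o ∉ D ∧ o ≠ a ∧ o ≠ b) : ∃ x ∈ D, ∃ y, y ∉ D ∧ x ≠ a ∧ x ≠ b ∧ y ≠ a ∧ y ≠ b ∧ G.Adj x y := by
  have h : Cn G ({a, b}ᶜ : Set V) := h3.2 {a, b} (lt_of_le_of_lt (Set.ncard_insert_le _ _) (by simp))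
  obtain ⟨d, hd, hd'⟩ := h1
  obtain ⟨o, ho, ho'⟩ := h2
  obtain ⟨x, hx, y, hy, hxA, hyA, hxy⟩ := h.cross (A := D) ⟨d, by simp [hd'], hd⟩ ⟨o, by simp [ho'], ho⟩
  simp at hx hy
  exact ⟨x, hxA, y, hyA, hx.1, hx.2, hy.1, hy.2, hxy⟩

abbrev Lab := Bool × Fin 3

def Fb (φ : V → Option Lab) (l : Lab) : Set V := {v | φ v = some l}

/-- a `K₃,₃` model given by a colouring -/
structure KM (G : SimpleGraph V) (φ : V → Option Lab) : Prop where
  cn : ∀ l, Cn G (Fb φ l)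
  tch : ∀ l m : Lab, l.1 ≠ m.1 → Tch G (Fb φ l) (Fb φ m)

open Classical in
noncomputable def rc (φ : V → Option Lab) (S : Set V) (o : Option Lab) : V → Option Lab := fun v => if v ∈ S then o else φ v

lemma mem_rc {φ : V → Option Lab} {S : Set V} {o : Option Lab} {l : Lab} {v : V} :
    v ∈ Fb (rc φ S o) l ↔ (v ∈ S ∧ o = some l) ∨ (v ∉ S ∧ v ∈ Fb φ l) := by
  unfold Fb rc
  by_cases h : v ∈ S <;> simp [h]

lemma rc_none {φ : V → Option Lab} {S : Set V} {o : Option Lab} {v : V} (h : v ∉ S) (hv : φ v = none) :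
    rc φ S o v = none := by
  unfold rc; rw [if_neg h]; exact hv

lemma fb_disj {φ : V → Option Lab} {l m : Lab} {v : V} (h : v ∈ Fb φ l) (h' : v ∈ Fb φ m) : l = m := by
  unfold Fb at h h'
  simp only [Set.mem_ofPred_eq] at h h'
  rw [h] at h'
  exact Option.some.inj h'

lemma fb_none {φ : V → Option Lab} {l : Lab} {v : V} (h : v ∈ Fb φ l) (h' : φ v = none) : False := by
  unfold Fb at h
  simp only [Set.mem_ofPred_eq] at h
  rw [h] at h'; cases h'

def lnum (l : Lab) : ℕ := if l.1 then 3 + l.2.val else l.2.val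
def numl (n : ℕ) : Lab := if h : n < 3 then (false, ⟨n, h⟩) else if h : n < 6 then (true, ⟨n - 3, by omega⟩) else (true, 0)

def exCerts : List (List (List ℕ)) :=
  [[[0],[1],[2],[3],[4],[5],[6]], [[3],[4],[5],[0],[1],[2],[6]]] ++
  ([[0,1,2],[0,2,1],[1,2,0]].flatMap fun s => [[3,4,5],[4,3,5],[5,3,4]].map fun t => (s ++ t ++ [6]).map fun x => [x]) ++
  ([[0,1,2],[1,0,2],[2,0,1]].flatMap fun s => [[3,4,5],[3,5,4],[4,5,3]].map fun t => (t ++ s ++ [6]).map fun x => [x])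

lemma exCerts_ok : ∀ i j k : Fin 6, i ≠ j → i ≠ k → j ≠ k →
    (exCerts.any fun c => chk 7 ([(6,i.val),(6,j.val),(6,k.val)] ++ K33E) 7 EX1E c || chk 7 ([(6,i.val),(6,j.val),(6,k.val)] ++ K33E) 7 EX8E c) = true := by
  decide +kernel

def EXs (G : SimpleGraph V) : Prop := HasM G 7 EX1E ∨ HasM G 7 EX8E

lemma lnum_lt : ∀ l : Lab, lnum l < 6 := by decide
lemma numl_lnum : ∀ l : Lab, numl (lnum l) = l := by decide
lemma lnum_inj {l m : Lab} (h : lnum l = lnum m) : l = m := by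
  rw [← numl_lnum l, ← numl_lnum m, h]
lemma lnum_numl : ∀ i < 6, lnum (numl i) = i := by decide

/-- a connected set seeing three branch sets -/
lemma KM.ex {φ : V → Option Lab} (h : KM G φ) {D : Set V} (hD : Cn G D) (hd : ∀ v ∈ D, φ v = none)
    {l1 l2 l3 : Lab} (h12 : l1 ≠ l2) (h13 : l1 ≠ l3) (h23 : l2 ≠ l3) (t1 : Tch G D (Fb φ l1))
    (t2 : Tch G D (Fb φ l2)) (t3 : Tch G D (Fb φ l3)) : EXs G := by
  have hM : HasM G 7 ([(6,lnum l1),(6,lnum l2),(6,lnum l3)] ++ K33E) := by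
    refine ⟨fun n => if n < 6 then Fb φ (numl n) else D, ⟨?_, ?_⟩, ?_⟩
    · intro i hi
      split_ifs
      · exact h.cn _
      · exact hD
    · intro i hi j hj v hvi hvj
      split_ifs at hvi hvj with a b b
      · have := fb_disj hvi hvj
        rw [← lnum_numl i a, ← lnum_numl j b, this]
      · exact (fb_none hvi (hd v hvj)).elim
      · exact (fb_none hvj (hd v hvi)).elim
      · omega
    · intro p hp
      rw [List.mem_append] at hp
      rcases hp with hp | hp
      · simp only [List.mem_cons, List.not_mem_nil, or_false] at hp
        rcases hp with rfl | rfl | rfl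
        all_goals
          dsimp only
          rw [if_neg (by decide), if_pos (lnum_lt _), numl_lnum]
          assumption
      · have : ∀ p ∈ K33E, p.1 < 6 ∧ p.2 < 6 ∧ (numl p.1).1 ≠ (numl p.2).1 := by decide
        obtain ⟨a, b, c⟩ := this p hp
        dsimp only
        rw [if_pos a, if_pos b]
        exact h.tch _ _ c
  have := exCerts_ok ⟨_, lnum_lt l1⟩ ⟨_, lnum_lt l2⟩ ⟨_, lnum_lt l3⟩ (fun e => h12 (lnum_inj (Fin.mk.inj e)))
    (fun e => h13 (lnum_inj (Fin.mk.inj e))) (fun e => h23 (lnum_inj (Fin.mk.inj e)))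
  rw [List.any_eq_true] at this
  obtain ⟨c, _, hc⟩ := this
  rw [Bool.or_eq_true] at hc
  rcases hc with hc | hc
  · exact Or.inl (hM.chk c hc)
  · exact Or.inr (hM.chk c hc)

end Span
end AP

set_option linter.all false
namespace AP
section Span
variable {V : Type*} {G : SimpleGraph V}

lemma rc_add {φ : V → Option Lab} {S : Set V} {m : Lab} : Fb (rc φ S (some m)) m = Fb φ m ∪ S := by
  ext v; rw [mem_rc]; simp only [Set.mem_union]; tauto

lemma rc_rem {φ : V → Option Lab} {S : Set V} {o : Option Lab} {m : Lab} (h : o ≠ some m) :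
    Fb (rc φ S o) m = Fb φ m \ S := by
  ext v; rw [mem_rc]; simp only [Set.mem_diff]; tauto

lemma rc_same {φ : V → Option Lab} {S : Set V} {o : Option Lab} {m : Lab} (h : o ≠ some m)
    (h' : ∀ v ∈ S, v ∉ Fb φ m) : Fb (rc φ S o) m = Fb φ m := by
  rw [rc_rem h]; ext v; simp only [Set.mem_diff]
  constructor
  · exact fun h => h.1
  · exact fun hv => ⟨hv, fun hs => h' v hs hv⟩

lemma fb_of_union {φ : V → Option Lab} {X Y : Set V} {l : Lab} (h : X ∪ Y = Fb φ l)
    (hd : ∀ v, v ∈ X → v ∈ Y → False) : Fb φ l \ X = Y := by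
  rw [← h]; ext v; simp only [Set.mem_diff, Set.mem_union]
  have := hd v; tauto

def opl (l : Lab) (i : Fin 3) : Lab := (!l.1, i)
lemma opl_ne (l : Lab) (i : Fin 3) : l.1 ≠ (opl l i).1 := by
  obtain ⟨b, j⟩ := l; cases b <;> simp [opl]
lemma opl_of {l m : Lab} (h : l.1 ≠ m.1) : m = opl l m.2 := by
  obtain ⟨b, j⟩ := l; obtain ⟨c, k⟩ := m; cases b <;> cases c <;> simp_all [opl]

lemma fin3_logic (P Q : Fin 3 → Prop) (h : ∀ i, P i ∨ Q i) (hP : ∃ i, P i) (hQ : ∃ i, Q i) :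
    ∃ i, (P i ∧ ∀ j, j ≠ i → Q j) ∨ (Q i ∧ ∀ j, j ≠ i → P j) := by
  by_cases hq : ∀ i, Q i
  · obtain ⟨i, hi⟩ := hP
    exact ⟨i, Or.inl ⟨hi, fun j _ => hq j⟩⟩
  by_cases hp : ∀ i, P i
  · obtain ⟨i, hi⟩ := hQ
    exact ⟨i, Or.inr ⟨hi, fun j _ => hp j⟩⟩
  push Not at hq hp
  obtain ⟨i, hi⟩ := hq
  obtain ⟨j, hj⟩ := hp
  have hij : i ≠ j := by rintro rfl; exact (h i).elim hj hi
  have h1 : P i := (h i).resolve_right hi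
  have h2 : Q j := (h j).resolve_left hj
  by_cases hk : ∀ k, k ≠ i → k ≠ j → P k
  · exact ⟨j, Or.inr ⟨h2, fun k hkj => if e : k = i then e ▸ h1 else hk k e hkj⟩⟩
  · push Not at hk
    obtain ⟨k, k1, k2, k3⟩ := hk
    have hQk := (h k).resolve_left k3
    refine ⟨i, Or.inl ⟨h1, fun x hx => ?_⟩⟩
    have : x = j ∨ x = k := by omega
    rcases this with rfl | rfl <;> assumption

lemma tch_union {X Y Z : Set V} (h : Tch G (X ∪ Y) Z) : Tch G X Z ∨ Tch G Y Z := by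
  obtain ⟨x, hx, y, hy, hxy⟩ := h
  rcases hx with hx | hx
  · exact Or.inl ⟨x, hx, y, hy, hxy⟩
  · exact Or.inr ⟨x, hx, y, hy, hxy⟩

/-- KM except possibly the edge `l0 l3` -/
structure KMx (G : SimpleGraph V) (φ : V → Option Lab) (l0 l3 : Lab) : Prop where
  op : l0.1 ≠ l3.1
  cn : ∀ l, Cn G (Fb φ l)
  tch : ∀ l m : Lab, l.1 ≠ m.1 → ¬ (l = l0 ∧ m = l3) → ¬ (l = l3 ∧ m = l0) → Tch G (Fb φ l) (Fb φ m)

/-- replacing the branch set `l` by another set -/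
lemma KM.remake {φ φ' : V → Option Lab} {l m : Lab} (h : ∀ x : Lab, x ≠ l → Cn G (Fb φ' x))
    (hl : Cn G (Fb φ' l))
    (h0 : ∀ x y : Lab, x ≠ l → y ≠ l → x.1 ≠ y.1 → Tch G (Fb φ' x) (Fb φ' y))
    (ht : ∀ x : Lab, l.1 ≠ x.1 → Tch G (Fb φ' l) (Fb φ' x)) : KM G φ' := by
  refine ⟨fun x => ?_, fun x y hxy => ?_⟩
  · by_cases e : x = l
    · subst e; exact hl
    · exact h x e
  · by_cases e : x = l
    · subst e; exact ht y hxy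
    · by_cases e' : y = l
      · subst e'; exact (ht x hxy.symm).symm
      · exact h0 x y e e' hxy

/-- moving a part of one branch set to an opposite one -/
lemma KM.move {φ : V → Option Lab} (h : ∀ l, Cn G (Fb φ l))
    {l m : Lab} (h0 : ∀ x y : Lab, x ≠ l → y ≠ l → x.1 ≠ y.1 → Tch G (Fb φ x) (Fb φ y))
    {X Y I : Set V} (hI : ∀ v ∈ I, φ v = none) (hXY : X ∪ Y = Fb φ l)
    (hd : ∀ v, v ∈ X → v ∈ Y → False) (hX : Cn G X) (hY : Cn G (Y ∪ I)) (hop : l.1 ≠ m.1)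
    (t1 : Tch G X (Fb φ m)) (t2 : Tch G (Y ∪ I) X) (ht : ∀ x : Lab, l.1 ≠ x.1 → x ≠ m → Tch G (Y ∪ I) (Fb φ x)) :
    KM G (rc (rc φ X (some m)) I (some l)) := by
  have hml : m ≠ l := by rintro rfl; exact hop rfl
  have hXl : ∀ v ∈ X, v ∈ Fb φ l := fun v hv => hXY ▸ Or.inl hv
  have e1 : Fb (rc (rc φ X (some m)) I (some l)) l = Y ∪ I := by
    rw [rc_add, rc_rem (by simpa using hml), fb_of_union hXY hd]
  have hI' : ∀ v ∈ I, ∀ x, v ∉ Fb φ x := fun v hv x hx => fb_none hx (hI v hv)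
  have e2 : Fb (rc (rc φ X (some m)) I (some l)) m = Fb φ m ∪ X := by
    rw [rc_same (by simpa using hml.symm), rc_add]
    rw [rc_add]
    rintro v hv (h | h)
    · exact hI' v hv _ h
    · exact hI' v hv _ (hXl v h)
  have e3 : ∀ x, x ≠ l → x ≠ m → Fb (rc (rc φ X (some m)) I (some l)) x = Fb φ x := by
    intro x h1 h2
    have : Fb (rc φ X (some m)) x = Fb φ x :=
      rc_same (by simpa using h2.symm) (fun v hv hx => h1 (fb_disj hx (hXl v hv)))
    rw [rc_same (by simpa using h1.symm), this]
    rw [this]; exact fun v hv => hI' v hv _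
  have sub : ∀ x, x ≠ l → Fb φ x ⊆ Fb (rc (rc φ X (some m)) I (some l)) x := by
    intro x hx
    by_cases e : x = m
    · subst e; rw [e2]; exact Set.subset_union_left
    · rw [e3 x hx e]
  refine KM.remake (l := l) (m := l) (φ := φ) (fun x hx => ?_) ?_ (fun x y hx hy hxy => ?_) (fun x hx => ?_)
  · by_cases e : x = m
    · subst e; rw [e2]; exact (h x).union_tch hX t1.symm
    · rw [e3 x hx e]; exact h x
  · rw [e1]; exact hY
  · exact (h0 x y hx hy hxy).mono (sub x hx) (sub y hy)
  · rw [e1]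
    by_cases e : x = m
    · subst e; rw [e2]; exact t2.mono (by rfl) Set.subset_union_right
    · exact (ht x hx e).mono (by rfl) (sub x (by rintro rfl; exact hx rfl))

/-- replacing a branch set by a part of it plus some free set -/
lemma KM.shrink {φ : V → Option Lab} (h : ∀ l, Cn G (Fb φ l))
    {l : Lab} (h0 : ∀ x y : Lab, x ≠ l → y ≠ l → x.1 ≠ y.1 → Tch G (Fb φ x) (Fb φ y))
    {X Y I : Set V} (hI : ∀ v ∈ I, φ v = none) (hXY : X ∪ Y = Fb φ l)
    (hd : ∀ v, v ∈ X → v ∈ Y → False) (hY : Cn G (Y ∪ I))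
    (ht : ∀ x : Lab, l.1 ≠ x.1 → Tch G (Y ∪ I) (Fb φ x)) :
    KM G (rc (rc φ X none) I (some l)) := by
  have hXl : ∀ v ∈ X, v ∈ Fb φ l := fun v hv => hXY ▸ Or.inl hv
  have e1 : Fb (rc (rc φ X none) I (some l)) l = Y ∪ I := by
    rw [rc_add, rc_rem (by simp), fb_of_union hXY hd]
  have hI' : ∀ v ∈ I, ∀ x, v ∉ Fb φ x := fun v hv x hx => fb_none hx (hI v hv)
  have e3 : ∀ x, x ≠ l → Fb (rc (rc φ X none) I (some l)) x = Fb φ x := by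
    intro x h1
    have : Fb (rc φ X none) x = Fb φ x :=
      rc_same (by simp) (fun v hv hx => h1 (fb_disj hx (hXl v hv)))
    rw [rc_same (by simpa using h1.symm), this]
    rw [this]; exact fun v hv => hI' v hv _
  refine KM.remake (l := l) (m := l) (φ := φ) (fun x hx => ?_) ?_ (fun x y hx hy hxy => ?_) (fun x hx => ?_)
  · rw [e3 x hx]; exact h x
  · rw [e1]; exact hY
  · rw [e3 x hx, e3 y hy]; exact h0 x y hx hy hxy
  · rw [e1, e3 x (by rintro rfl; exact hx rfl)]; exact ht x hx

def GoodD (G : SimpleGraph V) (D : Set V) : Prop := ∃ φ, KM G φ ∧ (∀ v ∈ D, φ v = none) ∧ Cn G D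

lemma stageA {φ : V → Option Lab} (h : KM G φ) {D : Set V} (hD : Cn G D) (hu : ∀ v ∈ D, φ v = none)
    (hmax : ∀ D', D ⊆ D' → GoodD G D' → D' ⊆ D)
    {l : Lab} {u w : V} (huw : u ≠ w) (hul : u ∈ Fb φ l) (hwl : w ∈ Fb φ l)
    (tu : Tch G D {u}) (tw : Tch G D {w}) :
    ∃ S T m, S ∪ T = Fb φ l ∧ (∀ v, v ∈ S → v ∈ T → False) ∧ Cn G S ∧ Cn G T ∧ Tch G S T ∧ Tch G D S ∧ Tch G D T
      ∧ l.1 ≠ m.1 ∧ Tch G S (Fb φ m) ∧ ∀ x : Lab, l.1 ≠ x.1 → x ≠ m → Tch G T (Fb φ x) := by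
  obtain ⟨X, Y, huX, hwY, cX, cY, hXY, hd, tXY⟩ := (h.cn l).split hul hwl huw
  have tDX : Tch G D X := tu.mono (by rfl) (by simpa using huX)
  have tDY : Tch G D Y := tw.mono (by rfl) (by simpa using hwY)
  have hor : ∀ i, Tch G X (Fb φ (opl l i)) ∨ Tch G Y (Fb φ (opl l i)) := fun i =>
    tch_union (hXY ▸ h.tch l _ (opl_ne l i))
  -- one side sees nothing
  have key : ∀ X Y : Set V, Cn G X → Cn G Y → X ∪ Y = Fb φ l → (∀ v, v ∈ X → v ∈ Y → False) → Tch G D X →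
      (∀ i, Tch G Y (Fb φ (opl l i))) → False := by
    intro X Y cX cY hXY hd tDX hall
    have k := KM.shrink (I := ∅) h.cn (l := l) (fun x y _ _ e => h.tch x y e) (by simp) hXY hd (by simpa using cY)
      (fun x hx => by rw [opl_of hx]; simpa using hall _)
    have hXn := cX.nonempty
    obtain ⟨x, hx⟩ := hXn
    have : x ∈ D := hmax (D ∪ X) Set.subset_union_left ⟨_, k, ?_, hD.union_tch cX tDX⟩ (Or.inr hx)
    · exact fb_none (hXY ▸ Or.inl hx : x ∈ Fb φ l) (hu x this)
    · intro v hv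
      apply rc_none (by simp)
      unfold rc
      split_ifs with hvX
      · rfl
      · exact hu v (hv.resolve_right hvX)
  by_cases hP : ∃ i, Tch G X (Fb φ (opl l i))
  · by_cases hQ : ∃ i, Tch G Y (Fb φ (opl l i))
    · obtain ⟨i, ⟨h1, h2⟩ | ⟨h1, h2⟩⟩ := fin3_logic _ _ hor hP hQ
      · refine ⟨X, Y, opl l i, hXY, hd, cX, cY, tXY, tDX, tDY, opl_ne l i, h1, fun x hx hxm => ?_⟩
        rw [opl_of hx] at hxm ⊢
        exact h2 _ (fun e => hxm (by rw [e]))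
      · refine ⟨Y, X, opl l i, by rw [Set.union_comm]; exact hXY, fun v a b => hd v b a, cY, cX, tXY.symm, tDY, tDX, opl_ne l i, h1, fun x hx hxm => ?_⟩
        rw [opl_of hx] at hxm ⊢
        exact h2 _ (fun e => hxm (by rw [e]))
    · push Not at hQ
      exact (key Y X cY cX (by rw [Set.union_comm]; exact hXY) (fun v a b => hd v b a) tDY
        (fun i => (hor i).resolve_right (hQ i))).elim
  · push Not at hP
    exact (key X Y cX cY hXY hd tDX (fun i => (hor i).resolve_left (hP i))).elim

structure Cfg (G : SimpleGraph V) (φ : V → Option Lab) (l0 l3 : Lab) (D I : Set V) : Prop extends KMx G φ l0 l3 where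
  cD : Cn G D
  cI : Cn G I
  uD : ∀ v ∈ D, φ v = none
  uI : ∀ v ∈ I, φ v = none
  dj : ∀ v, v ∈ D → v ∈ I → False
  tDI : Tch G D I
  tD0 : Tch G D (Fb φ l0)
  tD3 : Tch G D (Fb φ l3)
  tI0 : Tch G I (Fb φ l0)
  tI3 : Tch G I (Fb φ l3)

lemma Cfg.symm {φ : V → Option Lab} {l0 l3 : Lab} {D I : Set V} (h : Cfg G φ l0 l3 D I) : Cfg G φ l3 l0 D I where
  op := h.op.symm
  cn := h.cn
  tch := fun l m e a b => h.tch l m e b a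
  cD := h.cD
  cI := h.cI
  uD := h.uD
  uI := h.uI
  dj := h.dj
  tDI := h.tDI
  tD0 := h.tD3
  tD3 := h.tD0
  tI0 := h.tI3
  tI3 := h.tI0

lemma Cfg.swap {φ : V → Option Lab} {l0 l3 : Lab} {D I : Set V} (h : Cfg G φ l0 l3 D I) : Cfg G φ l0 l3 I D where
  op := h.op
  cn := h.cn
  tch := h.tch
  cD := h.cI
  cI := h.cD
  uD := h.uI
  uI := h.uD
  dj := fun v a b => h.dj v b a
  tDI := h.tDI.symm
  tD0 := h.tI0
  tD3 := h.tI3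
  tI0 := h.tD0
  tI3 := h.tD3

lemma Cfg.h0 {φ : V → Option Lab} {l0 l3 : Lab} {D I : Set V} (h : Cfg G φ l0 l3 D I) :
    ∀ x y : Lab, x ≠ l0 → y ≠ l0 → x.1 ≠ y.1 → Tch G (Fb φ x) (Fb φ y) :=
  fun x y hx hy e => h.tch x y e (fun a => hx a.1) (fun a => hy a.2)

lemma Cfg.km {φ : V → Option Lab} {l0 l3 : Lab} {D I : Set V} (h : Cfg G φ l0 l3 D I) :
    KM G (rc (rc φ ∅ none) I (some l0)) := by
  refine KM.shrink h.cn h.h0 h.uI (Y := Fb φ l0) (by simp) (by simp) ((h.cn l0).union_tch h.cI h.tI0.symm) ?_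
  intro x hx
  by_cases e : x = l3
  · subst e; exact h.tI3.mono Set.subset_union_right (by rfl)
  · exact (h.tch l0 x hx (fun a => e a.2) (fun a => h.op (by rw [a.1]))).mono Set.subset_union_left (by rfl)

lemma rc_empty {φ : V → Option Lab} {o : Option Lab} : rc φ ∅ o = φ := by
  funext v; simp [rc]

lemma Cfg.uncol {φ : V → Option Lab} {l0 l3 : Lab} {D I : Set V} (h : Cfg G φ l0 l3 D I) :
    ∀ v ∈ D, rc (rc φ ∅ none) I (some l0) v = none := by
  intro v hv
  rw [rc_empty]
  exact rc_none (fun hi => h.dj v hv hi) (h.uD v hv)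

lemma Cfg.seeD {φ : V → Option Lab} {l0 l3 t : Lab} {D I : Set V} (h : Cfg G φ l0 l3 D I) (h0 : t ≠ l0) (h3 : t ≠ l3)
    (ht : Tch G D (Fb φ t)) : EXs G := by
  have hs : ∀ x, Fb φ x ⊆ Fb (rc (rc φ ∅ none) I (some l0)) x := by
    intro x v hv
    rw [rc_empty, mem_rc]
    exact Or.inr ⟨fun hi => fb_none hv (h.uI v hi), hv⟩
  exact h.km.ex h.cD h.uncol h0.symm (l3 := l3) (by rintro rfl; exact h.op rfl) h3 (h.tD0.mono (by rfl) (hs _))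
    (ht.mono (by rfl) (hs _)) (h.tD3.mono (by rfl) (hs _))

/-- the split step -/
lemma Cfg.split {φ : V → Option Lab} {l0 l3 : Lab} {D I : Set V} (h : Cfg G φ l0 l3 D I)
    (hmax : ∀ D', D ⊆ D' → GoodD G D' → D' ⊆ D)
    {X Y : Set V} (cX : Cn G X) (cY : Cn G Y) (hXY : X ∪ Y = Fb φ l0) (hd : ∀ v, v ∈ X → v ∈ Y → False)
    (tXY : Tch G X Y) (tD : Tch G D X) (tI : Tch G I Y) :
    EXs G ∨ ∃ φ' I', Cfg G φ' l0 l3 D I' ∧ I ⊂ I' := by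
  have hop := h.op
  have hXl : ∀ v ∈ X, v ∈ Fb φ l0 := fun v hv => hXY ▸ Or.inl hv
  have hYl : ∀ v ∈ Y, v ∈ Fb φ l0 := fun v hv => hXY ▸ Or.inr hv
  have hor : ∀ x : Lab, l0.1 ≠ x.1 → x ≠ l3 → Tch G X (Fb φ x) ∨ Tch G Y (Fb φ x) := fun x hx e =>
    tch_union (hXY ▸ h.tch l0 x hx (fun a => e a.2) (fun a => hop (by rw [a.1])))
  have cYI := cY.union_tch h.cI tI.symm
  by_cases hY : ∀ x : Lab, l0.1 ≠ x.1 → x ≠ l3 → Tch G Y (Fb φ x)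
  · -- D ∪ X bigger
    exfalso
    have k := KM.shrink h.cn h.h0 h.uI hXY hd cYI (fun x hx => by
      by_cases e : x = l3
      · subst e; exact h.tI3.mono Set.subset_union_right (by rfl)
      · exact (hY x hx e).mono Set.subset_union_left (by rfl))
    obtain ⟨x, hx⟩ := cX.nonempty
    have : x ∈ D := hmax (D ∪ X) Set.subset_union_left ⟨_, k, ?_, h.cD.union_tch cX tD⟩ (Or.inr hx)
    · exact fb_none (hXl x hx) (h.uD x this)
    · intro v hv
      apply rc_none
      · intro hi
        rcases hv with hv | hv
        · exact h.dj v hv hi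
        · exact fb_none (hXl v hv) (h.uI v hi)
      · unfold rc
        split_ifs with hvX
        · rfl
        · exact h.uD v (hv.resolve_right hvX)
  by_cases hX : ∀ x : Lab, l0.1 ≠ x.1 → x ≠ l3 → Tch G X (Fb φ x)
  · -- I ∪ Y bigger
    right
    refine ⟨rc φ Y none, I ∪ Y, ?_, Set.ssubset_iff_of_subset Set.subset_union_left |>.2 ?_⟩
    · have e0 : Fb (rc φ Y none) l0 = X := by
        rw [rc_rem (by simp), fb_of_union (by rw [Set.union_comm]; exact hXY) (fun v a b => hd v b a)]
      have e1 : ∀ x, x ≠ l0 → Fb (rc φ Y none) x = Fb φ x := fun x hx =>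
        rc_same (by simp) (fun v hv hx' => hx (fb_disj hx' (hYl v hv)))
      have hne : l3 ≠ l0 := by rintro rfl; exact hop rfl
      have hcn : ∀ x, Cn G (Fb (rc φ Y none) x) := by
        intro x
        by_cases e : x = l0
        · subst e; rw [e0]; exact cX
        · rw [e1 x e]; exact h.cn x
      refine ⟨⟨hop, hcn, ?_⟩, h.cD, h.cI.union_tch cY tI, ?_, ?_, ?_, h.tDI.mono (by rfl) Set.subset_union_left, ?_, ?_, ?_, ?_⟩
      · intro x y e n1 n2
        by_cases e2 : x = l0
        · subst e2
          have : y ≠ x := by rintro rfl; exact e rfl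
          rw [e0, e1 y this]
          exact hX y e (fun e => n1 ⟨rfl, e⟩)
        · by_cases e3 : y = l0
          · subst e3
            rw [e0, e1 x e2]
            exact (hX x e.symm (fun e => n2 ⟨e, rfl⟩)).symm
          · rw [e1 x e2, e1 y e3]; exact h.tch x y e n1 n2
      · intro v hv
        exact rc_none (fun hy => fb_none (hYl v hy) (h.uD v hv)) (h.uD v hv)
      · intro v hv
        unfold rc
        split_ifs with hvY
        · rfl
        · exact h.uI v (hv.resolve_right hvY)
      · rintro v hv (hi | hi)
        · exact h.dj v hv hi
        · exact fb_none (hYl v hi) (h.uD v hv)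
      · rw [e0]; exact tD
      · rw [e1 _ hne]; exact h.tD3
      · rw [e0]; exact tXY.symm.mono Set.subset_union_right (by rfl)
      · rw [e1 _ hne]; exact h.tI3.mono Set.subset_union_left (by rfl)
    · obtain ⟨y, hy⟩ := cY.nonempty
      exact ⟨y, Or.inr hy, fun hi => fb_none (hYl y hy) (h.uI y hi)⟩
  left
  push Not at hX hY
  obtain ⟨m', hm'1, hm'2, hm'3⟩ := hX
  obtain ⟨m, hm1, hm2, hm3⟩ := hY
  have hm'Y := (hor m' hm'1 hm'2).resolve_left hm'3
  have hmX := (hor m hm1 hm2).resolve_right hm3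
  have hml : m ≠ l0 := by rintro rfl; exact hm1 rfl
  have h3l : l3 ≠ l0 := by rintro rfl; exact hop rfl
  have k := KM.move h.cn h.h0 h.uI hXY hd cX cYI hm1 hmX (tXY.symm.mono Set.subset_union_left (by rfl)) (fun x hx hxm => by
      by_cases e : x = l3
      · subst e; exact h.tI3.mono Set.subset_union_right (by rfl)
      · have : x = m' := by
          rw [opl_of hx, opl_of hm'1]
          rw [opl_of hx] at hxm e
          rw [opl_of hm1] at hxm
          rw [opl_of hop] at e
          rw [opl_of hm'1, opl_of hop] at hm'2
          rw [opl_of hm1, opl_of hop] at hm2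
          have hmm : m.2 ≠ m'.2 := by
            intro e
            have : m = m' := by rw [opl_of hm1, opl_of hm'1, e]
            subst this; exact hm3 hm'Y
          congr 1
          have a1 : x.2 ≠ m.2 := fun e' => hxm (by rw [e'])
          have a2 : x.2 ≠ l3.2 := fun e' => e (by rw [e'])
          have a3 : m'.2 ≠ l3.2 := fun e' => hm'2 (by rw [e'])
          have a4 : m.2 ≠ l3.2 := fun e' => hm2 (by rw [e'])
          omega
        subst this
        exact hm'Y.mono Set.subset_union_left (by rfl))
  have hDX : ∀ v ∈ D, v ∉ X := fun v hv hx => fb_none (hXl v hx) (h.uD v hv)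
  refine k.ex h.cD (fun v hv => rc_none (fun hi => h.dj v hv hi) (rc_none (hDX v hv) (h.uD v hv)))
    hml hm2 h3l.symm ?_ ?_ ?_
  · refine tD.mono (by rfl) (fun v hv => ?_)
    rw [mem_rc, mem_rc]
    exact Or.inr ⟨fun hi => fb_none (hXl v hv) (h.uI v hi), Or.inl ⟨hv, rfl⟩⟩
  · refine h.tDI.mono (by rfl) (fun v hv => ?_)
    rw [mem_rc]
    exact Or.inl ⟨hv, rfl⟩
  · refine h.tD3.mono (by rfl) (fun v hv => ?_)
    rw [mem_rc, mem_rc]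
    exact Or.inr ⟨fun hi => fb_none hv (h.uI v hi), Or.inr ⟨fun hx => h3l (fb_disj hv (hXl v hx)), hv⟩⟩

lemma three_nbrs (h3 : KConnected G 3) {φ : V → Option Lab} (hcn : ∀ l, Cn G (Fb φ l)) {Z : Set V} (hZ : Cn G Z)
    (hu : ∀ v ∈ Z, φ v = none) : ∃ y1 y2 y3, y1 ≠ y2 ∧ y1 ≠ y3 ∧ y2 ≠ y3 ∧ (y1 ∉ Z ∧ Tch G Z {y1}) ∧
      (y2 ∉ Z ∧ Tch G Z {y2}) ∧ (y3 ∉ Z ∧ Tch G Z {y3}) := by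
  obtain ⟨d, hd⟩ := hZ.nonempty
  have key : ∀ a b, (d ≠ a ∧ d ≠ b) → ∃ y, y ∉ Z ∧ Tch G Z {y} ∧ y ≠ a ∧ y ≠ b := by
    intro a b hab
    have : ∃ o, o ∉ Z ∧ o ≠ a ∧ o ≠ b := by
      obtain ⟨p, hp⟩ := (hcn (false, 0)).nonempty
      obtain ⟨q, hq⟩ := (hcn (false, 1)).nonempty
      obtain ⟨r, hr⟩ := (hcn (false, 2)).nonempty
      have n1 : p ≠ q := by rintro rfl; have := fb_disj hp hq; simp at this
      have n2 : p ≠ r := by rintro rfl; have := fb_disj hp hr; simp at this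
      have n3 : q ≠ r := by rintro rfl; have := fb_disj hq hr; simp at this
      have z1 : p ∉ Z := fun hz => fb_none hp (hu p hz)
      have z2 : q ∉ Z := fun hz => fb_none hq (hu q hz)
      have z3 : r ∉ Z := fun hz => fb_none hr (hu r hz)
      grind
    obtain ⟨x, hx, y, hy, _, _, h1, h2, h⟩ := con3 h3 Z a b ⟨d, hd, hab.1, hab.2⟩ this
    exact ⟨y, hy, ⟨x, hx, y, rfl, h⟩, h1, h2⟩
  have hne : ∃ a, d ≠ a := by
    obtain ⟨p, hp⟩ := (hcn (false, 0)).nonempty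
    exact ⟨p, by rintro rfl; exact fb_none hp (hu _ hd)⟩
  obtain ⟨a, ha⟩ := hne
  obtain ⟨y1, n1, t1, _, _⟩ := key a a ⟨ha, ha⟩
  have d1 : d ≠ y1 := by rintro rfl; exact n1 hd
  obtain ⟨y2, n2, t2, e2, _⟩ := key y1 y1 ⟨d1, d1⟩
  have d2 : d ≠ y2 := by rintro rfl; exact n2 hd
  obtain ⟨y3, n3, t3, e3, e3'⟩ := key y1 y2 ⟨d1, d2⟩
  exact ⟨y1, y2, y3, e2.symm, e3.symm, e3'.symm, ⟨n1, t1⟩, ⟨n2, t2⟩, n3, t3⟩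

end Span
end AP

set_option linter.all false
namespace AP
section Span
variable {V : Type*} {G : SimpleGraph V}

/-- two neighbours in the same special branch set -/
lemma Cfg.two {φ : V → Option Lab} {l0 l3 : Lab} {D I : Set V} (h : Cfg G φ l0 l3 D I)
    (hmax : ∀ D', D ⊆ D' → GoodD G D' → D' ⊆ D) {u w : V} (huw : u ≠ w) (hu : u ∈ Fb φ l0) (hw : w ∈ Fb φ l0)
    (tu : Tch G (D ∪ I) {u}) (tw : Tch G (D ∪ I) {w}) :
    EXs G ∨ ∃ φ' I', Cfg G φ' l0 l3 D I' ∧ I ⊂ I' := by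
  obtain ⟨X, Y, huX, hwY, cX, cY, hXY, hd, tXY⟩ := (h.cn l0).split hu hw huw
  have a1 := tch_union (tu.mono (by rfl) (by simpa using huX : ({u} : Set V) ⊆ X))
  have a2 := tch_union (tw.mono (by rfl) (by simpa using hwY : ({w} : Set V) ⊆ Y))
  have b1 : Tch G D X ∨ Tch G D Y := by
    have := h.tD0; rw [← hXY] at this
    exact (tch_union this.symm).imp Tch.symm Tch.symm
  have b2 : Tch G I X ∨ Tch G I Y := by
    have := h.tI0; rw [← hXY] at this
    exact (tch_union this.symm).imp Tch.symm Tch.symm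
  have : (Tch G D X ∧ Tch G I Y) ∨ (Tch G D Y ∧ Tch G I X) := by tauto
  rcases this with ⟨p, q⟩ | ⟨p, q⟩
  · exact h.split hmax cX cY hXY hd tXY p q
  · exact h.split hmax cY cX (by rw [Set.union_comm]; exact hXY) (fun v a b => hd v b a) tXY.symm p q

lemma Cfg.step (h3 : KConnected G 3) {φ : V → Option Lab} {l0 l3 : Lab} {D I : Set V} (h : Cfg G φ l0 l3 D I)
    (hmax : ∀ D', D ⊆ D' → GoodD G D' → D' ⊆ D) :
    EXs G ∨ ∃ φ' l0' l3' I', Cfg G φ' l0' l3' D I' ∧ I ⊂ I' := by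
  have hcZ := h.cD.union_tch h.cI h.tDI
  have huZ : ∀ v ∈ D ∪ I, φ v = none := by
    rintro v (hv | hv)
    · exact h.uD v hv
    · exact h.uI v hv
  obtain ⟨y1, y2, y3, n12, n13, n23, q1, q2, q3⟩ := three_nbrs h3 h.cn hcZ huZ
  by_contra hcon
  push Not at hcon
  obtain ⟨hc1, hc2⟩ := hcon
  have lab : ∀ y, (y ∉ D ∪ I ∧ Tch G (D ∪ I) {y}) → y ∈ Fb φ l0 ∨ y ∈ Fb φ l3 := by
    rintro y ⟨hy, ht⟩
    rcases hφ : φ y with _ | t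
    · exfalso
      rcases tch_union ht with ht | ht
      · have : y ∈ D := hmax (D ∪ {y}) Set.subset_union_left ⟨_, h.km, ?_, h.cD.union_tch (Cn.singleton y) ht⟩ (Or.inr rfl)
        · exact hy (Or.inl this)
        · rintro v (hv | rfl)
          · exact h.uncol v hv
          · rw [rc_empty]
            exact rc_none (fun hi => hy (Or.inr hi)) hφ
      · refine hc2 φ l0 l3 (I ∪ {y}) { h with
          cI := h.cI.union_tch (Cn.singleton y) ht
          uI := ?_
          dj := ?_
          tDI := h.tDI.mono (by rfl) Set.subset_union_left
          tI0 := h.tI0.mono Set.subset_union_left (by rfl)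
          tI3 := h.tI3.mono Set.subset_union_left (by rfl) } ?_
        · rintro v (hv | rfl)
          · exact h.uI v hv
          · exact hφ
        · rintro v hv (hi | rfl)
          · exact h.dj v hv hi
          · exact hy (Or.inl hv)
        · exact (Set.ssubset_iff_of_subset Set.subset_union_left).2 ⟨y, Or.inr rfl, fun hi => hy (Or.inr hi)⟩
    · by_cases e0 : t = l0
      · subst e0; exact Or.inl hφ
      by_cases e3 : t = l3
      · subst e3; exact Or.inr hφ
      exfalso
      have hyt : ({y} : Set V) ⊆ Fb φ t := by
        rintro v rfl; exact hφ
      rcases tch_union ht with ht | ht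
      · exact hc1 (h.seeD e0 e3 (ht.mono (by rfl) hyt))
      · exact hc1 (h.swap.seeD e0 e3 (ht.mono (by rfl) hyt))
  have two : ∀ u w, u ≠ w → Tch G (D ∪ I) {u} → Tch G (D ∪ I) {w} → (u ∈ Fb φ l0 ∧ w ∈ Fb φ l0) ∨ (u ∈ Fb φ l3 ∧ w ∈ Fb φ l3) → False := by
    rintro u w huw tu tw (⟨a, b⟩ | ⟨a, b⟩)
    · rcases h.two hmax huw a b tu tw with k | ⟨φ', I', k, k'⟩
      · exact hc1 k
      · exact hc2 _ _ _ _ k k'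
    · rcases h.symm.two hmax huw a b tu tw with k | ⟨φ', I', k, k'⟩
      · exact hc1 k
      · exact hc2 _ _ _ _ k k'
  have l1 := lab y1 q1
  have l2 := lab y2 q2
  have l3 := lab y3 q3
  have t12 := two y1 y2 n12 q1.2 q2.2
  have t13 := two y1 y3 n13 q1.2 q3.2
  have t23 := two y2 y3 n23 q2.2 q3.2
  tauto

lemma Cfg.ex [Finite V] (h3 : KConnected G 3) {D : Set V} (hmax : ∀ D', D ⊆ D' → GoodD G D' → D' ⊆ D) :
    ∀ (n : ℕ) {φ : V → Option Lab} {l0 l3 : Lab} {I : Set V} (h : Cfg G φ l0 l3 D I), Nat.card V - I.ncard ≤ n → EXs G := by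
  intro n
  induction n with
  | zero =>
    intro φ l0 l3 I h hn
    rcases h.step h3 hmax with k | ⟨φ', a, b, I', h', hs⟩
    · exact k
    · have := Set.ncard_lt_ncard hs
      have := Set.ncard_le_card I'
      omega
  | succ n ih =>
    intro φ l0 l3 I h hn
    rcases h.step h3 hmax with k | ⟨φ', a, b, I', h', hs⟩
    · exact k
    · have := Set.ncard_lt_ncard hs
      have := Set.ncard_le_card I'
      exact ih h' (by omega)

lemma stage2 [Finite V] (h3 : KConnected G 3) {φ : V → Option Lab} (h : KM G φ) {D : Set V} (hD : Cn G D) (hu : ∀ v ∈ D, φ v = none)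
    (hmax : ∀ D', D ⊆ D' → GoodD G D' → D' ⊆ D)
    {l t : Lab} {u w : V} (huw : u ≠ w) (hul : u ∈ Fb φ l) (hwl : w ∈ Fb φ l)
    (tu : Tch G D {u}) (tw : Tch G D {w}) (hlt : t ≠ l) (ht : Tch G D (Fb φ t)) : EXs G := by
  obtain ⟨S, T, m, hST, hd, cS, cT, tST, tDS, tDT, hop, tSm, hT⟩ := stageA h hD hu hmax huw hul hwl tu tw
  have hml : m ≠ l := by rintro rfl; exact hop rfl
  have hSl : ∀ v ∈ S, v ∈ Fb φ l := fun v hv => hST ▸ Or.inl hv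
  have hDS : ∀ v ∈ D, v ∉ S := fun v hv hs => fb_none (hSl v hs) (hu v hv)
  by_cases e : t = m
  · subst e
    have e0 : Fb (rc φ S none) l = T := by rw [rc_rem (by simp), fb_of_union hST hd]
    have e1 : ∀ x, x ≠ l → Fb (rc φ S none) x = Fb φ x := fun x hx =>
      rc_same (by simp) (fun v hv hx' => hx (fb_disj hx' (hSl v hv)))
    refine Cfg.ex h3 hmax (Nat.card V) (φ := rc φ S none) (l0 := l) (l3 := t) (I := S) ?_ (by omega)
    refine ⟨⟨hop, fun x => ?_, ?_⟩, hD, cS, ?_, ?_, hDS, tDS, ?_, ?_, ?_, ?_⟩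
    · by_cases e : x = l
      · subst e; rw [e0]; exact cT
      · rw [e1 x e]; exact h.cn x
    · intro x y hxy n1 n2
      by_cases ex : x = l
      · subst ex
        have : y ≠ x := by rintro rfl; exact hxy rfl
        rw [e0, e1 y this]
        exact hT y hxy (fun e => n1 ⟨rfl, e⟩)
      · by_cases ey : y = l
        · subst ey
          rw [e0, e1 x ex]
          exact (hT x hxy.symm (fun e => n2 ⟨e, rfl⟩)).symm
        · rw [e1 x ex, e1 y ey]; exact h.tch x y hxy
    · exact fun v hv => rc_none (hDS v hv) (hu v hv)
    · intro v hv
      simp [rc, hv]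
    · rw [e0]; exact tDT
    · rw [e1 t hml]; exact ht
    · rw [e0]; exact tST
    · rw [e1 t hml]; exact tSm
  · have k := KM.move (I := ∅) h.cn (l := l) (fun x y _ _ e => h.tch x y e) (by simp) hST hd cS (by simpa using cT) hop tSm
      (by simpa using tST.symm) (by simpa using hT)
    rw [rc_empty] at k
    refine k.ex hD (fun v hv => rc_none (hDS v hv) (hu v hv)) (l1 := l) (l2 := m) (l3 := t) hml.symm hlt.symm (Ne.symm e) ?_ ?_ ?_
    · rw [rc_rem (by simpa using hml), fb_of_union hST hd]; exact tDT
    · rw [rc_add]; exact tDS.mono (by rfl) Set.subset_union_right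
    · rw [rc_same (by simpa using Ne.symm e)]
      · exact ht
      · exact fun v hv hx => hlt (fb_disj hx (hSl v hv))

lemma GoodD.ex [Finite V] (h3 : KConnected G 3) {D : Set V} (hG : GoodD G D) (hmax : ∀ D', D ⊆ D' → GoodD G D' → D' ⊆ D) :
    EXs G := by
  obtain ⟨φ, h, hu, hD⟩ := hG
  obtain ⟨y1, y2, y3, n12, n13, n23, q1, q2, q3⟩ := three_nbrs h3 h.cn hD hu
  have lab : ∀ φ, KM G φ → (∀ v ∈ D, φ v = none) → ∀ y, (y ∉ D ∧ Tch G D {y}) → ∃ t, y ∈ Fb φ t := by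
    rintro φ h hu y ⟨hy, ht⟩
    rcases hφ : φ y with _ | t
    · exfalso
      apply hy
      refine hmax (D ∪ {y}) Set.subset_union_left ⟨φ, h, ?_, hD.union_tch (Cn.singleton y) ht⟩ (Or.inr rfl)
      rintro v (hv | rfl)
      · exact hu v hv
      · exact hφ
    · exact ⟨t, hφ⟩
  have tt : ∀ {φ : V → Option Lab} {y t}, y ∈ Fb φ t → Tch G D {y} → Tch G D (Fb φ t) := by
    intro φ y t hy ht
    exact ht.mono (by rfl) (by rintro v rfl; exact hy)
  -- all but the monochromatic case
  have gen : ∀ φ, KM G φ → (∀ v ∈ D, φ v = none) → ∀ t1 t2 t3, y1 ∈ Fb φ t1 → y2 ∈ Fb φ t2 → y3 ∈ Fb φ t3 →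
      (EXs G ∨ (t1 = t2 ∧ t1 = t3)) := by
    intro φ h hu t1 t2 t3 h1 h2 h3'
    by_cases e12 : t1 = t2
    · by_cases e13 : t1 = t3
      · exact Or.inr ⟨e12, e13⟩
      · subst e12
        exact Or.inl (stage2 h3 h hD hu hmax n12 h1 h2 q1.2 q2.2 (Ne.symm e13) (tt h3' q3.2))
    · left
      by_cases e13 : t1 = t3
      · subst e13
        exact stage2 h3 h hD hu hmax n13 h1 h3' q1.2 q3.2 (Ne.symm e12) (tt h2 q2.2)
      · by_cases e23 : t2 = t3
        · subst e23
          exact stage2 h3 h hD hu hmax n23 h2 h3' q2.2 q3.2 e12 (tt h1 q1.2)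
        · exact h.ex hD hu e12 e13 e23 (tt h1 q1.2) (tt h2 q2.2) (tt h3' q3.2)
  obtain ⟨t1, h1⟩ := lab φ h hu y1 q1
  obtain ⟨t2, h2⟩ := lab φ h hu y2 q2
  obtain ⟨t3, h3'⟩ := lab φ h hu y3 q3
  rcases gen φ h hu t1 t2 t3 h1 h2 h3' with k | ⟨e, e'⟩
  · exact k
  subst e; subst e'
  obtain ⟨S, T, m, hST, hd, cS, cT, tST, tDS, tDT, hop, tSm, hT⟩ := stageA h hD hu hmax n12 h1 h2 q1.2 q2.2
  have hml : m ≠ t1 := by rintro rfl; exact hop rfl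
  have hSl : ∀ v ∈ S, v ∈ Fb φ t1 := fun v hv => hST ▸ Or.inl hv
  have hDS : ∀ v ∈ D, v ∉ S := fun v hv hs => fb_none (hSl v hs) (hu v hv)
  have k := KM.move (I := ∅) h.cn (l := t1) (fun x y _ _ e => h.tch x y e) (by simp) hST hd cS (by simpa using cT) hop tSm
      (by simpa using tST.symm) (by simpa using hT)
  rw [rc_empty] at k
  have hu' : ∀ v ∈ D, rc φ S (some m) v = none := fun v hv => rc_none (hDS v hv) (hu v hv)
  -- use neighbours from S and T and a third one
  obtain ⟨d1, hd1, s, hs, a1⟩ := tDS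
  obtain ⟨d2, hd2, t, ht, a2⟩ := tDT
  have hsm : s ∈ Fb (rc φ S (some m)) m := by rw [rc_add]; exact Or.inr hs
  have htl : t ∈ Fb (rc φ S (some m)) t1 := by
    rw [rc_rem (by simpa using hml), fb_of_union hST hd]; exact ht
  have hst : s ≠ t := by rintro rfl; exact hd _ hs ht
  have ts : Tch G D {s} := ⟨d1, hd1, s, rfl, a1⟩
  have tT : Tch G D {t} := ⟨d2, hd2, t, rfl, a2⟩
  have : ∃ y, y ≠ s ∧ y ≠ t ∧ (y ∉ D ∧ Tch G D {y}) := by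
    by_cases e1 : y1 ≠ s ∧ y1 ≠ t
    · exact ⟨y1, e1.1, e1.2, q1⟩
    by_cases e2 : y2 ≠ s ∧ y2 ≠ t
    · exact ⟨y2, e2.1, e2.2, q2⟩
    refine ⟨y3, ?_, ?_, q3⟩ <;> grind
  obtain ⟨y, ys, yt, q⟩ := this
  obtain ⟨c, hc⟩ := lab _ k hu' y q
  by_cases ec : c = m
  · subst ec
    exact stage2 h3 k hD hu' hmax ys hc hsm q.2 ts hml.symm (tt htl tT)
  by_cases ec' : c = t1
  · subst ec'
    exact stage2 h3 k hD hu' hmax yt hc htl q.2 tT hml (tt hsm ts)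
  · exact k.ex hD hu' (Ne.symm ec) hml ec' (tt hsm ts) (tt hc q.2) (tt htl tT)

/-- a 3-connected graph with a nonspanning `K₃,₃` model has an EX1 or EX8 minor -/
theorem K33i_EX [Finite V] (h3 : KConnected G 3) (h : HasM G 7 K33E) : EXs G := by
  obtain ⟨R, hR, hE⟩ := h
  have hg : GoodD G (R 6) := by
    classical
    let φ : V → Option Lab := fun v => if h : ∃ l : Lab, v ∈ R (lnum l) then some h.choose else none
    have hF : ∀ l, Fb φ l = R (lnum l) := by
      intro l
      ext v
      show φ v = some l ↔ _
      constructor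
      · intro hv
        by_cases hx : ∃ l : Lab, v ∈ R (lnum l)
        · have : φ v = some hx.choose := dif_pos hx
          rw [this] at hv
          rw [← Option.some.inj hv]; exact hx.choose_spec
        · have : φ v = none := dif_neg hx
          rw [this] at hv; cases hv
      · intro hv
        have hx : ∃ l : Lab, v ∈ R (lnum l) := ⟨l, hv⟩
        have e : φ v = some hx.choose := dif_pos hx
        rw [e]
        have := hR.disj _ (by have := lnum_lt hx.choose; omega) _ (by have := lnum_lt l; omega) v hx.choose_spec hv
        rw [lnum_inj this]
    refine ⟨φ, ⟨fun l => ?_, fun l m hlm => ?_⟩, ?_, hR.cn 6 (by omega)⟩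
    · rw [hF]; exact hR.cn _ (by have := lnum_lt l; omega)
    · rw [hF, hF]
      have : ∀ l m : Lab, l.1 ≠ m.1 → adjB K33E (lnum l) (lnum m) = true := by decide
      exact adjB_tch hE (this l m hlm)
    · intro v hv
      refine dif_neg ?_
      rintro ⟨l, hl⟩
      have := lnum_lt l
      have := hR.disj _ (by omega) 6 (by omega) v hl hv
      omega
  have hfin : {D : Set V | GoodD G D}.Finite := Set.toFinite _
  obtain ⟨D, hD⟩ := hfin.exists_maximal ⟨_, hg⟩
  exact GoodD.ex h3 hD.1 (fun D' h1 h2 => hD.2 h2 h1)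
end Span
end AP

set_option linter.all false
namespace AP
section KFive
variable {V : Type*} {G : SimpleGraph V}

structure M5 (G : SimpleGraph V) (R : Fin 5 → Set V) : Prop where
  cn : ∀ l, Cn G (R l)
  dj : ∀ l m v, v ∈ R l → v ∈ R m → l = m
  tch : ∀ l m, l ≠ m → Tch G (R l) (R m)

lemma four_split : ∀ p q : Fin 4 → Bool, (∀ i, p i = true ∨ q i = true) → (∀ j, ∃ i, i ≠ j ∧ p i = true) → (∀ j, ∃ i, i ≠ j ∧ q i = true) →
    ∃ s ∈ [((0,1,2,3) : Fin 4 × Fin 4 × Fin 4 × Fin 4),(0,2,1,3),(0,3,1,2),(1,2,0,3),(1,3,0,2),(2,3,0,1)], p s.1 = true ∧ p s.2.1 = true ∧ q s.2.2.1 = true ∧ q s.2.2.2 = true := by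
  decide +kernel

lemma M5.split {R : Fin 5 → Set V} (h : M5 G R) {k : Fin 5} {P Q : Set V} (hPQ : P ∪ Q = R k) (cP : Cn G P) (cQ : Cn G Q)
    (hd : ∀ v, v ∈ P → v ∈ Q → False) (tPQ : Tch G P Q) :
    HasM G 6 K33E ∨ ∃ j, j ≠ k ∧ ((∀ l, l ≠ k → l ≠ j → ¬ Tch G P (R l)) ∨ (∀ l, l ≠ k → l ≠ j → ¬ Tch G Q (R l))) := by
  classical
  by_contra hcon
  push Not at hcon
  obtain ⟨hno, hcon⟩ := hcon
  have hPk : ∀ v ∈ P, v ∈ R k := fun v hv => hPQ ▸ Or.inl hv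
  have hQk : ∀ v ∈ Q, v ∈ R k := fun v hv => hPQ ▸ Or.inr hv
  let e := k.succAbove
  have back : ∀ l, l ≠ k → ∃ i, e i = l := fun l hl => Fin.exists_succAbove_eq hl
  obtain ⟨s, hs, a, b, c, d⟩ := four_split (fun i => decide (Tch G P (R (e i)))) (fun i => decide (Tch G Q (R (e i)))) (by
      intro i
      simp only [decide_eq_true_eq]
      exact tch_union (hPQ ▸ h.tch k _ (Fin.succAbove_ne k i).symm)) (by
      intro j
      obtain ⟨⟨l, h1, h2, h3⟩, _⟩ := hcon (e j) (Fin.succAbove_ne k j)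
      obtain ⟨i, rfl⟩ := back l h1
      exact ⟨i, fun e' => h2 (by rw [e']), by simpa using h3⟩) (by
      intro j
      obtain ⟨_, ⟨l, h1, h2, h3⟩⟩ := hcon (e j) (Fin.succAbove_ne k j)
      obtain ⟨i, rfl⟩ := back l h1
      exact ⟨i, fun e' => h2 (by rw [e']), by simpa using h3⟩)
  simp only [decide_eq_true_eq] at a b c d
  apply hno
  have hM : HasM G 6 [(4,5),(4,s.1.val),(4,s.2.1.val),(5,s.2.2.1.val),(5,s.2.2.2.val),(0,1),(0,2),(0,3),(1,2),(1,3),(2,3)] := by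
    let F : ℕ → Set V := fun n => if hn : n < 4 then R (e ⟨n, hn⟩) else if n = 4 then P else Q
    have F4 : F 4 = P := rfl
    have F5 : F 5 = Q := rfl
    have Fi : ∀ i : Fin 4, F i.val = R (e i) := fun i => by
      have := i.2; simp [F]
    have cases6 : ∀ n, n < 6 → (∃ i : Fin 4, n = i.val) ∨ n = 4 ∨ n = 5 := by
      intro n hn
      by_cases h4 : n < 4
      · exact Or.inl ⟨⟨n, h4⟩, rfl⟩
      · omega
    have hek : ∀ i v, v ∈ R (e i) → v ∈ R k → False := fun i v h1 h2 => Fin.succAbove_ne k i (h.dj _ _ v h1 h2)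
    refine ⟨F, ⟨?_, ?_⟩, ?_⟩
    · intro n hn
      rcases cases6 n hn with ⟨i, rfl⟩ | rfl | rfl
      · rw [Fi]; exact h.cn _
      · exact cP
      · exact cQ
    · intro n hn m hm v hv hv'
      rcases cases6 n hn with ⟨i, rfl⟩ | rfl | rfl <;> rcases cases6 m hm with ⟨j, rfl⟩ | rfl | rfl
      · rw [Fi] at hv hv'
        rw [Fin.succAbove_right_injective (h.dj _ _ v hv hv')]
      · rw [Fi] at hv; exact (hek _ _ hv (hPk v hv')).elim
      · rw [Fi] at hv; exact (hek _ _ hv (hQk v hv')).elim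
      · rw [Fi] at hv'; exact (hek _ _ hv' (hPk v hv)).elim
      · rfl
      · exact (hd v hv hv').elim
      · rw [Fi] at hv'; exact (hek _ _ hv' (hQk v hv)).elim
      · exact (hd v hv' hv).elim
      · rfl
    · have hij : ∀ i j : Fin 4, i ≠ j → Tch G (F i.val) (F j.val) := by
        intro i j hij
        rw [Fi, Fi]; exact h.tch _ _ (fun e' => hij (Fin.succAbove_right_injective e'))
      simp only [List.forall_mem_cons, Fi]
      refine ⟨tPQ, a, b, c, d, hij 0 1 (by decide), hij 0 2 (by decide), hij 0 3 (by decide), hij 1 2 (by decide), hij 1 3 (by decide), hij 2 3 (by decide), by simp⟩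
  refine hM.chk [[4],[s.2.2.1.val],[s.2.2.2.val],[5],[s.1.val],[s.2.1.val]] ?_
  clear a b c d hM
  revert s
  decide +kernel

structure St (G : SimpleGraph V) (R : Fin 5 → Set V) (X : Set V) (k i : Fin 5) : Prop where
  cn : ∀ l, Cn G (R l)
  dj : ∀ l m v, v ∈ R l → v ∈ R m → l = m
  djX : ∀ l v, v ∈ X → v ∈ R l → False
  cov : ∀ v, v ∈ X ∨ ∃ l, v ∈ R l
  ki : k ≠ i
  tch : ∀ l m, l ≠ m → ¬ (l = k ∧ m = i) → ¬ (l = i ∧ m = k) → Tch G (R l) (R m)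
  cX : X.Nonempty → Cn G X
  sees : ∀ l, Tch G X (R l) → l = k ∨ l = i
  alt : Tch G (R k) (R i) ∨ (Tch G X (R k) ∧ Tch G X (R i))

lemma St.symm {R : Fin 5 → Set V} {X : Set V} {k i : Fin 5} (h : St G R X k i) : St G R X i k where
  cn := h.cn
  dj := h.dj
  djX := h.djX
  cov := h.cov
  ki := h.ki.symm
  tch := fun l m e a b => h.tch l m e b a
  cX := h.cX
  sees := fun l hl => (h.sees l hl).symm
  alt := h.alt.imp Tch.symm And.symm

lemma St.next {R : Fin 5 → Set V} {X : Set V} {k i : Fin 5} (h : St G R X k i) {P Q : Set V} {j : Fin 5} (hj : j ≠ k)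
    (hPQ : P ∪ Q = R k) (cP : Cn G P) (cQ : Cn G Q) (hd : ∀ v, v ∈ P → v ∈ Q → False) (tPQ : Tch G P Q)
    (hP : ∀ l, l ≠ k → l ≠ j → ¬ Tch G P (R l)) (hXP : X.Nonempty → Tch G X P)
    (hij : j = i ∨ (¬ Tch G X (R i) ∧ Tch G (R k) (R i))) :
    ∃ R' X' k' i', St G R' X' k' i' ∧ X ⊂ X' := by
  have hPk : ∀ v ∈ P, v ∈ R k := fun v hv => hPQ ▸ Or.inl hv
  have hQk : ∀ v ∈ Q, v ∈ R k := fun v hv => hPQ ▸ Or.inr hv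
  refine ⟨Function.update R k Q, X ∪ P, k, j, ?_, (Set.ssubset_iff_of_subset Set.subset_union_left).2 ?_⟩
  · have e0 : Function.update R k Q k = Q := by simp
    have e1 : ∀ l, l ≠ k → Function.update R k Q l = R l := fun l hl => by simp [hl]
    have es : ∀ l v, v ∈ Function.update R k Q l → v ∈ R l := by
      intro l v hv
      by_cases e : l = k
      · subst e; rw [e0] at hv; exact hQk v hv
      · rwa [e1 l e] at hv
    have tQ : ∀ m, m ≠ k → m ≠ j → Tch G Q (R m) := by
      intro m hm hmj
      have : Tch G (R k) (R m) := by
        by_cases e : m = i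
        · subst e
          rcases hij with e | e
          · exact (hmj e.symm).elim
          · exact e.2
        · exact h.tch k m hm.symm (fun a => e a.2) (fun a => hm a.2)
      rw [← hPQ] at this
      exact (tch_union this).resolve_left (hP m hm hmj)
    refine ⟨?_, ?_, ?_, ?_, hj.symm, ?_, ?_, ?_, ?_⟩
    · intro l
      by_cases e : l = k
      · subst e; rw [e0]; exact cQ
      · rw [e1 l e]; exact h.cn l
    · exact fun l m v a b => h.dj l m v (es l v a) (es m v b)
    · rintro l v (hv | hv) hl
      · exact h.djX l v hv (es l v hl)
      · have := h.dj _ _ v (hPk v hv) (es l v hl)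
        subst this
        rw [e0] at hl
        exact hd v hv hl
    · intro v
      rcases h.cov v with hv | ⟨l, hl⟩
      · exact Or.inl (Or.inl hv)
      · by_cases e : l = k
        · subst e
          rw [← hPQ] at hl
          rcases hl with hl | hl
          · exact Or.inl (Or.inr hl)
          · exact Or.inr ⟨l, by rw [e0]; exact hl⟩
        · exact Or.inr ⟨l, by rw [e1 l e]; exact hl⟩
    · intro l m hlm n1 n2
      by_cases el : l = k
      · subst el
        rw [e0, e1 m hlm.symm]
        exact tQ m hlm.symm (fun e => n1 ⟨rfl, e⟩)
      · by_cases em : m = k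
        · subst em
          rw [e0, e1 l el]
          exact (tQ l el (fun e => n2 ⟨e, rfl⟩)).symm
        · rw [e1 l el, e1 m em]
          exact h.tch l m hlm (fun a => el a.1) (fun a => em a.2)
    · intro _
      by_cases hX : X.Nonempty
      · exact (h.cX hX).union_tch cP (hXP hX)
      · rw [Set.not_nonempty_iff_eq_empty.1 hX]; simpa using cP
    · intro l hl
      by_contra hcon
      push Not at hcon
      rw [e1 l hcon.1] at hl
      rcases tch_union hl with hl | hl
      · rcases h.sees l hl with e | e
        · exact hcon.1 e
        · subst e
          rcases hij with e | e
          · exact hcon.2 e.symm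
          · exact e.1 hl
      · exact hP l hcon.1 hcon.2 hl
    · rw [e0, e1 j hj]
      have tt : Tch G (X ∪ P) Q := tPQ.mono Set.subset_union_right (by rfl)
      have : Tch G (R k) (R j) ∨ Tch G X (R j) := by
        by_cases e : j = i
        · subst e
          exact h.alt.imp id And.right
        · exact Or.inl (h.tch k j hj.symm (fun a => e a.2) (fun a => h.ki a.1))
      rcases this with t | t
      · rw [← hPQ] at t
        rcases tch_union t with t | t
        · exact Or.inr ⟨tt, t.mono Set.subset_union_right (by rfl)⟩
        · exact Or.inl t
      · exact Or.inr ⟨tt, t.mono Set.subset_union_left (by rfl)⟩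
  · obtain ⟨x, hx⟩ := cP.nonempty
    exact ⟨x, Or.inr hx, fun h' => h.djX k x h' (hPk x hx)⟩

lemma St.two {R : Fin 5 → Set V} {X : Set V} {k i : Fin 5} (h : St G R X k i) (hno : ¬ HasM G 6 K33E) {u w : V} (huw : u ≠ w)
    (hu : u ∈ R k) (hw : w ∈ R k) (tu : X.Nonempty → Tch G X {u}) (tw : X.Nonempty → Tch G X {w}) :
    ∃ R' X' k' i', St G R' X' k' i' ∧ X ⊂ X' := by
  obtain ⟨P, Q, huP, hwQ, cP, cQ, hPQ, hd, tPQ⟩ := (h.cn k).split hu hw huw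
  have tP : X.Nonempty → Tch G X P := fun hx => (tu hx).mono (by rfl) (by simpa using huP)
  have tQ : X.Nonempty → Tch G X Q := fun hx => (tw hx).mono (by rfl) (by simpa using hwQ)
  have hQP : Q ∪ P = R k := by rw [Set.union_comm]; exact hPQ
  by_cases hi : Tch G X (R i)
  · have hne : X.Nonempty := by obtain ⟨x, hx, _⟩ := hi; exact ⟨x, hx⟩
    have e1 : ∀ l, l ≠ i → Function.update R i (R i ∪ X) l = R l := fun l hl => by simp [hl]
    have e0 : Function.update R i (R i ∪ X) i = R i ∪ X := by simp
    have sub : ∀ l, R l ⊆ Function.update R i (R i ∪ X) l := by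
      intro l
      by_cases e : l = i
      · subst e; rw [e0]; exact Set.subset_union_left
      · rw [e1 l e]
    have m5 : M5 G (Function.update R i (R i ∪ X)) := by
      have key : ∀ m, m ≠ i → Tch G (R i ∪ X) (R m) := by
        intro m hm
        by_cases e : m = k
        · subst e; exact (tP hne).mono Set.subset_union_right (fun v hv => hPQ ▸ Or.inl hv)
        · exact (h.tch i m hm.symm (fun a => hm a.2) (fun a => e a.2)).mono Set.subset_union_left (by rfl)
      refine ⟨?_, ?_, ?_⟩
      · intro l
        by_cases e : l = i
        · subst e; rw [e0]; exact (h.cn l).union_tch (h.cX hne) hi.symm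
        · rw [e1 l e]; exact h.cn l
      · intro l m v hl hm
        by_cases e : l = i
        · by_cases e' : m = i
          · rw [e, e']
          · rw [e1 m e'] at hm
            subst e; rw [e0] at hl
            rcases hl with hl | hl
            · exact h.dj _ _ v hl hm
            · exact (h.djX _ v hl hm).elim
        · rw [e1 l e] at hl
          by_cases e' : m = i
          · subst e'; rw [e0] at hm
            rcases hm with hm | hm
            · exact h.dj _ _ v hl hm
            · exact (h.djX _ v hm hl).elim
          · rw [e1 m e'] at hm
            exact h.dj _ _ v hl hm
      · intro l m hlm
        by_cases e : l = i
        · subst e; rw [e0, e1 m hlm.symm]; exact key m hlm.symm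
        · by_cases e' : m = i
          · subst e'; rw [e0, e1 l e]; exact (key l e).symm
          · rw [e1 l e, e1 m e']
            exact h.tch l m hlm (fun a => e' a.2) (fun a => e a.1)
    have hPQ' : P ∪ Q = Function.update R i (R i ∪ X) k := by rw [e1 k h.ki]; exact hPQ
    rcases m5.split hPQ' cP cQ hd tPQ with k' | ⟨j, hj, hP | hQ⟩
    · exact (hno k').elim
    · have : j = i := by
        by_contra e
        exact hP i h.ki.symm (Ne.symm e) ((tP hne).symm.mono (by rfl) (by rw [e0]; exact Set.subset_union_right))
      subst this
      exact h.next hj hPQ cP cQ hd tPQ (fun l a b t => hP l a b (t.mono (by rfl) (sub l))) tP (Or.inl rfl)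
    · have : j = i := by
        by_contra e
        exact hQ i h.ki.symm (Ne.symm e) ((tQ hne).symm.mono (by rfl) (by rw [e0]; exact Set.subset_union_right))
      subst this
      exact h.next hj hQP cQ cP (fun v a b => hd v b a) tPQ.symm (fun l a b t => hQ l a b (t.mono (by rfl) (sub l))) tQ (Or.inl rfl)
  · have tki : Tch G (R k) (R i) := h.alt.resolve_right (fun a => hi a.2)
    have m5 : M5 G R := ⟨h.cn, h.dj, fun l m hlm => by
      by_cases e : l = k ∧ m = i
      · rw [e.1, e.2]; exact tki
      by_cases e' : l = i ∧ m = k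
      · rw [e'.1, e'.2]; exact tki.symm
      exact h.tch l m hlm e e'⟩
    rcases m5.split hPQ cP cQ hd tPQ with k' | ⟨j, hj, hP | hQ⟩
    · exact (hno k').elim
    · exact h.next hj hPQ cP cQ hd tPQ hP tP (Or.inr ⟨hi, tki⟩)
    · exact h.next hj hQP cQ cP (fun v a b => hd v b a) tPQ.symm hQ tQ (Or.inr ⟨hi, tki⟩)

lemma St.step (h3 : KConnected G 3) {R : Fin 5 → Set V} {X : Set V} {k i : Fin 5} (h : St G R X k i) (hno : ¬ HasM G 6 K33E)
    (hX : X.Nonempty) : ∃ R' X' k' i', St G R' X' k' i' ∧ X ⊂ X' := by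
  obtain ⟨d, hd⟩ := hX
  have key : ∀ a b, (d ≠ a ∧ d ≠ b) → ∃ y, Tch G X {y} ∧ (y ∈ R k ∨ y ∈ R i) ∧ y ≠ a ∧ y ≠ b := by
    intro a b hab
    have : ∃ o, o ∉ X ∧ o ≠ a ∧ o ≠ b := by
      obtain ⟨p, hp⟩ := (h.cn 0).nonempty
      obtain ⟨q, hq⟩ := (h.cn 1).nonempty
      obtain ⟨r, hr⟩ := (h.cn 2).nonempty
      have n1 : p ≠ q := by rintro rfl; have := h.dj _ _ _ hp hq; simp at this
      have n2 : p ≠ r := by rintro rfl; have := h.dj _ _ _ hp hr; simp at this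
      have n3 : q ≠ r := by rintro rfl; have := h.dj _ _ _ hq hr; simp at this
      have z1 : p ∉ X := fun hz => h.djX _ p hz hp
      have z2 : q ∉ X := fun hz => h.djX _ q hz hq
      have z3 : r ∉ X := fun hz => h.djX _ r hz hr
      grind
    obtain ⟨x, hx, y, hy, _, _, h1, h2, hxy⟩ := con3 h3 X a b ⟨d, hd, hab.1, hab.2⟩ this
    refine ⟨y, ⟨x, hx, y, rfl, hxy⟩, ?_, h1, h2⟩
    rcases h.cov y with hv | ⟨l, hl⟩
    · exact (hy hv).elim
    · rcases h.sees l ⟨x, hx, y, hl, hxy⟩ with rfl | rfl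
      · exact Or.inl hl
      · exact Or.inr hl
  have dn : ∀ y, (y ∈ R k ∨ y ∈ R i) → d ≠ y := by
    rintro y (hy | hy) rfl
    · exact h.djX _ _ hd hy
    · exact h.djX _ _ hd hy
  obtain ⟨p, hp⟩ := (h.cn k).nonempty
  have dp := dn p (Or.inl hp)
  obtain ⟨y1, t1, l1, _, _⟩ := key p p ⟨dp, dp⟩
  obtain ⟨y2, t2, l2, n21, _⟩ := key y1 y1 ⟨dn _ l1, dn _ l1⟩
  obtain ⟨y3, t3, l3, n31, n32⟩ := key y1 y2 ⟨dn _ l1, dn _ l2⟩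
  have two : ∀ u w, u ≠ w → Tch G X {u} → Tch G X {w} → (u ∈ R k ∧ w ∈ R k) ∨ (u ∈ R i ∧ w ∈ R i) →
      ∃ R' X' k' i', St G R' X' k' i' ∧ X ⊂ X' := by
    rintro u w huw tu tw (⟨a, b⟩ | ⟨a, b⟩)
    · exact h.two hno huw a b (fun _ => tu) (fun _ => tw)
    · exact h.symm.two hno huw a b (fun _ => tu) (fun _ => tw)
  rcases l1 with l1 | l1 <;> rcases l2 with l2 | l2 <;> rcases l3 with l3 | l3
  · exact two y1 y2 n21.symm t1 t2 (Or.inl ⟨l1, l2⟩)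
  · exact two y1 y2 n21.symm t1 t2 (Or.inl ⟨l1, l2⟩)
  · exact two y1 y3 n31.symm t1 t3 (Or.inl ⟨l1, l3⟩)
  · exact two y2 y3 n32.symm t2 t3 (Or.inr ⟨l2, l3⟩)
  · exact two y2 y3 n32.symm t2 t3 (Or.inl ⟨l2, l3⟩)
  · exact two y1 y3 n31.symm t1 t3 (Or.inr ⟨l1, l3⟩)
  · exact two y1 y2 n21.symm t1 t2 (Or.inr ⟨l1, l2⟩)
  · exact two y1 y2 n21.symm t1 t2 (Or.inr ⟨l1, l2⟩)

lemma St.no [Finite V] (h3 : KConnected G 3) (hno : ¬ HasM G 6 K33E) : ∀ (n : ℕ) {R : Fin 5 → Set V} {X : Set V} {k i : Fin 5}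
    (h : St G R X k i) (hX : X.Nonempty), Nat.card V - X.ncard ≤ n → False := by
  intro n
  induction n with
  | zero =>
    intro R X k i h hX hn
    obtain ⟨R', X', k', i', h', hs⟩ := h.step h3 hno hX
    have := Set.ncard_lt_ncard hs
    have := Set.ncard_le_card X'
    omega
  | succ n ih =>
    intro R X k i h hX hn
    obtain ⟨R', X', k', i', h', hs⟩ := h.step h3 hno hX
    have := Set.ncard_lt_ncard hs
    have := Set.ncard_le_card X'
    exact ih h' (hX.mono hs.1) (by omega)

/-- models in a connected graph extend to covering models -/
lemma Mod.cover [Finite V] (hG : Cn G Set.univ) {n : ℕ} (hn : 0 < n) {R : ℕ → Set V} (h : Mod G n R) :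
    ∃ R', Mod G n R' ∧ (∀ i, R i ⊆ R' i) ∧ ∀ v, ∃ i < n, v ∈ R' i := by
  have : ∀ (m : ℕ) (R : ℕ → Set V), Mod G n R → ({v | ¬ ∃ i < n, v ∈ R i}).ncard ≤ m →
      ∃ R', Mod G n R' ∧ (∀ i, R i ⊆ R' i) ∧ ∀ v, ∃ i < n, v ∈ R' i := by
    intro m
    induction m with
    | zero =>
      intro R h hm
      refine ⟨R, h, fun i => by rfl, fun v => ?_⟩
      have : {v | ¬ ∃ i < n, v ∈ R i} = ∅ := by
        rw [← Set.ncard_eq_zero]; omega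
      by_contra hv
      have : v ∈ ({v | ¬ ∃ i < n, v ∈ R i} : Set V) := hv
      simp_all
    | succ m ih =>
      intro R h hm
      by_cases hall : ∀ v, ∃ i < n, v ∈ R i
      · exact ⟨R, h, fun i => by rfl, hall⟩
      push Not at hall
      obtain ⟨v, hv⟩ := hall
      obtain ⟨w, hw⟩ := (h.cn 0 hn).nonempty
      obtain ⟨x, _, y, _, hx, hy, hxy⟩ := hG.cross (A := {v | ∃ i < n, v ∈ R i}) ⟨w, trivial, 0, hn, hw⟩
        ⟨v, trivial, by rintro ⟨i, h1, h2⟩; exact hv i h1 h2⟩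
      obtain ⟨i, hi, hxi⟩ := hx
      have hy' : ∀ j < n, y ∉ R j := fun j hj hyj => hy ⟨j, hj, hyj⟩
      have e0 : Function.update R i (insert y (R i)) i = insert y (R i) := by simp
      have e1 : ∀ l, l ≠ i → Function.update R i (insert y (R i)) l = R l := fun l hl => by simp [hl]
      have sub : ∀ l, R l ⊆ Function.update R i (insert y (R i)) l := by
        intro l
        by_cases e : l = i
        · subst e; rw [e0]; exact Set.subset_insert _ _
        · rw [e1 l e]
      have hmod : Mod G n (Function.update R i (insert y (R i))) := by
        refine ⟨?_, ?_⟩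
        · intro l hl
          by_cases e : l = i
          · subst e; rw [e0]; exact (h.cn l hl).insert ⟨x, hxi, hxy.symm⟩
          · rw [e1 l e]; exact h.cn l hl
        · intro a ha b hb z hza hzb
          by_cases e : a = i
          · by_cases e' : b = i
            · rw [e, e']
            · rw [e1 b e'] at hzb
              subst e; rw [e0] at hza
              rcases hza with rfl | hza
              · exact (hy' b hb hzb).elim
              · exact h.disj _ ha _ hb z hza hzb
          · rw [e1 a e] at hza
            by_cases e' : b = i
            · subst e'; rw [e0] at hzb
              rcases hzb with rfl | hzb
              · exact (hy' a ha hza).elim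
              · exact h.disj _ ha _ hb z hza hzb
            · rw [e1 b e'] at hzb
              exact h.disj _ ha _ hb z hza hzb
      have hlt : ({v | ¬ ∃ l < n, v ∈ Function.update R i (insert y (R i)) l}).ncard ≤ m := by
        have : ({v | ¬ ∃ l < n, v ∈ Function.update R i (insert y (R i)) l}) ⊂ {v | ¬ ∃ i < n, v ∈ R i} := by
          refine (Set.ssubset_iff_of_subset ?_).2 ⟨y, hy, ?_⟩
          · rintro z hz ⟨l, hl, hzl⟩
            exact hz ⟨l, hl, sub l hzl⟩
          · intro hz
            exact hz ⟨i, hi, by rw [e0]; exact Set.mem_insert _ _⟩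
        have := Set.ncard_lt_ncard this
        omega
      obtain ⟨R', h1, h2, h3⟩ := ih _ hmod hlt
      exact ⟨R', h1, fun l => (sub l).trans (h2 l), h3⟩
  exact this _ R h le_rfl

lemma cn_univ (h3 : KConnected G 3) : Cn G Set.univ := by
  have := h3.2 ∅ (by simp)
  rwa [Set.compl_empty] at this

theorem K5_card [Finite V] (h3 : KConnected G 3) (hno : ¬ HasM G 6 K33E) (h5 : HasM G 5 K5E) :
    Nat.card V = 5 := by
  obtain ⟨R0, hR0, hE⟩ := h5
  obtain ⟨R1, hR1, hs, hcov⟩ := hR0.cover (cn_univ h3) (by omega)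
  let R : Fin 5 → Set V := fun i => R1 i.val
  have m5 : M5 G R := by
    refine ⟨fun l => hR1.cn _ l.2, fun l m v a b => Fin.ext (hR1.disj _ l.2 _ m.2 v a b), fun l m hlm => ?_⟩
    have : ∀ l m : Fin 5, l ≠ m → adjB K5E l.val m.val = true := by decide
    exact (adjB_tch hE (this l m hlm)).mono (hs _) (hs _)
  have sing : ∀ k u w, u ∈ R k → w ∈ R k → u = w := by
    intro k u w hu hw
    by_contra huw
    obtain ⟨i, hi⟩ : ∃ i : Fin 5, k ≠ i := by clear hu hw; revert k; decide
    have st : St G R ∅ k i := ⟨m5.cn, m5.dj, by simp, fun v => by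
        obtain ⟨l, hl, hv⟩ := hcov v
        exact Or.inr ⟨⟨l, hl⟩, hv⟩, hi, fun l m e _ _ => m5.tch l m e, by simp, by rintro l ⟨x, hx, _⟩; exact hx.elim,
        Or.inl (m5.tch k i hi)⟩
    obtain ⟨R', X', k', i', h', hX⟩ := st.two hno huw hu hw (by simp) (by simp)
    exact St.no h3 hno _ h' (by
      obtain ⟨x, hx, _⟩ := (Set.ssubset_iff_of_subset hX.1).1 hX
      exact ⟨x, hx⟩) le_rfl
  have : Nat.card V = Nat.card (Fin 5) := by
    symm
    refine Nat.card_eq_of_bijective (fun i => (m5.cn i).nonempty.some) ⟨?_, ?_⟩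
    · intro i j hij
      have h1 := (m5.cn i).nonempty.some_mem
      have h2 := (m5.cn j).nonempty.some_mem
      dsimp only at hij
      rw [hij] at h1
      exact m5.dj _ _ _ h1 h2
    · intro v
      obtain ⟨l, hl, hv⟩ := hcov v
      exact ⟨⟨l, hl⟩, sing _ _ _ (m5.cn ⟨l, hl⟩).nonempty.some_mem hv⟩
  simpa using this

theorem dw3_of_card5 {V : Type} [Finite V] {G : SimpleGraph V} (h : Nat.card V = 5) : IsMinor G (doubleWheel 3) := by
  have e : V ≃ (Fin 3 ⊕ Fin 2) := (Finite.equivFinOfCardEq h).trans (finSumFinEquiv (m := 3) (n := 2)).symm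
  refine isMinor_of_map (fun v => e v) (fun a b hab => e.injective hab) ?_
  intro a b hab
  have : ∀ x y : Fin 3 ⊕ Fin 2, x ≠ y → (doubleWheel 3).Adj x y := by
    rintro (x | x) (y | y) hxy <;> fin_cases x <;> fin_cases y <;> simp_all [doubleWheel]
  exact this _ _ (fun h => hab.ne (e.injective h))

end KFive
end AP

set_option linter.all false
namespace AP
section TKs
variable {V : Type*} {G : SimpleGraph V}

lemma tripod {S : Set V} (hS : Cn G S) (x : Fin 3 → V) (hx : ∀ i, x i ∈ S) :
    ∃ (c : V) (q : Fin 3 → ℕ → V) (m : Fin 3 → ℕ), (∀ i, q i 0 = c) ∧ (∀ i, q i (m i) = x i) ∧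
      (∀ i s, s < m i → G.Adj (q i s) (q i (s+1))) ∧ (∀ i s, s ≤ m i → q i s ∈ S) ∧
      (∀ i s i' s', s ≤ m i → s' ≤ m i' → q i s = q i' s' → (i = i' ∧ s = s') ∨ (s = 0 ∧ s' = 0)) := by
  classical
  obtain ⟨p, n, hp, p0, pn, pS⟩ := hS.path (hx 0) (hx 1)
  obtain ⟨r, m, hr, r0, rm, rS⟩ := hS.path (hx 2) (hx 0)
  have hex : ∃ t, t ≤ m ∧ ∃ s ≤ n, r t = p s := ⟨m, le_rfl, 0, Nat.zero_le _, by rw [rm, p0]⟩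
  set t := Nat.find hex with ht
  obtain ⟨htm, s, hsn, hts⟩ := Nat.find_spec hex
  rw [← ht] at htm hts
  have hmin : ∀ u < t, ∀ s ≤ n, r u ≠ p s := fun u hu s hs e => Nat.find_min hex hu ⟨by omega, s, hs, e⟩
  refine ⟨p s, ![fun u => p (s - u), fun u => p (s + u), fun u => r (t - u)], ![s, n - s, t], ?_, ?_, ?_, ?_, ?_⟩
  · intro i; fin_cases i <;> simp [hts]
  · intro i; fin_cases i
    · simpa using p0
    · simpa [show s + (n - s) = n by omega] using pn
    · simpa using r0
  · intro i u hu
    fin_cases i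
    · simp at hu ⊢
      have := hp.adj (s - (u+1)) (by omega)
      rw [show s - (u+1) + 1 = s - u by omega] at this
      exact this.symm
    · simp at hu ⊢
      exact hp.adj (s + u) (by omega)
    · simp at hu ⊢
      have := hr.adj (t - (u+1)) (by omega)
      rw [show t - (u+1) + 1 = t - u by omega] at this
      exact this.symm
  · intro i u hu
    fin_cases i
    · exact pS _ (by simp at hu ⊢; omega)
    · simp at hu ⊢
      exact pS _ (by omega)
    · simp at hu ⊢
      exact rS _ (by omega)
  · have k01 : ∀ u u', u ≤ s → u' ≤ n - s → p (s - u) = p (s + u') → u = 0 ∧ u' = 0 := by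
      intro u u' h1 h2 e
      have := hp.inj _ (by omega) _ (by omega) e
      omega
    have k2 : ∀ u s', u ≤ t → s' ≤ n → r (t - u) = p s' → u = 0 ∧ s' = s := by
      intro u s' h1 h2 e
      have hu : u = 0 := by
        by_contra hu
        exact hmin (t - u) (by omega) s' h2 e
      subst hu
      rw [Nat.sub_zero, hts] at e
      exact ⟨rfl, (hp.inj _ (by omega) _ (by omega) e).symm⟩
    intro i u i' u' h1 h2 e
    fin_cases i <;> fin_cases i' <;> simp at h1 h2 e ⊢
    · have := hp.inj _ (by omega) _ (by omega) e; omega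
    · exact k01 u u' h1 h2 e
    · have := k2 u' (s - u) h2 (by omega) e.symm; omega
    · have := k01 u' u h2 h1 e.symm; omega
    · have := hp.inj _ (by omega) _ (by omega) e; omega
    · have := k2 u' (s + u) h2 (by omega) e.symm; omega
    · have := k2 u (s - u') h1 (by omega) e; omega
    · have := k2 u (s + u') h1 (by omega) e; omega
    · have := hr.inj _ (by omega) _ (by omega) e; omega

/-- a spanning subdivision of `K₃,₃` -/
structure TK (G : SimpleGraph V) where
  n : Fin 3 → Fin 3 → ℕ
  p : Fin 3 → Fin 3 → ℕ → V
  a : Fin 3 → V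
  b : Fin 3 → V
  pos : ∀ i j, 1 ≤ n i j
  p0 : ∀ i j, p i j 0 = a i
  pn : ∀ i j, p i j (n i j) = b j
  adj : ∀ i j s, s < n i j → G.Adj (p i j s) (p i j (s+1))
  uniq : ∀ i j s i' j' s', s ≤ n i j → s' ≤ n i' j' → p i j s = p i' j' s' →
    (i = i' ∧ j = j' ∧ s = s') ∨ (s = 0 ∧ s' = 0 ∧ i = i') ∨ (s = n i j ∧ s' = n i' j' ∧ j = j')
  cov : ∀ v, ∃ i j s, s ≤ n i j ∧ p i j s = v

namespace TK
variable (T : TK G)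

/-- interior of a segment -/
def I (i j : Fin 3) : Set V := {v | ∃ s, 0 < s ∧ s < T.n i j ∧ T.p i j s = v}

lemma a_inj {i i' : Fin 3} (h : T.a i = T.a i') : i = i' := by
  rw [← T.p0 i 0, ← T.p0 i' 0] at h
  have h1 := T.pos i 0
  have := T.uniq _ _ _ _ _ _ (by omega) (by omega) h
  omega

lemma b_inj {j j' : Fin 3} (h : T.b j = T.b j') : j = j' := by
  rw [← T.pn 0 j, ← T.pn 0 j'] at h
  have h1 := T.pos 0 j
  have := T.uniq _ _ _ _ _ _ (by omega) (by omega) h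
  omega

lemma ab_ne {i j : Fin 3} : T.a i ≠ T.b j := by
  intro h
  rw [← T.p0 i j, ← T.pn i j] at h
  have h1 := T.pos i j
  have := T.uniq _ _ _ _ _ _ (by omega) (by omega) h
  omega

lemma a_notI {i i' j : Fin 3} : T.a i ∉ T.I i' j := by
  rintro ⟨s, h1, h2, h⟩
  rw [← T.p0 i j] at h
  have := T.uniq _ _ _ _ _ _ (by omega) (by omega) h
  omega

lemma b_notI {i j j' : Fin 3} : T.b j ∉ T.I i j' := by
  rintro ⟨s, h1, h2, h⟩
  rw [← T.pn i j] at h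
  rcases T.uniq _ _ _ _ _ _ (by omega) (by omega) h with ⟨_, rfl, h⟩ | h | h <;> omega

lemma I_disj {i j i' j' : Fin 3} {v : V} (h : v ∈ T.I i j) (h' : v ∈ T.I i' j') : i = i' ∧ j = j' := by
  obtain ⟨s, h1, h2, rfl⟩ := h
  obtain ⟨s', h1', h2', e⟩ := h'
  have := T.uniq _ _ _ _ _ _ (by omega) (by omega) e
  omega

lemma cases (v : V) : (∃ i, v = T.a i) ∨ (∃ j, v = T.b j) ∨ ∃ i j, v ∈ T.I i j := by
  obtain ⟨i, j, s, hs, rfl⟩ := T.cov v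
  by_cases h0 : s = 0
  · subst h0; exact Or.inl ⟨i, T.p0 i j⟩
  · by_cases hn : s = T.n i j
    · subst hn; exact Or.inr (Or.inl ⟨j, T.pn i j⟩)
    · exact Or.inr (Or.inr ⟨i, j, s, by omega, by omega, rfl⟩)

/-- permuting the branch vertices -/
def perm (σ τ : Equiv.Perm (Fin 3)) : TK G where
  n i j := T.n (σ i) (τ j)
  p i j := T.p (σ i) (τ j)
  a i := T.a (σ i)
  b j := T.b (τ j)
  pos i j := T.pos _ _
  p0 i j := T.p0 _ _
  pn i j := T.pn _ _
  adj i j := T.adj _ _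
  uniq i j s i' j' s' h1 h2 h := by
    have := T.uniq _ _ _ _ _ _ h1 h2 h
    simpa [σ.injective.eq_iff, τ.injective.eq_iff] using this
  cov v := by
    obtain ⟨i, j, s, hs, e⟩ := T.cov v
    exact ⟨σ.symm i, τ.symm j, s, by simpa using hs, by simpa using e⟩

/-- exchanging the two sides -/
def swap : TK G where
  n i j := T.n j i
  p i j s := T.p j i (T.n j i - s)
  a i := T.b i
  b j := T.a j
  pos i j := T.pos _ _
  p0 i j := by simpa using T.pn j i
  pn i j := by simpa using T.p0 j i
  adj i j s hs := by
    have := T.adj j i (T.n j i - (s+1)) (by omega)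
    rw [show T.n j i - (s+1) + 1 = T.n j i - s by omega] at this
    exact this.symm
  uniq i j s i' j' s' h1 h2 h := by
    rcases T.uniq _ _ _ _ _ _ (by omega) (by omega) h with ⟨rfl, rfl, h⟩ | ⟨h, h', rfl⟩ | ⟨h, h', rfl⟩ <;> omega
  cov v := by
    obtain ⟨i, j, s, hs, e⟩ := T.cov v
    exact ⟨j, i, T.n i j - s, by omega, by rw [show T.n i j - (T.n i j - s) = s by omega]; exact e⟩

lemma swap_I (i j : Fin 3) : T.swap.I i j = T.I j i := by
  ext v
  constructor
  · rintro ⟨s, h1, h2, e⟩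
    exact ⟨T.n j i - s, by simp only [swap] at h2; omega, by simp only [swap] at h2; omega, e⟩
  · rintro ⟨s, h1, h2, e⟩
    exact ⟨T.n j i - s, by omega, by simp only [swap]; omega, by
      simp only [swap]; rw [show T.n j i - (T.n j i - s) = s by omega]; exact e⟩

lemma I_cn {i j : Fin 3} (h : 1 < T.n i j) : Cn G (T.I i j) := by
  have : T.I i j = Itv (T.p i j) 1 (T.n i j - 1) := by
    ext v
    constructor
    · rintro ⟨s, h1, h2, e⟩; exact ⟨s, by omega, by omega, e⟩
    · rintro ⟨s, h1, h2, e⟩; exact ⟨s, by omega, by omega, e⟩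
  rw [this]
  exact Itv.cn (by omega) (fun s _ hs => T.adj i j s (by omega))

lemma I_nonempty {i j : Fin 3} (h : (T.I i j).Nonempty) : 1 < T.n i j := by
  obtain ⟨v, s, h1, h2, _⟩ := h; omega

lemma tch_aI {i j : Fin 3} (h : 1 < T.n i j) : Tch G {T.a i} (T.I i j) :=
  ⟨T.a i, rfl, T.p i j 1, ⟨1, by omega, h, rfl⟩, by have := T.adj i j 0 (by omega); rwa [T.p0] at this⟩

lemma tch_Ib {i j : Fin 3} (h : 1 < T.n i j) : Tch G (T.I i j) {T.b j} :=
  ⟨T.p i j (T.n i j - 1), ⟨_, by omega, by omega, rfl⟩, T.b j, rfl, by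
    have := T.adj i j (T.n i j - 1) (by omega)
    rwa [show T.n i j - 1 + 1 = T.n i j by omega, T.pn] at this⟩

lemma adj_ab {i j : Fin 3} (h : ¬ 1 < T.n i j) : G.Adj (T.a i) (T.b j) := by
  have h1 : T.n i j = 1 := by have := T.pos i j; omega
  have := T.adj i j 0 (by omega)
  rw [T.p0] at this
  have h2 := T.pn i j
  rw [h1] at h2
  rwa [h2] at this

lemma I_empty {i j : Fin 3} (h : ¬ 1 < T.n i j) : T.I i j = ∅ := by
  ext v; simp; rintro ⟨s, h1, h2, _⟩; omega

end TK

/-- the model with an uncovered set -/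
theorem exists_TK (hno : ¬ HasM G 7 K33E) (h : HasM G 6 K33E) : Nonempty (TK G) := by
  classical
  obtain ⟨R, hR, hE⟩ := h
  have htch : ∀ i j : Fin 3, ∃ x y, x ∈ R i.val ∧ y ∈ R (3 + j.val) ∧ G.Adj x y := by
    intro i j
    have : ∀ i j : Fin 3, adjB K33E i.val (3 + j.val) = true := by decide
    obtain ⟨x, hx, y, hy, hxy⟩ := adjB_tch hE (this i j)
    exact ⟨x, y, hx, hy, hxy⟩
  choose x y hx hy hxy using htch
  have hA := fun i : Fin 3 => tripod (hR.cn i.val (by omega)) (x i) (fun j => hx i j)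
  have hB := fun j : Fin 3 => tripod (hR.cn (3 + j.val) (by omega)) (fun i => y i j) (fun i => hy i j)
  choose a q m q0 qm qadj qS quniq using hA
  choose b r k r0 rk radj rS runiq using hB
  let n : Fin 3 → Fin 3 → ℕ := fun i j => m i j + k j i + 1
  let p : Fin 3 → Fin 3 → ℕ → V := fun i j s => if s ≤ m i j then q i j s else r j i (n i j - s)
  have pA : ∀ i j s, s ≤ m i j → p i j s = q i j s := fun i j s hs => if_pos hs
  have pB : ∀ i j s, ¬ s ≤ m i j → p i j s = r j i (n i j - s) := fun i j s hs => if_neg hs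
  have p0 : ∀ i j, p i j 0 = a i := fun i j => by rw [pA _ _ _ (Nat.zero_le _), q0]
  have pn : ∀ i j, p i j (n i j) = b j := fun i j => by
    rw [pB _ _ _ (by simp only [n]; omega), Nat.sub_self, r0]
  have padj : ∀ i j s, s < n i j → G.Adj (p i j s) (p i j (s+1)) := by
    intro i j s hs
    have hs' : s < m i j + k j i + 1 := hs
    by_cases h1 : s + 1 ≤ m i j
    · rw [pA _ _ _ h1, pA _ _ _ (by omega)]; exact qadj i j s (by omega)
    · by_cases h2 : s ≤ m i j
      · have e : s = m i j := by omega
        rw [pA _ _ _ h2, pB _ _ _ h1, e, qm]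
        have : n i j - (m i j + 1) = k j i := by simp only [n]; omega
        rw [this, rk]; exact hxy i j
      · rw [pB _ _ _ h1, pB _ _ _ h2]
        have e : n i j - s = n i j - (s+1) + 1 := by simp only [n]; omega
        rw [e]
        exact (radj j i _ (by simp only [n]; omega)).symm
  have puniq : ∀ i j s i' j' s', s ≤ n i j → s' ≤ n i' j' → p i j s = p i' j' s' →
    (i = i' ∧ j = j' ∧ s = s') ∨ (s = 0 ∧ s' = 0 ∧ i = i') ∨ (s = n i j ∧ s' = n i' j' ∧ j = j') := by
    intro i j s i' j' s' hs hs' e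
    have hs1 : s ≤ m i j + k j i + 1 := hs
    have hs2 : s' ≤ m i' j' + k j' i' + 1 := hs'
    by_cases h1 : s ≤ m i j <;> by_cases h2 : s' ≤ m i' j'
    · rw [pA _ _ _ h1, pA _ _ _ h2] at e
      have hi : i = i' := Fin.ext (hR.disj _ (by omega) _ (by omega) _ (qS i j s h1) (e ▸ qS i' j' s' h2))
      subst hi
      have := quniq i j s j' s' h1 h2 e
      omega
    · rw [pA _ _ _ h1, pB _ _ _ h2] at e
      have := hR.disj _ (by omega) _ (by omega) _ (qS i j s h1) (e ▸ rS j' i' _ (by simp only [n]; omega))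
      omega
    · rw [pB _ _ _ h1, pA _ _ _ h2] at e
      have := hR.disj _ (by omega) _ (by omega) _ (qS i' j' s' h2) (e ▸ rS j i _ (by simp only [n]; omega))
      omega
    · rw [pB _ _ _ h1, pB _ _ _ h2] at e
      have hj : j = j' := by
        have := hR.disj _ (by omega) _ (by omega) _ (rS j i (n i j - s) (by simp only [n]; omega)) (e ▸ rS j' i' _ (by simp only [n]; omega))
        omega
      subst hj
      have := runiq j i (n i j - s) i' (n i' j - s') (by simp only [n]; omega) (by simp only [n]; omega) e
      rcases this with ⟨rfl, h⟩ | ⟨h, h'⟩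
      · left; refine ⟨rfl, rfl, ?_⟩; simp only [n] at h; omega
      · right; right; refine ⟨?_, ?_, rfl⟩ <;> omega
  refine ⟨⟨n, p, a, b, fun i j => by simp only [n]; omega, p0, pn, padj, puniq, ?_⟩⟩
  intro v
  by_contra hv
  push Not at hv
  apply hno
  -- branch sets
  let A : Fin 3 → Set V := fun i => {w | ∃ j s, s ≤ m i j ∧ q i j s = w}
  let B : Fin 3 → Set V := fun j => {w | ∃ i s, s ≤ k j i ∧ r j i s = w}
  have hAR : ∀ i w, w ∈ A i → w ∈ R i.val := by rintro i w ⟨j, s, hs, rfl⟩; exact qS i j s hs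
  have hBR : ∀ j w, w ∈ B j → w ∈ R (3 + j.val) := by rintro j w ⟨i, s, hs, rfl⟩; exact rS j i s hs
  have leg : ∀ (f : ℕ → V) (S : Set V) (M : ℕ), (∀ s < M, G.Adj (f s) (f (s+1))) → (∀ s ≤ M, f s ∈ S) → ∀ s ≤ M, Rch G S (f 0) (f s) := by
    intro f S M h1 h2 s
    induction s with
    | zero => intro _; exact .refl
    | succ s ih =>
      intro hs
      refine (ih (by omega)).tail ?_
      have := h1 s (by omega)
      have := h2 (s+1) hs
      have := h2 s (by omega)
      grind
  have hAc : ∀ i, Cn G (A i) := by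
    intro i
    refine cn_of_root (r := a i) ⟨0, 0, Nat.zero_le _, q0 i 0⟩ ?_
    rintro w ⟨j, s, hs, rfl⟩
    rw [← q0 i j]
    exact leg (q i j) (A i) (m i j) (qadj i j) (fun s hs => ⟨j, s, hs, rfl⟩) s hs
  have hBc : ∀ i, Cn G (B i) := by
    intro i
    refine cn_of_root (r := b i) ⟨0, 0, Nat.zero_le _, r0 i 0⟩ ?_
    rintro w ⟨j, s, hs, rfl⟩
    rw [← r0 i j]
    exact leg (r i j) (B i) (k i j) (radj i j) (fun s hs => ⟨j, s, hs, rfl⟩) s hs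
  have hvA : ∀ i, v ∉ A i := by
    rintro i ⟨j, s, hs, e⟩
    exact hv i j s (by simp only [n]; omega) (by rw [pA _ _ _ hs]; exact e)
  have hvB : ∀ i, v ∉ B i := by
    rintro j ⟨i, s, hs, e⟩
    exact hv i j (n i j - s) (by omega) (by
      rw [pB _ _ _ (by simp only [n]; omega), show n i j - (n i j - s) = s by simp only [n]; omega]; exact e)
  let F : ℕ → Set V := fun l => if h : l < 3 then A ⟨l, h⟩ else if h : l < 6 then B ⟨l - 3, by omega⟩ else {v}
  have FA : ∀ i : Fin 3, F i.val = A i := fun i => by simp [F]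
  have FB : ∀ i : Fin 3, F (3 + i.val) = B i := fun i => by
    have := i.2
    simp [F]
    omega
  have F6 : F 6 = {v} := rfl
  have cases7 : ∀ l < 7, (∃ i : Fin 3, l = i.val) ∨ (∃ i : Fin 3, l = 3 + i.val) ∨ l = 6 := by
    intro l hl
    by_cases h3 : l < 3
    · exact Or.inl ⟨⟨l, h3⟩, rfl⟩
    by_cases h6 : l < 6
    · exact Or.inr (Or.inl ⟨⟨l - 3, by omega⟩, by simp; omega⟩)
    · omega
  refine ⟨F, ⟨?_, ?_⟩, ?_⟩
  · intro l hl
    rcases cases7 l hl with ⟨i, rfl⟩ | ⟨i, rfl⟩ | rfl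
    · rw [FA]; exact hAc i
    · rw [FB]; exact hBc i
    · exact Cn.singleton v
  · have sub : ∀ l < 6, ∀ w, w ∈ F l → w ∈ R l ∧ w ≠ v := by
      intro l hl w hw
      rcases cases7 l (by omega) with ⟨i, rfl⟩ | ⟨i, rfl⟩ | rfl
      · rw [FA] at hw; exact ⟨hAR i w hw, by rintro rfl; exact hvA i hw⟩
      · rw [FB] at hw; exact ⟨hBR i w hw, by rintro rfl; exact hvB i hw⟩
      · omega
    intro l hl l' hl' w hw hw'
    by_cases e : l < 6 <;> by_cases e' : l' < 6
    · exact hR.disj _ e _ e' w (sub l e w hw).1 (sub l' e' w hw').1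
    · have : l' = 6 := by omega
      subst this
      exact ((sub l e w hw).2 hw').elim
    · have : l = 6 := by omega
      subst this
      exact ((sub l' e' w hw').2 hw).elim
    · omega
  · intro pr hpr
    have : ∀ pr ∈ K33E, ∃ i j : Fin 3, pr = (i.val, 3 + j.val) := by decide
    obtain ⟨i, j, rfl⟩ := this pr hpr
    rw [FA, FB]
    exact ⟨x i j, ⟨j, m i j, le_rfl, qm i j⟩, y i j, ⟨i, k j i, le_rfl, rk j i⟩, hxy i j⟩

end TKs
end AP

set_option linter.all false
namespace AP
variable {V : Type*} {G : SimpleGraph V}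

/-- chords of a subdivided `K₃,₃` -/
inductive Ch
  | A (i j k : Fin 3)
  | B (i j l : Fin 3)
  | aa (i k : Fin 3)
  | bb (j l : Fin 3)
  | ii (i j i' j' : Fin 3)

def Ch.seg : Ch → List (Fin 3 × Fin 3)
  | .A i j _ => [(i,j)]
  | .B i j _ => [(i,j)]
  | .aa _ _ => []
  | .bb _ _ => []
  | .ii i j i' j' => [(i,j),(i',j')]

def Ch.edge (L : List (Fin 3 × Fin 3)) : Ch → ℕ × ℕ
  | .A i j k => (6 + L.idxOf (i,j), k)
  | .B i j l => (6 + L.idxOf (i,j), 3 + l)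
  | .aa i k => (i, k)
  | .bb j l => (3 + j, 3 + l)
  | .ii i j i' j' => (6 + L.idxOf (i,j), 6 + L.idxOf (i',j'))

def allP : List (Fin 3 × Fin 3) := [(0,0),(0,1),(0,2),(1,0),(1,1),(1,2),(2,0),(2,1),(2,2)]

lemma mem_allP : ∀ i j : Fin 3, (i,j) ∈ allP := by decide

def baseE (L : List (Fin 3 × Fin 3)) : List (ℕ × ℕ) :=
  allP.flatMap fun c => if c ∈ L then [(c.1.val, 6 + L.idxOf c), (6 + L.idxOf c, 3 + c.2.val)]
    else [(c.1.val, 3 + c.2.val)]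

def segs (cs : List Ch) : List (Fin 3 × Fin 3) := (cs.flatMap Ch.seg).dedup

def V8E : List (ℕ × ℕ) := [(0,1),(1,2),(2,3),(3,4),(4,5),(5,6),(6,7),(7,0),(0,4),(1,5),(2,6),(3,7)]
def X7E : List (ℕ × ℕ) := [(0,1),(1,2),(2,3),(3,4),(4,5),(5,6),(6,0),(0,3),(3,6),(6,2),(2,5),(5,1),(1,4)]

namespace TK
variable (T : TK G)

def holds : Ch → Prop
  | .A i j k => Tch G (T.I i j) {T.a k}
  | .B i j l => Tch G (T.I i j) {T.b l}
  | .aa i k => G.Adj (T.a i) (T.a k)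
  | .bb j l => G.Adj (T.b j) (T.b l)
  | .ii i j i' j' => Tch G (T.I i j) (T.I i' j')

def R (L : List (Fin 3 × Fin 3)) (m : ℕ) : Set V :=
  {v | (∃ i : Fin 3, m = i ∧ (v = T.a i ∨ ∃ j, (i,j) ∉ L ∧ v ∈ T.I i j)) ∨
    (∃ j : Fin 3, m = 3 + j ∧ v = T.b j) ∨ (∃ c ∈ L, m = 6 + L.idxOf c ∧ v ∈ T.I c.1 c.2)}

lemma a_mem_R (L) (i : Fin 3) : T.a i ∈ T.R L i := Or.inl ⟨i, rfl, Or.inl rfl⟩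
lemma b_mem_R (L) (j : Fin 3) : T.b j ∈ T.R L (3 + j) := Or.inr (Or.inl ⟨j, rfl, rfl⟩)
lemma I_sub_R {L : List (Fin 3 × Fin 3)} {i j : Fin 3} (h : (i,j) ∈ L) :
    T.I i j ⊆ T.R L (6 + L.idxOf (i,j)) := fun v hv => Or.inr (Or.inr ⟨(i,j), h, rfl, hv⟩)

lemma R_mod (L : List (Fin 3 × Fin 3)) (hnd : L.Nodup) (hne : ∀ c ∈ L, 1 < T.n c.1 c.2) :
    Mod G (6 + L.length) (T.R L) := by
  constructor
  · intro m hm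
    rcases (show m < 3 ∨ (3 ≤ m ∧ m < 6) ∨ 6 ≤ m by omega) with h | h | h
    · refine cn_of_root (r := T.a ⟨m, h⟩) (T.a_mem_R L ⟨m, h⟩) ?_
      rintro x (⟨i, rfl, rfl | ⟨j, hj, hx⟩⟩ | ⟨j, rfl, _⟩ | ⟨c, _, rfl, _⟩)
      · exact ((Cn.singleton (T.a i)).rch rfl rfl).mono (by
          rintro v rfl; exact T.a_mem_R L i)
      · have h1 : 1 < T.n i j := T.I_nonempty ⟨x, hx⟩
        refine (((Cn.singleton (T.a i)).union_tch (T.I_cn h1) (T.tch_aI h1)).rch (Or.inl rfl)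
          (Or.inr hx)).mono ?_
        rintro v (rfl | hv)
        · exact T.a_mem_R L i
        · exact Or.inl ⟨i, rfl, Or.inr ⟨j, hj, hv⟩⟩
      · omega
      · omega
    · have : T.R L m = {T.b ⟨m - 3, by omega⟩} := by
        ext v
        constructor
        · rintro (⟨i, rfl, _⟩ | ⟨j, rfl, rfl⟩ | ⟨c, _, rfl, _⟩)
          · omega
          · simp
          · omega
        · rintro rfl
          exact Or.inr (Or.inl ⟨⟨m - 3, by omega⟩, by simp; omega, rfl⟩)
      rw [this]; exact Cn.singleton _
    · have hl : m - 6 < L.length := by omega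
      have hmem : L[m-6] ∈ L := List.getElem_mem hl
      have hid : L.idxOf (L[m-6]) = m - 6 := hnd.idxOf_getElem _ _
      have : T.R L m = T.I (L[m-6]).1 (L[m-6]).2 := by
        ext v
        constructor
        · rintro (⟨i, rfl, _⟩ | ⟨j, rfl, rfl⟩ | ⟨c, hc, e, hv⟩)
          · omega
          · omega
          · have : L[m-6] = c := by
              have h2 : L.idxOf c = m - 6 := by omega
              rw [← List.idxOf_inj hmem, hid, h2]
            rwa [this]
        · intro hv
          exact Or.inr (Or.inr ⟨_, hmem, by omega, hv⟩)
      rw [this]; exact T.I_cn (hne _ hmem)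
  · rintro m hm m' hm' v (⟨i, rfl, h⟩ | ⟨j, rfl, rfl⟩ | ⟨c, hc, rfl, h⟩)
      (⟨i', rfl, h'⟩ | ⟨j', rfl, h'⟩ | ⟨c', hc', rfl, h'⟩)
    · rcases h with rfl | ⟨j, hj, h⟩ <;> rcases h' with h' | ⟨j', hj', h'⟩
      · rw [T.a_inj h']
      · exact (T.a_notI h').elim
      · subst h'; exact (T.a_notI h).elim
      · rw [(T.I_disj h h').1]
    · subst h'
      rcases h with h | ⟨j, hj, h⟩
      · exact (T.ab_ne h.symm).elim
      · exact (T.b_notI h).elim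
    · rcases h with rfl | ⟨j, hj, h⟩
      · exact (T.a_notI h').elim
      · obtain ⟨h1, h2⟩ := T.I_disj h h'
        subst h1; subst h2; exact (hj hc').elim
    · rcases h' with h' | ⟨j, hj, h'⟩
      · exact (T.ab_ne h'.symm).elim
      · exact (T.b_notI h').elim
    · rw [T.b_inj h']
    · exact (T.b_notI h').elim
    · rcases h' with rfl | ⟨j, hj, h'⟩
      · exact (T.a_notI h).elim
      · obtain ⟨h1, h2⟩ := T.I_disj h h'
        subst h1; subst h2; exact (hj hc).elim
    · subst h'; exact (T.b_notI h).elim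
    · obtain ⟨h1, h2⟩ := T.I_disj h h'
      rw [Prod.ext h1 h2]

lemma R_base (L : List (Fin 3 × Fin 3)) (hne : ∀ c ∈ L, 1 < T.n c.1 c.2) :
    ∀ p ∈ baseE L, Tch G (T.R L p.1) (T.R L p.2) := by
  intro p hp
  simp only [baseE, List.mem_flatMap] at hp
  obtain ⟨c, _, hp⟩ := hp
  split_ifs at hp with h
  · simp only [List.mem_cons, List.not_mem_nil, or_false] at hp
    have h1 := hne c h
    rcases hp with rfl | rfl
    · exact (T.tch_aI h1).mono (by rintro v rfl; exact T.a_mem_R L _) (T.I_sub_R h)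
    · exact (T.tch_Ib h1).mono (T.I_sub_R h) (by rintro v rfl; exact T.b_mem_R L _)
  · simp only [List.mem_cons, List.not_mem_nil, or_false] at hp
    subst hp
    by_cases h1 : 1 < T.n c.1 c.2
    · exact (T.tch_Ib h1).mono (fun v hv => Or.inl ⟨c.1, rfl, Or.inr ⟨c.2, h, hv⟩⟩)
        (by rintro v rfl; exact T.b_mem_R L _)
    · exact ⟨_, T.a_mem_R L _, _, T.b_mem_R L _, T.adj_ab h1⟩

lemma holds_seg {c : Ch} (h : T.holds c) : ∀ s ∈ c.seg, 1 < T.n s.1 s.2 := by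
  cases c <;> simp only [Ch.seg, List.mem_cons, List.not_mem_nil, or_false, false_imp_iff, forall_eq,
    forall_eq_or_imp, implies_true]
  · obtain ⟨x, hx, _⟩ := h; exact T.I_nonempty ⟨x, hx⟩
  · obtain ⟨x, hx, _⟩ := h; exact T.I_nonempty ⟨x, hx⟩
  · obtain ⟨x, hx, y, hy, _⟩ := h; exact ⟨T.I_nonempty ⟨x, hx⟩, T.I_nonempty ⟨y, hy⟩⟩

theorem hasM (cs : List Ch) (h : ∀ c ∈ cs, T.holds c) :
    HasM G (6 + (segs cs).length) (baseE (segs cs) ++ cs.map (Ch.edge (segs cs))) := by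
  have hne : ∀ c ∈ segs cs, 1 < T.n c.1 c.2 := by
    intro c hc
    simp only [segs, List.mem_dedup, List.mem_flatMap] at hc
    obtain ⟨d, hd, hc⟩ := hc
    exact T.holds_seg (h d hd) c hc
  refine ⟨T.R (segs cs), T.R_mod _ (List.nodup_dedup _) hne, ?_⟩
  intro p hp
  rcases List.mem_append.1 hp with hp | hp
  · exact T.R_base _ hne p hp
  · obtain ⟨c, hc, rfl⟩ := List.mem_map.1 hp
    have h1 := h c hc
    have h2 : ∀ s ∈ c.seg, s ∈ segs cs := fun s hs => by
      simp only [segs, List.mem_dedup, List.mem_flatMap]; exact ⟨c, hc, hs⟩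
    cases c with
    | A i j k => exact Tch.mono h1 (T.I_sub_R (h2 _ (by simp [Ch.seg]))) (by rintro v rfl; exact T.a_mem_R _ _)
    | B i j k => exact Tch.mono h1 (T.I_sub_R (h2 _ (by simp [Ch.seg]))) (by rintro v rfl; exact T.b_mem_R _ _)
    | aa i k => exact ⟨_, T.a_mem_R _ _, _, T.a_mem_R _ _, h1⟩
    | bb i k => exact ⟨_, T.b_mem_R _ _, _, T.b_mem_R _ _, h1⟩
    | ii i j i' j' => exact Tch.mono h1 (T.I_sub_R (h2 _ (by simp [Ch.seg]))) (T.I_sub_R (h2 _ (by simp [Ch.seg])))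

/-- a chord bypassing interior vertices of a segment -/
theorem bypass (i j : Fin 3) (s t : ℕ) (hst : s + 1 < t) (ht : t ≤ T.n i j)
    (h : G.Adj (T.p i j s) (T.p i j t)) : HasM G 7 K33E := by
  -- branch sets: `a i` with `p[0..s]`, `b j` with `p[t..n]`, the middle part is left over
  set L : List (Fin 3 × Fin 3) := [(i,j)] with hL
  have hn : 1 < T.n i j := by omega
  have hM := T.R_mod L (by simp [L]) (by simp [L, hn])
  have hid : L.idxOf (i,j) = 0 := by simp [L]
  have h6 : ∀ v, v ∈ T.I i j → v ∈ T.R L 6 := fun v hv => by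
    have := T.I_sub_R (L := L) (i := i) (j := j) (by simp [L]) hv
    rwa [hid] at this
  have hI : ∀ u, 0 < u → u < T.n i j → T.p i j u ∈ T.R L 6 := fun u h1 h2 => h6 _ ⟨u, h1, h2, rfl⟩
  have hlen : 6 + L.length = 7 := by simp [L]
  rw [hlen] at hM
  have hinj : ∀ u u', u ≤ T.n i j → u' ≤ T.n i j → T.p i j u = T.p i j u' → u = u' := by
    intro u u' h1 h2 e
    rcases T.uniq _ _ _ _ _ _ h1 h2 e with h | h | h <;> omega
  set X : ℕ → Set V := fun m => (if m = i then Itv (T.p i j) 0 s else ∅) ∪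
    (if m = 3 + j then Itv (T.p i j) t (T.n i j) else ∅) with hX
  let R' : ℕ → Set V := fun m => if m = 6 then Itv (T.p i j) (s+1) (t-1) else T.R L m ∪ X m
  have hsub : ∀ m, T.R L m ⊆ T.R L m ∪ X m := fun m => Set.subset_union_left
  have e6 : R' 6 = Itv (T.p i j) (s+1) (t-1) := by simp [R']
  have e0 : ∀ m, m < 6 → R' m = T.R L m ∪ X m := fun m hm => by simp [R']; omega
  have cnI : ∀ x y, x ≤ y → y ≤ T.n i j → Cn G (Itv (T.p i j) x y) := fun x y h1 h2 =>
    Itv.cn h1 (fun u _ hu => T.adj i j u (by omega))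
  -- membership in `X`
  have hXm : ∀ m, m < 6 → ∀ v, v ∈ X m → ∃ u, u ≤ T.n i j ∧ T.p i j u = v ∧
      ((u ≤ s ∧ m = i) ∨ (t ≤ u ∧ m = 3 + j)) := by
    rintro m hm v (hv | hv)
    · split_ifs at hv with h1
      · obtain ⟨u, h2, h3, h4⟩ := hv
        exact ⟨u, by omega, h4, Or.inl ⟨h3, h1⟩⟩
      · exact hv.elim
    · split_ifs at hv with h1
      · obtain ⟨u, h2, h3, h4⟩ := hv
        exact ⟨u, by omega, h4, Or.inr ⟨h2, h1⟩⟩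
      · exact hv.elim
  have hXR : ∀ m, m < 6 → ∀ v, v ∈ X m → v ∈ T.R L m ∨ v ∈ T.R L 6 := by
    intro m hm v hv
    obtain ⟨u, h1, rfl, h2⟩ := hXm m hm v hv
    by_cases h0 : u = 0
    · subst h0
      rcases h2 with ⟨_, rfl⟩ | ⟨h2, _⟩
      · left; rw [T.p0]; exact T.a_mem_R L i
      · omega
    · by_cases hn' : u = T.n i j
      · subst hn'
        rcases h2 with ⟨h2, _⟩ | ⟨_, rfl⟩
        · omega
        · left; rw [T.pn]; exact T.b_mem_R L j
      · right; exact hI u (by omega) (by omega)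
  have hmid : ∀ v, v ∈ Itv (T.p i j) (s+1) (t-1) → v ∈ T.R L 6 := by
    rintro v ⟨u, h1, h2, rfl⟩; exact hI u (by omega) (by omega)
  refine ⟨R', ⟨?_, ?_⟩, ?_⟩
  · intro m hm
    by_cases h6' : m = 6
    · subst h6'; rw [e6]; exact cnI _ _ (by omega) (by omega)
    · rw [e0 m (by omega)]
      have c0 := hM.cn m (by omega)
      simp only [hX]
      by_cases hi : m = i
      · rw [if_pos hi, if_neg (by omega), Set.union_empty]
        refine c0.union (cnI _ _ (by omega) (by omega)) ⟨T.a i, hi ▸ T.a_mem_R L i, 0, by omega, by omega, T.p0 i j⟩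
      · rw [if_neg hi, Set.empty_union]
        split_ifs with hj
        · refine c0.union (cnI _ _ (by omega) (by omega)) ⟨T.b j, hj ▸ T.b_mem_R L j, T.n i j, by omega, by omega, T.pn i j⟩
        · rwa [Set.union_empty]
  · have key : ∀ m < 6, ∀ v, v ∈ R' m → v ∈ R' 6 → False := by
      intro m hm v hv hv6
      rw [e0 m hm] at hv
      rw [e6] at hv6
      rcases hv with hv | hv
      · have := hM.disj _ (by omega) 6 (by omega) v hv (hmid v hv6); omega
      · obtain ⟨u, h1, h2, h3⟩ := hXm m hm v hv
        obtain ⟨u', h4, h5, h6⟩ := hv6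
        have := hinj u u' h1 (by omega) (by rw [h2, h6]); omega
    intro m hm m' hm' v hv hv'
    by_cases h6' : m = 6 <;> by_cases h6'' : m' = 6
    · omega
    · subst h6'; exact (key m' (by omega) v hv' hv).elim
    · subst h6''; exact (key m (by omega) v hv hv').elim
    · rw [e0 m (by omega)] at hv
      rw [e0 m' (by omega)] at hv'
      rcases hv with hv | hv <;> rcases hv' with hv' | hv'
      · exact hM.disj _ (by omega) _ (by omega) v hv hv'
      · rcases hXR _ (by omega) v hv' with h1 | h1
        · exact hM.disj _ (by omega) _ (by omega) v hv h1
        · have := hM.disj _ (by omega) _ (by omega) v hv h1; omega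
      · rcases hXR _ (by omega) v hv with h1 | h1
        · exact hM.disj _ (by omega) _ (by omega) v h1 hv'
        · have := hM.disj _ (by omega) _ (by omega) v h1 hv'; omega
      · obtain ⟨u, h1, h2, h3⟩ := hXm m (by omega) v hv
        obtain ⟨u', h4, h5, h6⟩ := hXm m' (by omega) v hv'
        have := hinj u u' h1 h4 (by rw [h2, h5]); omega
  · intro q hq
    have hb : ∀ i' j' : Fin 3, Tch G (R' i') (R' (3 + j')) := by
      intro i' j'
      rw [e0 _ (by omega), e0 _ (by omega)]
      by_cases hc : (i',j') = (i,j)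
      · obtain ⟨rfl, rfl⟩ := Prod.mk.inj hc
        refine ⟨T.p i' j' s, Or.inr ?_, T.p i' j' t, Or.inr ?_, h⟩
        · simp only [hX]; left; rw [if_pos trivial]; exact ⟨s, by omega, by omega, rfl⟩
        · simp only [hX]; right; rw [if_pos trivial]; exact ⟨t, by omega, by omega, rfl⟩
      · have := T.R_base L (by simp [L, hn]) (i'.val, 3 + j'.val) (by
          simp only [baseE, List.mem_flatMap]
          refine ⟨(i',j'), ?_, ?_⟩
          · exact mem_allP i' j'
          · rw [if_neg (by simpa [L] using hc)]; simp)
        exact this.mono (hsub _) (hsub _)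
    have h3 : ∀ q ∈ K33E, ∃ i' j' : Fin 3, q = (i'.val, 3 + j'.val) := by decide
    obtain ⟨i', j', rfl⟩ := h3 q hq
    exact hb i' j'

end TK
end AP

set_option linter.all false
namespace AP
variable {V : Type*} {G : SimpleGraph V}

structure Fr (G : SimpleGraph V) : Prop where
  k33i : ¬ HasM G 7 K33E
  k33h : ¬ HasM G 8 K33hE
  k5h : ¬ HasM G 7 K5hE
  ex2 : ¬ HasM G 6 EX2E
  v8 : ¬ HasM G 8 V8E
  x7 : ¬ HasM G 7 X7E

lemma perm1 (j : Fin 3) : ∃ τ : Equiv.Perm (Fin 3), τ 0 = j := by revert j; decide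
lemma perm2 {i k : Fin 3} (h : i ≠ k) : ∃ τ : Equiv.Perm (Fin 3), τ 0 = i ∧ τ 1 = k := by
  revert i k; decide
lemma perm_cases (σ : Equiv.Perm (Fin 3)) (l : Fin 3) : l = σ 0 ∨ l = σ 1 ∨ l = σ 2 := by
  obtain ⟨x, rfl⟩ := σ.surjective l
  fin_cases x <;> simp

namespace TK
lemma r2_0 (hF : Fr G) (T : TK G) (h0 : T.holds (.A 0 0 1)) (h1 : T.holds (.A 0 0 2)) : False :=
  hF.k33i ((T.hasM [.A 0 0 1, .A 0 0 2] (by simp only [List.forall_mem_cons]; simp [h0, h1])).chk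
    [[0], [1], [2], [4], [5], [6], [3]] (by decide +kernel))
lemma r1_0 (hF : Fr G) (T : TK G) (h0 : T.holds (.A 0 0 1)) (h1 : T.holds (.A 1 0 0)) : False :=
  hF.k33i ((T.hasM [.A 0 0 1, .A 1 0 0] (by simp only [List.forall_mem_cons]; simp [h0, h1])).chk
    [[0], [1], [2, 3], [4], [5], [6], [7]] (by decide +kernel))
lemma r1_1 (hF : Fr G) (T : TK G) (h0 : T.holds (.A 0 0 1)) (h1 : T.holds (.A 1 0 2)) : False :=
  hF.k33i ((T.hasM [.A 0 0 1, .A 1 0 2] (by simp only [List.forall_mem_cons]; simp [h0, h1])).chk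
    [[0], [1], [2, 3], [4], [5], [6], [7]] (by decide +kernel))
lemma rr_0 (hF : Fr G) (T : TK G) (h0 : T.holds (.A 0 0 1)) (h1 : T.holds (.B 1 0 1)) : False :=
  hF.k33i ((T.hasM [.A 0 0 1, .B 1 0 1] (by simp only [List.forall_mem_cons]; simp [h0, h1])).chk
    [[0], [1], [2, 3], [4], [5], [6], [7]] (by decide +kernel))
lemma rr_1 (hF : Fr G) (T : TK G) (h0 : T.holds (.A 0 0 1)) (h1 : T.holds (.B 1 1 0)) : False :=
  hF.v8 ((T.hasM [.A 0 0 1, .B 1 1 0] (by simp only [List.forall_mem_cons]; simp [h0, h1])).chk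
    [[0], [4], [7], [1], [5], [2], [3], [6]] (by decide +kernel))
lemma rr_2 (hF : Fr G) (T : TK G) (h0 : T.holds (.A 0 0 1)) (h1 : T.holds (.B 1 1 2)) : False :=
  hF.k33h ((T.hasM [.A 0 0 1, .B 1 1 2] (by simp only [List.forall_mem_cons]; simp [h0, h1])).chk
    [[1], [4], [5], [0], [2], [7], [6], [3]] (by decide +kernel))
lemma rr_3 (hF : Fr G) (T : TK G) (h0 : T.holds (.A 0 0 1)) (h1 : T.holds (.B 0 1 0)) : False :=
  hF.k33i ((T.hasM [.A 0 0 1, .B 0 1 0] (by simp only [List.forall_mem_cons]; simp [h0, h1])).chk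
    [[0, 5], [3], [4], [1], [2], [7], [6]] (by decide +kernel))
lemma rr_4 (hF : Fr G) (T : TK G) (h0 : T.holds (.A 0 0 1)) (h1 : T.holds (.B 2 1 0)) : False :=
  hF.k33h ((T.hasM [.A 0 0 1, .B 2 1 0] (by simp only [List.forall_mem_cons]; simp [h0, h1])).chk
    [[2], [0], [1], [4], [6], [5], [7], [3]] (by decide +kernel))
lemma s1_0 (hF : Fr G) (T : TK G) (h0 : T.holds (.A 0 0 1)) (h1 : T.holds (.aa 0 2)) (h2 : T.holds (.bb 0 1)) : False :=
  hF.x7 ((T.hasM [.A 0 0 1, .aa 0 2, .bb 0 1] (by simp only [List.forall_mem_cons]; simp [h0, h1, h2])).chk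
    [[6], [0], [4], [1], [5], [2], [3]] (by decide +kernel))
lemma s1_1 (hF : Fr G) (T : TK G) (h0 : T.holds (.A 0 0 1)) (h1 : T.holds (.aa 0 2)) (h2 : T.holds (.bb 1 2)) : False :=
  hF.k5h ((T.hasM [.A 0 0 1, .aa 0 2, .bb 1 2] (by simp only [List.forall_mem_cons]; simp [h0, h1, h2])).chk
    [[1], [0], [2], [4], [5], [6], [3]] (by decide +kernel))
lemma s1_2 (hF : Fr G) (T : TK G) (h0 : T.holds (.A 0 0 1)) (h1 : T.holds (.aa 0 2)) (h2 : T.holds (.B 0 0 1)) : False :=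
  hF.x7 ((T.hasM [.A 0 0 1, .aa 0 2, .B 0 0 1] (by simp only [List.forall_mem_cons]; simp [h0, h1, h2])).chk
    [[5], [1], [4], [2], [3], [6], [0]] (by decide +kernel))
lemma s1_3 (hF : Fr G) (T : TK G) (h0 : T.holds (.A 0 0 1)) (h1 : T.holds (.aa 0 2)) (h2 : T.holds (.B 0 1 2)) : False :=
  hF.k33i ((T.hasM [.A 0 0 1, .aa 0 2, .B 0 1 2] (by simp only [List.forall_mem_cons]; simp [h0, h1, h2])).chk
    [[0, 6], [4], [5], [1], [2], [7], [3]] (by decide +kernel))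
lemma s1_4 (hF : Fr G) (T : TK G) (h0 : T.holds (.A 0 0 1)) (h1 : T.holds (.aa 0 2)) (h2 : T.holds (.B 2 1 2)) : False :=
  hF.k33i ((T.hasM [.A 0 0 1, .aa 0 2, .B 2 1 2] (by simp only [List.forall_mem_cons]; simp [h0, h1, h2])).chk
    [[0], [1, 3], [7], [2], [4], [5], [6]] (by decide +kernel))
lemma s1_5 (hF : Fr G) (T : TK G) (h0 : T.holds (.A 0 0 1)) (h1 : T.holds (.aa 0 2)) (h2 : T.holds (.B 2 0 1)) : False :=
  hF.x7 ((T.hasM [.A 0 0 1, .aa 0 2, .B 2 0 1] (by simp only [List.forall_mem_cons]; simp [h0, h1, h2])).chk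
    [[6], [0], [4], [1], [5], [2], [3, 7]] (by decide +kernel))
lemma s2_0 (hF : Fr G) (T : TK G) (h0 : T.holds (.A 0 0 1)) (h1 : T.holds (.A 0 1 2)) (h2 : T.holds (.bb 0 1)) : False :=
  hF.v8 ((T.hasM [.A 0 0 1, .A 0 1 2, .bb 0 1] (by simp only [List.forall_mem_cons]; simp [h0, h1, h2])).chk
    [[0], [6], [3], [2], [5], [1], [4], [7]] (by decide +kernel))
lemma s2_1 (hF : Fr G) (T : TK G) (h0 : T.holds (.A 0 0 1)) (h1 : T.holds (.A 0 1 2)) (h2 : T.holds (.bb 0 2)) : False :=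
  hF.k33h ((T.hasM [.A 0 0 1, .A 0 1 2, .bb 0 2] (by simp only [List.forall_mem_cons]; simp [h0, h1, h2])).chk
    [[2], [5], [6], [0], [1], [3], [7], [4]] (by decide +kernel))
lemma s2_2 (hF : Fr G) (T : TK G) (h0 : T.holds (.A 0 0 1)) (h1 : T.holds (.A 0 1 2)) (h2 : T.holds (.bb 1 2)) : False :=
  hF.k33h ((T.hasM [.A 0 0 1, .A 0 1 2, .bb 1 2] (by simp only [List.forall_mem_cons]; simp [h0, h1, h2])).chk
    [[1], [5], [7], [0], [2], [4], [6], [3]] (by decide +kernel))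
lemma s2_3 (hF : Fr G) (T : TK G) (h0 : T.holds (.A 0 0 1)) (h1 : T.holds (.A 0 1 2)) (h2 : T.holds (.B 0 0 2)) : False :=
  hF.x7 ((T.hasM [.A 0 0 1, .A 0 1 2, .B 0 0 2] (by simp only [List.forall_mem_cons]; simp [h0, h1, h2])).chk
    [[4], [1], [5], [2], [3], [7], [0, 6]] (by decide +kernel))
lemma s2_4 (hF : Fr G) (T : TK G) (h0 : T.holds (.A 0 0 1)) (h1 : T.holds (.A 0 1 2)) (h2 : T.holds (.B 0 1 2)) : False :=
  hF.x7 ((T.hasM [.A 0 0 1, .A 0 1 2, .B 0 1 2] (by simp only [List.forall_mem_cons]; simp [h0, h1, h2])).chk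
    [[4], [1], [5], [2], [3], [0, 6], [7]] (by decide +kernel))
lemma s2_5 (hF : Fr G) (T : TK G) (h0 : T.holds (.A 0 0 1)) (h1 : T.holds (.A 1 1 0)) (h2 : T.holds (.bb 0 1)) : False :=
  hF.k33h ((T.hasM [.A 0 0 1, .A 1 1 0, .bb 0 1] (by simp only [List.forall_mem_cons]; simp [h0, h1, h2])).chk
    [[2], [0], [1], [6], [7], [5], [3], [4]] (by decide +kernel))
lemma s2_6 (hF : Fr G) (T : TK G) (h0 : T.holds (.A 0 0 1)) (h1 : T.holds (.A 1 1 0)) (h2 : T.holds (.bb 0 2)) : False :=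
  hF.x7 ((T.hasM [.A 0 0 1, .A 1 1 0, .bb 0 2] (by simp only [List.forall_mem_cons]; simp [h0, h1, h2])).chk
    [[6], [0], [5], [1], [7], [2, 4], [3]] (by decide +kernel))
lemma s2_7 (hF : Fr G) (T : TK G) (h0 : T.holds (.A 0 0 1)) (h1 : T.holds (.A 1 1 0)) (h2 : T.holds (.bb 1 2)) : False :=
  hF.x7 ((T.hasM [.A 0 0 1, .A 1 1 0, .bb 1 2] (by simp only [List.forall_mem_cons]; simp [h0, h1, h2])).chk
    [[6], [0], [5], [1], [7], [4], [2, 3]] (by decide +kernel))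
lemma s2_8 (hF : Fr G) (T : TK G) (h0 : T.holds (.A 0 0 1)) (h1 : T.holds (.A 1 1 0)) (h2 : T.holds (.B 2 0 2)) : False :=
  hF.x7 ((T.hasM [.A 0 0 1, .A 1 1 0, .B 2 0 2] (by simp only [List.forall_mem_cons]; simp [h0, h1, h2])).chk
    [[6], [0], [5], [1], [7], [2, 4], [3, 8]] (by decide +kernel))
lemma s2_9 (hF : Fr G) (T : TK G) (h0 : T.holds (.A 0 0 1)) (h1 : T.holds (.A 1 1 0)) (h2 : T.holds (.B 2 1 2)) : False :=
  hF.x7 ((T.hasM [.A 0 0 1, .A 1 1 0, .B 2 1 2] (by simp only [List.forall_mem_cons]; simp [h0, h1, h2])).chk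
    [[6], [0], [5], [1], [7], [4, 8], [2, 3]] (by decide +kernel))
lemma s2_10 (hF : Fr G) (T : TK G) (h0 : T.holds (.A 0 0 1)) (h1 : T.holds (.A 1 1 2)) (h2 : T.holds (.bb 0 1)) : False :=
  hF.k33i ((T.hasM [.A 0 0 1, .A 1 1 2, .bb 0 1] (by simp only [List.forall_mem_cons]; simp [h0, h1, h2])).chk
    [[0, 4], [1], [2], [3], [5], [7], [6]] (by decide +kernel))
lemma s2_11 (hF : Fr G) (T : TK G) (h0 : T.holds (.A 0 0 1)) (h1 : T.holds (.A 1 1 2)) (h2 : T.holds (.bb 0 2)) : False :=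
  hF.k33h ((T.hasM [.A 0 0 1, .A 1 1 2, .bb 0 2] (by simp only [List.forall_mem_cons]; simp [h0, h1, h2])).chk
    [[2], [5], [6], [0], [1], [3], [4], [7]] (by decide +kernel))
lemma s2_12 (hF : Fr G) (T : TK G) (h0 : T.holds (.A 0 0 1)) (h1 : T.holds (.A 1 1 2)) (h2 : T.holds (.bb 1 2)) : False :=
  hF.x7 ((T.hasM [.A 0 0 1, .A 1 1 2, .bb 1 2] (by simp only [List.forall_mem_cons]; simp [h0, h1, h2])).chk
    [[7], [1], [5], [2], [3], [0, 6], [4]] (by decide +kernel))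
lemma s2_13 (hF : Fr G) (T : TK G) (h0 : T.holds (.A 0 0 1)) (h1 : T.holds (.A 1 1 2)) (h2 : T.holds (.B 0 0 2)) : False :=
  hF.x7 ((T.hasM [.A 0 0 1, .A 1 1 2, .B 0 0 2] (by simp only [List.forall_mem_cons]; simp [h0, h1, h2])).chk
    [[6], [1], [5], [2], [3], [7], [0, 4]] (by decide +kernel))
lemma s2_14 (hF : Fr G) (T : TK G) (h0 : T.holds (.A 0 0 1)) (h1 : T.holds (.A 1 1 2)) (h2 : T.holds (.B 0 1 2)) : False :=
  hF.x7 ((T.hasM [.A 0 0 1, .A 1 1 2, .B 0 1 2] (by simp only [List.forall_mem_cons]; simp [h0, h1, h2])).chk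
    [[7], [1], [5], [2], [3], [0, 6], [4, 8]] (by decide +kernel))
lemma s2_15 (hF : Fr G) (T : TK G) (h0 : T.holds (.A 0 0 1)) (h1 : T.holds (.A 2 1 0)) (h2 : T.holds (.bb 0 1)) : False :=
  hF.k33i ((T.hasM [.A 0 0 1, .A 2 1 0, .bb 0 1] (by simp only [List.forall_mem_cons]; simp [h0, h1, h2])).chk
    [[0], [1], [2, 3], [4], [5], [6], [7]] (by decide +kernel))
lemma s2_16 (hF : Fr G) (T : TK G) (h0 : T.holds (.A 0 0 1)) (h1 : T.holds (.A 2 1 0)) (h2 : T.holds (.bb 0 2)) : False :=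
  hF.x7 ((T.hasM [.A 0 0 1, .A 2 1 0, .bb 0 2] (by simp only [List.forall_mem_cons]; simp [h0, h1, h2])).chk
    [[6], [0], [5], [1], [4], [2, 7], [3]] (by decide +kernel))
lemma s2_17 (hF : Fr G) (T : TK G) (h0 : T.holds (.A 0 0 1)) (h1 : T.holds (.A 2 1 0)) (h2 : T.holds (.bb 1 2)) : False :=
  hF.k33h ((T.hasM [.A 0 0 1, .A 2 1 0, .bb 1 2] (by simp only [List.forall_mem_cons]; simp [h0, h1, h2])).chk
    [[1], [5], [7], [0], [2], [4], [6], [3]] (by decide +kernel))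
lemma s2_18 (hF : Fr G) (T : TK G) (h0 : T.holds (.A 0 0 1)) (h1 : T.holds (.A 2 1 0)) (h2 : T.holds (.B 2 0 2)) : False :=
  hF.x7 ((T.hasM [.A 0 0 1, .A 2 1 0, .B 2 0 2] (by simp only [List.forall_mem_cons]; simp [h0, h1, h2])).chk
    [[6], [0], [5], [1], [4], [2, 7], [3, 8]] (by decide +kernel))
lemma s2_19 (hF : Fr G) (T : TK G) (h0 : T.holds (.A 0 0 1)) (h1 : T.holds (.A 2 1 0)) (h2 : T.holds (.B 2 1 2)) : False :=
  hF.x7 ((T.hasM [.A 0 0 1, .A 2 1 0, .B 2 1 2] (by simp only [List.forall_mem_cons]; simp [h0, h1, h2])).chk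
    [[6], [0], [5], [1], [4], [7], [2, 3]] (by decide +kernel))
lemma s4_0 (hF : Fr G) (T : TK G) (h0 : T.holds (.A 0 0 1)) (h1 : T.holds (.A 0 1 1)) (h2 : T.holds (.bb 0 1)) : False :=
  hF.k33h ((T.hasM [.A 0 0 1, .A 0 1 1, .bb 0 1] (by simp only [List.forall_mem_cons]; simp [h0, h1, h2])).chk
    [[2], [0], [1], [6], [7], [5], [3], [4]] (by decide +kernel))
lemma s4_1 (hF : Fr G) (T : TK G) (h0 : T.holds (.A 0 0 1)) (h1 : T.holds (.A 2 1 1)) (h2 : T.holds (.bb 0 1)) : False :=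
  hF.k33i ((T.hasM [.A 0 0 1, .A 2 1 1, .bb 0 1] (by simp only [List.forall_mem_cons]; simp [h0, h1, h2])).chk
    [[0, 4], [1], [2], [3], [5], [7], [6]] (by decide +kernel))
lemma s5_0 (hF : Fr G) (T : TK G) (h0 : T.holds (.A 0 0 1)) (h1 : T.holds (.bb 0 1)) (h2 : T.holds (.bb 0 2)) : False :=
  hF.k33i ((T.hasM [.A 0 0 1, .bb 0 1, .bb 0 2] (by simp only [List.forall_mem_cons]; simp [h0, h1, h2])).chk
    [[0], [1], [3], [4], [5], [6], [2]] (by decide +kernel))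
lemma ex_0 (hF : Fr G) (T : TK G) (h0 : T.holds (.aa 0 1)) (h1 : T.holds (.aa 0 2)) (h2 : T.holds (.aa 1 2)) (h3 : T.holds (.bb 0 1)) : False :=
  hF.ex2 ((T.hasM [.aa 0 1, .aa 0 2, .aa 1 2, .bb 0 1] (by simp only [List.forall_mem_cons]; simp [h0, h1, h2, h3])).chk
    [[0], [1], [2], [3], [4], [5]] (by decide +kernel))

lemma iiAdj (hF : Fr G) (T : TK G) (h : T.holds (.ii 0 0 0 1)) : False :=
  hF.k33h ((T.hasM [.ii 0 0 0 1] (by simp [h])).chk [[0],[1],[2],[3],[4],[5],[6],[7]] (by decide +kernel))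

/-- interiors of disjoint segments -/
lemma iiDis (T : TK G) (h : T.holds (.ii 0 0 1 1)) : HasM G 8 V8E :=
  (T.hasM [.ii 0 0 1 1] (by simp [h])).chk [[0],[5],[1],[7],[4],[2],[3],[6]] (by decide +kernel)

lemma swap_AB (T : TK G) (i j k : Fin 3) : T.swap.holds (.A j i k) ↔ T.holds (.B i j k) := by
  simp only [holds, swap_I]; rfl
lemma swap_BA (T : TK G) (i j k : Fin 3) : T.swap.holds (.B j i k) ↔ T.holds (.A i j k) := by
  simp only [holds, swap_I]; rfl

/-- general forms -/
lemma g_r2 (hF : Fr G) (T : TK G) {i j k k' : Fin 3} (h1 : k ≠ i) (h2 : k' ≠ i) (hA : T.holds (.A i j k))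
    (hB : T.holds (.A i j k')) : k = k' := by
  by_contra hne
  obtain ⟨σ, rfl, rfl⟩ := perm2 h1.symm
  obtain ⟨τ, rfl⟩ := perm1 j
  rcases perm_cases σ k' with rfl | rfl | rfl
  · exact h2 rfl
  · exact hne rfl
  · exact r2_0 hF (T.perm σ τ) hA hB

lemma g_r1 (hF : Fr G) (T : TK G) {i j k l : Fin 3} (h1 : k ≠ i) (h2 : l ≠ k) (hA : T.holds (.A i j k))
    (hB : T.holds (.A k j l)) : False := by
  obtain ⟨σ, rfl, rfl⟩ := perm2 h1.symm
  obtain ⟨τ, rfl⟩ := perm1 j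
  rcases perm_cases σ l with rfl | rfl | rfl
  · exact r1_0 hF (T.perm σ τ) hA hB
  · exact h2 rfl
  · exact r1_1 hF (T.perm σ τ) hA hB

/-- all items in a column have the same hub -/
lemma g_col (hF : Fr G) (T : TK G) {i i' j k k' : Fin 3} (h1 : k ≠ i) (h2 : k' ≠ i') (hA : T.holds (.A i j k))
    (hB : T.holds (.A i' j k')) : k = k' := by
  by_cases e1 : i = i'
  · subst e1; exact g_r2 hF T h1 h2 hA hB
  by_cases e2 : i' = k
  · subst e2; exact (g_r1 hF T h1 h2 hA hB).elim
  by_cases e3 : i = k'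
  · subst e3; exact (g_r1 hF T h2 h1 hB hA).elim
  omega

lemma g_rr (hF : Fr G) (T : TK G) {i j k r l m : Fin 3} (h1 : k ≠ i) (h2 : m ≠ l) (hA : T.holds (.A i j k))
    (hB : T.holds (.B r l m)) : r ≠ k ∧ m ≠ j := by
  by_contra hc
  obtain ⟨σ, rfl, rfl⟩ := perm2 h1.symm
  by_cases hl : l = j
  · subst hl
    have hr : r = σ 1 := by omega
    subst hr
    obtain ⟨τ, rfl, rfl⟩ := perm2 h2.symm
    exact rr_0 hF (T.perm σ τ) hA hB
  · obtain ⟨τ, rfl, rfl⟩ := perm2 (Ne.symm hl)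
    rcases perm_cases τ m with rfl | rfl | rfl
    · rcases perm_cases σ r with rfl | rfl | rfl
      · exact rr_3 hF (T.perm σ τ) hA hB
      · exact rr_1 hF (T.perm σ τ) hA hB
      · exact rr_4 hF (T.perm σ τ) hA hB
    · exact h2 rfl
    · have hr : r = σ 1 := by
        by_contra hr
        exact hc ⟨hr, by simp⟩
      subst hr
      exact rr_2 hF (T.perm σ τ) hA hB

/-- some edge on the `b` side -/
def Bside (T : TK G) : Prop := (∃ x y, x ≠ y ∧ T.holds (.bb x y)) ∨ ∃ r l m, m ≠ l ∧ T.holds (.B r l m)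
def Aside (T : TK G) : Prop := (∃ x y, x ≠ y ∧ T.holds (.aa x y)) ∨ ∃ r l m, m ≠ r ∧ T.holds (.A r l m)

lemma bb_symm (T : TK G) {x y : Fin 3} (h : T.holds (.bb x y)) : T.holds (.bb y x) := SimpleGraph.Adj.symm h
lemma aa_symm (T : TK G) {x y : Fin 3} (h : T.holds (.aa x y)) : T.holds (.aa y x) := SimpleGraph.Adj.symm h

lemma bb_norm (T : TK G) {x y : Fin 3} (h : x ≠ y) (hb : T.holds (.bb x y)) :
    T.holds (.bb 0 1) ∨ T.holds (.bb 0 2) ∨ T.holds (.bb 1 2) := by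
  have hb' := T.bb_symm hb
  fin_cases x <;> fin_cases y <;> first | (exact absurd rfl h) | (left; assumption) | (right; left; assumption) | (right; right; assumption)

/-- the `b` side of a permuted configuration -/
lemma bside_perm (T : TK G) (σ τ : Equiv.Perm (Fin 3)) (h : T.Bside) : (T.perm σ τ).Bside := by
  rcases h with ⟨x, y, hne, h⟩ | ⟨r, l, m, hne, h⟩
  · left
    refine ⟨τ.symm x, τ.symm y, by simpa using hne, ?_⟩
    simpa [holds, perm] using h
  · right
    obtain ⟨r, rfl⟩ := σ.surjective r
    obtain ⟨l, rfl⟩ := τ.surjective l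
    obtain ⟨m, rfl⟩ := τ.surjective m
    exact ⟨r, l, m, fun e => hne (by rw [e]), h⟩

lemma s2_norm (hF : Fr G) (T : TK G) {i k : Fin 3} (hA : T.holds (.A 0 0 1)) (h2 : k ≠ i) (hk : k ≠ 1)
    (hA' : T.holds (.A i 1 k)) (hb : T.Bside) : False := by
  rcases hb with ⟨x, y, hxy, hb⟩ | ⟨r, l, m, hml, hb⟩
  · have hk' : k = 0 ∨ k = 2 := by omega
    have hi' : i = 0 ∨ i = 1 ∨ i = 2 := by omega
    rcases T.bb_norm hxy hb with hb | hb | hb <;> rcases hk' with rfl | rfl <;>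
      rcases hi' with rfl | rfl | rfl <;> first
      | exact absurd rfl h2
      | exact s2_0 hF T hA hA' hb | exact s2_1 hF T hA hA' hb | exact s2_2 hF T hA hA' hb
      | exact s2_5 hF T hA hA' hb | exact s2_6 hF T hA hA' hb | exact s2_7 hF T hA hA' hb
      | exact s2_10 hF T hA hA' hb | exact s2_11 hF T hA hA' hb | exact s2_12 hF T hA hA' hb
      | exact s2_15 hF T hA hA' hb | exact s2_16 hF T hA hA' hb | exact s2_17 hF T hA hA' hb
  · have q1 := g_rr hF T (by decide) hml hA hb
    have q2 := g_rr hF T h2 hml hA' hb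
    have hm : m = 2 := by omega
    have hl : l = 0 ∨ l = 1 := by omega
    subst hm
    have hk' : (k = 0 ∧ r = 2) ∨ (k = 2 ∧ r = 0) := by omega
    have hi' : i = 0 ∨ i = 1 ∨ i = 2 := by omega
    rcases hl with rfl | rfl <;> rcases hk' with ⟨rfl, rfl⟩ | ⟨rfl, rfl⟩ <;>
      rcases hi' with rfl | rfl | rfl <;> first
      | exact absurd rfl h2
      | exact s2_3 hF T hA hA' hb | exact s2_4 hF T hA hA' hb
      | exact s2_8 hF T hA hA' hb | exact s2_9 hF T hA hA' hb
      | exact s2_13 hF T hA hA' hb | exact s2_14 hF T hA hA' hb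
      | exact s2_18 hF T hA hA' hb | exact s2_19 hF T hA hA' hb

/-- if the `b` side is used then all items on the `a` side have the same hub -/
lemma g_s2 (hF : Fr G) (T : TK G) {i j k i' j' k' : Fin 3} (h1 : k ≠ i) (h2 : k' ≠ i') (hA : T.holds (.A i j k))
    (hA' : T.holds (.A i' j' k')) (hb : T.Bside) : k = k' := by
  by_contra hne
  by_cases hj : j = j'
  · subst hj; exact hne (g_col hF T h1 h2 hA hA')
  obtain ⟨σ, rfl, rfl⟩ := perm2 h1.symm
  obtain ⟨τ, rfl, rfl⟩ := perm2 hj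
  obtain ⟨x, rfl⟩ := σ.surjective i'
  obtain ⟨y, rfl⟩ := σ.surjective k'
  exact s2_norm hF (T.perm σ τ) hA (fun e => h2 (by rw [e])) (fun e => hne (by rw [e])) hA' (T.bside_perm σ τ hb)

lemma s1_norm (hF : Fr G) (T : TK G) (hA : T.holds (.A 0 0 1)) (ha : T.holds (.aa 0 2)) (hb : T.Bside) : False := by
  rcases hb with ⟨x, y, hxy, hb⟩ | ⟨r, l, m, hml, hb⟩
  · rcases T.bb_norm hxy hb with hb | hb | hb
    · exact s1_0 hF T hA ha hb
    · exact s1_0 hF (T.perm 1 (Equiv.swap 1 2)) hA ha hb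
    · exact s1_1 hF T hA ha hb
  · have q1 := g_rr hF T (by decide) hml hA hb
    have hr : r = 0 ∨ r = 2 := by omega
    have hm : (m = 1 ∧ l = 0) ∨ (m = 1 ∧ l = 2) ∨ (m = 2 ∧ l = 0) ∨ (m = 2 ∧ l = 1) := by omega
    rcases hr with rfl | rfl <;> rcases hm with ⟨rfl, rfl⟩ | ⟨rfl, rfl⟩ | ⟨rfl, rfl⟩ | ⟨rfl, rfl⟩ <;> first
      | exact s1_2 hF T hA ha hb | exact s1_3 hF T hA ha hb | exact s1_4 hF T hA ha hb | exact s1_5 hF T hA ha hb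
      | exact s1_2 hF (T.perm 1 (Equiv.swap 1 2)) hA ha hb | exact s1_3 hF (T.perm 1 (Equiv.swap 1 2)) hA ha hb
      | exact s1_4 hF (T.perm 1 (Equiv.swap 1 2)) hA ha hb | exact s1_5 hF (T.perm 1 (Equiv.swap 1 2)) hA ha hb

lemma g_s1 (hF : Fr G) (T : TK G) {i j k x y : Fin 3} (h1 : k ≠ i) (hA : T.holds (.A i j k)) (hb : T.Bside)
    (hxy : x ≠ y) (ha : T.holds (.aa x y)) : x = k ∨ y = k := by
  by_contra hc
  obtain ⟨σ, rfl, rfl⟩ := perm2 h1.symm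
  obtain ⟨τ, rfl⟩ := perm1 j
  have ha' := T.aa_symm ha
  rcases perm_cases σ x with rfl | rfl | rfl <;> rcases perm_cases σ y with rfl | rfl | rfl
  · exact hxy rfl
  · exact hc (Or.inr rfl)
  · exact s1_norm hF (T.perm σ τ) hA ha (T.bside_perm σ τ hb)
  · exact hc (Or.inl rfl)
  · exact hc (Or.inl rfl)
  · exact hc (Or.inl rfl)
  · exact s1_norm hF (T.perm σ τ) hA ha' (T.bside_perm σ τ hb)
  · exact hc (Or.inr rfl)
  · exact hxy rfl

lemma g_s4 (hF : Fr G) (T : TK G) {i j k i' j' : Fin 3} (h1 : k ≠ i) (h2 : k ≠ i') (hj : j ≠ j')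
    (hA : T.holds (.A i j k)) (hA' : T.holds (.A i' j' k)) (hb : T.holds (.bb j j')) : False := by
  obtain ⟨σ, rfl, rfl⟩ := perm2 h1.symm
  obtain ⟨τ, rfl, rfl⟩ := perm2 hj
  rcases perm_cases σ i' with rfl | rfl | rfl
  · exact s4_0 hF (T.perm σ τ) hA hA' hb
  · exact h2 rfl
  · exact s4_1 hF (T.perm σ τ) hA hA' hb

lemma g_s5 (hF : Fr G) (T : TK G) {i j k x y : Fin 3} (h1 : k ≠ i) (hx : x ≠ j) (hy : y ≠ j) (hxy : x ≠ y)
    (hA : T.holds (.A i j k)) (hb : T.holds (.bb j x)) (hb' : T.holds (.bb j y)) : False := by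
  obtain ⟨σ, rfl, rfl⟩ := perm2 h1.symm
  obtain ⟨τ, rfl, rfl⟩ := perm2 hx.symm
  rcases perm_cases τ y with rfl | rfl | rfl
  · exact hy rfl
  · exact hxy rfl
  · exact s5_0 hF (T.perm σ τ) hA hb hb'

lemma g_ex (hF : Fr G) (T : TK G) (h1 : T.holds (.aa 0 1)) (h2 : T.holds (.aa 0 2)) (h3 : T.holds (.aa 1 2))
    {x y : Fin 3} (hxy : x ≠ y) (hb : T.holds (.bb x y)) : False := by
  obtain ⟨τ, rfl, rfl⟩ := perm2 hxy
  exact ex_0 hF (T.perm 1 τ) h1 h2 h3 hb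

/-- hub of the `aa` chords when no items are present -/
lemma g_hub (hF : Fr G) (T : TK G) {x y : Fin 3} (hxy : x ≠ y) (hb : T.holds (.bb x y)) :
    ∃ k, ∀ u w, u ≠ w → T.holds (.aa u w) → u = k ∨ w = k := by
  have h0 := g_ex hF T (hxy := hxy) (hb := hb)
  by_cases h1 : T.holds (.aa 0 1)
  · by_cases h2 : T.holds (.aa 0 2)
    · refine ⟨0, fun u w huw h => ?_⟩
      have h' := T.aa_symm h
      by_contra hc
      have : (u = 1 ∧ w = 2) ∨ (u = 2 ∧ w = 1) := by omega
      rcases this with ⟨rfl, rfl⟩ | ⟨rfl, rfl⟩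
      · exact h0 h1 h2 h
      · exact h0 h1 h2 h'
    · refine ⟨1, fun u w huw h => ?_⟩
      have h' := T.aa_symm h
      by_contra hc
      have : (u = 0 ∧ w = 2) ∨ (u = 2 ∧ w = 0) := by omega
      rcases this with ⟨rfl, rfl⟩ | ⟨rfl, rfl⟩
      · exact h2 h
      · exact h2 h'
  · refine ⟨2, fun u w huw h => ?_⟩
    have h' := T.aa_symm h
    by_contra hc
    have : (u = 0 ∧ w = 1) ∨ (u = 1 ∧ w = 0) := by omega
    rcases this with ⟨rfl, rfl⟩ | ⟨rfl, rfl⟩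
    · exact h1 h
    · exact h1 h'
end TK
end AP

set_option linter.all false
namespace AP
variable {V : Type*} {G : SimpleGraph V}
namespace TK

/-- oriented description of an edge -/
def cl (T : TK G) (u v : V) : Prop :=
  (∃ i j s, s < T.n i j ∧ u = T.p i j s ∧ v = T.p i j (s+1)) ∨
  (∃ i k, i ≠ k ∧ u = T.a i ∧ v = T.a k) ∨ (∃ j l, j ≠ l ∧ u = T.b j ∧ v = T.b l) ∨
  (∃ i j k, k ≠ i ∧ u ∈ T.I i j ∧ v = T.a k) ∨ (∃ i j l, l ≠ j ∧ u ∈ T.I i j ∧ v = T.b l)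

lemma cl_seg (hF : Fr G) (T : TK G) {i j : Fin 3} {s t : ℕ} (hs : s ≤ T.n i j) (ht : t ≤ T.n i j)
    (h : G.Adj (T.p i j s) (T.p i j t)) : T.cl (T.p i j s) (T.p i j t) ∨ T.cl (T.p i j t) (T.p i j s) := by
  rcases lt_trichotomy s t with h1 | h1 | h1
  · by_cases h2 : t = s + 1
    · subst h2; exact Or.inl (Or.inl ⟨i, j, s, by omega, rfl, rfl⟩)
    · exact (hF.k33i (T.bypass i j s t (by omega) ht h)).elim
  · subst h1; exact (G.irrefl h).elim
  · by_cases h2 : s = t + 1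
    · subst h2; exact Or.inr (Or.inl ⟨i, j, t, by omega, rfl, rfl⟩)
    · exact (hF.k33i (T.bypass i j t s (by omega) hs h.symm)).elim

lemma cl_aux (hF : Fr G) (T : TK G) {i j : Fin 3} {u v : V} (hu : u ∈ T.I i j) (h : G.Adj u v) :
    T.cl u v ∨ T.cl v u := by
  rcases T.cases v with ⟨k, rfl⟩ | ⟨l, rfl⟩ | ⟨i', j', hv⟩
  · by_cases hk : k = i
    · subst hk
      obtain ⟨s, h1, h2, rfl⟩ := hu
      rw [← T.p0 k j] at h ⊢
      exact cl_seg hF T (by omega) (by omega) h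
    · exact Or.inl (Or.inr (Or.inr (Or.inr (Or.inl ⟨i, j, k, hk, hu, rfl⟩))))
  · by_cases hk : l = j
    · subst hk
      obtain ⟨s, h1, h2, rfl⟩ := hu
      rw [← T.pn i l] at h ⊢
      exact cl_seg hF T (by omega) (by omega) h
    · exact Or.inl (Or.inr (Or.inr (Or.inr (Or.inr ⟨i, j, l, hk, hu, rfl⟩))))
  · have ht : T.holds (.ii i j i' j') := ⟨u, hu, v, hv, h⟩
    by_cases hi : i = i'
    · subst hi
      by_cases hj : j = j'
      · subst hj
        obtain ⟨s, h1, h2, rfl⟩ := hu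
        obtain ⟨t, h3, h4, rfl⟩ := hv
        exact cl_seg hF T (by omega) (by omega) h
      · obtain ⟨σ, rfl⟩ := perm1 i
        obtain ⟨τ, rfl, rfl⟩ := perm2 hj
        exact (iiAdj hF (T.perm σ τ) ht).elim
    · by_cases hj : j = j'
      · subst hj
        have ht' : T.swap.holds (.ii j i j i') := by
          simp only [holds, swap_I]; exact ht
        obtain ⟨σ, rfl⟩ := perm1 j
        obtain ⟨τ, rfl, rfl⟩ := perm2 hi
        exact (iiAdj hF (T.swap.perm σ τ) ht').elim
      · obtain ⟨σ, rfl, rfl⟩ := perm2 hi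
        obtain ⟨τ, rfl, rfl⟩ := perm2 hj
        exact (hF.v8 (iiDis (T.perm σ τ) ht)).elim

theorem classify (hF : Fr G) (T : TK G) {u v : V} (h : G.Adj u v) : T.cl u v ∨ T.cl v u := by
  rcases T.cases u with ⟨k, rfl⟩ | ⟨l, rfl⟩ | ⟨i, j, hu⟩
  · rcases T.cases v with ⟨k', rfl⟩ | ⟨l', rfl⟩ | ⟨i', j', hv⟩
    · exact Or.inl (Or.inr (Or.inl ⟨k, k', fun e => h.ne (by rw [e]), rfl, rfl⟩))
    · rw [← T.p0 k l', ← T.pn k l'] at h ⊢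
      exact cl_seg hF T (by omega) (by omega) h
    · exact (cl_aux hF T hv h.symm).symm
  · rcases T.cases v with ⟨k', rfl⟩ | ⟨l', rfl⟩ | ⟨i', j', hv⟩
    · rw [← T.p0 k' l, ← T.pn k' l] at h ⊢
      exact cl_seg hF T (by omega) (by omega) h
    · exact Or.inl (Or.inr (Or.inr (Or.inl ⟨l, l', fun e => h.ne (by rw [e]), rfl, rfl⟩)))
    · exact (cl_aux hF T hv h.symm).symm
  · exact cl_aux hF T hu h

/-- every long segment has an item -/
theorem item (hF : Fr G) (h3 : KConnected G 3) (T : TK G) {i j : Fin 3} (h : 1 < T.n i j) :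
    (∃ k, k ≠ i ∧ T.holds (.A i j k)) ∨ ∃ l, l ≠ j ∧ T.holds (.B i j l) := by
  have hp : T.p i j 1 ∈ T.I i j := ⟨1, by omega, h, rfl⟩
  obtain ⟨x, hx, y, hy, hxa, hxb, hya, hyb, hxy⟩ := con3 h3 (T.I i j) (T.a i) (T.b j)
    ⟨_, hp, fun e => T.a_notI (e ▸ hp), fun e => T.b_notI (e ▸ hp)⟩
    ⟨T.a (i+1), T.a_notI, fun e => (by decide : ∀ i : Fin 3, i + 1 ≠ i) i (T.a_inj e), T.ab_ne⟩
  have hseg : ∀ i' j' s s', s ≤ T.n i' j' → s' ≤ T.n i' j' → x = T.p i' j' s → y = T.p i' j' s' → False := by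
    intro i' j' s s' hs hs' e e'
    have hs0 : s ≠ 0 := by
      rintro rfl; rw [T.p0] at e; subst e; exact T.a_notI hx
    have hs1 : s ≠ T.n i' j' := by
      rintro rfl; rw [T.pn] at e; subst e; exact T.b_notI hx
    have hx' : x ∈ T.I i' j' := ⟨s, by omega, by omega, e.symm⟩
    obtain ⟨rfl, rfl⟩ := T.I_disj hx hx'
    by_cases h0 : s' = 0
    · subst h0; rw [T.p0] at e'; exact hya e'
    by_cases h1 : s' = T.n i j
    · subst h1; rw [T.pn] at e'; exact hyb e'
    exact hy ⟨s', by omega, by omega, e'.symm⟩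
  rcases classify hF T hxy with h | h
  · rcases h with ⟨i', j', s, hs, e, e'⟩ | ⟨i', k, _, e, _⟩ | ⟨i', k, _, e, _⟩ | ⟨i', j', k, hk, hx', rfl⟩ | ⟨i', j', k, hk, hx', rfl⟩
    · exact (hseg i' j' s (s+1) (by omega) (by omega) e e').elim
    · subst e; exact (T.a_notI hx).elim
    · subst e; exact (T.b_notI hx).elim
    · obtain ⟨rfl, rfl⟩ := T.I_disj hx hx'
      exact Or.inl ⟨k, hk, x, hx, _, rfl, hxy⟩
    · obtain ⟨rfl, rfl⟩ := T.I_disj hx hx'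
      exact Or.inr ⟨k, hk, x, hx, _, rfl, hxy⟩
  · rcases h with ⟨i', j', s, hs, e, e'⟩ | ⟨i', k, _, _, e⟩ | ⟨i', k, _, _, e⟩ | ⟨i', j', k, hk, hx', e⟩ | ⟨i', j', k, hk, hx', e⟩
    · exact (hseg i' j' (s+1) s (by omega) (by omega) e' e).elim
    · subst e; exact (T.a_notI hx).elim
    · subst e; exact (T.b_notI hx).elim
    · subst e; exact (T.a_notI hx).elim
    · subst e; exact (T.b_notI hx).elim

structure T2 (T : TK G) (k m : Fin 3) : Prop where
  row : ∀ j, ¬ 1 < T.n k j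
  col : ∀ i, ¬ 1 < T.n i m
  hA : ∀ i j x, x ≠ i → T.holds (.A i j x) → x = k
  hB : ∀ i j x, x ≠ j → T.holds (.B i j x) → x = m
  haa : ∀ x y, x ≠ y → T.holds (.aa x y) → x = k ∨ y = k
  hbb : ∀ x y, x ≠ y → T.holds (.bb x y) → x = m ∨ y = m

structure T3 (T : TK G) (h : Fin 3 → Fin 3) : Prop where
  short : ∀ j, ¬ 1 < T.n (h j) j
  hA : ∀ i j x, x ≠ i → T.holds (.A i j x) → x = h j
  hB : ∀ i j x, x ≠ j → ¬ T.holds (.B i j x)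
  hbb : ∀ x y, x ≠ y → ¬ T.holds (.bb x y)

theorem t3_of (hF : Fr G) (h3 : KConnected G 3) (T : TK G) (hb : ¬ T.Bside) : ∃ h, T.T3 h := by
  classical
  have hB : ∀ i j x, x ≠ j → ¬ T.holds (.B i j x) := fun i j x hx h => hb (Or.inr ⟨i, j, x, hx, h⟩)
  have hbb : ∀ x y, x ≠ y → ¬ T.holds (.bb x y) := fun x y hx h => hb (Or.inl ⟨x, y, hx, h⟩)
  have hex : ∀ j, ∃ k, (¬ 1 < T.n k j) ∧ ∀ i x, x ≠ i → T.holds (.A i j x) → x = k := by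
    intro j
    by_cases h : ∃ i x, x ≠ i ∧ T.holds (.A i j x)
    · obtain ⟨i, k, hk, hA⟩ := h
      refine ⟨k, fun hn => ?_, fun i' x hx hA' => g_col hF T hx hk hA' hA⟩
      rcases item hF h3 T hn with ⟨l, hl, hA'⟩ | ⟨l, hl, hB'⟩
      · exact g_r1 hF T hk hl hA hA'
      · exact hB _ _ _ hl hB'
    · refine ⟨0, fun hn => ?_, fun i' x hx hA' => (h ⟨i', x, hx, hA'⟩).elim⟩
      rcases item hF h3 T hn with ⟨l, hl, hA'⟩ | ⟨l, hl, hB'⟩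
      · exact h ⟨0, l, hl, hA'⟩
      · exact hB _ _ _ hl hB'
  choose f hf using hex
  exact ⟨f, fun j => (hf j).1, fun i j x => (hf j).2 i x, hB, hbb⟩

lemma swap_Bside (T : TK G) : T.swap.Bside ↔ T.Aside := by
  constructor
  · rintro (⟨x, y, hxy, h⟩ | ⟨r, l, m, hm, h⟩)
    · exact Or.inl ⟨x, y, hxy, h⟩
    · exact Or.inr ⟨l, r, m, hm, (T.swap_BA l r m).1 h⟩
  · rintro (⟨x, y, hxy, h⟩ | ⟨r, l, m, hm, h⟩)
    · exact Or.inl ⟨x, y, hxy, h⟩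
    · exact Or.inr ⟨l, r, m, hm, (T.swap_BA r l m).2 h⟩

lemma swap_Aside (T : TK G) : T.swap.Aside ↔ T.Bside := by
  constructor
  · rintro (⟨x, y, hxy, h⟩ | ⟨r, l, m, hm, h⟩)
    · exact Or.inl ⟨x, y, hxy, h⟩
    · exact Or.inr ⟨l, r, m, hm, (T.swap_AB l r m).1 h⟩
  · rintro (⟨x, y, hxy, h⟩ | ⟨r, l, m, hm, h⟩)
    · exact Or.inl ⟨x, y, hxy, h⟩
    · exact Or.inr ⟨l, r, m, hm, (T.swap_AB r l m).2 h⟩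

lemma T2.of_swap {T : TK G} {k m : Fin 3} (h : T.swap.T2 m k) : T.T2 k m where
  row j := h.col j
  col i := h.row i
  hA i j x hx hA := h.hB j i x hx ((T.swap_BA i j x).2 hA)
  hB i j x hx hB := h.hA j i x hx ((T.swap_AB i j x).2 hB)
  haa x y hxy ha := h.hbb x y hxy ha
  hbb x y hxy ha := h.haa x y hxy ha

lemma pick_m (J : Fin 3 → Prop) (Q : Fin 3 → Fin 3 → Prop) (hs : ∀ x y, Q x y → Q y x)
    (hJ : ∃ j, J j) (h4 : ∀ x y, x ≠ y → J x → J y → ¬ Q x y)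
    (h5 : ∀ j x y, J j → x ≠ j → y ≠ j → x ≠ y → Q j x → Q j y → False) (hQ : ∃ x y, x ≠ y ∧ Q x y) :
    ∃ m, ¬ J m ∧ ∀ x y, x ≠ y → Q x y → x = m ∨ y = m := by
  obtain ⟨x, y, hxy, h⟩ := hQ
  obtain ⟨z, hzx, hzy⟩ : ∃ z : Fin 3, z ≠ x ∧ z ≠ y := by
    clear h hJ; revert x y; decide
  have h' := hs _ _ h
  have third : ∀ w : Fin 3, w = x ∨ w = y ∨ w = z := by intro w; omega
  have fin : ∀ m, (∀ u w, u ≠ w → u ≠ m → w ≠ m → ¬ Q u w) → ∀ u w, u ≠ w → Q u w → u = m ∨ w = m := by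
    intro m hm u w huw hq
    by_contra hc
    exact hm u w huw (fun e => hc (Or.inl e)) (fun e => hc (Or.inr e)) hq
  by_cases q1 : Q x z
  · have Jx : ¬ J x := fun hJx => h5 x y z hJx hxy.symm hzx hzy.symm h q1
    by_cases q2 : Q y z
    · exfalso
      have Jy : ¬ J y := fun hJy => h5 y x z hJy hxy hzy hzx.symm h' q2
      have Jz : ¬ J z := fun hJz => h5 z x y hJz hzx.symm hzy.symm hxy (hs _ _ q1) (hs _ _ q2)
      obtain ⟨j, hj⟩ := hJ
      rcases third j with rfl | rfl | rfl <;> contradiction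
    · refine ⟨x, Jx, fin x ?_⟩
      intro u w huw hu hw hq
      rcases third u with rfl | rfl | rfl
      · exact hu rfl
      · rcases third w with rfl | rfl | rfl
        · exact hw rfl
        · exact huw rfl
        · exact q2 hq
      · rcases third w with rfl | rfl | rfl
        · exact hw rfl
        · exact q2 (hs _ _ hq)
        · exact huw rfl
  · by_cases q2 : Q y z
    · have Jy : ¬ J y := fun hJy => h5 y x z hJy hxy hzy hzx.symm h' q2
      refine ⟨y, Jy, fin y ?_⟩
      intro u w huw hu hw hq
      rcases third u with rfl | rfl | rfl
      · rcases third w with rfl | rfl | rfl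
        · exact huw rfl
        · exact hw rfl
        · exact q1 hq
      · exact hu rfl
      · rcases third w with rfl | rfl | rfl
        · exact q1 (hs _ _ hq)
        · exact hw rfl
        · exact huw rfl
    · have only : ∀ u w, u ≠ w → Q u w → (u = x ∧ w = y) ∨ (u = y ∧ w = x) := by
        intro u w huw hq
        rcases third u with rfl | rfl | rfl <;> rcases third w with rfl | rfl | rfl
        · exact (huw rfl).elim
        · exact Or.inl ⟨rfl, rfl⟩
        · exact (q1 hq).elim
        · exact Or.inr ⟨rfl, rfl⟩
        · exact (huw rfl).elim
        · exact (q2 hq).elim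
        · exact (q1 (hs _ _ hq)).elim
        · exact (q2 (hs _ _ hq)).elim
        · exact (huw rfl).elim
      by_cases Jx : J x
      · refine ⟨y, fun Jy => h4 x y hxy Jx Jy h, fun u w huw hq => ?_⟩
        rcases only u w huw hq with ⟨e, e'⟩ | ⟨e, e'⟩
        · exact Or.inr e'
        · exact Or.inl e
      · refine ⟨x, Jx, fun u w huw hq => ?_⟩
        rcases only u w huw hq with ⟨e, e'⟩ | ⟨e, e'⟩
        · exact Or.inl e
        · exact Or.inr e'

theorem t2_item (hF : Fr G) (h3 : KConnected G 3) (T : TK G) (hb : T.Bside) {i j k : Fin 3} (hk : k ≠ i)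
    (hA : T.holds (.A i j k)) : ∃ k m, T.T2 k m := by
  have hall : ∀ i j x, x ≠ i → T.holds (.A i j x) → x = k := fun i' j' x hx h => g_s2 hF T hx hk h hA hb
  have hrow : ∀ j, ¬ 1 < T.n k j := by
    intro j' hn
    rcases item hF h3 T hn with ⟨l, hl, h⟩ | ⟨l, hl, h⟩
    · exact hl (hall _ _ _ hl h)
    · exact (g_rr hF T hk hl hA h).1 rfl
  have haa := fun x y hxy ha => g_s1 hF T hk hA hb (x := x) (y := y) hxy ha
  by_cases hB : ∃ r l m, m ≠ l ∧ T.holds (.B r l m)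
  · obtain ⟨r, l, m, hm, hB⟩ := hB
    have hB' : T.swap.holds (.A l r m) := (T.swap_AB r l m).2 hB
    have hb' : T.swap.Bside := T.swap_Bside.2 (Or.inr ⟨i, j, k, hk, hA⟩)
    have hall' : ∀ i j x, x ≠ j → T.holds (.B i j x) → x = m := fun i' j' x hx h =>
      g_s2 hF T.swap hx hm ((T.swap_AB i' j' x).2 h) hB' hb'
    refine ⟨k, m, hrow, ?_, hall, hall', haa, fun x y hxy ha => g_s1 hF T.swap hm hB' hb' (x := x) (y := y) hxy ha⟩
    intro i' hn
    rcases item hF h3 T hn with ⟨l', hl, h⟩ | ⟨l', hl, h⟩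
    · exact (g_rr hF T hl hm h hB).2 rfl
    · exact hl (hall' _ _ _ hl h)
  · have hQ : ∃ x y, x ≠ y ∧ T.holds (.bb x y) := by
      rcases hb with h | h
      · exact h
      · exact (hB h).elim
    obtain ⟨m, hm, hm'⟩ := pick_m (fun j => ∃ i, k ≠ i ∧ T.holds (.A i j k)) (fun x y => T.holds (.bb x y))
      (fun x y h => T.bb_symm h) ⟨j, i, hk, hA⟩
      (fun x y hxy ⟨i1, h1, h2⟩ ⟨i2, h1', h2'⟩ hq => g_s4 hF T h1 h1' hxy h2 h2' hq)
      (fun j x y ⟨i1, h1, h2⟩ hx hy hxy q1 q2 => g_s5 hF T h1 hx hy hxy h2 q1 q2) hQ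
    refine ⟨k, m, hrow, ?_, hall, fun i j x hx h => (hB ⟨i, j, x, hx, h⟩).elim, haa, hm'⟩
    intro i' hn
    rcases item hF h3 T hn with ⟨l', hl, h⟩ | ⟨l', hl, h⟩
    · have := hall _ _ _ hl h; subst this
      exact hm ⟨i', hl, h⟩
    · exact hB ⟨_, _, _, hl, h⟩

/-- structure of the chords -/
theorem chords (hF : Fr G) (h3 : KConnected G 3) (T : TK G) :
    (∃ k m, T.T2 k m) ∨ (∃ h, T.T3 h) ∨ ∃ h, T.swap.T3 h := by
  by_cases hb : T.Bside
  swap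
  · exact Or.inr (Or.inl (t3_of hF h3 T hb))
  by_cases ha : T.Aside
  swap
  · exact Or.inr (Or.inr (t3_of hF h3 T.swap (fun h => ha (T.swap_Bside.1 h))))
  left
  by_cases hA : ∃ i j k, k ≠ i ∧ T.holds (.A i j k)
  · obtain ⟨i, j, k, hk, hA⟩ := hA
    exact t2_item hF h3 T hb hk hA
  by_cases hB : ∃ i j k, k ≠ j ∧ T.holds (.B i j k)
  · obtain ⟨i, j, k, hk, hB⟩ := hB
    obtain ⟨m, k, h⟩ := t2_item hF h3 T.swap (T.swap_Bside.2 ha) hk ((T.swap_AB i j k).2 hB)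
    exact ⟨k, m, h.of_swap⟩
  have hn : ∀ i j, ¬ 1 < T.n i j := by
    intro i j hn
    rcases item hF h3 T hn with ⟨l', hl, h⟩ | ⟨l', hl, h⟩
    · exact hA ⟨_, _, _, hl, h⟩
    · exact hB ⟨_, _, _, hl, h⟩
  obtain ⟨x, y, hxy, hb⟩ : ∃ x y, x ≠ y ∧ T.holds (.bb x y) := hb.resolve_right hB
  obtain ⟨x', y', hxy', ha⟩ : ∃ x y, x ≠ y ∧ T.holds (.aa x y) := ha.resolve_right hA
  obtain ⟨k, hk⟩ := g_hub hF T hxy hb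
  obtain ⟨m, hm⟩ := g_hub hF T.swap hxy' ha
  exact ⟨k, m, hn k, fun i => hn i m, fun i j x hx h => (hA ⟨i, j, x, hx, h⟩).elim,
    fun i j x hx h => (hB ⟨i, j, x, hx, h⟩).elim, hk, hm⟩

end TK
end AP

set_option linter.all false
namespace AP

section DW
variable {V : Type*} {G : SimpleGraph V}

/-- cyclic neighbours with respect to an enumeration -/
def Rel (g : ℕ → V) (N : ℕ) (u v : V) : Prop :=
  ∃ t < N, (u = g t ∧ v = g ((t+1) % N)) ∨ (v = g t ∧ u = g ((t+1) % N))

lemma Rel.symm {g : ℕ → V} {N : ℕ} {u v : V} (h : Rel g N u v) : Rel g N v u := by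
  obtain ⟨t, ht, h⟩ := h; exact ⟨t, ht, h.symm⟩

lemma dw_of (N : ℕ) (x y : V) (g : ℕ → V) (hN : 3 ≤ N)
    (hcov : ∀ v, v = x ∨ v = y ∨ ∃ t < N, g t = v)
    (hinj : ∀ t < N, ∀ t' < N, g t = g t' → t = t')
    (hedge : ∀ u v, G.Adj u v → u = x ∨ u = y ∨ v = x ∨ v = y ∨ Rel g N u v) :
    IsMinor G (doubleWheel N) := by
  classical
  have hf : ∀ v, ∃ w : Fin N ⊕ Fin 2, (w = .inr 0 ∧ v = x) ∨ (w = .inr 1 ∧ v = y ∧ v ≠ x) ∨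
      ∃ t : Fin N, w = .inl t ∧ g t = v ∧ v ≠ x ∧ v ≠ y := by
    intro v
    by_cases h1 : v = x
    · exact ⟨_, Or.inl ⟨rfl, h1⟩⟩
    by_cases h2 : v = y
    · exact ⟨_, Or.inr (Or.inl ⟨rfl, h2, h1⟩)⟩
    · rcases hcov v with h | h | ⟨t, ht, h⟩
      · exact (h1 h).elim
      · exact (h2 h).elim
      · exact ⟨_, Or.inr (Or.inr ⟨⟨t, ht⟩, rfl, h, h1, h2⟩)⟩
  choose f hf using hf
  have hfin : Function.Injective f := by
    intro u v h
    rcases hf u with ⟨e, e'⟩ | ⟨e, e', _⟩ | ⟨t, e, e', _⟩ <;> rcases hf v with ⟨q, q'⟩ | ⟨q, q', _⟩ | ⟨t', q, q', _⟩ <;>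
      rw [e, q] at h <;> first | (exfalso; revert h; simp; done) | (rw [e', q']) | skip
    obtain rfl := Sum.inl.inj h
    rw [← e', q']
  refine isMinor_of_map f hfin ?_
  intro u v huv
  have hne : f u ≠ f v := fun h => huv.ne (hfin h)
  simp only [doubleWheel, fromRel_adj]
  refine ⟨hne, ?_⟩
  rcases hf u with ⟨e, e'⟩ | ⟨e, e', _⟩ | ⟨t, e, e', h1, h2⟩ <;>
    rcases hf v with ⟨q, q'⟩ | ⟨q, q', _⟩ | ⟨t', q, q', h3, h4⟩ <;> rw [e, q] <;> simp
  rcases hedge u v huv with h | h | h | h | ⟨s, hs, h⟩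
  · exact (h1 h).elim
  · exact (h2 h).elim
  · exact (h3 h).elim
  · exact (h4 h).elim
  have hm : (s+1) % N < N := Nat.mod_lt _ (by omega)
  rcases h with ⟨h5, h6⟩ | ⟨h5, h6⟩
  · left
    have e1 := hinj t t.2 s hs (e'.trans h5)
    have e2 := hinj t' t'.2 _ hm (q'.trans h6)
    rw [e1, e2]
  · right
    have e1 := hinj t' t'.2 s hs (q'.trans h5)
    have e2 := hinj t t.2 _ hm (e'.trans h6)
    rw [e1, e2]

lemma TK.T2.perm {T : TK G} {σ τ : Equiv.Perm (Fin 3)} (h : T.T2 (σ 0) (τ 0)) : (T.perm σ τ).T2 0 0 where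
  row j := h.row (τ j)
  col i := h.col (σ i)
  hA i j x hx hA := σ.injective (h.hA (σ i) (τ j) (σ x) (fun e => hx (σ.injective e)) hA)
  hB i j x hx hB := τ.injective (h.hB (σ i) (τ j) (τ x) (fun e => hx (τ.injective e)) hB)
  haa x y hxy ha := (h.haa (σ x) (σ y) (fun e => hxy (σ.injective e)) ha).imp (fun e => σ.injective e) (fun e => σ.injective e)
  hbb x y hxy ha := (h.hbb (τ x) (τ y) (fun e => hxy (τ.injective e)) ha).imp (fun e => τ.injective e) (fun e => τ.injective e)

theorem TK.T2.dw0 (hF : Fr G) {T : TK G} (h : T.T2 0 0) : ∃ n, 3 ≤ n ∧ IsMinor G (doubleWheel n) := by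
  obtain ⟨A, hA⟩ : ∃ A, A = T.n 1 1 := ⟨_, rfl⟩
  obtain ⟨B, hB⟩ : ∃ B, B = T.n 2 1 := ⟨_, rfl⟩
  obtain ⟨C, hC⟩ : ∃ C, C = T.n 2 2 := ⟨_, rfl⟩
  obtain ⟨D, hD⟩ : ∃ D, D = T.n 1 2 := ⟨_, rfl⟩
  have pA : 1 ≤ A := hA ▸ T.pos 1 1
  have pB : 1 ≤ B := hB ▸ T.pos 2 1
  have pC : 1 ≤ C := hC ▸ T.pos 2 2
  have pD : 1 ≤ D := hD ▸ T.pos 1 2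
  let g : ℕ → V := fun t => if t ≤ A then T.p 1 1 t else if t ≤ A + B then T.p 2 1 (A + B - t) else
    if t ≤ A + B + C then T.p 2 2 (t - (A + B)) else T.p 1 2 (A + B + C + D - t)
  have b1 : T.p 1 1 A = T.p 2 1 B := by rw [hA, hB, T.pn, T.pn]
  have b2 : T.p 2 2 C = T.p 1 2 D := by rw [hC, hD, T.pn, T.pn]
  have a2 : T.p 2 1 0 = T.p 2 2 0 := by rw [T.p0, T.p0]
  have a1 : T.p 1 1 0 = T.p 1 2 0 := by rw [T.p0, T.p0]
  have e1 : ∀ s, s ≤ A → g s = T.p 1 1 s := fun s hs => by simp only [g]; rw [if_pos hs]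
  have e2 : ∀ s, s ≤ B → g (A + B - s) = T.p 2 1 s := fun s hs => by
    simp only [g]
    by_cases hs' : s = B
    · subst hs'; rw [if_pos (by omega), ← b1]; congr 1; omega
    · rw [if_neg (by omega), if_pos (by omega)]; congr 1; omega
  have e3 : ∀ s, s ≤ C → g (A + B + s) = T.p 2 2 s := fun s hs => by
    simp only [g]
    by_cases hs' : s = 0
    · subst hs'; rw [if_neg (by omega), if_pos (by omega), ← a2]; congr 1; omega
    · rw [if_neg (by omega), if_neg (by omega), if_pos (by omega)]; congr 1; omega
  have e4 : ∀ s, s ≤ D → 0 < s → g (A + B + C + D - s) = T.p 1 2 s := fun s hs h0 => by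
    simp only [g]
    by_cases hs' : s = D
    · subst hs'; rw [if_neg (by omega), if_neg (by omega), if_pos (by omega), ← b2]; congr 1; omega
    · rw [if_neg (by omega), if_neg (by omega), if_neg (by omega)]; congr 1; omega
  have hp : ∀ i j s, i ≠ 0 → j ≠ 0 → s ≤ T.n i j → ∃ t < A + B + C + D, g t = T.p i j s := by
    intro i j s hi hj hs
    have hi' : i = 1 ∨ i = 2 := by omega
    have hj' : j = 1 ∨ j = 2 := by omega
    rcases hi' with rfl | rfl <;> rcases hj' with rfl | rfl
    · exact ⟨s, by omega, e1 s (by omega)⟩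
    · by_cases h0 : s = 0
      · subst h0; exact ⟨0, by omega, by rw [e1 0 (by omega), a1]⟩
      · exact ⟨_, by omega, e4 s (by omega) (by omega)⟩
    · exact ⟨_, by omega, e2 s (by omega)⟩
    · exact ⟨_, by omega, e3 s (by omega)⟩
  have hp2 : ∀ i j s, i ≠ 0 → j ≠ 0 → s < T.n i j → Rel g (A + B + C + D) (T.p i j s) (T.p i j (s+1)) := by
    intro i j s hi hj hs
    have hi' : i = 1 ∨ i = 2 := by omega
    have hj' : j = 1 ∨ j = 2 := by omega
    rcases hi' with rfl | rfl <;> rcases hj' with rfl | rfl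
    · refine ⟨s, by omega, Or.inl ⟨(e1 s (by omega)).symm, ?_⟩⟩
      rw [Nat.mod_eq_of_lt (by omega), e1 (s+1) (by omega)]
    · refine ⟨A + B + C + D - (s+1), by omega, Or.inr ⟨(e4 _ (by omega) (by omega)).symm, ?_⟩⟩
      by_cases h0 : s = 0
      · subst h0
        rw [show A + B + C + D - (0 + 1) + 1 = A + B + C + D by omega, Nat.mod_self, e1 0 (by omega), a1]
      · rw [Nat.mod_eq_of_lt (by omega), show A + B + C + D - (s+1) + 1 = A + B + C + D - s by omega,
          e4 _ (by omega) (by omega)]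
    · refine ⟨A + B - (s+1), by omega, Or.inr ⟨(e2 _ (by omega)).symm, ?_⟩⟩
      rw [Nat.mod_eq_of_lt (by omega), show A + B - (s+1) + 1 = A + B - s by omega, e2 _ (by omega)]
    · refine ⟨A + B + s, by omega, Or.inl ⟨(e3 _ (by omega)).symm, ?_⟩⟩
      rw [Nat.mod_eq_of_lt (by omega), show A + B + s + 1 = A + B + (s + 1) by omega, e3 _ (by omega)]
  refine ⟨A + B + C + D, by omega, dw_of _ (T.a 0) (T.b 0) g (by omega) ?_ ?_ ?_⟩
  · intro v
    rcases T.cases v with ⟨i, rfl⟩ | ⟨j, rfl⟩ | ⟨i, j, hv⟩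
    · by_cases hi : i = 0
      · subst hi; exact Or.inl rfl
      · rw [← T.p0 i 1]; exact Or.inr (Or.inr (hp i 1 0 hi (by decide) (by omega)))
    · by_cases hj : j = 0
      · subst hj; exact Or.inr (Or.inl rfl)
      · rw [← T.pn 1 j]; exact Or.inr (Or.inr (hp 1 j _ (by decide) hj (by omega)))
    · obtain ⟨s, h1, h2, rfl⟩ := hv
      refine Or.inr (Or.inr (hp i j s ?_ ?_ (by omega)))
      · rintro rfl; exact h.row j (by omega)
      · rintro rfl; exact h.col i (by omega)
  · have co : ∀ t < A + B + C + D, ∃ i j s, g t = T.p i j s ∧ s ≤ T.n i j ∧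
        ((i = 1 ∧ j = 1 ∧ t = s) ∨ (i = 2 ∧ j = 1 ∧ t = A + B - s ∧ s < B) ∨
        (i = 2 ∧ j = 2 ∧ t = A + B + s ∧ 0 < s) ∨ (i = 1 ∧ j = 2 ∧ t = A + B + C + D - s ∧ 0 < s ∧ s < D)) := by
      intro t ht
      by_cases h1 : t ≤ A
      · exact ⟨1, 1, t, e1 t h1, by omega, Or.inl ⟨rfl, rfl, rfl⟩⟩
      by_cases h2 : t ≤ A + B
      · refine ⟨2, 1, A + B - t, ?_, by omega, Or.inr (Or.inl ⟨rfl, rfl, by omega, by omega⟩)⟩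
        rw [← e2 _ (by omega)]; congr 1; omega
      by_cases h3 : t ≤ A + B + C
      · refine ⟨2, 2, t - (A + B), ?_, by omega, Or.inr (Or.inr (Or.inl ⟨rfl, rfl, by omega, by omega⟩))⟩
        rw [← e3 _ (by omega)]; congr 1; omega
      · refine ⟨1, 2, A + B + C + D - t, ?_, by omega, Or.inr (Or.inr (Or.inr ⟨rfl, rfl, by omega, by omega, by omega⟩))⟩
        rw [← e4 _ (by omega) (by omega)]; congr 1; omega
    intro t ht t' ht' e
    obtain ⟨i, j, s, h1, h2, h3⟩ := co t ht
    obtain ⟨i', j', s', h1', h2', h3'⟩ := co t' ht'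
    have hu := T.uniq i j s i' j' s' h2 h2' (by rw [← h1, ← h1', e])
    rcases h3 with ⟨rfl, rfl, h3⟩ | ⟨rfl, rfl, h3⟩ | ⟨rfl, rfl, h3⟩ | ⟨rfl, rfl, h3⟩ <;>
      rcases h3' with ⟨rfl, rfl, h3'⟩ | ⟨rfl, rfl, h3'⟩ | ⟨rfl, rfl, h3'⟩ | ⟨rfl, rfl, h3'⟩ <;>
      simp at hu <;> omega
  · have key : ∀ u v, G.Adj u v → T.cl u v → u = T.a 0 ∨ u = T.b 0 ∨ v = T.a 0 ∨ v = T.b 0 ∨ Rel g (A + B + C + D) u v := by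
      rintro u v huv (⟨i, j, s, hs, rfl, rfl⟩ | ⟨i, k, hik, rfl, rfl⟩ | ⟨i, k, hik, rfl, rfl⟩ | ⟨i, j, k, hk, hu, rfl⟩ | ⟨i, j, k, hk, hu, rfl⟩)
      · by_cases hi : i = 0
        · subst hi
          have : s = 0 := by have := h.row j; omega
          subst this; left; exact T.p0 0 j
        by_cases hj : j = 0
        · subst hj
          have := h.col i
          have : s = 0 ∧ T.n i 0 = 1 := by omega
          obtain ⟨rfl, q⟩ := this
          right; right; right; left
          have := T.pn i 0; rwa [q] at this
        exact Or.inr (Or.inr (Or.inr (Or.inr (hp2 i j s hi hj hs))))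
      · rcases h.haa i k hik huv with rfl | rfl <;> simp
      · rcases h.hbb i k hik huv with rfl | rfl <;> simp
      · have := h.hA i j k hk ⟨u, hu, _, rfl, huv⟩
        subst this; simp
      · have := h.hB i j k hk ⟨u, hu, _, rfl, huv⟩
        subst this; simp
    intro u v huv
    rcases TK.classify hF T huv with hc | hc
    · exact key u v huv hc
    · rcases key v u huv.symm hc with h | h | h | h | h
      · exact Or.inr (Or.inr (Or.inl h))
      · exact Or.inr (Or.inr (Or.inr (Or.inl h)))
      · exact Or.inl h
      · exact Or.inr (Or.inl h)
      · exact Or.inr (Or.inr (Or.inr (Or.inr h.symm)))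

theorem TK.T2.dw (hF : Fr G) {T : TK G} {k m : Fin 3} (h : T.T2 k m) :
    ∃ n, 3 ≤ n ∧ IsMinor G (doubleWheel n) := by
  obtain ⟨σ, rfl⟩ := perm1 k
  obtain ⟨τ, rfl⟩ := perm1 m
  exact h.perm.dw0 hF
end DW

section W
variable {V : Type} {G : SimpleGraph V}

/-- one column of the structure as a wheel -/
lemma column (T : TK G) (j h i1 i2 : Fin 3) (h1 : i1 ≠ h) (h2 : i2 ≠ h) (h12 : i1 ≠ i2) (hs : ¬ 1 < T.n h j) :
    ∃ (N : ℕ) (c : ℕ → V), 3 ≤ N ∧ (∀ t < N, ∀ t' < N, c t = c t' → t = t') ∧ (∀ t < N, c t ≠ T.a h) ∧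
      (∀ v, (v = T.a h ∨ ∃ t < N, v = c t) ↔ ((∃ i, v = T.a i) ∨ v = T.b j ∨ ∃ i, v ∈ T.I i j)) ∧
      (∀ i s, i ≠ h → s < T.n i j → Rel c N (T.p i j s) (T.p i j (s+1))) ∧ Rel c N (T.a i1) (T.a i2) := by
  obtain ⟨A, hA⟩ : ∃ A, A = T.n i1 j := ⟨_, rfl⟩
  obtain ⟨B, hB⟩ : ∃ B, B = T.n i2 j := ⟨_, rfl⟩
  have pA : 1 ≤ A := hA ▸ T.pos _ _
  have pB : 1 ≤ B := hB ▸ T.pos _ _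
  let c : ℕ → V := fun t => if t ≤ A then T.p i1 j t else T.p i2 j (A + B - t)
  have b1 : T.p i1 j A = T.p i2 j B := by rw [hA, hB, T.pn, T.pn]
  have e1 : ∀ s, s ≤ A → c s = T.p i1 j s := fun s hs => by simp only [c]; rw [if_pos hs]
  have e2 : ∀ s, s ≤ B → c (A + B - s) = T.p i2 j s := fun s hs => by
    simp only [c]
    by_cases hs' : s = B
    · subst hs'; rw [if_pos (by omega), ← b1]; congr 1; omega
    · rw [if_neg (by omega)]; congr 1; omega
  have co : ∀ t < A + B + 1, ∃ i s, c t = T.p i j s ∧ s ≤ T.n i j ∧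
      ((i = i1 ∧ t = s) ∨ (i = i2 ∧ t = A + B - s ∧ s < B)) := by
    intro t ht
    by_cases h1 : t ≤ A
    · exact ⟨i1, t, e1 t h1, by omega, Or.inl ⟨rfl, rfl⟩⟩
    · refine ⟨i2, A + B - t, ?_, by omega, Or.inr ⟨rfl, by omega, by omega⟩⟩
      rw [← e2 _ (by omega)]; congr 1; omega
  have hp : ∀ i s, i ≠ h → s ≤ T.n i j → ∃ t < A + B + 1, T.p i j s = c t := by
    intro i s hi hs
    have : i = i1 ∨ i = i2 := by omega
    rcases this with rfl | rfl
    · exact ⟨s, by omega, (e1 s (by omega)).symm⟩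
    · exact ⟨_, by omega, (e2 s (by omega)).symm⟩
  refine ⟨A + B + 1, c, by omega, ?_, ?_, ?_, ?_, ?_⟩
  · intro t ht t' ht' e
    obtain ⟨i, s, h1, h2, h3⟩ := co t ht
    obtain ⟨i', s', h1', h2', h3'⟩ := co t' ht'
    have hu := T.uniq i j s i' j s' h2 h2' (by rw [← h1, ← h1', e])
    rcases h3 with ⟨rfl, h3⟩ | ⟨rfl, h3⟩ <;> rcases h3' with ⟨rfl, h3'⟩ | ⟨rfl, h3'⟩
    · omega
    · rcases hu with hu | hu | hu
      · exact (h12 hu.1).elim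
      · exact (h12 hu.2.2).elim
      · omega
    · rcases hu with hu | hu | hu
      · exact (h12 hu.1.symm).elim
      · exact (h12 hu.2.2.symm).elim
      · omega
    · omega
  · intro t ht e
    obtain ⟨i, s, q1, q2, q3⟩ := co t ht
    have hi : i ≠ h := by rcases q3 with ⟨rfl, _⟩ | ⟨rfl, _⟩ <;> assumption
    have hu := T.uniq i j s h j 0 q2 (by omega) (by rw [← q1, e, T.p0])
    have := T.pos h j
    rcases hu with hu | hu | hu
    · exact hi hu.1
    · exact hi hu.2.2
    · omega
  · intro v
    constructor
    · rintro (rfl | ⟨t, ht, rfl⟩)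
      · exact Or.inl ⟨h, rfl⟩
      · obtain ⟨i, s, q1, q2, q3⟩ := co t ht
        rw [q1]
        by_cases h0 : s = 0
        · subst h0; exact Or.inl ⟨i, T.p0 i j⟩
        by_cases hn : s = T.n i j
        · subst hn; exact Or.inr (Or.inl (T.pn i j))
        · exact Or.inr (Or.inr ⟨i, s, by omega, by omega, rfl⟩)
    · rintro (⟨i, rfl⟩ | rfl | ⟨i, s, q1, q2, rfl⟩)
      · by_cases hi : i = h
        · subst hi; exact Or.inl rfl
        · right; rw [← T.p0 i j]; exact hp i 0 hi (by omega)
      · right; rw [← T.pn i1 j]; exact hp i1 _ h1 (by omega)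
      · right
        refine hp i s ?_ (by omega)
        rintro rfl; omega
  · intro i s hi hs
    have : i = i1 ∨ i = i2 := by omega
    rcases this with rfl | rfl
    · refine ⟨s, by omega, Or.inl ⟨(e1 s (by omega)).symm, ?_⟩⟩
      rw [Nat.mod_eq_of_lt (by omega), e1 (s+1) (by omega)]
    · refine ⟨A + B - (s+1), by omega, Or.inr ⟨(e2 _ (by omega)).symm, ?_⟩⟩
      rw [Nat.mod_eq_of_lt (by omega), show A + B - (s+1) + 1 = A + B - s by omega, e2 _ (by omega)]
  · refine ⟨A + B, by omega, Or.inr ⟨?_, ?_⟩⟩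
    · rw [← T.p0 i2 j, ← e2 0 (by omega)]; rfl
    · rw [Nat.mod_self, e1 0 (by omega), T.p0]

theorem TK.T3.cw (hF : Fr G) {T : TK G} {h : Fin 3 → Fin 3} (hT : T.T3 h) :
    ∃ (U : Type) (H : SimpleGraph U), InClassW H ∧ IsMinor G H := by
  classical
  have col := fun j => column T j (h j) (h j + 1) (h j + 2) ((by decide : ∀ x : Fin 3, x + 1 ≠ x) _)
    ((by decide : ∀ x : Fin 3, x + 2 ≠ x) _) ((by decide : ∀ x : Fin 3, x + 1 ≠ x + 2) _) (hT.short j)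
  choose N c hN hinj hhub hW hcons htri using col
  let Wm : Fin 3 → V → Prop := fun j v => v = T.a (h j) ∨ ∃ t < N j, v = c j t
  let w : Fin 3 → V → V → Prop := fun j u v => (u = T.a (h j) ∧ Wm j v) ∨ (v = T.a (h j) ∧ Wm j u) ∨ Rel (c j) (N j) u v
  have wsymm : ∀ j u v, w j u v → w j v u := by
    rintro j u v (h | h | h)
    · exact Or.inr (Or.inl h)
    · exact Or.inl h
    · exact Or.inr (Or.inr h.symm)
  have wmem : ∀ j u v, w j u v → Wm j u ∧ Wm j v := by
    rintro j u v (⟨h1, h2⟩ | ⟨h1, h2⟩ | ⟨t, ht, h⟩)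
    · exact ⟨Or.inl h1, h2⟩
    · exact ⟨h2, Or.inl h1⟩
    · have hm : (t+1) % N j < N j := Nat.mod_lt _ (by omega)
      rcases h with ⟨h1, h2⟩ | ⟨h1, h2⟩
      · exact ⟨Or.inr ⟨_, ht, h1⟩, Or.inr ⟨_, hm, h2⟩⟩
      · exact ⟨Or.inr ⟨_, hm, h2⟩, Or.inr ⟨_, ht, h1⟩⟩
  have wa : ∀ j i, Wm j (T.a i) := fun j i => (hW j _).2 (Or.inl ⟨i, rfl⟩)
  have wtri : ∀ j i i', i ≠ i' → w j (T.a i) (T.a i') := by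
    intro j i i' hne
    by_cases e1 : i = h j
    · exact Or.inl ⟨by rw [e1], wa j _⟩
    by_cases e2 : i' = h j
    · exact Or.inr (Or.inl ⟨by rw [e2], wa j _⟩)
    right; right
    have : ∀ x i i' : Fin 3, i ≠ i' → i ≠ x → i' ≠ x → (i = x + 1 ∧ i' = x + 2) ∨ (i = x + 2 ∧ i' = x + 1) := by decide
    rcases this _ _ _ hne e1 e2 with ⟨rfl, rfl⟩ | ⟨rfl, rfl⟩
    · exact htri j
    · exact (htri j).symm
  let H : SimpleGraph V :=
    { Adj := fun u v => u ≠ v ∧ ∃ j, w j u v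
      symm := ⟨fun u v ⟨h1, j, h2⟩ => ⟨h1.symm, j, wsymm j u v h2⟩⟩
      loopless := ⟨fun u h => h.1 rfl⟩ }
  have hP : ∀ v, ∃ q : Fin 4, (q = 0 ↔ ∃ i, v = T.a i) ∧ ∀ j : Fin 3, (q = j.succ ↔ (v = T.b j ∨ ∃ i, v ∈ T.I i j)) := by
    intro v
    rcases T.cases v with ⟨i, rfl⟩ | ⟨j, rfl⟩ | ⟨i, j, hv⟩
    · refine ⟨0, by simp, fun j => ⟨fun h => by simpa using h.symm, ?_⟩⟩
      rintro (h | ⟨i', h⟩)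
      · exact (T.ab_ne h).elim
      · exact (T.a_notI h).elim
    · refine ⟨j.succ, ⟨fun h => by simp at h, ?_⟩, fun j' => ⟨?_, ?_⟩⟩
      · rintro ⟨i, h⟩; exact (T.ab_ne h.symm).elim
      · intro h; left; rw [Fin.succ_inj.1 h]
      · rintro (h | ⟨i', h⟩)
        · rw [T.b_inj h]
        · exact (T.b_notI h).elim
    · refine ⟨j.succ, ⟨fun h => by simp at h, ?_⟩, fun j' => ⟨?_, ?_⟩⟩
      · rintro ⟨i, rfl⟩; exact (T.a_notI hv).elim
      · intro h; right; rw [← Fin.succ_inj.1 h]; exact ⟨i, hv⟩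
      · rintro (rfl | ⟨i', h⟩)
        · exact (T.b_notI hv).elim
        · rw [(T.I_disj hv h).2]
  choose P hP0 hP1 using hP
  have hset : ∀ j v, (P v = 0 ∨ P v = j.succ) ↔ Wm j v := by
    intro j v
    rw [hP0, hP1]; exact (hW j v).symm
  refine ⟨V, H, ⟨P, ?_, ?_, ?_, ?_⟩, isMinor_of_map id Function.injective_id ?_⟩
  · have : P ⁻¹' {0} = T.a '' Set.univ := by
      ext v
      simp only [Set.mem_preimage, Set.mem_singleton_iff, hP0, Set.image_univ, Set.mem_range]
      constructor <;> rintro ⟨i, e⟩ <;> exact ⟨i, e.symm⟩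
    rw [this, Set.ncard_image_of_injective _ (fun i i' e => T.a_inj e)]
    simp
  · intro x y hx hy hne
    obtain ⟨i, rfl⟩ := (hP0 x).1 hx
    obtain ⟨i', rfl⟩ := (hP0 y).1 hy
    exact ⟨hne, 0, wtri 0 i i' (fun e => hne (by rw [e]))⟩
  · intro q hq
    obtain ⟨j, rfl⟩ := Fin.exists_succ_eq.2 hq
    refine ⟨N j, hN j, ?_⟩
    have hx : ∀ o : Option (Fin (N j)), P (o.elim (T.a (h j)) (fun t => c j t)) = 0 ∨
        P (o.elim (T.a (h j)) (fun t => c j t)) = j.succ := by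
      intro o
      rw [hset]
      cases o with
      | none => exact Or.inl rfl
      | some t => exact Or.inr ⟨t, t.2, rfl⟩
    let e : Option (Fin (N j)) → {v | P v = 0 ∨ P v = j.succ} := fun o => ⟨o.elim (T.a (h j)) (fun t => c j t), hx o⟩
    have hbij : Function.Bijective e := by
      constructor
      · intro o o' he
        have he' : o.elim (T.a (h j)) (fun t => c j t) = o'.elim (T.a (h j)) (fun t => c j t) := congrArg Subtype.val he
        cases o <;> cases o' <;> simp only [Option.elim] at he'
        · rfl
        · exact (hhub j _ (Fin.is_lt _) he'.symm).elim
        · exact (hhub j _ (Fin.is_lt _) he').elim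
        · rw [Fin.ext (hinj j _ (Fin.is_lt _) _ (Fin.is_lt _) he')]
      · rintro ⟨v, hv⟩
        rcases (hset j v).1 hv with rfl | ⟨t, ht, rfl⟩
        · exact ⟨none, rfl⟩
        · exact ⟨some ⟨t, ht⟩, rfl⟩
    have hadj : ∀ o o', (H.induce {v | P v = 0 ∨ P v = j.succ}).Adj (e o) (e o') ↔ (wheelGraph (N j)).Adj o o' := by
      intro o o'
      have hne : (e o).1 ≠ (e o').1 ↔ o ≠ o' := by
        rw [not_iff_not]; exact ⟨fun h => hbij.1 (Subtype.ext h), fun h => by rw [h]⟩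
      have hw : (∃ j', w j' (e o).1 (e o').1) ∧ (e o).1 ≠ (e o').1 ↔ w j (e o).1 (e o').1 ∧ (e o).1 ≠ (e o').1 := by
        constructor
        · rintro ⟨⟨j', h'⟩, hne'⟩
          refine ⟨?_, hne'⟩
          by_cases hj : j' = j
          · subst hj; exact h'
          obtain ⟨m1, m2⟩ := wmem _ _ _ h'
          have inter : ∀ v, Wm j v → Wm j' v → ∃ i, v = T.a i := by
            intro v q1 q2
            rw [← hset] at q1 q2
            rw [← hP0]
            rcases q1 with q1 | q1
            · exact q1
            · rcases q2 with q2 | q2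
              · exact q2
              · rw [q1] at q2; exact (hj (Fin.succ_inj.1 q2).symm).elim
          obtain ⟨i, q1⟩ := inter _ ((hset j _).1 (e o).2) m1
          obtain ⟨i', q2⟩ := inter _ ((hset j _).1 (e o').2) m2
          rw [q1, q2] at hne' ⊢
          exact wtri j i i' (fun e => hne' (by rw [e]))
        · rintro ⟨h1, h2⟩; exact ⟨⟨j, h1⟩, h2⟩
      have hl : (H.induce {v | P v = 0 ∨ P v = j.succ}).Adj (e o) (e o') ↔ w j (e o).1 (e o').1 ∧ (e o).1 ≠ (e o').1 := by
        rw [← hw]; exact and_comm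
      rw [hl, hne, wheelGraph, fromRel_adj, and_comm]
      refine and_congr_right fun hoo => ?_
      have hm : ∀ t, (t+1) % N j < N j := fun t => Nat.mod_lt _ (by have := hN j; omega)
      constructor
      · rintro (⟨q1, q2⟩ | ⟨q1, q2⟩ | ⟨t, ht, q⟩)
        · cases o with
          | some t => exact (hhub j t t.2 q1).elim
          | none =>
            cases o' with
            | none => exact (hoo rfl).elim
            | some t => left; trivial
        · cases o' with
          | some t => exact (hhub j t t.2 q1).elim
          | none =>
            cases o with
            | none => exact (hoo rfl).elim
            | some t => right; trivial
        · cases o with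
          | none =>
            rcases q with ⟨q, _⟩ | ⟨_, q⟩
            · exact (hhub j t ht q.symm).elim
            · exact (hhub j _ (hm t) q.symm).elim
          | some s =>
            cases o' with
            | none =>
              rcases q with ⟨_, q⟩ | ⟨q, _⟩
              · exact (hhub j _ (hm t) q.symm).elim
              · exact (hhub j t ht q.symm).elim
            | some s' =>
              rcases q with ⟨q, q'⟩ | ⟨q, q'⟩
              · left
                have a1 := hinj j _ s.2 _ ht q
                have a2 := hinj j _ s'.2 _ (hm t) q'
                show s'.val = (s.val + 1) % N j
                rw [a2, a1]
              · right
                have a1 := hinj j _ s'.2 _ ht q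
                have a2 := hinj j _ s.2 _ (hm t) q'
                show s.val = (s'.val + 1) % N j
                rw [a2, a1]
      · intro q
        cases o with
        | none =>
          exact Or.inl ⟨rfl, (hset j _).1 (e o').2⟩
        | some s =>
          cases o' with
          | none => exact Or.inr (Or.inl ⟨rfl, (hset j _).1 (e (some s)).2⟩)
          | some s' =>
            right; right
            rcases q with q | q
            · refine ⟨s, s.2, Or.inl ⟨rfl, ?_⟩⟩
              have q : s'.val = (s.val + 1) % N j := q
              rw [← q]; rfl
            · refine ⟨s', s'.2, Or.inr ⟨rfl, ?_⟩⟩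
              have q : s.val = (s'.val + 1) % N j := q
              rw [← q]; rfl
    exact ⟨(⟨Equiv.ofBijective e hbij, fun {o o'} => hadj o o'⟩ : wheelGraph (N j) ≃g H.induce {v | P v = 0 ∨ P v = j.succ}).symm⟩
  · rintro x y ⟨hne, j, hw⟩
    obtain ⟨m1, m2⟩ := wmem _ _ _ hw
    exact ⟨j.succ, Fin.succ_ne_zero j, (hset j x).2 m1, (hset j y).2 m2⟩
  · have key : ∀ u v, G.Adj u v → T.cl u v → ∃ j, w j u v := by
      rintro u v huv (⟨i, j, s, hs, rfl, rfl⟩ | ⟨i, k, hik, rfl, rfl⟩ | ⟨i, k, hik, rfl, rfl⟩ | ⟨i, j, k, hk, hu, rfl⟩ | ⟨i, j, k, hk, hu, rfl⟩)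
      · by_cases hi : i = h j
        · subst hi
          have h1 := hT.short j
          have : s = 0 ∧ T.n (h j) j = 1 := by omega
          obtain ⟨rfl, q⟩ := this
          refine ⟨j, Or.inl ⟨T.p0 _ _, ?_⟩⟩
          have := T.pn (h j) j
          rw [q] at this
          rw [this]; exact (hW j _).2 (Or.inr (Or.inl rfl))
        · exact ⟨j, Or.inr (Or.inr (hcons j i s hi hs))⟩
      · exact ⟨0, wtri 0 i k hik⟩
      · exact (hT.hbb i k hik huv).elim
      · have := hT.hA i j k hk ⟨u, hu, _, rfl, huv⟩
        subst this
        exact ⟨j, Or.inr (Or.inl ⟨rfl, (hW j _).2 (Or.inr (Or.inr ⟨i, hu⟩))⟩)⟩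
      · exact (hT.hB i j k hk ⟨u, hu, _, rfl, huv⟩).elim
    intro u v huv
    refine ⟨huv.ne, ?_⟩
    rcases TK.classify hF T huv with hc | hc
    · exact key u v huv hc
    · obtain ⟨j, hw⟩ := key v u huv.symm hc
      exact ⟨j, wsymm _ _ _ hw⟩

end W
end AP

set_option linter.all false
namespace AP

section Mob
variable {V : Type*} {G : SimpleGraph V}

def nx (m k : ℕ) : ℕ := if k + 1 = m then 0 else k + 1
def pv (m k : ℕ) : ℕ := if k = 0 then m - 1 else k - 1
def dst (m k l : ℕ) : ℕ := if k ≤ l then l - k else l + m - k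

/-- a base graph: a Hamilton cycle with chords, together with a pool of minor certificates -/
structure BD where
  m : ℕ
  d1 : ℕ → ℕ
  d2 : ℕ → ℕ
  al : ℕ → ℕ → Bool
  pool : List (List (List ℕ))

namespace BD
variable (D : BD)

def badB (n : ℕ) (E : List (ℕ × ℕ)) : Bool :=
  D.pool.any fun c => chk n E 7 K33E c || chk n E 8 K33hE c || chk n E 7 K5hE c

def rimE : List (ℕ × ℕ) := (List.range D.m).map fun j => (j, nx D.m j)

def chE (P : ℕ → ℕ → Bool) : List (ℕ × ℕ) :=
  (((List.range D.m).map fun j => (j, D.d1 j)) ++ ((List.range D.m).map fun j => (j, D.d2 j))).filter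
    fun c => P c.1 c.2

def dropE (k d : ℕ) : List (ℕ × ℕ) :=
  D.rimE ++ D.chE fun a b => !((a == k && b == d) || (a == d && b == k))

def rsE (k : ℕ) : List (ℕ × ℕ) :=
  D.rimE ++ (D.chE fun a b => !(a == k || b == k)) ++ [(D.m, k), (D.m, D.d1 k), (D.m, D.d2 k)]

def exE (L : List (ℕ × ℕ)) : List (ℕ × ℕ) := D.rimE ++ (D.chE fun _ _ => true) ++ L

def wrE (k l1 l2 : ℕ) (b1 b2 : Bool) : List (ℕ × ℕ) :=
  ((List.range D.m).map fun j => (if j = k then D.m else j, nx D.m j)) ++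
    (D.chE fun a b => !(a == k || b == k)) ++
    [(k, D.m), (k, l1), (D.m, l2), (bif b1 then k else D.m, D.d1 k), (bif b2 then k else D.m, D.d2 k)]

def parc (k l x y d : ℕ) : ℕ × ℕ :=
  if d = l then (k, x) else (if dst D.m k l < dst D.m k d then x else k, d)

def parE (k l : ℕ) : List (ℕ × ℕ) :=
  ((List.range D.m).map fun j => (if j = k then D.m else if j = l then D.m + 1 else j, nx D.m j)) ++
    (D.chE fun a b => !(a == k || b == k || a == l || b == l)) ++
    [(k, D.m), (l, D.m + 1), (k, D.m + 1), (D.m, l),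
      D.parc k l D.m (D.m+1) (D.d1 k), D.parc k l D.m (D.m+1) (D.d2 k),
      D.parc l k (D.m+1) D.m (D.d1 l), D.parc l k (D.m+1) D.m (D.d2 l)]

structure OK : Prop where
  hm : 5 ≤ D.m
  lt1 : ∀ k < D.m, D.d1 k < D.m ∧ D.d1 k ≠ k ∧ (D.d1 (D.d1 k) = k ∨ D.d2 (D.d1 k) = k)
  lt2 : ∀ k < D.m, D.d2 k < D.m ∧ D.d2 k ≠ k ∧ (D.d1 (D.d2 k) = k ∨ D.d2 (D.d2 k) = k)
  ald : ∀ k < D.m, D.al k (D.d1 k) = true ∧ D.al k (D.d2 k) = true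
  alk : ∀ k < D.m, ∀ l < D.m, D.al k l = true → D.al l k = true ∧ l ≠ k ∧ l ≠ nx D.m k ∧ l ≠ pv D.m k
  dr : ∀ k < D.m, D.badB (D.m+1) (D.dropE k (D.d1 k)) = true ∧ D.badB (D.m+1) (D.dropE k (D.d2 k)) = true
  rs : ∀ k < D.m, D.badB (D.m+1) (D.rsE k) = true
  ex : ∀ k < D.m, ∀ l < D.m, (l ≠ k ∧ l ≠ nx D.m k ∧ l ≠ pv D.m k ∧ D.al k l = false) →
    D.badB D.m (D.exE [(k, l)]) = true
  wr : ∀ k < D.m, ∀ l1 < D.m, ∀ l2 < D.m, (D.al k l1 = true ∧ D.al k l2 = true ∧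
    dst D.m k l2 < dst D.m k l1) → ∀ b1 b2 : Bool, D.badB (D.m+1) (D.wrE k l1 l2 b1 b2) = true
  par : ∀ k < D.m, ∀ l < D.m, k < l → D.al k l = true → D.badB (D.m+2) (D.parE k l) = true
  two : ∀ k < D.m, ∀ l < D.m, (k < l ∧ D.al k l = true) → ∀ k' < D.m, ∀ l' < D.m,
    (k < k' ∧ k' ≠ l ∧ k' < l' ∧ l' ≠ l ∧ D.al k' l' = true ∧ (l < k' ∨ l' < l)) → D.badB D.m (D.exE [(k, l), (k', l')]) = true

end BD

def bV8 : BD where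
  m := 8
  d1 := fun k => (k + 4) % 8
  d2 := fun k => (k + 4) % 8
  al := fun k l => [3,4,5].contains (dst 8 k l)
  pool := [  [[0,1],[3],[6],[2],[4,5],[7],[8]], [[0],[1,5,6],[3],[4],[7],[8],[2]], [[0,7],[5],[8],[1],[2,6],[4],[3]],
  [[0,1],[6],[8],[2],[3,7],[5],[4]], [[0],[6],[8],[2,3],[4,5],[7],[1]], [[0],[3],[8],[1,2,5],[4],[7],[6]],
  [[0],[2,3,6],[5],[1],[4],[8],[7]], [[1],[3,4,7],[6],[2],[5],[8],[0]], [[0,4,5],[2],[7],[3],[6],[8],[1]],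
  [[0,7],[1,2],[4],[3],[5],[8],[6]], [[0,1],[2,3],[5],[4],[6],[8],[7]], [[1,2],[3,4],[6],[5],[7],[8],[0]],
  [[0,1,4],[3],[6],[2],[7],[8],[5]], [[0],[3,4],[5,6],[1],[7],[8],[2]], [[0,4,7],[2],[8],[1],[5],[6],[3]],
  [[0,1,5],[3],[8],[2],[6],[7],[4]], [[0,1],[3],[7],[2,6],[4],[8],[5]], [[0],[3],[5,6],[1,2],[4],[7],[8]],
  [[0,7],[2,3],[5],[1],[4],[6],[8]], [[0],[3],[6],[2],[4,5],[7],[1]], [[0],[2,3],[5],[1],[4],[6],[7]],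
  [[0],[3],[5,6],[1],[4],[7],[2]], [[1],[3,4],[6],[2],[5],[7],[0]], [[0,7],[2],[5],[1],[4],[6],[3]],
  [[0,1],[3],[6],[2],[5],[7],[4]], [[0,1],[3],[6],[2],[4],[7],[5]], [[0],[3],[5],[1,2],[4],[7],[6]],
  [[0,7],[2,3],[4,5],[6],[8],[9],[1]], [[0,7],[1,2,5],[4],[3],[8],[9],[6]], [[0,7],[1,2,3],[5],[4],[8],[9],[6]],
  [[1,2],[4],[7],[0],[3],[5],[6]], [[2,3],[0],[5],[1],[4],[7],[6]], [[0,1],[3,4],[5,6],[7],[8],[9],[2]],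
  [[0,1],[2,3,6],[5],[4],[8],[9],[7]], [[0,1],[2,3,4],[6],[5],[8],[9],[7]], [[0,4],[2],[6],[1],[5],[3],[7]],
  [[0,1,4,7],[8],[9],[2],[5],[6],[3]], [[0,1,5],[8],[9],[2],[3,7],[6],[4]], [[2],[3,4,5],[7],[6],[8],[9],[0,1]],
  [[0,1],[3],[6],[2],[7],[4],[5]], [[0,1,2],[8],[9],[3],[6],[7],[4]], [[0,1,4],[3],[7],[2,6],[8],[9],[5]],
  [[0,1,2],[4],[7],[3],[8],[9],[5]]]

def bX7 : BD where
  m := 7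
  d1 := fun k => [3,5,6,0,1,2,3].getD k 0
  d2 := fun k => [3,4,5,6,1,1,2].getD k 0
  al := fun k l => [3,4].contains (dst 7 k l) || (k == 1 && l == 3) || (k == 3 && l == 1)
  pool := [  [[0],[2],[4,5],[1],[3],[6],[7]], [[0,1],[2],[4],[3],[5],[7],[6]], [[0],[2],[7],[1,4],[3],[6],[5]],
  [[0,6],[2],[4],[1],[3],[5],[7]], [[2],[1],[3],[0],[4],[7],[6],[5]], [[2],[1],[7],[0],[4],[3],[6],[5]],
  [[0,6],[1],[3],[2],[4],[7],[5]], [[0,1],[6],[7],[2],[3],[5],[4]], [[0],[4],[5],[1],[2,3],[7],[6]],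
  [[1],[5],[6],[2],[3,4],[7],[0]], [[0,1],[2],[6],[3],[5],[7],[4]], [[1],[3],[6],[0],[2],[4],[5]],
  [[0],[2],[4],[1],[3],[5],[6]], [[1],[3],[5],[2],[4],[6],[0]], [[3],[1],[5],[2],[4],[0],[6]],
  [[0],[2],[5],[1],[3],[6],[4]], [[0],[2],[4],[1],[3],[6],[5]], [[0,6],[1,4],[3],[2],[7],[8],[5]],
  [[0,6],[1,2],[4],[3],[7],[8],[5]], [[0],[3],[5],[1],[4],[6],[2]], [[4],[0],[2],[1],[6],[3],[7],[5]],
  [[0,1],[3],[4,5],[6],[7],[8],[2]], [[0,1],[4],[5],[2,3],[7],[8],[6]], [[0,1],[2,3],[5],[4],[7],[8],[6]],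
  [[5],[1],[3],[0],[2],[4],[6],[7]], [[0,1],[7],[8],[2],[5],[6],[3]], [[0,1,3],[2],[6],[5],[7],[8],[4]],
  [[0],[2],[4],[3],[5],[1],[7],[6]], [[0,1],[3],[6],[2],[7],[8],[4]]]

set_option synthInstance.maxSize 10000 in
set_option synthInstance.maxHeartbeats 400000 in
set_option maxRecDepth 100000 in
lemma bV8_ok : bV8.OK := by
  refine ⟨?_, ?_, ?_, ?_, ?_, ?_, ?_, ?_, ?_, ?_, ?_⟩ <;> decide +kernel

set_option synthInstance.maxSize 10000 in
set_option synthInstance.maxHeartbeats 400000 in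
set_option maxRecDepth 100000 in
lemma bX7_ok : bX7.OK := by
  refine ⟨?_, ?_, ?_, ?_, ?_, ?_, ?_, ?_, ?_, ?_, ?_⟩ <;> decide +kernel

end Mob
end AP

set_option linter.all false
namespace AP

section Mob
variable {V : Type*} {G : SimpleGraph V}

structure Ph (G : SimpleGraph V) : Prop where
  k33i : ¬ HasM G 7 K33E
  k33h : ¬ HasM G 8 K33hE
  k5h : ¬ HasM G 7 K5hE

lemma Ph.bad (hP : Ph G) {D : BD} {n : ℕ} {E : List (ℕ × ℕ)} (h : D.badB n E = true) (hM : HasM G n E) : False := by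
  unfold BD.badB at h
  simp only [List.any_eq_true, Bool.or_eq_true] at h
  obtain ⟨c, _, (h | h) | h⟩ := h
  · exact hP.k33i (hM.chk _ h)
  · exact hP.k33h (hM.chk _ h)
  · exact hP.k5h (hM.chk _ h)

structure BM (G : SimpleGraph V) (D : BD) (R : ℕ → Set V) : Prop where
  ok : D.OK
  ph : Ph G
  mod : Mod G D.m R
  cov : ∀ v, ∃ k < D.m, v ∈ R k
  rim : ∀ k < D.m, Tch G (R k) (R (nx D.m k))
  c1 : ∀ k < D.m, Tch G (R k) (R (D.d1 k))
  c2 : ∀ k < D.m, Tch G (R k) (R (D.d2 k))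

lemma nx_lt {m k : ℕ} (h : k < m) : nx m k < m := by unfold nx; split <;> omega
lemma pv_lt {m k : ℕ} (h : k < m) : pv m k < m := by unfold pv; split <;> omega
lemma nx_pv {m k : ℕ} (h : k < m) : nx m (pv m k) = k := by unfold pv; split_ifs <;> unfold nx <;> split_ifs <;> omega
lemma pv_nx {m k : ℕ} (h : k < m) : pv m (nx m k) = k := by
  by_cases e : k + 1 = m
  · simp only [nx, e, pv, if_true]; omega
  · simp [nx, e, pv]
lemma nx_ne {m k : ℕ} (hm : 5 ≤ m) (h : k < m) : nx m k ≠ k := by unfold nx; split_ifs <;> omega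
lemma pv_ne {m k : ℕ} (hm : 5 ≤ m) (h : k < m) : pv m k ≠ k := by unfold pv; split_ifs <;> omega
lemma pv_ne_nx {m k : ℕ} (hm : 5 ≤ m) (h : k < m) : pv m k ≠ nx m k := by unfold nx pv; split_ifs <;> omega

namespace BD
variable {D : BD}

lemma mem_rimE {p : ℕ × ℕ} : p ∈ D.rimE ↔ ∃ j < D.m, p = (j, nx D.m j) := by
  unfold rimE; simp only [List.mem_map, List.mem_range]
  exact ⟨fun ⟨j, h, e⟩ => ⟨j, h, e.symm⟩, fun ⟨j, h, e⟩ => ⟨j, h, e.symm⟩⟩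

lemma mem_chE {P : ℕ → ℕ → Bool} {p : ℕ × ℕ} : p ∈ D.chE P ↔
    (∃ j < D.m, p = (j, D.d1 j) ∨ p = (j, D.d2 j)) ∧ P p.1 p.2 = true := by
  unfold chE; simp only [List.mem_filter, List.mem_append, List.mem_map, List.mem_range]
  constructor
  · rintro ⟨(⟨j, h, e⟩ | ⟨j, h, e⟩), hp⟩
    · exact ⟨⟨j, h, Or.inl e.symm⟩, hp⟩
    · exact ⟨⟨j, h, Or.inr e.symm⟩, hp⟩
  · rintro ⟨⟨j, h, (e | e)⟩, hp⟩
    · exact ⟨Or.inl ⟨j, h, e.symm⟩, hp⟩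
    · exact ⟨Or.inr ⟨j, h, e.symm⟩, hp⟩
end BD

namespace BM
variable {D : BD} {R : ℕ → Set V}

lemma prv (B : BM G D R) {k : ℕ} (hk : k < D.m) : Tch G (R k) (R (pv D.m k)) := by
  have := B.rim _ (pv_lt hk); rw [nx_pv hk] at this; exact this.symm

/-- chords are symmetric -/
lemma chsym (B : BM G D R) {j d : ℕ} (hj : j < D.m) (h : d = D.d1 j ∨ d = D.d2 j) :
    d < D.m ∧ d ≠ j ∧ (j = D.d1 d ∨ j = D.d2 d) ∧ Tch G (R j) (R d) ∧ D.al j d = true := by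
  rcases h with rfl | rfl
  · obtain ⟨a, b, c⟩ := B.ok.lt1 j hj
    exact ⟨a, b, c.imp Eq.symm Eq.symm, B.c1 j hj, (B.ok.ald j hj).1⟩
  · obtain ⟨a, b, c⟩ := B.ok.lt2 j hj
    exact ⟨a, b, c.imp Eq.symm Eq.symm, B.c2 j hj, (B.ok.ald j hj).2⟩

lemma chmem (B : BM G D R) {P : ℕ → ℕ → Bool} {p : ℕ × ℕ} (hp : p ∈ D.chE P) :
    p.1 < D.m ∧ p.2 < D.m ∧ p.2 ≠ p.1 ∧ (p.2 = D.d1 p.1 ∨ p.2 = D.d2 p.1) ∧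
     (p.1 = D.d1 p.2 ∨ p.1 = D.d2 p.2) ∧ Tch G (R p.1) (R p.2) ∧ P p.1 p.2 = true := by
  obtain ⟨⟨j, hj, h⟩, hP⟩ := BD.mem_chE.1 hp
  have h' : p.1 = j ∧ (p.2 = D.d1 j ∨ p.2 = D.d2 j) := by
    rcases h with rfl | rfl
    · exact ⟨rfl, Or.inl rfl⟩
    · exact ⟨rfl, Or.inr rfl⟩
  obtain ⟨rfl, h2⟩ := h'
  obtain ⟨a, b, c, d, _⟩ := B.chsym hj h2
  exact ⟨hj, a, b, h2, c, d, hP⟩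

/-- dropping a chord and a vertex -/
lemma drop (B : BM G D R) {k d : ℕ} (hk : k < D.m) {S : Set V} (hS : S ⊆ R k) (hc : Cn G S)
    (hn : Tch G S (R (nx D.m k))) (hp : Tch G S (R (pv D.m k))) {w : V} (hw : w ∈ R k) (hwS : w ∉ S)
    (hd : d = D.d1 k ∨ d = D.d2 k)
    (hS' : ∀ d', (d' = D.d1 k ∨ d' = D.d2 k) → d' ≠ d → Tch G S (R d')) : False := by
  have hb : D.badB (D.m+1) (D.dropE k d) = true := by
    rcases hd with rfl | rfl
    · exact (B.ok.dr k hk).1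
    · exact (B.ok.dr k hk).2
  refine B.ph.bad hb ⟨fun j => if j = k then S else if j = D.m then {w} else R j, ⟨?_, ?_⟩, ?_⟩
  · intro i hi
    split_ifs with h1 h2
    · exact hc
    · exact Cn.singleton w
    · exact B.mod.cn i (by omega)
  · intro i hi j hj v
    have hd := B.mod.disj
    split_ifs with h1 h2 h3 h4 h5 h6 h7 <;> intro a b
    · omega
    · rw [Set.mem_singleton_iff.1 b] at a; exact (hwS a).elim
    · exact (h1.trans (hd k hk j (by omega) v (hS a) b))
    · rw [Set.mem_singleton_iff.1 a] at b; exact (hwS b).elim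
    · omega
    · rw [Set.mem_singleton_iff.1 a] at b
      have := hd k hk j (by omega) w hw b
      omega
    · exact ((hd i (by omega) k hk v a (hS b)).trans h7.symm)
    · rw [Set.mem_singleton_iff.1 b] at a
      have := hd i (by omega) k hk w a hw
      omega
    · exact hd i (by omega) j (by omega) v a b
  · intro p hp'
    rw [BD.dropE, List.mem_append] at hp'
    rcases hp' with hp' | hp'
    · obtain ⟨j, hj, rfl⟩ := BD.mem_rimE.1 hp'
      have h1 := nx_lt hj
      dsimp only
      by_cases hjk : j = k
      · subst hjk
        rw [if_pos rfl, if_neg (nx_ne B.ok.hm hj), if_neg (by omega)]; exact hn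
      · rw [if_neg hjk, if_neg (by omega : j ≠ D.m)]
        by_cases hjk' : nx D.m j = k
        · rw [if_pos hjk']
          subst hjk'
          rw [pv_nx hj] at hp; exact hp.symm
        · rw [if_neg hjk', if_neg (by omega)]; exact B.rim j hj
    · obtain ⟨a, b, c, e, f, g, hP⟩ := B.chmem hp'
      simp only [Bool.not_eq_true', Bool.or_eq_false_iff, Bool.and_eq_false_iff, beq_eq_false_iff_ne] at hP
      dsimp only
      by_cases h1 : p.1 = k
      · rw [if_pos h1, if_neg (by omega), if_neg (by omega)]
        rw [h1] at e
        refine hS' _ e ?_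
        rcases hP.1 with h | h
        · exact (h h1).elim
        · exact h
      · rw [if_neg h1, if_neg (by omega : p.1 ≠ D.m)]
        by_cases h2 : p.2 = k
        · rw [if_pos h2]
          rw [h2] at f
          refine (hS' _ f ?_).symm
          rcases hP.2 with h | h
          · exact h
          · exact (h h2).elim
        · rw [if_neg h2, if_neg (by omega)]; exact g

lemma cover (B : BM G D R) {k : ℕ} (hk : k < D.m) {Q : Set V} (hQ : Q ⊆ R k) (hc : Cn G Q)
    (hn : Tch G Q (R (nx D.m k))) (hp : Tch G Q (R (pv D.m k))) : R k ⊆ Q := by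
  intro w hw
  by_contra hwQ
  have e1 := B.chsym hk (Or.inl rfl)
  have e2 := B.chsym hk (Or.inr rfl)
  by_cases t1 : Tch G Q (R (D.d1 k))
  · refine B.drop hk hQ hc hn hp hw hwQ (Or.inr rfl) ?_
    rintro d' (rfl | rfl) h
    · exact t1
    · exact (h rfl).elim
  by_cases t2 : Tch G Q (R (D.d2 k))
  · refine B.drop hk hQ hc hn hp hw hwQ (Or.inl rfl) ?_
    rintro d' (rfl | rfl) h
    · exact (h rfl).elim
    · exact t2
  obtain ⟨z1, hz1, y1, hy1, a1⟩ := e1.2.2.2.1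
  obtain ⟨z2, hz2, y2, hy2, a2⟩ := e2.2.2.2.1
  have hz1Q : z1 ∉ Q := fun h => t1 ⟨z1, h, y1, hy1, a1⟩
  have hz2Q : z2 ∉ Q := fun h => t2 ⟨z2, h, y2, hy2, a2⟩
  have hz1' : z1 ∈ R k \ Q := ⟨hz1, hz1Q⟩
  have hZs : cmp G (R k \ Q) z1 ⊆ R k \ Q := cmp_sub hz1'
  have hZc := cmp_cn (G := G) hz1'
  have hZ1 : z1 ∈ cmp G (R k \ Q) z1 := cmp_self
  have hZQ : Tch G (cmp G (R k \ Q) z1) Q := by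
    obtain ⟨q, hq⟩ := hc.nonempty
    obtain ⟨x, hx, y, hy, hxZ, hyZ, h⟩ := (B.mod.cn k hk).cross (A := cmp G (R k \ Q) z1)
      ⟨z1, hz1, hZ1⟩ ⟨q, hQ hq, fun h => (hZs h).2 hq⟩
    refine ⟨x, hxZ, y, ?_, h⟩
    by_contra hyQ
    exact hyZ (cmp_closed hz1' hxZ ⟨hy, hyQ⟩ h)
  set Z := cmp G (R k \ Q) z1 with hZ
  by_cases hz2Z : z2 ∈ Z
  · refine B.ph.bad (B.ok.rs k hk) ⟨fun j => if j = k then Q else if j = D.m then Z else R j, ⟨?_, ?_⟩, ?_⟩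
    · intro i hi
      split_ifs with h1 h2
      · exact hc
      · exact hZc
      · exact B.mod.cn i (by omega)
    · intro i hi j hj v
      have hd := B.mod.disj
      split_ifs with h1 h2 h3 h4 h5 h6 h7 <;> intro a b
      · omega
      · exact ((hZs b).2 a).elim
      · exact (h1.trans (hd k hk j (by omega) v (hQ a) b))
      · exact ((hZs a).2 b).elim
      · omega
      · have := hd k hk j (by omega) v (hZs a).1 b
        omega
      · exact ((hd i (by omega) k hk v a (hQ b)).trans h7.symm)
      · have := hd i (by omega) k hk v a (hZs b).1
        omega
      · exact hd i (by omega) j (by omega) v a b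
    · intro p hp'
      rw [BD.rsE, List.mem_append, List.mem_append] at hp'
      rcases hp' with (hp' | hp') | hp'
      · obtain ⟨j, hj, rfl⟩ := BD.mem_rimE.1 hp'
        have h1 := nx_lt hj
        dsimp only
        by_cases hjk : j = k
        · subst hjk
          rw [if_pos rfl, if_neg (nx_ne B.ok.hm hj), if_neg (by omega)]; exact hn
        · rw [if_neg hjk, if_neg (by omega : j ≠ D.m)]
          by_cases hjk' : nx D.m j = k
          · rw [if_pos hjk']
            subst hjk'
            rw [pv_nx hj] at hp; exact hp.symm
          · rw [if_neg hjk', if_neg (by omega)]; exact B.rim j hj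
      · obtain ⟨a, b, c, e, f, g, hP⟩ := B.chmem hp'
        simp only [Bool.not_eq_true', Bool.or_eq_false_iff, beq_eq_false_iff_ne] at hP
        dsimp only
        rw [if_neg hP.1, if_neg (by omega), if_neg hP.2, if_neg (by omega)]; exact g
      · simp only [List.mem_cons, List.not_mem_nil, or_false] at hp'
        rcases hp' with rfl | rfl | rfl <;> dsimp only <;> rw [if_neg (by omega), if_pos rfl]
        · rw [if_pos rfl]; exact hZQ
        · rw [if_neg e1.2.1, if_neg (by have := e1.1; omega)]
          exact ⟨z1, hZ1, y1, hy1, a1⟩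
        · rw [if_neg e2.2.1, if_neg (by have := e2.1; omega)]
          exact ⟨z2, hz2Z, y2, hy2, a2⟩
  · refine B.drop hk (S := Q ∪ Z) (Set.union_subset hQ (fun x h => (hZs h).1)) (hc.union_tch hZc hZQ.symm)
      (hn.mono Set.subset_union_left subset_rfl) (hp.mono Set.subset_union_left subset_rfl) hz2
      (fun h => h.elim hz2Q hz2Z) (Or.inr rfl) ?_
    rintro d' (rfl | rfl) h
    · exact ⟨z1, Or.inr hZ1, y1, hy1, a1⟩
    · exact (h rfl).elim

end BM
end Mob
end AP

set_option linter.all false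
namespace AP

section Mob
variable {V : Type*} {G : SimpleGraph V}

structure AM (G : SimpleGraph V) (D : BD) (R : ℕ → Set V) (p : ℕ → ℕ → V) (n : ℕ → ℕ) : Prop where
  bm : BM G D R
  pth : ∀ k < D.m, Pth G (p k) (n k)
  mem : ∀ k < D.m, ∀ v, v ∈ R k ↔ ∃ i ≤ n k, p k i = v
  t0 : ∀ k < D.m, ∃ y ∈ R (pv D.m k), G.Adj (p k 0) y
  tn : ∀ k < D.m, ∃ y ∈ R (nx D.m k), G.Adj (p k (n k)) y
  first : ∀ k < D.m, ∀ i ≤ n k, ∀ y ∈ R (pv D.m k), G.Adj (p k i) y → i = 0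
  last : ∀ k < D.m, ∀ i ≤ n k, ∀ y ∈ R (nx D.m k), G.Adj (p k i) y → i = n k
  inn : ∀ k < D.m, ∀ i ≤ n k, ∀ j ≤ n k, i < j → G.Adj (p k i) (p k j) → j = i + 1

lemma BM.arc {D : BD} {R : ℕ → Set V} (B : BM G D R) {k : ℕ} (hk : k < D.m) : ∃ (p : ℕ → V) (n : ℕ),
    Pth G p n ∧ (∀ v, v ∈ R k ↔ ∃ i ≤ n, p i = v) ∧ (∃ y ∈ R (pv D.m k), G.Adj (p 0) y) ∧
    (∃ y ∈ R (nx D.m k), G.Adj (p n) y) ∧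
    (∀ i ≤ n, ∀ y ∈ R (pv D.m k), G.Adj (p i) y → i = 0) ∧
    (∀ i ≤ n, ∀ y ∈ R (nx D.m k), G.Adj (p i) y → i = n) ∧
    (∀ i ≤ n, ∀ j ≤ n, i < j → G.Adj (p i) (p j) → j = i + 1) := by
  obtain ⟨x, hx, x', hx', ax⟩ := B.prv hk
  obtain ⟨y, hy, y', hy', ay⟩ := B.rim k hk
  obtain ⟨p, n, hp, h0, hn, hm⟩ := (B.mod.cn k hk).path hx hy
  have hI : ∀ a b, a ≤ b → b ≤ n → Cn G (Itv p a b) := fun a b hab hb =>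
    Itv.cn hab (fun i _ hi => hp.adj i (by omega))
  have hsub : ∀ a b, b ≤ n → Itv p a b ⊆ R k := by
    rintro a b hb v ⟨s, h1, h2, rfl⟩; exact hm s (by omega)
  have key : ∀ Q, Q ⊆ R k → Cn G Q → (∃ u ∈ Q, ∃ y ∈ R (pv D.m k), G.Adj u y) →
      (∃ u ∈ Q, ∃ y ∈ R (nx D.m k), G.Adj u y) → ∀ i ≤ n, p i ∈ Q := by
    intro Q h1 h2 h3 h4 i hi
    exact B.cover hk h1 h2 h4 h3 (hm i hi)
  have e0 : ∃ y ∈ R (pv D.m k), G.Adj (p 0) y := ⟨x', hx', h0 ▸ ax⟩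
  have en : ∃ y ∈ R (nx D.m k), G.Adj (p n) y := ⟨y', hy', hn ▸ ay⟩
  have inI : ∀ a b s, b ≤ n → s ≤ n → p s ∈ Itv p a b → a ≤ s ∧ s ≤ b := by
    rintro a b s hb hs ⟨t, h1, h2, h⟩
    have := hp.inj t (by omega) s hs h
    omega
  refine ⟨p, n, hp, ?_, e0, en, ?_, ?_, ?_⟩
  · intro v
    constructor
    · intro hv
      obtain ⟨s, _, hs, e⟩ := B.cover hk (hsub 0 n le_rfl) (hI 0 n (by omega) le_rfl)
        (by obtain ⟨y, a, b⟩ := en; exact ⟨p n, ⟨n, by omega, le_rfl, rfl⟩, y, a, b⟩)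
        (by obtain ⟨y, a, b⟩ := e0; exact ⟨p 0, ⟨0, le_rfl, by omega, rfl⟩, y, a, b⟩) hv
      exact ⟨s, hs, e⟩
    · rintro ⟨i, hi, rfl⟩; exact hm i hi
  · intro i hi y hy h
    have := key (Itv p i n) (hsub _ _ le_rfl) (hI _ _ hi le_rfl) ⟨p i, ⟨i, le_rfl, hi, rfl⟩, y, hy, h⟩
      ⟨p n, ⟨n, hi, le_rfl, rfl⟩, en⟩ 0 (by omega)
    have := inI _ _ _ le_rfl (by omega) this
    omega
  · intro i hi y hy h
    have := key (Itv p 0 i) (hsub _ _ hi) (hI _ _ (by omega) hi) ⟨p 0, ⟨0, le_rfl, by omega, rfl⟩, e0⟩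
      ⟨p i, ⟨i, by omega, le_rfl, rfl⟩, y, hy, h⟩ n le_rfl
    have := inI _ _ _ hi le_rfl this
    omega
  · intro i hi j hj hij h
    by_contra hne
    have := key (Itv p 0 i ∪ Itv p j n) (Set.union_subset (hsub _ _ hi) (hsub _ _ le_rfl))
      ((hI _ _ (by omega) hi).union_tch (hI _ _ hj le_rfl)
        ⟨p i, ⟨i, by omega, le_rfl, rfl⟩, p j, ⟨j, le_rfl, hj, rfl⟩, h⟩)
      ⟨p 0, Or.inl ⟨0, le_rfl, by omega, rfl⟩, e0⟩ ⟨p n, Or.inr ⟨n, hj, le_rfl, rfl⟩, en⟩ (i+1) (by omega)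
    rcases this with h | h
    · have := inI _ _ _ hi (by omega) h; omega
    · have := inI _ _ _ le_rfl (by omega) h; omega

lemma BM.toAM {D : BD} {R : ℕ → Set V} (B : BM G D R) : ∃ p n, AM G D R p n := by
  have h : ∀ k, ∃ (p : ℕ → V) (n : ℕ), k < D.m → Pth G p n ∧ (∀ v, v ∈ R k ↔ ∃ i ≤ n, p i = v) ∧ (∃ y ∈ R (pv D.m k), G.Adj (p 0) y) ∧
    (∃ y ∈ R (nx D.m k), G.Adj (p n) y) ∧
    (∀ i ≤ n, ∀ y ∈ R (pv D.m k), G.Adj (p i) y → i = 0) ∧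
    (∀ i ≤ n, ∀ y ∈ R (nx D.m k), G.Adj (p i) y → i = n) ∧
    (∀ i ≤ n, ∀ j ≤ n, i < j → G.Adj (p i) (p j) → j = i + 1) := by
    intro k
    by_cases hk : k < D.m
    · obtain ⟨p, n, h⟩ := B.arc hk; exact ⟨p, n, fun _ => h⟩
    · obtain ⟨p, n, h⟩ := B.arc (k := 0) (by have := B.ok.hm; omega)
      exact ⟨p, n, fun h => (hk h).elim⟩
  choose p n h using h
  exact ⟨p, n, B, fun k hk => (h k hk).1, fun k hk => (h k hk).2.1, fun k hk => (h k hk).2.2.1,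
    fun k hk => (h k hk).2.2.2.1, fun k hk => (h k hk).2.2.2.2.1, fun k hk => (h k hk).2.2.2.2.2.1,
    fun k hk => (h k hk).2.2.2.2.2.2⟩

namespace AM
variable {D : BD} {R : ℕ → Set V} {p : ℕ → ℕ → V} {n : ℕ → ℕ}

lemma pm (A : AM G D R p n) {k i : ℕ} (hk : k < D.m) (hi : i ≤ n k) : p k i ∈ R k := (A.mem k hk _).2 ⟨i, hi, rfl⟩

/-- adding extra chords -/
lemma exs (A : AM G D R p n) (L : List (ℕ × ℕ)) (hL : ∀ q ∈ L, Tch G (R q.1) (R q.2)) : HasM G D.m (D.exE L) := by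
  refine ⟨R, A.bm.mod, ?_⟩
  intro q hq
  rw [BD.exE, List.mem_append, List.mem_append] at hq
  rcases hq with (hq | hq) | hq
  · obtain ⟨j, hj, rfl⟩ := BD.mem_rimE.1 hq
    exact A.bm.rim j hj
  · exact (A.bm.chmem hq).2.2.2.2.2.1
  · exact hL q hq

lemma allow (A : AM G D R p n) {k l : ℕ} (hk : k < D.m) (hl : l < D.m) (h1 : l ≠ k) (h2 : l ≠ nx D.m k)
    (h3 : l ≠ pv D.m k) (h : Tch G (R k) (R l)) : D.al k l = true := by
  by_contra hc
  refine A.bm.ph.bad (A.bm.ok.ex k hk l hl ⟨h1, h2, h3, by simpa using hc⟩) (A.exs _ ?_)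
  intro q hq
  simp only [List.mem_cons, List.not_mem_nil, or_false] at hq
  subst hq; exact h

lemma two (A : AM G D R p n) {k l k' l' : ℕ} (hk : k < D.m) (hl : l < D.m) (hk' : k' < D.m) (hl' : l' < D.m)
    (hkl : k < l) (a : D.al k l = true) (h1 : k < k') (h2 : k' ≠ l) (h3 : k' < l') (h4 : l' ≠ l)
    (a' : D.al k' l' = true) (h : Tch G (R k) (R l)) (h' : Tch G (R k') (R l')) : k' < l ∧ l < l' := by
  by_contra hc
  refine A.bm.ph.bad (A.bm.ok.two k hk l hl ⟨hkl, a⟩ k' hk' l' hl' ⟨h1, h2, h3, h4, a', by omega⟩) (A.exs _ ?_)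
  intro q hq
  simp only [List.mem_cons, List.not_mem_nil, or_false] at hq
  rcases hq with rfl | rfl
  · exact h
  · exact h'

/-- the two parts of an arc -/
lemma parts (A : AM G D R p n) {k i : ℕ} (hk : k < D.m) (hi : i < n k) :
    Cn G (Itv (p k) 0 i) ∧ Cn G (Itv (p k) (i+1) (n k)) ∧ Tch G (Itv (p k) 0 i) (Itv (p k) (i+1) (n k)) ∧
    Itv (p k) 0 i ⊆ R k ∧ Itv (p k) (i+1) (n k) ⊆ R k ∧ (∀ v, v ∈ Itv (p k) 0 i → v ∈ Itv (p k) (i+1) (n k) → False) ∧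
    Tch G (Itv (p k) 0 i) (R (pv D.m k)) ∧ Tch G (Itv (p k) (i+1) (n k)) (R (nx D.m k)) := by
  have hp := A.pth k hk
  refine ⟨Itv.cn (by omega) (fun j _ hj => hp.adj j (by omega)), Itv.cn (by omega) (fun j _ hj => hp.adj j (by omega)),
    ⟨p k i, ⟨i, by omega, le_rfl, rfl⟩, p k (i+1), ⟨i+1, le_rfl, hi, rfl⟩, hp.adj i hi⟩, ?_, ?_, ?_, ?_, ?_⟩
  · rintro v ⟨s, _, hs, rfl⟩; exact A.pm hk (by omega)
  · rintro v ⟨s, _, hs, rfl⟩; exact A.pm hk (by omega)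
  · rintro v ⟨s, _, hs, rfl⟩ ⟨t, ht, ht', e⟩
    have := hp.inj t ht' s (by omega) e
    omega
  · obtain ⟨y, hy, h⟩ := A.t0 k hk
    exact ⟨_, ⟨0, le_rfl, by omega, rfl⟩, y, hy, h⟩
  · obtain ⟨y, hy, h⟩ := A.tn k hk
    exact ⟨_, ⟨n k, by omega, le_rfl, rfl⟩, y, hy, h⟩

lemma wrong (A : AM G D R p n) {k i i' l1 l2 : ℕ} (hk : k < D.m) (hl1 : l1 < D.m) (hl2 : l2 < D.m)
    (hi : i < i') (hi' : i' ≤ n k) (h1 : ∃ y ∈ R l1, G.Adj (p k i) y) (h2 : ∃ y ∈ R l2, G.Adj (p k i') y)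
    (a1 : D.al k l1 = true) (a2 : D.al k l2 = true) (hd : dst D.m k l2 < dst D.m k l1) : False := by
  have B := A.bm
  obtain ⟨c1, c2, c3, s1, s2, dj, tp, tn⟩ := A.parts hk (by omega : i < n k)
  have hsplit : ∀ l, Tch G (R k) (R l) → ∃ b : Bool, Tch G (bif b then Itv (p k) 0 i else Itv (p k) (i+1) (n k)) (R l) := by
    rintro l ⟨x, hx, y, hy, h⟩
    obtain ⟨s, hs, rfl⟩ := (A.mem k hk x).1 hx
    by_cases hsi : s ≤ i
    · exact ⟨true, _, ⟨s, by omega, hsi, rfl⟩, y, hy, h⟩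
    · exact ⟨false, _, ⟨s, by omega, hs, rfl⟩, y, hy, h⟩
  obtain ⟨b1, hb1⟩ := hsplit _ (B.c1 k hk)
  obtain ⟨b2, hb2⟩ := hsplit _ (B.c2 k hk)
  have e1 := B.chsym hk (Or.inl rfl)
  have e2 := B.chsym hk (Or.inr rfl)
  refine B.ph.bad (B.ok.wr k hk l1 hl1 l2 hl2 ⟨a1, a2, hd⟩ b1 b2)
    ⟨fun j => if j = k then Itv (p k) 0 i else if j = D.m then Itv (p k) (i+1) (n k) else R j, ⟨?_, ?_⟩, ?_⟩
  · intro i hi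
    split_ifs with h1 h2
    · exact c1
    · exact c2
    · exact B.mod.cn i (by omega)
  · intro i hi j hj v
    have hd := B.mod.disj
    split_ifs with h1 h2 h3 h4 h5 h6 h7 <;> intro a b
    · omega
    · exact (dj v a b).elim
    · exact (h1.trans (hd k hk j (by omega) v (s1 a) b))
    · exact (dj v b a).elim
    · omega
    · have := hd k hk j (by omega) v (s2 a) b
      omega
    · exact ((hd i (by omega) k hk v a (s1 b)).trans h7.symm)
    · have := hd i (by omega) k hk v a (s2 b)
      omega
    · exact hd i (by omega) j (by omega) v a b
  · have n1 : l1 ≠ k := (B.ok.alk k hk l1 hl1 a1).2.1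
    have n2 : l2 ≠ k := (B.ok.alk k hk l2 hl2 a2).2.1
    have hself : ∀ b : Bool, (if (bif b then k else D.m) = k then Itv (p k) 0 i else
        if (bif b then k else D.m) = D.m then Itv (p k) (i+1) (n k) else R (bif b then k else D.m)) =
        (bif b then Itv (p k) 0 i else Itv (p k) (i+1) (n k)) := by
      intro b
      cases b
      · rw [cond_false, cond_false, if_neg (by omega), if_pos rfl]
      · rw [cond_true, cond_true, if_pos rfl]
    intro q hq
    rw [BD.wrE, List.mem_append, List.mem_append] at hq
    rcases hq with (hq | hq) | hq
    · simp only [List.mem_map, List.mem_range] at hq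
      obtain ⟨j, hj, rfl⟩ := hq
      have h1 := nx_lt hj
      dsimp only
      by_cases hjk : j = k
      · subst hjk
        rw [if_pos rfl, if_neg (by omega), if_pos rfl, if_neg (nx_ne B.ok.hm hj), if_neg (by omega)]; exact tn
      · rw [if_neg hjk, if_neg hjk, if_neg (by omega : j ≠ D.m)]
        by_cases hjk' : nx D.m j = k
        · rw [if_pos hjk']
          subst hjk'
          rw [pv_nx hj] at tp; exact tp.symm
        · rw [if_neg hjk', if_neg (by omega)]; exact B.rim j hj
    · obtain ⟨a, b, c, e, f, g, hP⟩ := B.chmem hq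
      simp only [Bool.not_eq_true', Bool.or_eq_false_iff, beq_eq_false_iff_ne] at hP
      dsimp only
      rw [if_neg hP.1, if_neg (by omega), if_neg hP.2, if_neg (by omega)]; exact g
    · simp only [List.mem_cons, List.not_mem_nil, or_false] at hq
      rcases hq with rfl | rfl | rfl | rfl | rfl <;> dsimp only
      · rw [if_pos rfl, if_neg (by omega), if_pos rfl]; exact c3
      · rw [if_pos rfl, if_neg n1, if_neg (by omega)]
        obtain ⟨y, hy, h⟩ := h1
        exact ⟨_, ⟨i, by omega, le_rfl, rfl⟩, y, hy, h⟩
      · rw [if_neg (by omega), if_pos rfl, if_neg n2, if_neg (by omega)]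
        obtain ⟨y, hy, h⟩ := h2
        exact ⟨_, ⟨i', by omega, hi', rfl⟩, y, hy, h⟩
      · rw [hself b1, if_neg e1.2.1, if_neg (by have := e1.1; omega)]; exact hb1
      · rw [hself b2, if_neg e2.2.1, if_neg (by have := e2.1; omega)]; exact hb2


lemma dst_ne {m k d l : ℕ} (hk : k < m) (hd : d < m) (hl : l < m) (h : d ≠ l) : dst m k d ≠ dst m k l := by
  unfold dst; split_ifs <;> omega

/-- placing a base chord at a split arc -/
lemma place (A : AM G D R p n) {k l d i i' : ℕ} (hk : k < D.m) (hl : l < D.m) (hi : i < i') (hi' : i' ≤ n k)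
    (h1 : ∃ y ∈ R l, G.Adj (p k i) y) (h2 : ∃ y ∈ R l, G.Adj (p k i') y)
    (a : D.al k l = true) (hd : d = D.d1 k ∨ d = D.d2 k) (hdl : d ≠ l) :
    Tch G (if dst D.m k l < dst D.m k d then Itv (p k) (i+1) (n k) else Itv (p k) 0 i) (R d) := by
  obtain ⟨e1, e2, e3, ⟨x, hx, y, hy, hxy⟩, e5⟩ := A.bm.chsym hk hd
  obtain ⟨s, hs, rfl⟩ := (A.mem k hk x).1 hx
  have hne := dst_ne hk e1 hl hdl
  split_ifs with hc
  · refine ⟨_, ⟨s, ?_, hs, rfl⟩, y, hy, hxy⟩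
    by_contra hsi
    exact A.wrong hk e1 hl (by omega : s < i') hi' ⟨y, hy, hxy⟩ h2 e5 a hc
  · refine ⟨_, ⟨s, by omega, ?_, rfl⟩, y, hy, hxy⟩
    by_contra hsi
    exact A.wrong hk hl e1 (by omega : i < s) hs h1 ⟨y, hy, hxy⟩ a e5 (by omega)

lemma par (A : AM G D R p n) {k l i i' j j' : ℕ} (hk : k < D.m) (hl : l < D.m) (hkl : k < l)
    (a : D.al k l = true) (hi : i < i') (hi' : i' ≤ n k) (hj : j < j') (hj' : j' ≤ n l)
    (h1 : G.Adj (p k i) (p l j')) (h2 : G.Adj (p k i') (p l j)) : False := by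
  have B := A.bm
  obtain ⟨c1, c2, c3, s1, s2, dj, tp, tn⟩ := A.parts hk (by omega : i < n k)
  obtain ⟨c1', c2', c3', s1', s2', dj', tp', tn'⟩ := A.parts hl (by omega : j < n l)
  obtain ⟨al', n1, n2, n3⟩ := B.ok.alk k hk l hl a
  have hm := B.ok.hm
  have pk : ∀ d, d = D.d1 k ∨ d = D.d2 k → d ≠ l → _ := fun d hd hdl => A.place hk hl hi hi'
    ⟨_, A.pm hl hj', h1⟩ ⟨_, A.pm hl (by omega), h2⟩ a hd hdl
  have pl : ∀ d, d = D.d1 l ∨ d = D.d2 l → d ≠ k → _ := fun d hd hdl => A.place hl hk hj hj'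
    ⟨_, A.pm hk hi', h2.symm⟩ ⟨_, A.pm hk (by omega), h1.symm⟩ al' hd hdl
  set K1 := Itv (p k) 0 i with hK1
  set K2 := Itv (p k) (i+1) (n k) with hK2
  set L1 := Itv (p l) 0 j with hL1
  set L2 := Itv (p l) (j+1) (n l) with hL2
  set R' : ℕ → Set V := fun q => if q = k then K1 else if q = l then L1 else if q = D.m then K2 else
    if q = D.m + 1 then L2 else R q with hR'
  have rk : R' k = K1 := by simp only [hR', if_true]
  have rl : R' l = L1 := by simp only [hR']; rw [if_neg (by omega), if_pos trivial]
  have rm : R' D.m = K2 := by simp only [hR']; rw [if_neg (by omega), if_neg (by omega), if_pos trivial]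
  have rm1 : R' (D.m+1) = L2 := by
    simp only [hR']; rw [if_neg (by omega), if_neg (by omega), if_neg (by omega), if_pos trivial]
  have ro : ∀ q < D.m, q ≠ k → q ≠ l → R' q = R q := by
    intro q h1 h2 h3
    simp only [hR']; rw [if_neg h2, if_neg h3, if_neg (by omega), if_neg (by omega)]
  have cs : ∀ q < D.m + 2, q = k ∨ q = l ∨ q = D.m ∨ q = D.m + 1 ∨ (q < D.m ∧ q ≠ k ∧ q ≠ l) := by omega
  refine B.ph.bad (B.ok.par k hk l hl hkl a) ⟨R', ⟨?_, ?_⟩, ?_⟩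
  · intro q hq
    rcases cs q hq with rfl | rfl | rfl | rfl | ⟨q1, q2, q3⟩
    · rw [rk]; exact c1
    · rw [rl]; exact c1'
    · rw [rm]; exact c2
    · rw [rm1]; exact c2'
    · rw [ro q q1 q2 q3]; exact B.mod.cn q q1
  · have own : ∀ q < D.m + 2, ∀ v ∈ R' q, ∃ o < D.m, v ∈ R o ∧ (o = k → (q = k ∧ v ∈ K1) ∨ (q = D.m ∧ v ∈ K2)) ∧
        (o = l → (q = l ∧ v ∈ L1) ∨ (q = D.m+1 ∧ v ∈ L2)) ∧ (o ≠ k → o ≠ l → q = o) := by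
      intro q hq v hv
      rcases cs q hq with h | h | h | h | ⟨q1, q2, q3⟩
      · rw [h, rk] at hv; exact ⟨k, hk, s1 hv, fun _ => Or.inl ⟨h, hv⟩, fun h => by omega, fun h => by omega⟩
      · rw [h, rl] at hv; exact ⟨l, hl, s1' hv, fun h => by omega, fun _ => Or.inl ⟨h, hv⟩, fun _ h => by omega⟩
      · rw [h, rm] at hv; exact ⟨k, hk, s2 hv, fun _ => Or.inr ⟨h, hv⟩, fun h => by omega, fun h => by omega⟩
      · rw [h, rm1] at hv; exact ⟨l, hl, s2' hv, fun h => by omega, fun _ => Or.inr ⟨h, hv⟩, fun _ h => by omega⟩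
      · rw [ro q q1 q2 q3] at hv; exact ⟨q, q1, hv, fun h => by omega, fun h => by omega, fun _ _ => rfl⟩
    intro q hq q' hq' v hv hv'
    obtain ⟨o, ho, x1, x2, x3, x4⟩ := own q hq v hv
    obtain ⟨o', ho', y1, y2, y3, y4⟩ := own q' hq' v hv'
    obtain rfl := B.mod.disj o ho o' ho' v x1 y1
    by_cases z1 : o = k
    · rcases x2 z1 with ⟨e, f⟩ | ⟨e, f⟩ <;> rcases y2 z1 with ⟨e', f'⟩ | ⟨e', f'⟩
      · omega
      · exact (dj v f f').elim
      · exact (dj v f' f).elim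
      · omega
    by_cases z2 : o = l
    · rcases x3 z2 with ⟨e, f⟩ | ⟨e, f⟩ <;> rcases y3 z2 with ⟨e', f'⟩ | ⟨e', f'⟩
      · omega
      · exact (dj' v f f').elim
      · exact (dj' v f' f).elim
      · omega
    rw [x4 z1 z2, y4 z1 z2]
  · intro q hq
    rw [BD.parE, List.mem_append, List.mem_append] at hq
    rcases hq with (hq | hq) | hq
    · simp only [List.mem_map, List.mem_range] at hq
      obtain ⟨t, ht, rfl⟩ := hq
      have g1 := nx_lt ht
      have hend : ∀ S, Tch G S (R (nx D.m t)) → (nx D.m t = k → Tch G S K1) → (nx D.m t = l → Tch G S L1) →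
          Tch G S (R' (nx D.m t)) := by
        intro S x y z
        by_cases w1 : nx D.m t = k
        · rw [w1, rk]; exact y w1
        by_cases w2 : nx D.m t = l
        · rw [w2, rl]; exact z w2
        rw [ro _ g1 w1 w2]; exact x
      dsimp only
      split_ifs with w1 w2
      · rw [rm]; subst w1
        refine hend _ tn (fun h => (nx_ne hm ht h).elim) (fun h => (n2 h.symm).elim)
      · rw [rm1]; subst w2
        refine hend _ tn' (fun h => ?_) (fun h => (nx_ne hm ht h).elim)
        rw [← h, pv_nx ht] at n3; exact (n3 rfl).elim
      · rw [ro t ht w1 w2]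
        refine hend _ (B.rim t ht) (fun h => ?_) (fun h => ?_)
        · rw [← h, pv_nx ht] at tp; exact tp.symm
        · rw [← h, pv_nx ht] at tp'; exact tp'.symm
    · obtain ⟨a, b, c, e, f, g, hP⟩ := B.chmem hq
      simp only [Bool.not_eq_true', Bool.or_eq_false_iff, beq_eq_false_iff_ne] at hP
      rw [ro _ a hP.1.1.1 hP.1.2, ro _ b hP.1.1.2 hP.2]; exact g
    · have pck : ∀ d, d = D.d1 k ∨ d = D.d2 k → Tch G (R' (D.parc k l D.m (D.m+1) d).1) (R' (D.parc k l D.m (D.m+1) d).2) := by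
        intro d hd
        obtain ⟨x1, x2, _⟩ := B.chsym hk hd
        unfold BD.parc
        by_cases hdl : d = l
        · rw [if_pos hdl]; dsimp only; rw [rk, rm]; exact c3
        · rw [if_neg hdl]; dsimp only
          have := pk d hd hdl
          rw [ro d x1 x2 hdl]
          split_ifs with hc
          · rw [rm]; rw [if_pos hc] at this; exact this
          · rw [rk]; rw [if_neg hc] at this; exact this
      have pcl : ∀ d, d = D.d1 l ∨ d = D.d2 l → Tch G (R' (D.parc l k (D.m+1) D.m d).1) (R' (D.parc l k (D.m+1) D.m d).2) := by
        intro d hd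
        obtain ⟨x1, x2, _⟩ := B.chsym hl hd
        unfold BD.parc
        by_cases hdl : d = k
        · rw [if_pos hdl]; dsimp only; rw [rl, rm1]; exact c3'
        · rw [if_neg hdl]; dsimp only
          have := pl d hd hdl
          rw [ro d x1 hdl x2]
          split_ifs with hc
          · rw [rm1]; rw [if_pos hc] at this; exact this
          · rw [rl]; rw [if_neg hc] at this; exact this
      simp only [List.mem_cons, List.not_mem_nil, or_false] at hq
      rcases hq with rfl | rfl | rfl | rfl | rfl | rfl | rfl | rfl
      · dsimp only; rw [rk, rm]; exact c3
      · dsimp only; rw [rl, rm1]; exact c3'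
      · dsimp only; rw [rk, rm1]
        exact ⟨_, ⟨i, by omega, le_rfl, rfl⟩, _, ⟨j', by omega, hj', rfl⟩, h1⟩
      · dsimp only; rw [rm, rl]
        exact ⟨_, ⟨i', by omega, hi', rfl⟩, _, ⟨j, by omega, le_rfl, rfl⟩, h2⟩
      · exact pck _ (Or.inl rfl)
      · exact pck _ (Or.inr rfl)
      · exact pcl _ (Or.inl rfl)
      · exact pcl _ (Or.inr rfl)

end AM
end Mob
end AP

set_option linter.all false
namespace AP

section Mob
variable {V : Type*} {G : SimpleGraph V}

lemma mob_of (f : V → ℕ) (finj : Function.Injective f) (m : ℕ) (hm : 3 ≤ m) (F : ℕ → ℕ)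
    (mono : ∀ x y, x ≤ y → y < 2*m → F x ≤ F y) (surj : ∀ v, ∃ x < 2*m, F x = f v)
    (hF : ∀ x < 2*m, ∃ v, F x = f v)
    (edge : ∀ u v, G.Adj u v → f u < f v → (∀ w, ¬ (f u < f w ∧ f w < f v)) ∨
      ((∀ w, f u ≤ f w) ∧ ∀ w, f w ≤ f v) ∨ ∃ k < m, F k = f u ∧ F (k+m) = f v) :
    IsMinor G (mobiusLadder m) := by
  classical
  have adj1 : ∀ x (h : x + 1 < 2*m), (mobiusLadder m).Adj ⟨x, by omega⟩ ⟨x+1, h⟩ := by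
    intro x h
    simp only [mobiusLadder, fromRel_adj]
    refine ⟨fun e => by simp at e, Or.inl (Or.inl ?_)⟩
    rw [Nat.mod_eq_of_lt h]
  have adj2 : (mobiusLadder m).Adj ⟨2*m-1, by omega⟩ ⟨0, by omega⟩ := by
    simp only [mobiusLadder, fromRel_adj]
    refine ⟨fun e => by simp at e; omega, Or.inl (Or.inl ?_)⟩
    rw [show 2*m-1+1 = 2*m by omega, Nat.mod_self]
  have adj3 : ∀ x (h : x < m), (mobiusLadder m).Adj ⟨x, by omega⟩ ⟨x+m, by omega⟩ := by
    intro x h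
    simp only [mobiusLadder, fromRel_adj]
    refine ⟨fun e => by simp at e; omega, Or.inl (Or.inr ?_)⟩
    rw [Nat.mod_eq_of_lt (by omega)]
  refine ⟨fun v => {y | F y.1 = f v}, ?_, ?_, ?_, ?_⟩
  · intro v
    obtain ⟨x, hx, e⟩ := surj v
    exact ⟨⟨x, hx⟩, e⟩
  · intro v
    change Cn (mobiusLadder m) {y : Fin (2*m) | F y.1 = f v}
    set X := (Finset.range (2*m)).filter (fun x => F x = f v) with hX
    have hne : X.Nonempty := by
      obtain ⟨x, hx, e⟩ := surj v
      exact ⟨x, by simp [hX, hx, e]⟩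
    have ha := X.min'_mem hne
    have hb := X.max'_mem hne
    have hab := X.min'_le _ hb
    set a := X.min' hne
    set b := X.max' hne
    simp only [hX, Finset.mem_filter, Finset.mem_range] at ha hb
    let p : ℕ → Fin (2*m) := fun x => if h : x < 2*m then ⟨x, h⟩ else ⟨0, by omega⟩
    have : {y : Fin (2*m) | F y.1 = f v} = Itv p a b := by
      ext y
      constructor
      · intro hy
        have hyX : y.1 ∈ X := by simp only [hX, Finset.mem_filter, Finset.mem_range]; exact ⟨y.2, hy⟩
        refine ⟨y.1, X.min'_le _ hyX, X.le_max' _ hyX, ?_⟩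
        simp only [p, dif_pos y.2]
      · rintro ⟨s, h1, h2, rfl⟩
        have hs : s < 2*m := by omega
        simp only [p, dif_pos hs]
        have e1 := mono a s h1 hs
        have e2 := mono s b h2 hb.1
        show F s = f v
        omega
    rw [this]
    refine Itv.cn hab ?_
    intro i h1 h2
    have := adj1 i (by omega)
    simp only [p]
    rw [dif_pos (by omega), dif_pos (by omega)]
    exact this
  · intro u v huv
    refine Set.disjoint_left.2 ?_
    intro y h1 h2
    have h1' : F y.1 = f u := h1
    have h2' : F y.1 = f v := h2
    exact huv (finj (h1'.symm.trans h2'))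
  · have main : ∀ u v, G.Adj u v → f u < f v → ∃ x y : Fin (2*m), F x.1 = f u ∧ F y.1 = f v ∧ (mobiusLadder m).Adj x y := by
      intro u v huv hlt
      rcases edge u v huv hlt with h | ⟨h1, h2⟩ | ⟨k, hk, h1, h2⟩
      · obtain ⟨x, hx, ex⟩ := surj u
        obtain ⟨y, hy, ey⟩ := surj v
        set X := (Finset.range (2*m)).filter (fun x => F x = f u) with hX
        have hne : X.Nonempty := ⟨x, by simp [hX, hx, ex]⟩
        have hb := X.max'_mem hne
        set b := X.max' hne
        have hmax : ∀ z, z < 2*m → F z = f u → z ≤ b := fun z h1 h2 => X.le_max' z (by simp [hX, h1, h2])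
        simp only [hX, Finset.mem_filter, Finset.mem_range] at hb
        have hby : b < y := by
          by_contra hc
          have := mono y b (by omega) hb.1
          omega
        have e1 := mono b (b+1) (by omega) (by omega)
        have e2 := mono (b+1) y (by omega) hy
        have e3 : F (b+1) ≠ f u := by
          intro e
          have := hmax (b+1) (by omega) e
          omega
        obtain ⟨w, hw⟩ := hF (b+1) (by omega)
        have e4 := h w
        exact ⟨⟨b, hb.1⟩, ⟨b+1, by omega⟩, hb.2, by show F (b+1) = f v; omega, adj1 b (by omega)⟩
      · obtain ⟨x, hx, ex⟩ := surj u
        obtain ⟨y, hy, ey⟩ := surj v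
        obtain ⟨w, hw⟩ := hF 0 (by omega)
        obtain ⟨w', hw'⟩ := hF (2*m-1) (by omega)
        have e1 := mono 0 x (by omega) hx
        have e2 := mono y (2*m-1) (by omega) (by omega)
        have e3 := h1 w
        have e4 := h2 w'
        exact ⟨⟨0, by omega⟩, ⟨2*m-1, by omega⟩, by show F 0 = f u; omega, by show F (2*m-1) = f v; omega, adj2.symm⟩
      · exact ⟨⟨k, by omega⟩, ⟨k+m, by omega⟩, h1, h2, adj3 k hk⟩
    intro u v huv
    rcases lt_trichotomy (f u) (f v) with h | h | h
    · obtain ⟨x, y, h1, h2, h3⟩ := main u v huv h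
      exact ⟨x, h1, y, h2, h3⟩
    · exact (huv.ne (finj h)).elim
    · obtain ⟨x, y, h1, h2, h3⟩ := main v u huv.symm h
      exact ⟨y, h2, x, h1, h3.symm⟩

/-- pairwise weakly crossing chords give a minor of a Moebius ladder -/
lemma mob_sort [Finite V] (f : V → ℕ) (finj : Function.Injective f) (C : V → V → Prop)
    (hC : ∀ u v, C u v → f u < f v)
    (hcr : ∀ u v u' v', C u v → C u' v' → f u < f u' → f u' ≤ f v ∧ f v ≤ f v')
    (hcov : ∀ v, ∃ w, C v w ∨ C w v) (hcard : 5 ≤ Nat.card V)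
    (edge : ∀ u v, G.Adj u v → f u < f v → (∀ w, ¬ (f u < f w ∧ f w < f v)) ∨
      ((∀ w, f u ≤ f w) ∧ ∀ w, f w ≤ f v) ∨ C u v) :
    ∃ n, 3 ≤ n ∧ IsMinor G (mobiusLadder n) := by
  classical
  have := Fintype.ofFinite V
  obtain ⟨N, hN⟩ : ∃ N, ∀ v, f v < N := by
    refine ⟨Finset.univ.sup f + 1, fun v => ?_⟩
    have := Finset.le_sup (f := f) (Finset.mem_univ v)
    omega
  let K : Finset ℕ := ((Finset.univ : Finset (V × V)).filter (fun q => C q.1 q.2)).image (fun q => N * f q.1 + f q.2)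
  have hKm : ∀ x, x ∈ K ↔ ∃ u v, C u v ∧ N * f u + f v = x := by
    intro x
    simp only [K, Finset.mem_image, Finset.mem_filter, Finset.mem_univ, true_and, Prod.exists]
  obtain ⟨m, hm⟩ : ∃ m, K.card = m := ⟨_, rfl⟩
  let e := K.orderEmbOfFin hm
  have he : ∀ i, e i ∈ K := fun i => Finset.orderEmbOfFin_mem K hm i
  have hsur : ∀ x ∈ K, ∃ i, e i = x := by
    intro x hx
    have : x ∈ Set.range e := by rw [Finset.range_orderEmbOfFin]; exact hx
    exact this
  have hdec : ∀ i : ℕ, ∃ u v : V, ∀ h : i < m, C u v ∧ N * f u + f v = e ⟨i, h⟩ := by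
    intro i
    by_cases h : i < m
    · obtain ⟨u, v, h1, h2⟩ := (hKm _).1 (he ⟨i, h⟩)
      exact ⟨u, v, fun _ => ⟨h1, h2⟩⟩
    · have : Nonempty V := by
        have : 0 < Nat.card V := by omega
        exact (Nat.card_pos_iff.1 this).1
      exact ⟨this.some, this.some, fun h' => (h h').elim⟩
  choose s t hst using hdec
  have hlt : ∀ i j (hi : i < m) (hj : j < m), i < j → f (s i) < f (s j) ∨ (s i = s j ∧ f (t i) < f (t j)) := by
    intro i j hi hj hij
    have h1 := (hst i hi).2
    have h2 := (hst j hj).2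
    have h3 : e ⟨i, hi⟩ < e ⟨j, hj⟩ := e.strictMono (by exact hij)
    rw [← h1, ← h2] at h3
    have h4 := hN (t j)
    have h4' := hN (t i)
    rcases lt_trichotomy (f (s i)) (f (s j)) with h | h | h
    · exact Or.inl h
    · exact Or.inr ⟨finj h, by rw [h] at h3; omega⟩
    · have : N * (f (s j) + 1) ≤ N * f (s i) := Nat.mul_le_mul_left _ h
      rw [mul_add] at this; omega
  have hid : ∀ u v, C u v → ∃ k < m, s k = u ∧ t k = v := by
    intro u v h
    obtain ⟨i, hi⟩ := hsur _ ((hKm _).2 ⟨u, v, h, rfl⟩)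
    refine ⟨i.1, i.2, ?_⟩
    have h1 := (hst i.1 i.2).2
    have h1' : N * f (s i) + f (t i) = N * f u + f v := h1.trans hi
    have h2 := hN (t i.1)
    have h3 := hN v
    have hN0 : 0 < N := by omega
    have e1 : (N * f (s i) + f (t i)) / N = f (s i) := by
      rw [Nat.mul_add_div hN0, Nat.div_eq_of_lt h2]; rfl
    have e2 : (N * f u + f v) / N = f u := by
      rw [Nat.mul_add_div hN0, Nat.div_eq_of_lt h3]; rfl
    have e3 : f (s i) = f u := by rw [← e1, ← e2, h1']
    refine ⟨finj e3, finj ?_⟩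
    rw [e3] at h1'; omega
  have hm3 : 3 ≤ m := by
    by_contra hc
    have hcover : (Finset.univ : Finset V) ⊆ (Finset.range m).image s ∪ (Finset.range m).image t := by
      intro v _
      obtain ⟨w, h | h⟩ := hcov v
      · obtain ⟨k, hk, h1, h2⟩ := hid _ _ h
        exact Finset.mem_union_left _ (Finset.mem_image.2 ⟨k, Finset.mem_range.2 hk, h1⟩)
      · obtain ⟨k, hk, h1, h2⟩ := hid _ _ h
        exact Finset.mem_union_right _ (Finset.mem_image.2 ⟨k, Finset.mem_range.2 hk, h2⟩)
    have h1 := Finset.card_le_card hcover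
    have h2 := Finset.card_union_le ((Finset.range m).image s) ((Finset.range m).image t)
    have h3 := Finset.card_image_le (s := Finset.range m) (f := s)
    have h4 := Finset.card_image_le (s := Finset.range m) (f := t)
    rw [Finset.card_univ, ← Nat.card_eq_fintype_card] at h1
    rw [Finset.card_range] at h3 h4
    omega
  refine ⟨m, hm3, mob_of f finj m hm3 (fun x => if x < m then f (s x) else f (t (x - m))) ?_ ?_ ?_ ?_⟩
  · have hs : ∀ i j, i < m → j < m → i ≤ j → f (s i) ≤ f (s j) := by
      intro i j hi hj hij
      rcases Nat.eq_or_lt_of_le hij with rfl | h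
      · exact le_rfl
      · rcases hlt i j hi hj h with h | ⟨h, _⟩
        · omega
        · rw [h]
    have ht : ∀ i j, i < m → j < m → i ≤ j → f (t i) ≤ f (t j) := by
      intro i j hi hj hij
      rcases Nat.eq_or_lt_of_le hij with rfl | h
      · exact le_rfl
      · rcases hlt i j hi hj h with h | ⟨h, h'⟩
        · exact (hcr _ _ _ _ (hst i hi).1 (hst j hj).1 h).2
        · omega
    have hst' : ∀ i j, i < m → j < m → f (s i) ≤ f (t j) := by
      intro i j hi hj
      rcases lt_or_ge (f (s j)) (f (s i)) with h | h
      · exact (hcr _ _ _ _ (hst j hj).1 (hst i hi).1 h).1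
      · have := hC _ _ (hst j hj).1; omega
    intro x y hxy hy
    split_ifs with h1 h2 h2
    · exact hs x y h1 h2 hxy
    · exact hst' x _ h1 (by omega)
    · omega
    · exact ht _ _ (by omega) (by omega) (by omega)
  · intro v
    obtain ⟨w, h | h⟩ := hcov v
    · obtain ⟨k, hk, h1, h2⟩ := hid _ _ h
      exact ⟨k, by omega, by rw [if_pos hk, h1]⟩
    · obtain ⟨k, hk, h1, h2⟩ := hid _ _ h
      exact ⟨k+m, by omega, by rw [if_neg (by omega), Nat.add_sub_cancel, h2]⟩
  · intro x hx
    split_ifs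
    · exact ⟨_, rfl⟩
    · exact ⟨_, rfl⟩
  · intro u v huv h
    rcases edge u v huv h with h | h | h
    · exact Or.inl h
    · exact Or.inr (Or.inl h)
    · obtain ⟨k, hk, h1, h2⟩ := hid _ _ h
      exact Or.inr (Or.inr ⟨k, hk, by rw [if_pos hk, h1], by
        rw [if_neg (by omega), Nat.add_sub_cancel, h2]⟩)

end Mob
end AP

set_option linter.all false
namespace AP

section Mob
variable {V : Type*} {G : SimpleGraph V}

lemma AM.mob [Finite V] {D : BD} {R : ℕ → Set V} {p : ℕ → ℕ → V} {n : ℕ → ℕ} (A : AM G D R p n)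
    (h3 : KConnected G 3) : ∃ n, 3 ≤ n ∧ IsMinor G (mobiusLadder n) := by
  classical
  have B := A.bm
  have hm := B.ok.hm
  have hloc : ∀ v, ∃ k i, k < D.m ∧ i ≤ n k ∧ p k i = v := by
    intro v
    obtain ⟨k, hk, hv⟩ := B.cov v
    obtain ⟨i, hi, e⟩ := (A.mem k hk v).1 hv
    exact ⟨k, i, hk, hi, e⟩
  choose κ ι hκ hι hp using hloc
  have hR : ∀ v, v ∈ R (κ v) := fun v => (A.mem _ (hκ v) v).2 ⟨_, hι v, hp v⟩
  have huκ : ∀ k i, k < D.m → i ≤ n k → κ (p k i) = k := fun k i hk hi =>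
    B.mod.disj _ (hκ _) _ hk _ (hR _) (A.pm hk hi)
  have huι : ∀ k i, k < D.m → i ≤ n k → ι (p k i) = i := by
    intro k i hk hi
    have e := huκ k i hk hi
    have e1 := hp (p k i)
    have e2 := hι (p k i)
    rw [e] at e1 e2
    exact (A.pth k hk).inj _ e2 _ hi e1
  obtain ⟨M, hM⟩ : ∃ M, ∀ v, ι v < M := by
    have := Fintype.ofFinite V
    refine ⟨Finset.univ.sup ι + 1, fun v => ?_⟩
    have := Finset.le_sup (f := ι) (Finset.mem_univ v)
    omega
  obtain ⟨f, hf⟩ : ∃ f : V → ℕ, ∀ v, f v = M * κ v + ι v := ⟨_, fun _ => rfl⟩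
  have flt : ∀ u v, f u < f v ↔ κ u < κ v ∨ (κ u = κ v ∧ ι u < ι v) := by
    intro u v
    have h1 := hM u
    have h2 := hM v
    rw [hf, hf]
    rcases lt_trichotomy (κ u) (κ v) with h | h | h
    · have : M * (κ u + 1) ≤ M * κ v := Nat.mul_le_mul_left _ h
      rw [mul_add] at this; omega
    · rw [h]; omega
    · have : M * (κ v + 1) ≤ M * κ u := Nat.mul_le_mul_left _ h
      rw [mul_add] at this; omega
  have fle : ∀ u v, f u ≤ f v ↔ κ u < κ v ∨ (κ u = κ v ∧ ι u ≤ ι v) := by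
    intro u v
    rw [← not_lt, flt]; omega
  have veq : ∀ u v, κ u = κ v → ι u = ι v → u = v := by
    intro u v h1 h2
    rw [← hp u, ← hp v, h1, h2]
  have alsym : ∀ {k l}, k < D.m → l < D.m → D.al k l = true → D.al l k = true := fun hk hl a =>
    (B.ok.alk _ hk _ hl a).1
  have adjp : ∀ u v, G.Adj u v → G.Adj (p (κ u) (ι u)) v := fun u v h => by rw [hp]; exact h
  have tch : ∀ u v, G.Adj u v → Tch G (R (κ u)) (R (κ v)) := fun u v h => ⟨u, hR u, v, hR v, h⟩
  have hnext : ∀ u v, G.Adj u v → κ v = nx D.m (κ u) → ι u = n (κ u) ∧ ι v = 0 := by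
    intro u v h e
    refine ⟨A.last _ (hκ u) _ (hι u) v (e ▸ hR v) (adjp u v h), A.first _ (hκ v) _ (hι v) u ?_ (adjp v u h.symm)⟩
    rw [e, pv_nx (hκ u)]; exact hR u
  have hsame : ∀ u v, G.Adj u v → κ u = κ v → ι u < ι v → ι v = ι u + 1 := by
    intro u v h e hlt
    refine A.inn _ (hκ u) _ (hι u) _ (by rw [e]; exact hι v) hlt ?_
    rw [hp, e, hp]; exact h
  have wrong : ∀ u v u' v', κ u = κ u' → ι u < ι u' → G.Adj u v → G.Adj u' v' → D.al (κ u) (κ v) = true →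
      D.al (κ u) (κ v') = true → dst D.m (κ u) (κ v') < dst D.m (κ u) (κ v) → False := by
    intro u v u' v' e hlt h h' a a' hd
    refine A.wrong (hκ u) (hκ v) (hκ v') hlt (by rw [e]; exact hι u') ⟨v, hR v, adjp u v h⟩ ⟨v', hR v', ?_⟩ a a' hd
    rw [e]; exact adjp u' v' h'
  refine mob_sort f (fun u v e => ?_) (fun u v => G.Adj u v ∧ κ u < κ v ∧ D.al (κ u) (κ v) = true) ?_ ?_ ?_ ?_ ?_
  · have h1 := (fle u v).1 e.le
    have h2 := (fle v u).1 e.ge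
    exact veq u v (by omega) (by omega)
  · rintro u v ⟨_, h, _⟩
    exact (flt u v).2 (Or.inl h)
  · rintro u v u' v' ⟨h, hk, a⟩ ⟨h', hk', a'⟩ hlt
    rw [flt] at hlt
    rw [fle, fle]
    rcases hlt with hlt | ⟨e, hlt⟩
    · by_cases e1 : κ u' = κ v
      · refine ⟨Or.inr ⟨e1, ?_⟩, Or.inl (by omega)⟩
        by_contra hc
        refine wrong v u u' v' e1.symm (by omega) h.symm h' (alsym (hκ u) (hκ v) a) (by rw [← e1]; exact a') ?_
        have := hκ v'
        unfold dst; split_ifs <;> omega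
      · by_cases e2 : κ v' = κ v
        · refine ⟨Or.inl (by omega), Or.inr ⟨e2.symm, ?_⟩⟩
          by_contra hc
          refine wrong v' u' v u e2 (by omega) h'.symm h.symm (alsym (hκ u') (hκ v') a')
            (by rw [e2]; exact alsym (hκ u) (hκ v) a) ?_
          have := hκ v'
          unfold dst; split_ifs <;> omega
        · have := A.two (hκ u) (hκ v) (hκ u') (hκ v') hk a hlt e1 hk' e2 a' (tch u v h) (tch u' v' h')
          omega
    · refine ⟨Or.inl (by omega), ?_⟩
      rcases lt_trichotomy (κ v) (κ v') with h1 | h1 | h1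
      · exact Or.inl h1
      · refine Or.inr ⟨h1, ?_⟩
        by_contra hc
        refine A.par (hκ u) (hκ v) hk a hlt (by rw [e]; exact hι u') (j := ι v') (j' := ι v) (by omega) (hι v) ?_ ?_
        · rw [hp, hp]; exact h
        · rw [h1, e, hp, hp]; exact h'
      · exfalso
        refine wrong u v u' v' e hlt h h' a (by rw [e]; exact a') ?_
        unfold dst; split_ifs <;> omega
  · intro v
    obtain ⟨a, ha⟩ : ∃ a, a = if 0 < ι v then p (κ v) (ι v - 1) else p (pv D.m (κ v)) (n (pv D.m (κ v))) := ⟨_, rfl⟩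
    obtain ⟨b, hb⟩ : ∃ b, b = if ι v < n (κ v) then p (κ v) (ι v + 1) else p (nx D.m (κ v)) 0 := ⟨_, rfl⟩
    have hkv := hκ v
    have hiv := hι v
    have n1 := nx_ne hm hkv
    have n2 := pv_ne hm hkv
    have hκa : (κ a = κ v ∧ ι a + 1 = ι v) ∨ (ι v = 0 ∧ κ a = pv D.m (κ v) ∧ ι a = n (pv D.m (κ v))) := by
      by_cases h0 : 0 < ι v
      · rw [if_pos h0] at ha
        rw [ha, huκ _ _ hkv (by omega), huι _ _ hkv (by omega)]; omega
      · rw [if_neg h0] at ha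
        rw [ha, huκ _ _ (pv_lt hkv) le_rfl, huι _ _ (pv_lt hkv) le_rfl]; omega
    have hκb : (κ b = κ v ∧ ι b = ι v + 1) ∨ (ι v = n (κ v) ∧ κ b = nx D.m (κ v) ∧ ι b = 0) := by
      by_cases h0 : ι v < n (κ v)
      · rw [if_pos h0] at hb
        rw [hb, huκ _ _ hkv (by omega), huι _ _ hkv (by omega)]; omega
      · rw [if_neg h0] at hb
        rw [hb, huκ _ _ (nx_lt hkv) (Nat.zero_le _), huι _ _ (nx_lt hkv) (Nat.zero_le _)]; omega
    obtain ⟨d1, d2, d3, ⟨_, _, o, ho, _⟩, d5⟩ := B.chsym hkv (Or.inl rfl)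
    obtain ⟨_, m1, m2, m3⟩ := B.ok.alk _ hkv _ d1 d5
    have hκo : κ o = D.d1 (κ v) := B.mod.disj _ (hκ o) _ d1 o (hR o) ho
    obtain ⟨x, hx, y, hy, xa, xb, ya, yb, hxy⟩ := con3 h3 {v} a b
      ⟨v, rfl, by rintro rfl; omega, by rintro rfl; omega⟩
      ⟨o, by rintro (rfl : o = v); omega, by rintro rfl; omega, by rintro rfl; omega⟩
    have hxv : x = v := hx
    subst hxv
    refine ⟨y, ?_⟩
    have c1 : κ y ≠ κ x := by
      intro e
      rcases lt_trichotomy (ι x) (ι y) with h | h | h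
      · have h1 := hsame _ _ hxy e.symm h
        have h2 := hι y
        rw [e] at h2
        rcases hκb with ⟨q1, q2⟩ | ⟨q1, _, _⟩
        · exact yb (veq _ _ (by omega) (by omega))
        · omega
      · exact hxy.ne (veq _ _ e.symm h)
      · have h1 := hsame _ _ hxy.symm e h
        rcases hκa with ⟨q1, q2⟩ | ⟨q1, _, _⟩
        · exact ya (veq _ _ (by omega) (by omega))
        · omega
    have c2 : κ y ≠ nx D.m (κ x) := by
      intro e
      obtain ⟨h1, h2⟩ := hnext _ _ hxy e
      rcases hκb with ⟨q1, q2⟩ | ⟨q1, q2, q3⟩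
      · have := hι b; rw [q1] at this; omega
      · exact yb (veq _ _ (by omega) (by omega))
    have c3 : κ y ≠ pv D.m (κ x) := by
      intro e
      obtain ⟨h1, h2⟩ := hnext _ _ hxy.symm (by rw [e, nx_pv hkv])
      rcases hκa with ⟨q1, q2⟩ | ⟨q1, q2, q3⟩
      · omega
      · exact ya (veq _ _ (by omega) (by rw [q3, h1, e]))
    have al := A.allow hkv (hκ y) c1 c2 c3 (tch _ _ hxy)
    rcases lt_or_gt_of_ne c1 with h | h
    · exact Or.inr ⟨hxy.symm, h, alsym hkv (hκ y) al⟩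
    · exact Or.inl ⟨hxy, h, al⟩
  · have hinj : Function.Injective (fun i : Fin D.m => p i.1 0) := by
      intro i j e
      have e1 : p i.1 0 = p j.1 0 := e
      have := congrArg κ e1
      rw [huκ _ _ i.2 (Nat.zero_le _), huκ _ _ j.2 (Nat.zero_le _)] at this
      exact Fin.ext this
    have := Nat.card_le_card_of_injective _ hinj
    rw [Nat.card_fin] at this; omega
  · intro u v h hlt
    rw [flt] at hlt
    rcases hlt with hlt | ⟨e, hlt⟩
    · by_cases c2 : κ v = nx D.m (κ u)
      · obtain ⟨h1, h2⟩ := hnext _ _ h c2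
        left
        intro w ⟨w1, w2⟩
        rw [flt] at w1 w2
        have e : κ v = κ u + 1 := by rw [c2] at hlt ⊢; unfold nx at hlt ⊢; split_ifs at hlt ⊢ <;> omega
        have := hι w
        rcases w1 with w1 | ⟨w1, w1'⟩
        · omega
        · rw [← w1] at this; omega
      · by_cases c3 : κ v = pv D.m (κ u)
        · obtain ⟨h1, h2⟩ := hnext _ _ h.symm (by rw [c3, nx_pv (hκ u)])
          have e : κ u = 0 ∧ κ v = D.m - 1 := by
            rw [c3] at hlt ⊢; unfold pv at hlt ⊢; split_ifs at hlt ⊢ <;> omega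
          right; left
          refine ⟨fun w => (fle _ _).2 (by omega), fun w => (fle _ _).2 ?_⟩
          have q1 := hκ w
          have q2 := hι w
          by_cases q : κ w < κ v
          · exact Or.inl q
          · have q3 : κ w = κ v := by omega
            rw [q3] at q2; exact Or.inr ⟨q3, by omega⟩
        · right; right
          exact ⟨h, hlt, A.allow (hκ u) (hκ v) (by omega) c2 c3 (tch _ _ h)⟩
    · have h1 := hsame _ _ h e hlt
      left
      intro w ⟨w1, w2⟩
      rw [flt] at w1 w2
      omega

lemma mob_V8 [Finite V] (h3 : KConnected G 3) (hP : Ph G) (h : HasM G 8 V8E) : ∃ n, 3 ≤ n ∧ IsMinor G (mobiusLadder n) := by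
  obtain ⟨R, hR, hE⟩ := h
  obtain ⟨R', hR', hs, hc⟩ := Mod.cover (cn_univ h3) (by norm_num) hR
  have t : ∀ a b, (a, b) ∈ V8E → Tch G (R' a) (R' b) := fun a b h => (hE _ h).mono (hs a) (hs b)
  have t' : ∀ a b, (b, a) ∈ V8E → Tch G (R' a) (R' b) := fun a b h => (t b a h).symm
  have B : BM G bV8 R' := by
    refine ⟨bV8_ok, hP, hR', hc, ?_, ?_, ?_⟩ <;> intro k hk <;> change k < 8 at hk <;> interval_cases k
    all_goals first | exact t _ _ (by decide) | exact t' _ _ (by decide)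
  obtain ⟨p, n, A⟩ := B.toAM
  exact A.mob h3

lemma mob_X7 [Finite V] (h3 : KConnected G 3) (hP : Ph G) (h : HasM G 7 X7E) : ∃ n, 3 ≤ n ∧ IsMinor G (mobiusLadder n) := by
  obtain ⟨R, hR, hE⟩ := h
  obtain ⟨R', hR', hs, hc⟩ := Mod.cover (cn_univ h3) (by norm_num) hR
  have t : ∀ a b, (a, b) ∈ X7E → Tch G (R' a) (R' b) := fun a b h => (hE _ h).mono (hs a) (hs b)
  have t' : ∀ a b, (b, a) ∈ X7E → Tch G (R' a) (R' b) := fun a b h => (t b a h).symm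
  have B : BM G bX7 R' := by
    refine ⟨bX7_ok, hP, hR', hc, ?_, ?_, ?_⟩ <;> intro k hk <;> change k < 7 at hk <;> interval_cases k
    all_goals first | exact t _ _ (by decide) | exact t' _ _ (by decide)
  obtain ⟨p, n, A⟩ := B.toAM
  exact A.mob h3

end Mob
end AP

namespace AP
/-- (iii) implies (ii) -/
theorem gubser {V : Type} [Fintype V] (G : SimpleGraph V) (h3 : KConnected G 3) (hnp : ¬ Planar G)
    (h : ¬ IsMinor EX1 G ∧ ¬ IsMinor EX2 G ∧ ¬ IsMinor K33h G ∧ ¬ IsMinor K5h G ∧ ¬ IsMinor EX8 G) :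
    (∃ n, 3 ≤ n ∧ IsMinor G (doubleWheel n)) ∨ (∃ n, 3 ≤ n ∧ IsMinor G (mobiusLadder n)) ∨
       (∃ (U : Type) (H : SimpleGraph U), InClassW H ∧ IsMinor G H) := by
  obtain ⟨e1, e2, e3, e4, e5⟩ := h
  have k1 : ¬ HasM G 7 K33E := fun h => (K33i_EX h3 h).elim (fun h => e1 (minor_EX1 h)) (fun h => e5 (minor_EX8 h))
  have k2 : ¬ HasM G 8 K33hE := fun h => e3 (minor_K33h h)
  have k3 : ¬ HasM G 7 K5hE := fun h => e4 (minor_K5h h)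
  have k4 : ¬ HasM G 6 EX2E := fun h => e2 (minor_EX2 h)
  by_cases h33 : HasM G 6 K33E
  · by_cases h8 : HasM G 8 V8E
    · exact Or.inr (Or.inl (mob_V8 h3 ⟨k1, k2, k3⟩ h8))
    by_cases h7 : HasM G 7 X7E
    · exact Or.inr (Or.inl (mob_X7 h3 ⟨k1, k2, k3⟩ h7))
    have hF : Fr G := ⟨k1, k2, k3, k4, h8, h7⟩
    obtain ⟨T⟩ := exists_TK k1 h33
    rcases TK.chords hF h3 T with ⟨k, m, h⟩ | ⟨x, h⟩ | ⟨x, h⟩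
    · exact Or.inl (TK.T2.dw hF h)
    · exact Or.inr (Or.inr (TK.T3.cw hF h))
    · exact Or.inr (Or.inr (TK.T3.cw hF h))
  · have h5 : HasM G 5 K5E := by
      by_contra hc
      exact hnp ⟨fun h => hc (hasM_K5 h), fun h => h33 (hasM_K33 h)⟩
    exact Or.inl ⟨3, le_rfl, dw3_of_card5 (K5_card h3 h33 h5)⟩
end AP

end APmain

/-- Gubser's characterization of 3-connected almost-planar graphs:
(i) almost-planar ↔ (ii) minor of a double wheel, Möbius ladder, or graph in 𝒲
↔ (iii) {EX1, EX2, K33h, K5h, EX8}-free. -/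
theorem stmt0 {V : Type} [Fintype V] (G : SimpleGraph V)
    (h3 : KConnected G 3) (hnp : ¬ Planar G) :
    (AlmostPlanar G ↔
      ((∃ n, 3 ≤ n ∧ IsMinor G (doubleWheel n)) ∨
       (∃ n, 3 ≤ n ∧ IsMinor G (mobiusLadder n)) ∨
       (∃ (U : Type) (H : SimpleGraph U), InClassW H ∧ IsMinor G H))) ∧
    (AlmostPlanar G ↔
      (¬ IsMinor EX1 G ∧ ¬ IsMinor EX2 G ∧ ¬ IsMinor K33h G ∧
       ¬ IsMinor K5h G ∧ ¬ IsMinor EX8 G)) := by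
  have ap : AlmostPlanar G ↔ AP.EP G := ⟨fun h => h.2, fun h => ⟨hnp, h⟩⟩
  have h21 : ((∃ n, 3 ≤ n ∧ IsMinor G (doubleWheel n)) ∨
       (∃ n, 3 ≤ n ∧ IsMinor G (mobiusLadder n)) ∨
       (∃ (U : Type) (H : SimpleGraph U), InClassW H ∧ IsMinor G H)) → AP.EP G := by
    rintro (⟨n, hn, h⟩ | ⟨n, hn, h⟩ | ⟨U, H, hW, h⟩)
    · exact AP.EP.minor (AP.EP_dw hn) h
    · exact AP.EP.minor (AP.EP_mob hn) h
    · exact AP.EP.minor (AP.EP_W hW) h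
  have h13 : AP.EP G → (¬ IsMinor EX1 G ∧ ¬ IsMinor EX2 G ∧ ¬ IsMinor K33h G ∧
       ¬ IsMinor K5h G ∧ ¬ IsMinor EX8 G) := fun h =>
    ⟨fun m => AP.notEP_EX1 (AP.EP.minor h m), fun m => AP.notEP_EX2 (AP.EP.minor h m),
      fun m => AP.notEP_K33h (AP.EP.minor h m), fun m => AP.notEP_K5h (AP.EP.minor h m),
      fun m => AP.notEP_EX8 (AP.EP.minor h m)⟩
  have h32 := AP.gubser G h3 hnp
  exact ⟨ap.trans ⟨fun h => h32 (h13 h), h21⟩, ap.trans ⟨h13, fun h => h21 (h32 h)⟩⟩
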